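/- Let Ω ⊆ ℂ be a bounded open connected set with C^∞ smooth boundary. Then for every m ∈ ℕ and every δ > 0 there exists a function g, C^∞ on an open neighborhood of closure(Ω), holomorphic on Ω, injective on closure(Ω), and (m, δ)-close to the identity on closure(Ω), such that g(Ω) is a quadrature domain with respect to boundary arclength measure: there exist N ≥ 1, points w_1, …, w_N ∈ g(Ω), natural numbers n_1, …, n_N, and complex numbers c_{jk} such that ∫_{∂(g(Ω))} f dσ = Σ_{j=1}^N Σ_{k=0}^{n_j} c_{jk} f^{(k)}(w_j) for every function f holomorphic on g(Ω) that extends continuously to the closure of g(Ω), where σ is one-dimensional Hausdorff (arclength) measure on ∂(g(Ω)). -/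

import Mathlib

open MeasureTheory Complex ComplexConjugate Metric Set

noncomputable section

/-- `f` belongs to the Bergman space `A²(Ω)`. -/
def BergmanFun (Ω : Set ℂ) (f : ℂ → ℂ) : Prop :=
  DifferentiableOn ℂ f Ω ∧ IntegrableOn (fun z => ‖f z‖ ^ 2) Ω volume

/-- `Ω` is a finitely connected domain none of whose complementary components is a point. -/
def IsFinConnDomain (Ω : Set ℂ) : Prop :=
  IsOpen Ω ∧ IsConnected Ω ∧
  {C : Set ℂ | ∃ x ∈ Ωᶜ, C = connectedComponentIn Ωᶜ x}.Finite ∧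
  ∀ x ∈ Ωᶜ, ¬ (connectedComponentIn Ωᶜ x).Subsingleton

/-- `Ω` is a quadrature domain. -/
def IsQuadratureDomain (Ω : Set ℂ) : Prop :=
  ∃ N : ℕ, 0 < N ∧ ∃ (w : Fin N → ℂ) (n : Fin N → ℕ) (c : Fin N → ℕ → ℂ),
    (∀ j, w j ∈ Ω) ∧
    ∀ f : ℂ → ℂ, BergmanFun Ω f →
      (∫ z in Ω, f z) =
        ∑ j, ∑ k ∈ Finset.range (n j + 1), c j k * iteratedDerivWithin k f Ω (w j)

/-- `fa` is an Ahlfors map of `Ω` at `a`. -/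
def IsAhlforsMap (Ω : Set ℂ) (a : ℂ) (fa : ℂ → ℂ) : Prop :=
  DifferentiableOn ℂ fa Ω ∧ (∀ z ∈ Ω, ‖fa z‖ < 1) ∧
  (deriv fa a).im = 0 ∧ 0 < (deriv fa a).re ∧
  ∀ g : ℂ → ℂ, DifferentiableOn ℂ g Ω → (∀ z ∈ Ω, ‖g z‖ < 1) →
    ‖deriv g a‖ ≤ (deriv fa a).re

/-- `Ω` is bounded with `C^∞` smooth boundary consisting of finitely many disjoint
simple closed curves. -/
def HasSmoothBoundary (Ω : Set ℂ) : Prop :=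
  Bornology.IsBounded Ω ∧
  ∃ (n : ℕ) (γ : Fin n → ℝ → ℂ),
    (∀ i, ContDiff ℝ (⊤ : ℕ∞) (γ i)) ∧
    (∀ i, Function.Periodic (γ i) (2 * Real.pi)) ∧
    (∀ i, InjOn (γ i) (Ico 0 (2 * Real.pi))) ∧
    (∀ i t, deriv (γ i) t ≠ 0) ∧
    (Pairwise fun i j => Disjoint (range (γ i)) (range (γ j))) ∧
    frontier Ω = ⋃ i, range (γ i)

/-- Partial derivative in the `x`-direction of a real-valued function on `ℂ`. -/
def pdx (u : ℂ → ℝ) (z : ℂ) : ℝ := deriv (fun t : ℝ => u (z + (t : ℂ))) 0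

/-- Partial derivative in the `y`-direction of a real-valued function on `ℂ`. -/
def pdy (u : ℂ → ℝ) (z : ℂ) : ℝ := deriv (fun t : ℝ => u (z + (t : ℂ) * Complex.I)) 0

/-- `f` is a proper holomorphic map of `Ω` onto the open unit disc. -/
def IsProperOntoDisc (Ω : Set ℂ) (f : ℂ → ℂ) : Prop :=
  DifferentiableOn ℂ f Ω ∧ f '' Ω = ball (0 : ℂ) 1 ∧
  ∀ L : Set ℂ, L ⊆ ball (0 : ℂ) 1 → IsCompact L → IsCompact (Ω ∩ f ⁻¹' L)

/-- `g` is `(m, δ)`-close to the identity on `closure Ω`. -/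
def CloseToId (Ω : Set ℂ) (m : ℕ) (δ : ℝ) (g : ℂ → ℂ) : Prop :=
  ∀ k ≤ m, ∀ z ∈ closure Ω, ‖iteratedFDeriv ℝ k (fun w => g w - w) z‖ ≤ δ

/-- `σ : [0,1] → ℂ` is a piecewise continuously differentiable curve. -/
def PiecewiseC1On01 (σ : ℝ → ℂ) : Prop :=
  ContinuousOn σ (Icc 0 1) ∧ ∃ s : Finset ℝ, ContDiffOn ℝ 1 σ (Icc (0 : ℝ) 1 \ s)

/-- `Ω` is a generalized quadrature domain. -/
def IsGenQuadratureDomain (Ω : Set ℂ) : Prop :=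
  ∃ (N M : ℕ) (w : Fin N → ℂ) (n : Fin N → ℕ) (c : Fin N → ℕ → ℂ)
    (b : Fin M → ℂ) (σ : Fin M → ℝ → ℂ),
    (∀ j, w j ∈ Ω) ∧
    (∀ m, PiecewiseC1On01 (σ m)) ∧
    (∀ m, ∀ t ∈ Icc (0 : ℝ) 1, σ m t ∈ Ω) ∧
    ∀ f : ℂ → ℂ, BergmanFun Ω f →
      (∫ z in Ω, f z) =
        (∑ j, ∑ k ∈ Finset.range (n j + 1), c j k * iteratedDerivWithin k f Ω (w j)) +
        ∑ m, b m * ∫ t in (0 : ℝ)..1, f (σ m t) * deriv (σ m) t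

/-- The Wirtinger derivative `∂f`. -/
def dz (f : ℂ → ℂ) (z : ℂ) : ℂ := (fderiv ℝ f z 1 - I * fderiv ℝ f z I) / 2

/-- The Wirtinger derivative `∂̄f`. -/
def dbar (f : ℂ → ℂ) (z : ℂ) : ℂ := (fderiv ℝ f z 1 + I * fderiv ℝ f z I) / 2

theorem realLinear_apply_eq (L : ℂ →L[ℝ] ℂ) (v : ℂ) :
    L v = (L 1 - I * L I) / 2 * v + (L 1 + I * L I) / 2 * conj v := by
  have h : L v = v.re * L 1 + v.im * L I := by
    conv_lhs => rw [show v = v.re • (1 : ℂ) + v.im • I by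
      simp [Complex.re_add_im]]
    rw [map_add, map_smul, map_smul]; simp
  rw [h]
  conv_rhs => rw [← Complex.re_add_im v]
  simp only [map_add, conj_ofReal, map_mul, conj_I]
  linear_combination ((v.im : ℂ) * L I) * I_mul_I

theorem fderiv_apply_eq (f : ℂ → ℂ) (z v : ℂ) :
    fderiv ℝ f z v = dz f z * v + dbar f z * conj v :=
  realLinear_apply_eq _ v

theorem norm_dz_le (f : ℂ → ℂ) (z : ℂ) : ‖dz f z‖ ≤ ‖fderiv ℝ f z‖ := by
  have h1 := (fderiv ℝ f z).le_opNorm 1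
  have h2 := (fderiv ℝ f z).le_opNorm I
  have h3 := norm_sub_le (fderiv ℝ f z 1) (I * fderiv ℝ f z I)
  simp only [dz, norm_div, norm_mul, norm_I, one_mul, norm_one, mul_one] at *
  norm_num
  linarith

theorem norm_dbar_le (f : ℂ → ℂ) (z : ℂ) : ‖dbar f z‖ ≤ ‖fderiv ℝ f z‖ := by
  have h1 := (fderiv ℝ f z).le_opNorm 1
  have h2 := (fderiv ℝ f z).le_opNorm I
  have h3 := norm_add_le (fderiv ℝ f z 1) (I * fderiv ℝ f z I)
  simp only [dbar, norm_div, norm_mul, norm_I, one_mul, norm_one, mul_one] at *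
  norm_num
  linarith

theorem norm_fderiv_le_dz_dbar (f : ℂ → ℂ) (z : ℂ) :
    ‖fderiv ℝ f z‖ ≤ ‖dz f z‖ + ‖dbar f z‖ := by
  refine ContinuousLinearMap.opNorm_le_bound _ (by positivity) fun v => ?_
  rw [fderiv_apply_eq]
  refine (norm_add_le _ _).trans ?_
  simp [add_mul]

theorem dbar_eq_zero_of_differentiableAt {f : ℂ → ℂ} {z : ℂ} (h : DifferentiableAt ℂ f z) :
    dbar f z = 0 := by
  have := (differentiableAt_complex_iff_differentiableAt_real.1 h).2
  simp only [dbar, this, smul_eq_mul, ← mul_assoc, I_mul_I]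
  ring

theorem differentiableAt_of_dbar_eq_zero {f : ℂ → ℂ} {z : ℂ} (h : DifferentiableAt ℝ f z)
    (h0 : dbar f z = 0) : DifferentiableAt ℂ f z := by
  refine differentiableAt_complex_iff_differentiableAt_real.2 ⟨h, ?_⟩
  simp only [dbar] at h0
  have h1 : fderiv ℝ f z 1 + I * fderiv ℝ f z I = 0 := by simpa using h0
  rw [smul_eq_mul]
  linear_combination (-I) * h1 + (fderiv ℝ f z I) * I_mul_I

theorem dz_eq_deriv {f : ℂ → ℂ} {z : ℂ} (h : DifferentiableAt ℂ f z) :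
    dz f z = deriv f z := by
  have h2 : fderiv ℝ f z 1 = deriv f z := by
    rw [(h.hasDerivAt.hasFDerivAt.restrictScalars ℝ).fderiv]; simp
  have h1 := fderiv_apply_eq f z 1
  rw [dbar_eq_zero_of_differentiableAt h] at h1
  rw [← h2, h1]; simp

theorem dbar_congr {f g : ℂ → ℂ} {z : ℂ} (h : f =ᶠ[nhds z] g) : dbar f z = dbar g z := by
  simp only [dbar, h.fderiv_eq]

theorem dz_congr {f g : ℂ → ℂ} {z : ℂ} (h : f =ᶠ[nhds z] g) : dz f z = dz g z := by
  simp only [dz, h.fderiv_eq]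

theorem dbar_sub {f g : ℂ → ℂ} {z : ℂ} (hf : DifferentiableAt ℝ f z)
    (hg : DifferentiableAt ℝ g z) : dbar (fun w => f w - g w) z = dbar f z - dbar g z := by
  simp only [dbar, fderiv_fun_sub hf hg, _root_.sub_apply]; ring

theorem dbar_mul {f g : ℂ → ℂ} {z : ℂ} (hf : DifferentiableAt ℝ f z)
    (hg : DifferentiableAt ℝ g z) :
    dbar (fun w => f w * g w) z = dbar f z * g z + f z * dbar g z := by
  simp only [dbar, fderiv_fun_mul hf hg, _root_.add_apply,
    _root_.smul_apply, smul_eq_mul]; ring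

theorem dz_mul {f g : ℂ → ℂ} {z : ℂ} (hf : DifferentiableAt ℝ f z)
    (hg : DifferentiableAt ℝ g z) :
    dz (fun w => f w * g w) z = dz f z * g z + f z * dz g z := by
  simp only [dz, fderiv_fun_mul hf hg, _root_.add_apply,
    _root_.smul_apply, smul_eq_mul]; ring

theorem dbar_comp {V Γ : ℂ → ℂ} {z : ℂ} (hV : DifferentiableAt ℝ V (Γ z))
    (hΓ : DifferentiableAt ℝ Γ z) :
    dbar (fun w => V (Γ w)) z = dz V (Γ z) * dbar Γ z + dbar V (Γ z) * conj (dz Γ z) := by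
  have h : fderiv ℝ (fun w => V (Γ w)) z = (fderiv ℝ V (Γ z)).comp (fderiv ℝ Γ z) :=
    fderiv_comp z hV hΓ
  have e1 : ∀ v, fderiv ℝ (fun w => V (Γ w)) z v = dz V (Γ z) * (dz Γ z * v + dbar Γ z * conj v) +
      dbar V (Γ z) * conj (dz Γ z * v + dbar Γ z * conj v) := fun v => by
    rw [h, ContinuousLinearMap.comp_apply, fderiv_apply_eq V, fderiv_apply_eq Γ]
  rw [dbar, e1, e1]
  simp only [map_add, map_mul, conj_I, map_one, map_neg]
  linear_combination ((dz V (Γ z) * dz Γ z - dz V (Γ z) * dbar Γ z + dbar V (Γ z) * conj (dbar Γ z) - dbar V (Γ z) * conj (dz Γ z)) / 2) * I_mul_I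

theorem dz_comp {V Γ : ℂ → ℂ} {z : ℂ} (hV : DifferentiableAt ℝ V (Γ z))
    (hΓ : DifferentiableAt ℝ Γ z) :
    dz (fun w => V (Γ w)) z = dz V (Γ z) * dz Γ z + dbar V (Γ z) * conj (dbar Γ z) := by
  have h : fderiv ℝ (fun w => V (Γ w)) z = (fderiv ℝ V (Γ z)).comp (fderiv ℝ Γ z) :=
    fderiv_comp z hV hΓ
  have e1 : ∀ v, fderiv ℝ (fun w => V (Γ w)) z v = dz V (Γ z) * (dz Γ z * v + dbar Γ z * conj v) +
      dbar V (Γ z) * conj (dz Γ z * v + dbar Γ z * conj v) := fun v => by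
    rw [h, ContinuousLinearMap.comp_apply, fderiv_apply_eq V, fderiv_apply_eq Γ]
  rw [dz, e1, e1]
  simp only [map_add, map_mul, conj_I, map_one, map_neg]
  linear_combination ((-dz V (Γ z) * dz Γ z + dz V (Γ z) * dbar Γ z - dbar V (Γ z) * conj (dbar Γ z) + dbar V (Γ z) * conj (dz Γ z)) / 2) * I_mul_I

theorem continuous_dbar {f : ℂ → ℂ} (hf : ContDiff ℝ 1 f) : Continuous (dbar f) := by
  have h := hf.continuous_fderiv one_ne_zero
  unfold dbar
  fun_prop

theorem contDiff_dbar {f : ℂ → ℂ} (hf : ContDiff ℝ (⊤ : ℕ∞) f) :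
    ContDiff ℝ (⊤ : ℕ∞) (dbar f) := by
  have h : ContDiff ℝ (⊤ : ℕ∞) (fderiv ℝ f) := hf.fderiv_right (by simp)
  unfold dbar
  fun_prop

theorem periodic_deriv {f : ℝ → ℂ} {c : ℝ} (h : Function.Periodic f c) :
    Function.Periodic (deriv f) c := fun x => by
  rw [← deriv_comp_add_const f c x]
  exact congrArg (fun g => deriv g x) (funext h)

theorem exists_bound_of_periodic {f : ℝ → ℂ} (hf : Continuous f)
    (hp : Function.Periodic f (2 * Real.pi)) : ∃ M, ∀ t, ‖f t‖ ≤ M := by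
  obtain ⟨M, hM⟩ := (isCompact_Icc (a := (0 : ℝ)) (b := 2 * Real.pi)).exists_bound_of_continuousOn
    hf.continuousOn
  refine ⟨M, fun t => ?_⟩
  obtain ⟨y, hy, he⟩ := hp.exists_mem_Ico₀ Real.two_pi_pos t
  rw [he]
  exact hM y (Ico_subset_Icc_self hy)

theorem exists_fourierCoeff_bound (k : ℕ) : ∀ φ : ℝ → ℂ, ContDiff ℝ (⊤ : ℕ∞) φ →
    Function.Periodic φ (2 * Real.pi) →
    ∃ M, ∀ n : ℤ, |(n : ℝ)| ^ k * ‖fourierCoeffOn Real.two_pi_pos φ n‖ ≤ M := by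
  induction k with
  | zero =>
    intro φ hφ hp
    obtain ⟨M, hM⟩ := exists_bound_of_periodic hφ.continuous hp
    refine ⟨M, fun n => ?_⟩
    rw [fourierCoeffOn_eq_integral, pow_zero, one_mul, norm_smul]
    have h2 : ‖∫ x in (0 : ℝ)..2 * Real.pi,
        fourier (-n) (x : AddCircle (2 * Real.pi - 0)) • φ x‖ ≤ M * |2 * Real.pi - 0| := by
      refine intervalIntegral.norm_integral_le_of_norm_le_const fun x _ => ?_
      rw [norm_smul, fourier_apply, Circle.norm_coe, one_mul]
      exact hM x
    have h3 := Real.two_pi_pos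
    rw [sub_zero, abs_of_pos h3] at h2
    rw [sub_zero, norm_div, norm_one, Real.norm_of_nonneg h3.le, one_div, inv_mul_le_iff₀ h3]
    simpa [mul_comm] using h2
  | succ k ih =>
    intro φ hφ hp
    have hd : ContDiff ℝ (⊤ : ℕ∞) (deriv φ) := (contDiff_infty_iff_deriv.1 hφ).2
    obtain ⟨M, hM⟩ := ih (deriv φ) hd (periodic_deriv hp)
    refine ⟨max M 0, fun n => ?_⟩
    rcases eq_or_ne n 0 with rfl | hn
    · simp
    have hn' : (n : ℂ) ≠ 0 := by exact_mod_cast hn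
    have hn'' : (n : ℝ) ≠ 0 := by exact_mod_cast hn
    have hpi : (Real.pi : ℂ) ≠ 0 := by exact_mod_cast Real.pi_ne_zero
    have h1 := fourierCoeffOn_of_hasDerivAt Real.two_pi_pos hn (f := φ) (f' := deriv φ)
      (fun x _ => ((contDiff_infty_iff_deriv.1 hφ).1 x).hasDerivAt)
      (hd.continuous.intervalIntegrable _ _)
    have h0 : φ (2 * Real.pi) - φ 0 = 0 := by
      have := hp 0; rw [zero_add] at this; rw [this, sub_self]
    rw [h0, mul_zero, zero_sub] at h1
    have h2 : fourierCoeffOn Real.two_pi_pos φ n =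
        fourierCoeffOn Real.two_pi_pos (deriv φ) n / (I * n) := by
      rw [h1]; push_cast; field_simp; simp
    rw [h2, norm_div, norm_mul, norm_I, one_mul, Complex.norm_intCast]
    have h4 : |(n : ℝ)| ≠ 0 := abs_ne_zero.2 hn''
    calc _ = |(n : ℝ)| ^ k * ‖fourierCoeffOn Real.two_pi_pos (deriv φ) n‖ := by
          rw [pow_succ]; field_simp
      _ ≤ M := hM n
      _ ≤ _ := le_max_left _ _

theorem exists_fourier_series {φ : ℝ → ℂ} (hφ : ContDiff ℝ (⊤ : ℕ∞) φ)
    (hp : Function.Periodic φ (2 * Real.pi)) :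
    ∃ a : ℤ → ℂ, (∀ k : ℕ, Summable fun n : ℤ => |(n : ℝ)| ^ k * ‖a n‖) ∧
      ∀ t : ℝ, HasSum (fun n : ℤ => a n * cexp (I * (n * t))) (φ t) := by
  have hs : ∀ k : ℕ, Summable fun n : ℤ =>
      |(n : ℝ)| ^ k * ‖fourierCoeffOn Real.two_pi_pos φ n‖ := by
    intro k
    obtain ⟨M, hM⟩ := exists_fourierCoeff_bound (k + 2) φ hφ hp
    have h1 : Summable fun n : ℤ => M * (1 / (n : ℝ) ^ 2) +
        (if n = 0 then ‖fourierCoeffOn Real.two_pi_pos φ 0‖ else 0) :=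
      ((Real.summable_one_div_int_pow.2 one_lt_two).mul_left M).add
        (hasSum_ite_eq 0 _).summable
    refine h1.of_nonneg_of_le (fun n => by positivity) fun n => ?_
    rcases eq_or_ne n 0 with rfl | hn
    · rcases k.eq_zero_or_pos with rfl | hk
      · simp
      · simp [hk.ne']
    have hn'' : (n : ℝ) ≠ 0 := by exact_mod_cast hn
    have h2 : 0 < (n : ℝ) ^ 2 := by positivity
    rw [if_neg hn, add_zero, mul_one_div, le_div_iff₀ h2, ← sq_abs]
    calc _ = |(n : ℝ)| ^ (k + 2) * ‖fourierCoeffOn Real.two_pi_pos φ n‖ := by ring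
      _ ≤ M := hM n
  refine ⟨fourierCoeffOn Real.two_pi_pos φ, hs, fun t => ?_⟩
  have : Fact (0 < 2 * Real.pi) := ⟨Real.two_pi_pos⟩
  let F : C(AddCircle (2 * Real.pi), ℂ) :=
    ⟨hp.lift, continuous_quot_lift _ hφ.continuous⟩
  have hF : ∀ n, fourierCoeff F n = fourierCoeffOn Real.two_pi_pos φ n := by
    intro n
    rw [fourierCoeff_eq_intervalIntegral F n 0, fourierCoeffOn_eq_integral]
    simp only [zero_add]
    have h0 : ∀ x : ℝ, fourier (T := 2 * Real.pi) (-n) x =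
        fourier (T := 2 * Real.pi - 0) (-n) x := fun x => by
      rw [fourier_coe_apply, fourier_coe_apply, sub_zero]
    rw [sub_zero]
    simp only [h0]
    rfl
  have h1 : Summable (fourierCoeff F) := by
    have := hs 0
    simp only [pow_zero, one_mul] at this
    rw [funext hF]
    exact this.of_norm
  have h2 := has_pointwise_sum_fourier_series_of_summable h1 (t : AddCircle (2 * Real.pi))
  have h3 : F (t : AddCircle (2 * Real.pi)) = φ t := rfl
  rw [h3] at h2
  convert! h2 using 2 with n
  rw [hF, smul_eq_mul, fourier_coe_apply]
  congr 2
  have hpi : (Real.pi : ℂ) ≠ 0 := by exact_mod_cast Real.pi_ne_zero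
  push_cast
  field_simp

/-- A smooth function on `ℂ`, equal to `exp (iz)` near the real axis and supported in a strip. -/
def stripExp (z : ℂ) : ℂ :=
  cexp (I * z) * ((⟨1, 2, one_pos, one_lt_two⟩ : ContDiffBump (0 : ℝ)) z.im : ℝ)

theorem contDiff_stripExp : ContDiff ℝ (⊤ : ℕ∞) stripExp := by
  unfold stripExp
  have h1 : ContDiff ℝ (⊤ : ℕ∞) fun z : ℂ => cexp (I * z) :=
    Complex.contDiff_exp.comp (contDiff_const.mul contDiff_id)
  have h2 : ContDiff ℝ (⊤ : ℕ∞) fun z : ℂ =>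
      (((⟨1, 2, one_pos, one_lt_two⟩ : ContDiffBump (0 : ℝ)) z.im : ℝ) : ℂ) :=
    ofRealCLM.contDiff.comp ((ContDiffBump.contDiff _).comp imCLM.contDiff)
  exact h1.mul h2

theorem stripExp_periodic : Function.Periodic stripExp (2 * Real.pi : ℝ) := fun z => by
  simp only [stripExp, mul_add, add_im, ofReal_im, add_zero]
  congr 1
  rw [show I * ((2 * Real.pi : ℝ) : ℂ) = 2 * Real.pi * I by push_cast; ring]
  exact Complex.exp_periodic _

theorem stripExp_eq_zero {z : ℂ} (h : 2 ≤ |z.im|) : stripExp z = 0 := by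
  simp only [stripExp]
  rw [ContDiffBump.zero_of_le_dist]
  · simp
  · simpa [dist_eq_norm] using h

theorem stripExp_eq {z : ℂ} (h : |z.im| ≤ 1) : stripExp z = cexp (I * z) := by
  simp only [stripExp]
  rw [ContDiffBump.one_of_mem_closedBall]
  · simp
  · simpa [dist_eq_norm] using h

theorem exists_bound_of_periodic_strip {E : Type*} [NormedAddCommGroup E] {f : ℂ → E}
    (hf : Continuous f) (hp : Function.Periodic f (2 * Real.pi : ℝ)) (R : ℝ) :
    ∃ M, ∀ z : ℂ, |z.im| ≤ R → ‖f z‖ ≤ M := by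
  have hK : IsCompact (Icc 0 (2 * Real.pi) ×ℂ Icc (-R) R) :=
    isCompact_Icc.reProdIm isCompact_Icc
  obtain ⟨M, hM⟩ := hK.exists_bound_of_continuousOn hf.continuousOn
  refine ⟨M, fun z hz => ?_⟩
  have hq : Function.Periodic (fun x : ℝ => f (x + z.im * I)) (2 * Real.pi) := fun x => by
    have := hp (x + z.im * I)
    simp only
    rw [← this]; push_cast; ring_nf
  obtain ⟨y, hy, he⟩ := hq.exists_mem_Ico₀ Real.two_pi_pos z.re
  simp only [re_add_im] at he
  rw [he]
  refine hM _ ?_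
  rw [mem_reProdIm]
  simp only [add_re, ofReal_re, mul_re, I_re, mul_zero, ofReal_im, I_im, mul_one, sub_self,
    add_zero, add_im, mul_im, zero_add]
  exact ⟨Ico_subset_Icc_self hy, abs_le.1 hz⟩

theorem periodic_iteratedFDeriv {f : ℂ → ℂ} {c : ℂ} (hp : Function.Periodic f c) (k : ℕ) :
    Function.Periodic (iteratedFDeriv ℝ k f) c := fun z => by
  rw [← iteratedFDeriv_comp_add_right k c z]
  exact congrArg (fun g => iteratedFDeriv ℝ k g z) (funext hp)

theorem exists_bound_iteratedFDeriv_stripExp (k : ℕ) :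
    ∃ M, ∀ z, ‖iteratedFDeriv ℝ k stripExp z‖ ≤ M := by
  obtain ⟨M, hM⟩ := exists_bound_of_periodic_strip
    (contDiff_stripExp.continuous_iteratedFDeriv (m := k) (mod_cast le_top))
    (periodic_iteratedFDeriv stripExp_periodic k) 2
  refine ⟨max M 0, fun z => ?_⟩
  by_cases hz : |z.im| ≤ 2
  · exact (hM z hz).trans (le_max_left _ _)
  · have h1 : stripExp =ᶠ[nhds z] fun _ => 0 := by
      have : IsOpen {w : ℂ | 2 < |w.im|} := isOpen_lt continuous_const (by fun_prop)
      filter_upwards [this.mem_nhds (not_le.1 hz)] with w hw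
      exact stripExp_eq_zero (le_of_lt hw)
    rw [(h1.iteratedFDeriv ℝ k).eq_of_nhds]
    have : iteratedFDeriv ℝ k (fun _ : ℂ => (0 : ℂ)) = 0 := iteratedFDeriv_fun_zero
    rw [this]; simp

theorem norm_iteratedFDeriv_comp_intCast_mul_le {f : ℂ → ℂ} (hf : ContDiff ℝ (⊤ : ℕ∞) f) {k : ℕ}
    {M : ℝ} (hM : ∀ z, ‖iteratedFDeriv ℝ k f z‖ ≤ M) (n : ℤ) (z : ℂ) :
    ‖iteratedFDeriv ℝ k (fun z => f (n * z)) z‖ ≤ |(n : ℝ)| ^ k * M := by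
  have h := (((n : ℝ) • ContinuousLinearMap.id ℝ ℂ)).iteratedFDeriv_comp_right hf z
    (i := k) (mod_cast le_top)
  have h2 : f ∘ ((n : ℝ) • ContinuousLinearMap.id ℝ ℂ) = fun z => f (n * z) := by
    funext z; simp
  rw [h2] at h
  rw [h]
  refine (ContinuousMultilinearMap.norm_compContinuousLinearMap_le _ _).trans ?_
  rw [mul_comm]
  refine mul_le_mul ?_ (hM _) (norm_nonneg _) (by positivity)
  rw [Finset.prod_const, Finset.card_univ, Fintype.card_fin, norm_smul,
    ContinuousLinearMap.norm_id, mul_one, Real.norm_eq_abs]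

/-- Smooth periodic functions on the line have almost analytic extensions. -/
theorem exists_almost_analytic_extension {φ : ℝ → ℂ} (hφ : ContDiff ℝ (⊤ : ℕ∞) φ)
    (hp : Function.Periodic φ (2 * Real.pi)) :
    ∃ Φ : ℂ → ℂ, ContDiff ℝ (⊤ : ℕ∞) Φ ∧ Function.Periodic Φ (2 * Real.pi : ℝ) ∧
      (∀ t : ℝ, Φ t = φ t) ∧ ∀ N : ℕ, ∃ C, 0 ≤ C ∧ ∀ z, ‖dbar Φ z‖ ≤ C * |z.im| ^ N := by
  obtain ⟨a, ha, hsum⟩ := exists_fourier_series hφ hp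
  choose M hM using exists_bound_iteratedFDeriv_stripExp
  have hM0 : ∀ k, 0 ≤ M k := fun k => (norm_nonneg _).trans (hM k 0)
  have hterm : ∀ n : ℤ, ContDiff ℝ (⊤ : ℕ∞) fun z : ℂ => stripExp (n * z) := fun n =>
    contDiff_stripExp.comp (contDiff_const.mul contDiff_id)
  have hterm' : ∀ n : ℤ, ContDiff ℝ (⊤ : ℕ∞) fun z : ℂ => a n * stripExp (n * z) := fun n =>
    contDiff_const.mul (hterm n)
  have hbd : ∀ (k : ℕ) (n : ℤ) (z : ℂ),
      ‖iteratedFDeriv ℝ k (fun z : ℂ => a n * stripExp (n * z)) z‖ ≤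
        (|(n : ℝ)| ^ k * ‖a n‖) * M k := by
    intro k n z
    have h1 : iteratedFDeriv ℝ k (fun z : ℂ => a n • stripExp (n * z)) z =
        a n • iteratedFDeriv ℝ k (fun z : ℂ => stripExp (n * z)) z :=
      iteratedFDeriv_const_smul_apply' ((hterm n).of_le (mod_cast le_top)).contDiffAt
    simp only [smul_eq_mul] at h1
    rw [h1, norm_smul]
    calc _ ≤ ‖a n‖ * (|(n : ℝ)| ^ k * M k) := by
          gcongr; exact norm_iteratedFDeriv_comp_intCast_mul_le contDiff_stripExp (hM k) n z
      _ = _ := by ring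
  refine ⟨fun z => ∑' n : ℤ, a n * stripExp (n * z), ?_, ?_, ?_, ?_⟩
  · exact contDiff_tsum hterm' (fun k _ => (ha k).mul_right (M k)) fun k n z _ => hbd k n z
  · intro z
    simp only
    congr 1; funext n
    congr 1
    have := (stripExp_periodic.int_mul n) (n * z)
    rw [mul_add]; exact this
  · intro t
    rw [← (hsum t).tsum_eq]
    refine tsum_congr fun n => ?_
    rw [stripExp_eq (by simp)]
  · intro N
    have hfd : ∀ (n : ℤ) (z : ℂ), ‖fderiv ℝ (fun z : ℂ => a n * stripExp (n * z)) z‖ ≤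
        (|(n : ℝ)| ^ 1 * ‖a n‖) * M 1 := by
      intro n z
      rw [← norm_iteratedFDeriv_one]; exact hbd 1 n z
    have hzero : Summable fun n : ℤ => a n * stripExp (n * ((0 : ℝ) : ℂ)) := by
      refine (hsum 0).summable.congr fun n => ?_
      rw [stripExp_eq (by simp)]
    have hder : ∀ n : ℤ, ∀ z : ℂ, ‖dbar (fun z : ℂ => a n * stripExp (n * z)) z‖ ≤
        (|(n : ℝ)| ^ (N + 1) * ‖a n‖) * M 1 * |z.im| ^ N := by
      intro n z
      by_cases hz : |(n : ℝ)| * |z.im| < 1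
      · have h1 : dbar (fun z : ℂ => a n * stripExp (n * z)) z = 0 := by
          have h2 : (fun z : ℂ => a n * stripExp (n * z)) =ᶠ[nhds z]
              fun z => a n * cexp (I * (n * z)) := by
            have : IsOpen {w : ℂ | |(n : ℝ)| * |w.im| < 1} :=
              isOpen_lt (by fun_prop) continuous_const
            filter_upwards [this.mem_nhds hz] with w hw
            rw [stripExp_eq]
            simpa [abs_mul] using le_of_lt hw
          rw [dbar_congr h2]
          exact dbar_eq_zero_of_differentiableAt (by fun_prop)
        rw [h1, norm_zero]
        have := hM0 1
        positivity
      · refine (norm_dbar_le _ _).trans ((hfd n z).trans ?_)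
        have h3 : 1 ≤ (|(n : ℝ)| * |z.im|) ^ N := one_le_pow₀ (not_lt.1 hz)
        have := hM0 1
        calc _ = (|(n : ℝ)| * ‖a n‖ * M 1) * 1 := by ring
          _ ≤ (|(n : ℝ)| * ‖a n‖ * M 1) * (|(n : ℝ)| * |z.im|) ^ N := by gcongr
          _ = _ := by ring
    have hs2 := (ha (N + 1)).mul_right (M 1)
    refine ⟨∑' n : ℤ, (|(n : ℝ)| ^ (N + 1) * ‖a n‖) * M 1,
      tsum_nonneg fun n => by have := hM0 1; positivity, fun z => ?_⟩
    have hfds : Summable fun n : ℤ => fderiv ℝ (fun z : ℂ => a n * stripExp (n * z)) z :=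
      Summable.of_norm_bounded ((ha 1).mul_right (M 1)) fun n => hfd n z
    have h5 := congrFun (fderiv_tsum (𝕜 := ℝ) ((ha 1).mul_right (M 1))
      (fun n => (hterm' n).differentiable (by simp)) hfd hzero) z
    have h6 : ∀ v, HasSum (fun n : ℤ => fderiv ℝ (fun z : ℂ => a n * stripExp (n * z)) z v)
        (fderiv ℝ (fun z => ∑' n : ℤ, a n * stripExp (n * z)) z v) := fun v => by
      rw [h5]
      exact (ContinuousLinearMap.apply ℝ ℂ v).hasSum hfds.hasSum
    have h7 : HasSum (fun n : ℤ => dbar (fun z : ℂ => a n * stripExp (n * z)) z)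
        (dbar (fun z => ∑' n : ℤ, a n * stripExp (n * z)) z) :=
      ((h6 1).add ((h6 I).mul_left I)).div_const 2
    rw [← h7.tsum_eq, ← tsum_mul_right]
    exact tsum_of_norm_bounded (hs2.mul_right _).hasSum fun n => hder n z

/-- A system of disjoint collars: smooth almost analytic periodic parametrisations of
neighbourhoods of disjoint closed curves. -/
structure Collar (n : ℕ) where
  /-- the parametrisations -/
  Γ : Fin n → ℂ → ℂ
  /-- the width of the strip -/
  ε : ℝ
  ε_pos : 0 < ε
  ε_le : ε ≤ 1
  smooth : ∀ i, ContDiff ℝ (⊤ : ℕ∞) (Γ i)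
  periodic : ∀ i, Function.Periodic (Γ i) (2 * Real.pi : ℝ)
  inj : ∀ i j z w, |z.im| < ε → |w.im| < ε → Γ i z = Γ j w →
    i = j ∧ ∃ k : ℤ, w = z + k * (2 * Real.pi : ℝ)
  flat : ∀ N : ℕ, ∃ C, 0 ≤ C ∧ ∀ i z, ‖dbar (Γ i) z‖ ≤ C * |z.im| ^ N
  /-- a lower bound for the derivative -/
  c : ℝ
  c_pos : 0 < c
  le_dz : ∀ i z, |z.im| < ε → c ≤ ‖dz (Γ i) z‖
  dbar_le : ∀ i z, |z.im| < ε → ‖dbar (Γ i) z‖ ≤ ‖dz (Γ i) z‖ / 2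

theorem exists_equiv_fderiv {f : ℂ → ℂ} {z : ℂ} (h : ‖dbar f z‖ < ‖dz f z‖) :
    ∃ L : ℂ ≃L[ℝ] ℂ, (L : ℂ →L[ℝ] ℂ) = fderiv ℝ f z := by
  have hinj : Function.Injective (fderiv ℝ f z : ℂ →ₗ[ℝ] ℂ) := by
    rw [← LinearMap.ker_eq_bot, LinearMap.ker_eq_bot']
    intro v hv
    by_contra hv0
    have h1 : fderiv ℝ f z v = 0 := hv
    rw [fderiv_apply_eq] at h1
    have h2 : ‖dz f z * v‖ = ‖dbar f z * conj v‖ := by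
      rw [eq_neg_of_add_eq_zero_left h1, norm_neg]
    rw [norm_mul, norm_mul, RCLike.norm_conj] at h2
    have : 0 < ‖v‖ := norm_pos_iff.2 hv0
    nlinarith
  refine ⟨(LinearEquiv.ofInjectiveEndo _ hinj).toContinuousLinearEquiv, ?_⟩
  exact ContinuousLinearMap.ext fun v => rfl

theorem exists_injOn_nhds {f : ℂ → ℂ} {z : ℂ} (hf : ContDiff ℝ (⊤ : ℕ∞) f)
    (h : ‖dbar f z‖ < ‖dz f z‖) : ∃ U ∈ nhds z, InjOn f U := by
  obtain ⟨L, hL⟩ := exists_equiv_fderiv h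
  have h1 : HasStrictFDerivAt f (L : ℂ →L[ℝ] ℂ) z := by
    rw [hL]
    exact hf.contDiffAt.hasStrictFDerivAt (by simp)
  exact ⟨(h1.toOpenPartialHomeomorph f).source,
    (h1.toOpenPartialHomeomorph f).open_source.mem_nhds h1.mem_toOpenPartialHomeomorph_source,
    (h1.toOpenPartialHomeomorph f).injOn⟩

theorem periodic_add_int_mul {E : Type*} {f : ℂ → E} (h : Function.Periodic f (2 * Real.pi : ℝ))
    (k : ℤ) (z : ℂ) : f (z + k * (2 * Real.pi : ℝ)) = f z :=
  h.int_mul k z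

theorem exists_re_mem_Icc (z : ℂ) : ∃ k : ℤ, (z + k * (2 * Real.pi : ℝ)).re ∈
    Icc 0 (2 * Real.pi) ∧ (z + k * (2 * Real.pi : ℝ)).im = z.im := by
  obtain ⟨k, hk, -⟩ := existsUnique_add_zsmul_mem_Ico Real.two_pi_pos z.re 0
  refine ⟨k, ?_, by simp⟩
  have h1 : (z + k * (2 * Real.pi : ℝ)).re = z.re + k • (2 * Real.pi) := by
    simp
  rw [h1]
  simpa using Ico_subset_Icc_self hk

theorem dist_ofReal_re (w : ℂ) : dist w (w.re : ℂ) = |w.im| := by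
  rw [Complex.dist_of_re_eq (by simp)]
  simp

theorem eventually_strip_subset {U : Set ℂ} (hU : IsOpen U)
    (hper : ∀ (z : ℂ) (k : ℤ), z + k * (2 * Real.pi : ℝ) ∈ U → z ∈ U) (hreal : ∀ t : ℝ, (t : ℂ) ∈ U) :
    ∀ᶠ ε : ℝ in nhdsWithin 0 (Ioi 0), ∀ z : ℂ, |z.im| < ε → z ∈ U := by
  have hK : IsCompact ((fun t : ℝ => (t : ℂ)) '' Icc 0 (2 * Real.pi)) :=
    isCompact_Icc.image continuous_ofReal
  obtain ⟨δ, hδ, hsub⟩ := hK.exists_thickening_subset_open hU (by rintro _ ⟨t, -, rfl⟩; exact hreal t)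
  filter_upwards [Ioo_mem_nhdsGT hδ] with ε hε z hz
  obtain ⟨k, hk, him⟩ := exists_re_mem_Icc z
  refine hper z k (hsub ?_)
  rw [mem_thickening_iff]
  refine ⟨_, ⟨_, hk, rfl⟩, ?_⟩
  have := dist_ofReal_re (z + k * (2 * Real.pi : ℝ))
  rw [him] at this
  exact this.trans_lt (hz.trans hε.2)

theorem eventually_strip_subset_prod {U : Set (ℂ × ℂ)}
    (hper : ∀ (z w : ℂ) (k l : ℤ), (z + k * (2 * Real.pi : ℝ), w + l * (2 * Real.pi : ℝ)) ∈ U →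
      (z, w) ∈ U) (hreal : ∀ s t : ℝ, U ∈ nhds ((s : ℂ), (t : ℂ))) :
    ∀ᶠ ε : ℝ in nhdsWithin 0 (Ioi 0), ∀ z w : ℂ, |z.im| < ε → |w.im| < ε → (z, w) ∈ U := by
  have hK : IsCompact (((fun t : ℝ => (t : ℂ)) '' Icc 0 (2 * Real.pi)) ×ˢ
      ((fun t : ℝ => (t : ℂ)) '' Icc 0 (2 * Real.pi))) :=
    (isCompact_Icc.image continuous_ofReal).prod (isCompact_Icc.image continuous_ofReal)
  obtain ⟨δ, hδ, hsub⟩ := hK.exists_thickening_subset_open (isOpen_interior (s := U)) (by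
    rintro ⟨_, _⟩ ⟨⟨s, -, rfl⟩, ⟨t, -, rfl⟩⟩
    exact mem_interior_iff_mem_nhds.2 (hreal s t))
  filter_upwards [Ioo_mem_nhdsGT hδ] with ε hε z w hz hw
  obtain ⟨k, hk, him⟩ := exists_re_mem_Icc z
  obtain ⟨l, hl, him'⟩ := exists_re_mem_Icc w
  refine hper z w k l (interior_subset (hsub ?_))
  rw [mem_thickening_iff]
  refine ⟨(_, _), ⟨⟨_, hk, rfl⟩, ⟨_, hl, rfl⟩⟩, ?_⟩
  have h1 := dist_ofReal_re (z + k * (2 * Real.pi : ℝ))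
  have h2 := dist_ofReal_re (w + l * (2 * Real.pi : ℝ))
  rw [him] at h1
  rw [him'] at h2
  rw [Prod.dist_eq, max_lt_iff]
  exact ⟨h1.trans_lt (hz.trans hε.2), h2.trans_lt (hw.trans hε.2)⟩

theorem periodic_dz {f : ℂ → ℂ} {c : ℂ} (h : Function.Periodic f c) :
    Function.Periodic (dz f) c := fun z => by
  have : fderiv ℝ f (z + c) = fderiv ℝ f z := by
    rw [← fderiv_comp_add_right, funext h]
  simp only [dz, this]

theorem periodic_dbar {f : ℂ → ℂ} {c : ℂ} (h : Function.Periodic f c) :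
    Function.Periodic (dbar f) c := fun z => by
  have : fderiv ℝ f (z + c) = fderiv ℝ f z := by
    rw [← fderiv_comp_add_right, funext h]
  simp only [dbar, this]

theorem continuous_dz {f : ℂ → ℂ} (hf : ContDiff ℝ 1 f) : Continuous (dz f) := by
  have h := hf.continuous_fderiv one_ne_zero
  unfold dz
  fun_prop

theorem hasDerivAt_horizontal {f : ℂ → ℂ} (hf : Differentiable ℝ f) (t s : ℝ) :
    HasDerivAt (fun t : ℝ => f (t + s * I)) (fderiv ℝ f (t + s * I) 1) t := by
  have h1 : HasDerivAt (fun t : ℝ => (t : ℂ) + s * I) 1 t :=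
    (ofRealCLM.hasDerivAt).add_const _
  exact (hf _).hasFDerivAt.comp_hasDerivAt t h1

theorem exists_collar {n : ℕ} {γ : Fin n → ℝ → ℂ} (h1 : ∀ i, ContDiff ℝ (⊤ : ℕ∞) (γ i))
    (h2 : ∀ i, Function.Periodic (γ i) (2 * Real.pi))
    (h3 : ∀ i, InjOn (γ i) (Ico 0 (2 * Real.pi)))
    (h4 : ∀ i t, deriv (γ i) t ≠ 0)
    (h5 : Pairwise fun i j => Disjoint (range (γ i)) (range (γ j))) :
    ∃ col : Collar n, ∀ i (t : ℝ), col.Γ i t = γ i t := by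
  choose Γ hs hp hr hf using fun i => exists_almost_analytic_extension (h1 i) (h2 i)
  have hs1 : ∀ i, ContDiff ℝ 1 (Γ i) := fun i => (hs i).of_le (mod_cast le_top)
  have hdbar0 : ∀ i (t : ℝ), dbar (Γ i) t = 0 := fun i t => by
    obtain ⟨C, -, hC⟩ := hf i 1
    have := hC t
    simpa using this
  have hdz : ∀ i (t : ℝ), dz (Γ i) t = deriv (γ i) t := fun i t => by
    have e1 := hasDerivAt_horizontal ((hs i).differentiable (by simp)) t 0
    simp only [ofReal_zero, zero_mul, add_zero, hr] at e1
    have e2 := fderiv_apply_eq (Γ i) t 1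
    rw [hdbar0] at e2
    rw [e1.deriv, e2]; simp
  have hbd : ∀ i, ∃ c, 0 < c ∧ ∀ t, c < ‖deriv (γ i) t‖ := fun i => by
    have hc : Continuous (deriv (γ i)) := (contDiff_infty_iff_deriv.1 (h1 i)).2.continuous
    obtain ⟨t0, -, ht0⟩ := (isCompact_Icc (a := (0 : ℝ)) (b := 2 * Real.pi)).exists_isMinOn
      (nonempty_Icc.2 Real.two_pi_pos.le) hc.norm.continuousOn
    have hpos : 0 < ‖deriv (γ i) t0‖ := norm_pos_iff.2 (h4 i t0)
    refine ⟨‖deriv (γ i) t0‖ / 2, by positivity, fun t => ?_⟩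
    obtain ⟨y, hy, he⟩ := (periodic_deriv (h2 i)).exists_mem_Ico₀ Real.two_pi_pos t
    rw [he]
    have : ‖deriv (γ i) t0‖ ≤ ‖deriv (γ i) y‖ := ht0 (Ico_subset_Icc_self hy)
    linarith
  choose c' hc' hcd using hbd
  obtain ⟨c, hc, hcc⟩ : ∃ c, 0 < c ∧ ∀ i, c ≤ c' i := by
    rcases isEmpty_or_nonempty (Fin n) with hn | hn
    · exact ⟨1, one_pos, fun i => hn.elim i⟩
    · obtain ⟨i, hi⟩ := Finite.exists_min c'
      exact ⟨c' i, hc' i, hi⟩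
  have hev1 : ∀ i, ∀ᶠ ε : ℝ in nhdsWithin 0 (Ioi 0), ∀ z : ℂ, |z.im| < ε →
      z ∈ {z : ℂ | c < ‖dz (Γ i) z‖ ∧ ‖dbar (Γ i) z‖ < ‖dz (Γ i) z‖ / 2} := by
    intro i
    refine eventually_strip_subset ?_ ?_ ?_
    · have := continuous_dz (hs1 i)
      have := continuous_dbar (hs1 i)
      exact IsOpen.inter (s := {z | c < ‖dz (Γ i) z‖})
        (t := {z | ‖dbar (Γ i) z‖ < ‖dz (Γ i) z‖ / 2})
        (isOpen_lt (by fun_prop) (by fun_prop)) (isOpen_lt (by fun_prop) (by fun_prop))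
    · intro z k hz
      simpa only [mem_ofPred_eq, periodic_add_int_mul (periodic_dz (hp i)),
        periodic_add_int_mul (periodic_dbar (hp i))] using hz
    · intro t
      have := (hcc i).trans_lt (hcd i t)
      simp only [mem_ofPred_eq, hdbar0, hdz, norm_zero]
      exact ⟨this, by linarith⟩
  have hev2 : ∀ i j, ∀ᶠ ε : ℝ in nhdsWithin 0 (Ioi 0), ∀ z w : ℂ, |z.im| < ε → |w.im| < ε →
      (z, w) ∈ {p : ℂ × ℂ | Γ i p.1 = Γ j p.2 →
        i = j ∧ ∃ k : ℤ, p.2 = p.1 + k * (2 * Real.pi : ℝ)} := by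
    intro i j
    refine eventually_strip_subset_prod ?_ ?_
    · intro z w k l h he
      simp only [mem_ofPred_eq, periodic_add_int_mul (hp i), periodic_add_int_mul (hp j)] at h
      obtain ⟨hij, m, hm⟩ := h he
      refine ⟨hij, m + k - l, ?_⟩
      push_cast at hm ⊢
      linear_combination hm
    · intro s t
      by_cases he : Γ i s = Γ j t
      · rw [hr, hr] at he
        have hij : i = j := by
          by_contra hij
          exact (h5 hij).ne_of_mem ⟨s, rfl⟩ ⟨t, rfl⟩ he
        subst hij
        obtain ⟨k, hk, -⟩ := existsUnique_add_zsmul_mem_Ico Real.two_pi_pos s 0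
        obtain ⟨l, hl, -⟩ := existsUnique_add_zsmul_mem_Ico Real.two_pi_pos t 0
        rw [zero_add] at hk hl
        have e1 : γ i (s + k • (2 * Real.pi)) = γ i (t + l • (2 * Real.pi)) := by
          rw [(h2 i).zsmul k s, (h2 i).zsmul l t, he]
        have e2 := h3 i hk hl e1
        obtain ⟨U, hU, hinj⟩ := exists_injOn_nhds (hs i) (z := (s : ℂ)) (by
          rw [hdbar0, hdz, norm_zero]; exact norm_pos_iff.2 (h4 i s))
        have hst : (t : ℂ) - ((k - l : ℤ) : ℂ) * (2 * Real.pi : ℝ) = s := by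
          simp only [zsmul_eq_mul] at e2
          have e3 : (s : ℂ) + k * (2 * Real.pi : ℝ) = t + l * (2 * Real.pi : ℝ) := by
            exact_mod_cast e2
          push_cast at e3 ⊢
          linear_combination -e3
        have hc2 : ContinuousAt (fun p : ℂ × ℂ => p.2 - ((k - l : ℤ) : ℂ) * (2 * Real.pi : ℝ))
            ((s : ℂ), (t : ℂ)) := by fun_prop
        have e4 := hc2.preimage_mem_nhds (t := U) (by simp only; rw [hst]; exact hU)
        have e5 := (continuousAt_fst (p := ((s : ℂ), (t : ℂ)))).preimage_mem_nhds hU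
        filter_upwards [e4, e5] with p hp2 hp1 hpe
        refine ⟨rfl, k - l, ?_⟩
        have e6 : Γ i (p.2 - ((k - l : ℤ) : ℂ) * (2 * Real.pi : ℝ)) = Γ i p.2 := by
          conv_rhs => rw [← sub_add_cancel p.2 (((k - l : ℤ) : ℂ) * (2 * Real.pi : ℝ))]
          rw [periodic_add_int_mul (hp i)]
        have e7 := hinj hp1 hp2 (hpe.trans e6.symm)
        rw [e7]; ring
      · have hc3 : ContinuousAt (fun p : ℂ × ℂ => Γ i p.1 - Γ j p.2) ((s : ℂ), (t : ℂ)) := by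
          have := (hs i).continuous
          have := (hs j).continuous
          fun_prop
        filter_upwards [hc3.eventually_ne (sub_ne_zero.2 he)] with p hp1 hp2
        exact absurd (sub_eq_zero.2 hp2) hp1
  obtain ⟨ε, ⟨hε1, hε2⟩, hε3, hε4⟩ := (((Filter.eventually_all.2 hev1).and
    (Filter.eventually_all.2 fun i => Filter.eventually_all.2 fun j => hev2 i j)).and
    (Ioo_mem_nhdsGT (zero_lt_one (α := ℝ)))).exists
  refine ⟨⟨Γ, ε, hε3, hε4.le, hs, hp, fun i j z w hz hw he => hε2 i j z w hz hw he, fun N => ?_,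
    c, hc, fun i z hz => (hε1 i z hz).1.le, fun i z hz => (hε1 i z hz).2.le⟩, hr⟩
  choose C hC hCb using fun i => hf i N
  refine ⟨∑ i, C i, Finset.sum_nonneg fun i _ => hC i, fun i z => (hCb i z).trans ?_⟩
  have := Finset.single_le_sum (fun i _ => hC i) (Finset.mem_univ i)
  gcongr

namespace Collar

/-- Transfer periodic functions on the strips to the plane through the collar coordinates. -/
def push {n : ℕ} (col : Collar n) (Φ : Fin n → ℂ → ℂ) (z : ℂ) : ℂ :=
  open Classical in
  if h : ∃ i, ∃ ζ : ℂ, |ζ.im| < col.ε ∧ col.Γ i ζ = z then Φ h.choose h.choose_spec.choose else 0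

theorem push_apply {n : ℕ} (col : Collar n) {Φ : Fin n → ℂ → ℂ}
    (hp : ∀ i, Function.Periodic (Φ i) (2 * Real.pi : ℝ)) {i : Fin n} {ζ : ℂ}
    (hζ : |ζ.im| < col.ε) : col.push Φ (col.Γ i ζ) = Φ i ζ := by
  have h : ∃ j, ∃ ξ : ℂ, |ξ.im| < col.ε ∧ col.Γ j ξ = col.Γ i ζ := ⟨i, ζ, hζ, rfl⟩
  rw [push, dif_pos h]
  obtain ⟨h1, h2⟩ := h.choose_spec.choose_spec
  obtain ⟨hij, k, hk⟩ := col.inj _ _ _ _ h1 hζ h2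
  have e := periodic_add_int_mul (hp i) k h.choose_spec.choose
  rw [← hk] at e
  rw [e]
  exact congrArg (fun j => Φ j h.choose_spec.choose) hij

theorem push_of_not {n : ℕ} (col : Collar n) (Φ : Fin n → ℂ → ℂ) {z : ℂ}
    (h : ¬ ∃ i, ∃ ζ : ℂ, |ζ.im| < col.ε ∧ col.Γ i ζ = z) : col.push Φ z = 0 := by
  rw [push, dif_neg h]

theorem dbar_lt_dz {n : ℕ} (col : Collar n) {i : Fin n} {ζ : ℂ} (hζ : |ζ.im| < col.ε) :
    ‖dbar (col.Γ i) ζ‖ < ‖dz (col.Γ i) ζ‖ := by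
  have h1 := col.le_dz i ζ hζ
  have h2 := col.dbar_le i ζ hζ
  have := col.c_pos
  linarith

theorem exists_local_inverse {n : ℕ} (col : Collar n) {i : Fin n} {ζ : ℂ}
    (hζ : |ζ.im| < col.ε) : ∃ σ : ℂ → ℂ, ContDiffAt ℝ (⊤ : ℕ∞) σ (col.Γ i ζ) ∧
      σ (col.Γ i ζ) = ζ ∧ ∀ Φ : Fin n → ℂ → ℂ,
        (∀ i, Function.Periodic (Φ i) (2 * Real.pi : ℝ)) →
        col.push Φ =ᶠ[nhds (col.Γ i ζ)] fun z => Φ i (σ z) := by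
  obtain ⟨L, hL⟩ := exists_equiv_fderiv (col.dbar_lt_dz (i := i) hζ)
  have h0 : ContDiffAt ℝ (⊤ : ℕ∞) (col.Γ i) ζ := (col.smooth i).contDiffAt
  have h1 : HasFDerivAt (col.Γ i) (L : ℂ →L[ℝ] ℂ) ζ := by
    rw [hL]; exact (h0.differentiableAt (by simp)).hasFDerivAt
  have hsm := h0.to_localInverse h1 (by simp)
  have hval : h0.localInverse h1 (by simp) (col.Γ i ζ) = ζ :=
    h0.localInverse_apply_image h1 (by simp)
  refine ⟨h0.localInverse h1 (by simp), hsm, hval, fun Φ hΦ => ?_⟩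
  have h2 : ∀ᶠ z in nhds (col.Γ i ζ), col.Γ i (h0.localInverse h1 (by simp) z) = z :=
    (h0.hasStrictFDerivAt' h1 (by simp)).eventually_right_inverse
  have h3 : ∀ᶠ z in nhds (col.Γ i ζ), |(h0.localInverse h1 (by simp) z).im| < col.ε := by
    have hc : ContinuousAt (fun z => |(h0.localInverse h1 (by simp) z).im|) (col.Γ i ζ) :=
      (Complex.continuous_im.continuousAt.comp hsm.continuousAt).abs
    have := hc.eventually (eventually_lt_nhds (b := col.ε) (by beta_reduce; rw [hval]; exact hζ))
    exact this
  filter_upwards [h2, h3] with z hz hz'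
  conv_lhs => rw [← hz]
  exact col.push_apply hΦ hz'

theorem push_contDiffAt {n : ℕ} (col : Collar n) {Φ : Fin n → ℂ → ℂ}
    (hp : ∀ i, Function.Periodic (Φ i) (2 * Real.pi : ℝ)) {i : Fin n} {ζ : ℂ}
    (hζ : |ζ.im| < col.ε) {m : ℕ∞} (hΦ : ContDiffAt ℝ m (Φ i) ζ) :
    ContDiffAt ℝ m (col.push Φ) (col.Γ i ζ) := by
  obtain ⟨σ, h1, h2, h3⟩ := col.exists_local_inverse (i := i) hζ
  refine ContDiffAt.congr_of_eventuallyEq ?_ (h3 Φ hp)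
  exact ContDiffAt.comp _ (by rw [h2]; exact hΦ) (h1.of_le (mod_cast le_top))

theorem push_continuousAt {n : ℕ} (col : Collar n) {Φ : Fin n → ℂ → ℂ}
    (hp : ∀ i, Function.Periodic (Φ i) (2 * Real.pi : ℝ)) {i : Fin n} {ζ : ℂ}
    (hζ : |ζ.im| < col.ε) (hΦ : ContinuousAt (Φ i) ζ) :
    ContinuousAt (col.push Φ) (col.Γ i ζ) := by
  obtain ⟨σ, h1, h2, h3⟩ := col.exists_local_inverse (i := i) hζ
  refine ContinuousAt.congr ?_ (h3 Φ hp).symm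
  exact ContinuousAt.comp (g := Φ i) (by rw [h2]; exact hΦ) h1.continuousAt

/-- The closed collars of width `ρ`. -/
def shell {n : ℕ} (col : Collar n) (ρ : ℝ) : Set ℂ :=
  ⋃ i, col.Γ i '' (Icc 0 (2 * Real.pi) ×ℂ Icc (-ρ) ρ)

theorem isCompact_shell {n : ℕ} (col : Collar n) (ρ : ℝ) : IsCompact (col.shell ρ) :=
  isCompact_iUnion fun i =>
    (isCompact_Icc.reProdIm isCompact_Icc).image (col.smooth i).continuous

theorem mem_shell {n : ℕ} (col : Collar n) {ρ : ℝ} {i : Fin n} {ζ : ℂ} (h : |ζ.im| ≤ ρ) :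
    col.Γ i ζ ∈ col.shell ρ := by
  obtain ⟨k, hk, him⟩ := exists_re_mem_Icc ζ
  refine mem_iUnion.2 ⟨i, _, ⟨hk, ?_⟩, periodic_add_int_mul (col.periodic i) k ζ⟩
  simp only [mem_preimage]
  rw [him]; exact abs_le.1 h

theorem push_eq_zero {n : ℕ} (col : Collar n) {Φ : Fin n → ℂ → ℂ} {ρ : ℝ}
    (hs : ∀ i (ζ : ℂ), ρ ≤ |ζ.im| → Φ i ζ = 0) {z : ℂ}
    (hz : z ∉ col.shell ρ) : col.push Φ z = 0 := by
  by_cases h : ∃ i, ∃ ζ : ℂ, |ζ.im| < col.ε ∧ col.Γ i ζ = z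
  · rw [push, dif_pos h]
    refine hs _ _ ?_
    by_contra hlt
    obtain ⟨h1, h2⟩ := h.choose_spec.choose_spec
    rw [← h2] at hz
    exact hz (col.mem_shell (not_le.1 hlt).le)
  · exact col.push_of_not Φ h

theorem push_eventually_zero {n : ℕ} (col : Collar n) {Φ : Fin n → ℂ → ℂ} {ρ : ℝ}
    (hs : ∀ i (ζ : ℂ), ρ ≤ |ζ.im| → Φ i ζ = 0) {z : ℂ}
    (hz : z ∉ col.shell ρ) : col.push Φ =ᶠ[nhds z] fun _ => 0 := by
  filter_upwards [(col.isCompact_shell ρ).isClosed.isOpen_compl.mem_nhds hz] with w hw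
  exact col.push_eq_zero hs hw

theorem exists_of_mem_shell {n : ℕ} (col : Collar n) {ρ : ℝ} {z : ℂ} (h : z ∈ col.shell ρ) :
    ∃ i, ∃ ζ : ℂ, |ζ.im| ≤ ρ ∧ col.Γ i ζ = z := by
  obtain ⟨i, ζ, ⟨-, h2⟩, rfl⟩ := mem_iUnion.1 h
  exact ⟨i, ζ, abs_le.2 h2, rfl⟩

theorem push_hasCompactSupport {n : ℕ} (col : Collar n) {Φ : Fin n → ℂ → ℂ} {ρ : ℝ}
    (hs : ∀ i (ζ : ℂ), ρ ≤ |ζ.im| → Φ i ζ = 0) : HasCompactSupport (col.push Φ) :=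
  HasCompactSupport.intro (col.isCompact_shell ρ) fun _ hz => col.push_eq_zero hs hz

theorem push_contDiff {n : ℕ} (col : Collar n) {Φ : Fin n → ℂ → ℂ}
    (hp : ∀ i, Function.Periodic (Φ i) (2 * Real.pi : ℝ)) {ρ : ℝ} (hρ : ρ < col.ε)
    (hs : ∀ i (ζ : ℂ), ρ ≤ |ζ.im| → Φ i ζ = 0) {m : ℕ∞} (hΦ : ∀ i, ContDiff ℝ m (Φ i)) :
    ContDiff ℝ m (col.push Φ) := by
  refine contDiff_iff_contDiffAt.2 fun z => ?_
  by_cases hz : z ∈ col.shell ρ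
  · obtain ⟨i, ζ, h1, rfl⟩ := col.exists_of_mem_shell hz
    exact col.push_contDiffAt hp (h1.trans_lt hρ) (hΦ i).contDiffAt
  · exact contDiffAt_const.congr_of_eventuallyEq (col.push_eventually_zero hs hz)

theorem push_continuous {n : ℕ} (col : Collar n) {Φ : Fin n → ℂ → ℂ}
    (hp : ∀ i, Function.Periodic (Φ i) (2 * Real.pi : ℝ)) {ρ : ℝ} (hρ : ρ < col.ε)
    (hs : ∀ i (ζ : ℂ), ρ ≤ |ζ.im| → Φ i ζ = 0) (hΦ : ∀ i, Continuous (Φ i)) :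
    Continuous (col.push Φ) := by
  refine continuous_iff_continuousAt.2 fun z => ?_
  by_cases hz : z ∈ col.shell ρ
  · obtain ⟨i, ζ, h1, rfl⟩ := col.exists_of_mem_shell hz
    exact col.push_continuousAt hp (h1.trans_lt hρ) (hΦ i).continuousAt
  · exact continuousAt_const.congr (col.push_eventually_zero hs hz).symm

theorem exists_norm_dbar_push_le {n : ℕ} (col : Collar n) : ∃ C, 0 ≤ C ∧
    ∀ Φ : Fin n → ℂ → ℂ, (∀ i, Function.Periodic (Φ i) (2 * Real.pi : ℝ)) →
    ∀ i (ζ : ℂ), |ζ.im| < col.ε → ContDiffAt ℝ 1 (Φ i) ζ →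
      ‖dbar (col.push Φ) (col.Γ i ζ)‖ ≤
        C * (‖dbar (Φ i) ζ‖ + ‖fderiv ℝ (Φ i) ζ‖ * ‖dbar (col.Γ i) ζ‖) := by
  have hc := col.c_pos
  refine ⟨2 / col.c + 2 / col.c ^ 2, by positivity, fun Φ hp i ζ hζ hΦ => ?_⟩
  have hV : DifferentiableAt ℝ (col.push Φ) (col.Γ i ζ) :=
    (col.push_contDiffAt hp hζ (m := 1) hΦ).differentiableAt (by simp)
  have hΓ : DifferentiableAt ℝ (col.Γ i) ζ := (col.smooth i).contDiffAt.differentiableAt (by simp)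
  have heq : (fun w => col.push Φ (col.Γ i w)) =ᶠ[nhds ζ] Φ i := by
    have : IsOpen {w : ℂ | |w.im| < col.ε} := isOpen_lt (by fun_prop) continuous_const
    filter_upwards [this.mem_nhds hζ] with w hw
    exact col.push_apply hp hw
  have e1 := dbar_comp hV hΓ
  have e2 := dz_comp hV hΓ
  rw [dbar_congr heq] at e1
  rw [dz_congr heq] at e2
  set a := dz (col.push Φ) (col.Γ i ζ)
  set b := dbar (col.push Φ) (col.Γ i ζ)
  set p := dz (col.Γ i) ζ
  set q := dbar (col.Γ i) ζ
  have hp1 : col.c ≤ ‖p‖ := col.le_dz i ζ hζ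
  have hq1 : ‖q‖ ≤ ‖p‖ / 2 := col.dbar_le i ζ hζ
  have e3 : b * (p * conj p - q * conj q) = dbar (Φ i) ζ * p - dz (Φ i) ζ * q := by
    rw [e1, e2]; ring
  have e4 : ‖b‖ * ‖p * conj p - q * conj q‖ ≤ ‖dbar (Φ i) ζ‖ * ‖p‖ +
      ‖fderiv ℝ (Φ i) ζ‖ * ‖q‖ := by
    rw [← norm_mul, e3]
    refine (norm_sub_le _ _).trans ?_
    rw [norm_mul, norm_mul]
    gcongr
    exact norm_dz_le _ _
  have e5 : ‖p‖ ^ 2 / 2 ≤ ‖p * conj p - q * conj q‖ := by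
    have := norm_sub_norm_le (p * conj p) (q * conj q)
    rw [norm_mul, norm_mul, RCLike.norm_conj, RCLike.norm_conj] at this
    nlinarith [norm_nonneg q, norm_nonneg p]
  have hP : 0 < ‖p‖ := hc.trans_le hp1
  have e6 : ‖b‖ * (‖p‖ ^ 2 / 2) ≤ ‖dbar (Φ i) ζ‖ * ‖p‖ + ‖fderiv ℝ (Φ i) ζ‖ * ‖q‖ :=
    (mul_le_mul_of_nonneg_left e5 (norm_nonneg _)).trans e4
  set A := ‖dbar (Φ i) ζ‖
  set B := ‖fderiv ℝ (Φ i) ζ‖ * ‖q‖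
  have hA : 0 ≤ A := norm_nonneg _
  have hB : 0 ≤ B := by positivity
  have e7 : ‖b‖ ≤ 2 / ‖p‖ * A + 2 / ‖p‖ ^ 2 * B := by
    have : 2 / ‖p‖ * A + 2 / ‖p‖ ^ 2 * B = (A * ‖p‖ + B) / (‖p‖ ^ 2 / 2) := by
      field_simp
    rw [this, le_div_iff₀ (by positivity)]
    exact e6
  have e8 : 2 / ‖p‖ ≤ 2 / col.c := by gcongr
  have e9 : 2 / ‖p‖ ^ 2 ≤ 2 / col.c ^ 2 := by gcongr
  have e10 : 0 ≤ 2 / col.c := by positivity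
  have e11 : 0 ≤ 2 / col.c ^ 2 := by positivity
  nlinarith [mul_le_mul_of_nonneg_right e8 hA, mul_le_mul_of_nonneg_right e9 hB,
    mul_nonneg e10 hB, mul_nonneg e11 hA]

end Collar

theorem exists_cutoff {a b : ℝ} (ha : 0 < a) (hab : a < b) : ∃ θ : ℝ → ℝ,
    ContDiff ℝ (⊤ : ℕ∞) θ ∧ (∀ s, |s| ≤ a → θ s = 1) ∧ (∀ s, b ≤ |s| → θ s = 0) ∧
    ∀ s, 0 ≤ θ s ∧ θ s ≤ 1 := by
  let f : ContDiffBump (0 : ℝ) := ⟨a, b, ha, hab⟩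
  refine ⟨f, f.contDiff, fun s hs => f.one_of_mem_closedBall ?_, fun s hs => f.zero_of_le_dist ?_,
    fun s => ⟨f.nonneg, f.le_one⟩⟩
  · simpa [dist_eq_norm] using hs
  · simpa [dist_eq_norm] using hs

theorem contDiff_comp_im {θ : ℝ → ℝ} (hθ : ContDiff ℝ (⊤ : ℕ∞) θ) :
    ContDiff ℝ (⊤ : ℕ∞) fun ζ : ℂ => (θ ζ.im : ℂ) :=
  ofRealCLM.contDiff.comp (hθ.comp imCLM.contDiff)

theorem periodic_comp_im (θ : ℝ → ℂ) :
    Function.Periodic (fun ζ : ℂ => θ ζ.im) (2 * Real.pi : ℝ) := fun ζ => by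
  simp

/-- The Cauchy transform of `f`. -/
def cauchyT (f : ℂ → ℂ) (z : ℂ) : ℂ := (Real.pi : ℂ)⁻¹ * ∫ w, f w / (z - w)

theorem cauchyT_eq_integral_sub (f : ℂ → ℂ) (z : ℂ) :
    cauchyT f z = (Real.pi : ℂ)⁻¹ * ∫ t, t⁻¹ * f (z - t) := by
  rw [cauchyT, ← integral_sub_left_eq_self (fun w => f w / (z - w)) volume z]
  simp [div_eq_mul_inv, mul_comm]

theorem locallyIntegrable_inv : LocallyIntegrable (fun t : ℂ => t⁻¹) volume := by
  refine locallyIntegrable_of_norm_le_rpow (C := 1) (α := 1) ?_ ?_ ?_ ?_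
  · simp
  · simp
  · refine Filter.Eventually.of_forall fun x => ?_
    rw [norm_inv, Real.rpow_neg_one, one_mul]
  · exact measurable_inv.aestronglyMeasurable

theorem cauchyT_eq_convolution (f : ℂ → ℂ) (z : ℂ) :
    cauchyT f z = (Real.pi : ℂ)⁻¹ *
      convolution (fun t : ℂ => t⁻¹) f (ContinuousLinearMap.mul ℝ ℂ) volume z := by
  rw [cauchyT_eq_integral_sub]; rfl

theorem continuous_cauchyT {f : ℂ → ℂ} (hf : Continuous f) (hc : HasCompactSupport f) :
    Continuous (cauchyT f) := by
  have h := hc.continuous_convolution_right (ContinuousLinearMap.mul ℝ ℂ) locallyIntegrable_inv hf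
  rw [show cauchyT f = _ from funext (cauchyT_eq_convolution f)]
  exact continuous_const.mul h

theorem contDiff_cauchyT {f : ℂ → ℂ} (hf : ContDiff ℝ (⊤ : ℕ∞) f) (hc : HasCompactSupport f) :
    ContDiff ℝ (⊤ : ℕ∞) (cauchyT f) := by
  have h := hc.contDiff_convolution_right (n := ⊤) (ContinuousLinearMap.mul ℝ ℂ)
    locallyIntegrable_inv hf
  rw [show cauchyT f = _ from funext (cauchyT_eq_convolution f)]
  exact contDiff_const.mul h

theorem integrable_div_sub {f : ℂ → ℂ} (hf : Continuous f) (hc : HasCompactSupport f) (z : ℂ) :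
    Integrable (fun w => f w / (z - w)) := by
  have h := (hc.convolutionExists_right (ContinuousLinearMap.mul ℝ ℂ)
    (f := fun t : ℂ => t⁻¹) (μ := volume) locallyIntegrable_inv hf) z
  have h2 : Integrable (fun t : ℂ => t⁻¹ * f (z - t)) := h
  have h3 := h2.comp_sub_left z
  refine h3.congr (Filter.Eventually.of_forall fun w => ?_)
  simp [div_eq_mul_inv, mul_comm]

theorem cauchyT_sub {f g : ℂ → ℂ} (hf : Continuous f) (hfc : HasCompactSupport f)
    (hg : Continuous g) (hgc : HasCompactSupport g) (z : ℂ) :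
    cauchyT (fun w => f w - g w) z = cauchyT f z - cauchyT g z := by
  simp only [cauchyT, sub_div]
  rw [integral_sub (integrable_div_sub hf hfc z) (integrable_div_sub hg hgc z)]
  ring

theorem differentiableAt_cauchyT {f : ℂ → ℂ} (hf : Continuous f) (hc : HasCompactSupport f)
    {z₀ : ℂ} (h0 : f =ᶠ[nhds z₀] 0) : DifferentiableAt ℂ (cauchyT f) z₀ := by
  obtain ⟨ε, hε, hb⟩ := Metric.eventually_nhds_iff.1 h0
  have key : ∀ w, f w ≠ 0 → ∀ z ∈ ball z₀ (ε / 2), ε / 2 ≤ ‖z - w‖ := by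
    intro w hw z hz
    by_contra hlt
    push Not at hlt
    apply hw
    refine hb ?_
    rw [mem_ball] at hz
    have := dist_triangle w z z₀
    rw [dist_comm w z, dist_eq_norm z w] at this
    linarith
  have h := hasDerivAt_integral_of_dominated_loc_of_deriv_le (μ := (volume : Measure ℂ))
    (F := fun z w => f w / (z - w)) (F' := fun z w => -f w / (z - w) ^ 2)
    (bound := fun w => ‖f w‖ / (ε / 2) ^ 2) (x₀ := z₀) (s := ball z₀ (ε / 2))
    (ball_mem_nhds _ (by positivity))
    (Filter.Eventually.of_forall fun z => (integrable_div_sub hf hc z).aestronglyMeasurable)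
    (integrable_div_sub hf hc z₀)
    ((hf.neg.measurable.div (by fun_prop)).aestronglyMeasurable)
    (Filter.Eventually.of_forall fun w z hz => ?_)
    ((hf.integrable_of_hasCompactSupport hc).norm.div_const _)
    (Filter.Eventually.of_forall fun w z hz => ?_)
  · exact h.2.differentiableAt.const_mul _
  · by_cases hw : f w = 0
    · simp [hw]
    · have := key w hw z hz
      rw [norm_div, norm_neg, norm_pow]
      gcongr
  · by_cases hw : f w = 0
    · simpa [hw] using hasDerivAt_const z (0 : ℂ)
    · have h1 := key w hw z hz
      have hne : z - w ≠ 0 := by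
        intro h; rw [h, norm_zero] at h1; linarith
      have h2 : HasDerivAt (fun z => z - w) 1 z := (hasDerivAt_id z).sub_const w
      have h3 := (hasDerivAt_const z (f w)).fun_div h2 hne
      exact h3.congr_deriv (by simp)

theorem intervalIntegral_swap_of_continuous {F : ℝ → ℝ → ℂ} (hF : Continuous (Function.uncurry F))
    (a b c d : ℝ) :
    ∫ x in a..b, ∫ y in c..d, F x y = ∫ y in c..d, ∫ x in a..b, F x y := by
  refine intervalIntegral_intervalIntegral_swap ?_
  exact (hF.continuousOn.integrableOn_compact (isCompact_uIcc.prod isCompact_uIcc)).mono_set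
    (Set.prod_mono uIoc_subset_uIcc uIoc_subset_uIcc)

theorem integral_polar_rect {h : ℝ × ℝ → ℂ} (hc : Continuous h) {R : ℝ} (hR : 0 ≤ R)
    (h0 : ∀ p : ℝ × ℝ, R < p.1 → h p = 0) :
    IntegrableOn h (Ioi 0 ×ˢ Ioo (-Real.pi) Real.pi) ∧
    (∫ p in Ioi 0 ×ˢ Ioo (-Real.pi) Real.pi, h p) =
      ∫ θ in -Real.pi..Real.pi, ∫ r in (0 : ℝ)..R, h (r, θ) ∧
    (∫ p in Ioi 0 ×ˢ Ioo (-Real.pi) Real.pi, h p) =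
      ∫ r in (0 : ℝ)..R, ∫ θ in -Real.pi..Real.pi, h (r, θ) := by
  have hpi := Real.pi_pos
  have hsub : Ioc 0 R ×ˢ Ioo (-Real.pi) Real.pi ⊆ Ioi (0 : ℝ) ×ˢ Ioo (-Real.pi) Real.pi := by
    gcongr; exact fun x hx => hx.1
  have hz : ∀ p ∈ (Ioi (0 : ℝ) ×ˢ Ioo (-Real.pi) Real.pi) \ (Ioc 0 R ×ˢ Ioo (-Real.pi) Real.pi),
      h p = 0 := by
    rintro ⟨r, θ⟩ ⟨⟨h1, h2⟩, h3⟩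
    apply h0
    by_contra hlt
    exact h3 ⟨⟨h1, not_lt.1 hlt⟩, h2⟩
  have hi : IntegrableOn h (Ioc 0 R ×ˢ Ioo (-Real.pi) Real.pi) :=
    (hc.continuousOn.integrableOn_compact (isCompact_Icc.prod isCompact_Icc)).mono_set
      (Set.prod_mono Ioc_subset_Icc_self Ioo_subset_Icc_self)
  have hm : MeasurableSet (Ioi (0 : ℝ) ×ˢ Ioo (-Real.pi) Real.pi) :=
    measurableSet_Ioi.prod measurableSet_Ioo
  have hi2 : IntegrableOn h (Ioi 0 ×ˢ Ioo (-Real.pi) Real.pi) :=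
    hi.of_forall_sdiff_eq_zero hm hz
  have e1 : (∫ p in Ioi 0 ×ˢ Ioo (-Real.pi) Real.pi, h p) =
      ∫ r in (0 : ℝ)..R, ∫ θ in -Real.pi..Real.pi, h (r, θ) := by
    rw [setIntegral_eq_of_subset_of_forall_sdiff_eq_zero hm hsub hz, Measure.volume_eq_prod,
      setIntegral_prod _ hi, intervalIntegral.integral_of_le hR]
    congr 1; ext r
    rw [intervalIntegral.integral_of_le (by linarith), integral_Ioc_eq_integral_Ioo]
  refine ⟨hi2, ?_, e1⟩
  rw [e1]
  refine (intervalIntegral_swap_of_continuous (F := fun r θ => h (r, θ)) hc _ _ _ _)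

theorem hasFDerivAt_polar_shift {φ : ℂ → ℂ} (hφ : ContDiff ℝ 1 φ) (z : ℂ) (r θ : ℝ) :
    HasDerivAt (fun r : ℝ => φ (z - r * exp (θ * I)))
      (-(dbar φ (z - r * exp (θ * I)) * exp (-(θ * I)) +
        dz φ (z - r * exp (θ * I)) * exp (θ * I))) r ∧
    HasDerivAt (fun θ : ℝ => φ (z - r * exp (θ * I)))
      (r * I * (dbar φ (z - r * exp (θ * I)) * exp (-(θ * I)) -
        dz φ (z - r * exp (θ * I)) * exp (θ * I))) θ := by
  have hd : HasFDerivAt φ (fderiv ℝ φ (z - r * exp (θ * I))) (z - r * exp (θ * I)) :=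
    ((hφ.differentiable one_ne_zero) _).hasFDerivAt
  have hconj : conj (exp (θ * I)) = exp (-(θ * I)) := by
    rw [← exp_conj]; simp
  have h1 : HasDerivAt (fun r : ℝ => z - r * exp (θ * I)) (-(exp (θ * I))) r := by
    have := (((hasDerivAt_id r).ofReal_comp).mul_const (exp (θ * I))).const_sub z
    simpa using this
  have h2 : HasDerivAt (fun θ : ℝ => z - r * exp (θ * I)) (-(r * (exp (θ * I) * I))) θ := by
    have h0 : HasDerivAt (fun θ : ℝ => (θ : ℂ) * I) I θ := by
      simpa using ((hasDerivAt_id θ).ofReal_comp).mul_const I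
    exact ((h0.cexp).const_mul (r : ℂ)).const_sub z
  constructor
  · have := hd.comp_hasDerivAt r h1
    refine HasDerivAt.congr_deriv this ?_
    rw [fderiv_apply_eq, map_neg, hconj]; ring
  · have := hd.comp_hasDerivAt θ h2
    refine HasDerivAt.congr_deriv this ?_
    rw [fderiv_apply_eq, map_neg, map_mul, map_mul, hconj, conj_I, conj_ofReal]; ring

/-- The Cauchy–Pompeiu formula for compactly supported functions. -/
theorem cauchyT_dbar {φ : ℂ → ℂ} (hφ : ContDiff ℝ 1 φ) (hc : HasCompactSupport φ) (z : ℂ) :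
    cauchyT (dbar φ) z = φ z := by
  have hpi := Real.pi_pos
  obtain ⟨R, hR0, hR⟩ : ∃ R : ℝ, 0 < R ∧ ∀ r : ℝ, R < r → ∀ θ : ℝ,
      z - r * exp (θ * I) ∉ tsupport φ := by
    obtain ⟨R, hR⟩ := hc.isBounded.subset_closedBall z
    refine ⟨max R 1, by positivity, fun r hr θ hmem => ?_⟩
    have := hR hmem
    have hr0 : 0 < r := lt_of_lt_of_le one_pos ((le_max_right R 1).trans hr.le)
    rw [mem_closedBall, dist_eq_norm] at this
    simp only [sub_sub_cancel_left, norm_neg, norm_mul, norm_exp_ofReal_mul_I, mul_one,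
      norm_real, Real.norm_eq_abs, abs_of_pos hr0] at this
    exact absurd (lt_of_le_of_lt (le_max_left R 1) hr) (not_lt.2 this)
  set w : ℝ × ℝ → ℂ := fun p => z - p.1 * exp (p.2 * I) with hw
  have hwc : Continuous w := by fun_prop
  set A : ℝ × ℝ → ℂ := fun p => dbar φ (w p) * exp (-(p.2 * I)) with hA
  set B : ℝ × ℝ → ℂ := fun p => dz φ (w p) * exp (p.2 * I) with hB
  have hAc : Continuous A := ((continuous_dbar hφ).comp hwc).mul (by fun_prop)
  have hBc : Continuous B := ((continuous_dz hφ).comp hwc).mul (by fun_prop)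
  have hzero : ∀ p : ℝ × ℝ, R < p.1 → dbar φ (w p) = 0 ∧ dz φ (w p) = 0 := fun p hp => by
    have h1 := fderiv_of_notMem_tsupport (𝕜 := ℝ) (hR p.1 hp p.2)
    simp [dbar, dz, hw, h1]
  obtain ⟨iP, P1, -⟩ := integral_polar_rect (h := fun p => A p + B p) (hAc.add hBc) hR0.le
    (fun p hp => by simp [hA, hB, hzero p hp])
  obtain ⟨iM, -, M2⟩ := integral_polar_rect (h := fun p => A p - B p) (hAc.sub hBc) hR0.le
    (fun p hp => by simp [hA, hB, hzero p hp])
  have hφR : ∀ θ : ℝ, φ (z - R * exp (θ * I)) = 0 := fun θ => by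
    have hcl : IsClosed {r : ℝ | φ (z - r * exp (θ * I)) = 0} :=
      isClosed_eq (hφ.continuous.comp (by fun_prop)) continuous_const
    have hsub : Ioi R ⊆ {r : ℝ | φ (z - r * exp (θ * I)) = 0} := fun r hr =>
      image_eq_zero_of_notMem_tsupport (hR r hr θ)
    have := closure_minimal hsub hcl
    rw [closure_Ioi] at this
    exact this (mem_Ici.2 le_rfl)
  have eP : (∫ p in Ioi 0 ×ˢ Ioo (-Real.pi) Real.pi, (A p + B p)) = 2 * Real.pi * φ z := by
    rw [P1]
    have : ∀ θ : ℝ, ∫ r in (0 : ℝ)..R, (A (r, θ) + B (r, θ)) = φ z := fun θ => by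
      have := intervalIntegral.integral_eq_sub_of_hasDerivAt (a := 0) (b := R)
        (fun r _ => (hasFDerivAt_polar_shift hφ z r θ).1)
        (((hAc.add hBc).neg.comp (by fun_prop : Continuous fun r : ℝ => (r, θ))).intervalIntegrable
          _ _)
      rw [intervalIntegral.integral_neg, hφR θ] at this
      simpa using congrArg (-·) this
    simp only [this, intervalIntegral.integral_const, sub_neg_eq_add, real_smul, ofReal_add]
    ring
  have eM : (∫ p in Ioi 0 ×ˢ Ioo (-Real.pi) Real.pi, (A p - B p)) = 0 := by
    rw [M2]
    refine intervalIntegral.integral_zero_ae ?_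
    refine Filter.Eventually.of_forall fun r hr => ?_
    rw [uIoc_of_le hR0.le] at hr
    have := intervalIntegral.integral_eq_sub_of_hasDerivAt (a := -Real.pi) (b := Real.pi)
        (fun θ _ => (hasFDerivAt_polar_shift hφ z r θ).2)
        ((continuous_const.mul ((hAc.sub hBc).comp
          (by fun_prop : Continuous fun θ : ℝ => (r, θ)))).intervalIntegrable _ _)
    rw [intervalIntegral.integral_const_mul] at this
    have h2 : exp ((Real.pi : ℂ) * I) = exp (((-Real.pi : ℝ) : ℂ) * I) := by
      rw [ofReal_neg, exp_pi_mul_I, neg_mul, exp_neg, exp_pi_mul_I]; norm_num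
    rw [h2, sub_self] at this
    have hr1 : (r : ℂ) * I ≠ 0 := mul_ne_zero (ofReal_ne_zero.2 hr.1.ne') I_ne_zero
    exact (mul_eq_zero.1 this).resolve_left hr1
  have hmain : (∫ t, t⁻¹ * dbar φ (z - t)) = ∫ p in Ioi 0 ×ˢ Ioo (-Real.pi) Real.pi, A p := by
    rw [← Complex.integral_comp_polarCoord_symm]
    refine setIntegral_congr_fun (measurableSet_Ioi.prod measurableSet_Ioo) ?_
    rintro ⟨r, θ⟩ ⟨hr, -⟩
    have hr1 : (r : ℂ) ≠ 0 := ofReal_ne_zero.2 (ne_of_gt hr)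
    have : (Real.cos θ : ℂ) + Real.sin θ * I = exp (θ * I) := by
      rw [exp_mul_I, ofReal_cos, ofReal_sin]
    simp only [Complex.polarCoord_symm_apply, this, hA, hw, real_smul, mul_inv, exp_neg]
    field_simp
  have hsum : (∫ p in Ioi 0 ×ˢ Ioo (-Real.pi) Real.pi, A p) =
      ((∫ p in Ioi 0 ×ˢ Ioo (-Real.pi) Real.pi, (A p + B p)) +
        ∫ p in Ioi 0 ×ˢ Ioo (-Real.pi) Real.pi, (A p - B p)) / 2 := by
    rw [← integral_add iP iM, ← integral_div]
    congr 1; ext p; ring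
  rw [cauchyT_eq_integral_sub, hmain, hsum, eP, eM]
  have : (Real.pi : ℂ) ≠ 0 := ofReal_ne_zero.2 hpi.ne'
  field_simp
  ring

/-- Subtracting the Cauchy transform of its `∂̄` derivative makes a function holomorphic. -/
theorem differentiableOn_sub_cauchyT {Ω : Set ℂ} (hΩ : IsOpen Ω) {V f : ℂ → ℂ}
    (hV : ContDiffOn ℝ 1 V Ω) (hf : Continuous f) (hfc : HasCompactSupport f)
    (h : ∀ z ∈ Ω, dbar V z = f z) :
    DifferentiableOn ℂ (fun z => V z - cauchyT f z) Ω := by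
  intro z₀ hz₀
  obtain ⟨ε, hε, hb⟩ := Metric.isOpen_iff.1 hΩ z₀ hz₀
  let ψ : ContDiffBump z₀ := ⟨ε / 3, ε / 2, by positivity, by linarith⟩
  have hψ : ContDiff ℝ 1 (fun z => (ψ z : ℂ)) := ofRealCLM.contDiff.comp ψ.contDiff
  have hts : tsupport ψ ⊆ Ω := by
    rw [ψ.tsupport_eq]
    exact (closedBall_subset_ball (by change ε / 2 < ε; linarith)).trans hb
  set φ : ℂ → ℂ := fun z => ψ z * V z with hφ
  have hsupp : tsupport φ ⊆ tsupport ψ :=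
    closure_mono fun z hz => by
      rw [Function.mem_support] at hz ⊢
      intro h0; apply hz; simp [hφ, h0]
  have hφc : HasCompactSupport φ := ψ.hasCompactSupport.of_isClosed_subset (isClosed_tsupport _) hsupp
  have hφ1 : ContDiff ℝ 1 φ := by
    rw [contDiff_iff_contDiffAt]
    intro z
    by_cases hz : z ∈ Ω
    · exact (hψ.contDiffAt).mul ((hV z hz).contDiffAt (hΩ.mem_nhds hz))
    · have : φ =ᶠ[nhds z] fun _ => 0 :=
        notMem_tsupport_iff_eventuallyEq.1 fun h => hz (hts (hsupp h))
      exact contDiffAt_const.congr_of_eventuallyEq this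
  have hnear : φ =ᶠ[nhds z₀] V := by
    filter_upwards [ψ.eventuallyEq_one] with z hz
    simp [hφ, hz]
  have hdφ : HasCompactSupport (dbar φ) := by
    refine (hφc.fderiv (𝕜 := ℝ)).mono' fun z hz => subset_tsupport _ ?_
    rw [Function.mem_support] at hz ⊢
    intro h0; apply hz; simp [dbar, h0]
  have h1 : (fun z => V z - cauchyT f z) =ᶠ[nhds z₀] cauchyT (fun w => dbar φ w - f w) := by
    filter_upwards [hnear] with z hz
    rw [cauchyT_sub (continuous_dbar hφ1) hdφ hf hfc, cauchyT_dbar hφ1 hφc, hz]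
  refine (h1.differentiableAt_iff.2 (differentiableAt_cauchyT ((continuous_dbar hφ1).sub hf)
    (hdφ.sub hfc) ?_)).differentiableWithinAt
  filter_upwards [hnear.eventuallyEq_nhds, hΩ.mem_nhds hz₀] with z hz hzΩ
  simp [dbar_congr hz, h z hzΩ]

theorem fderiv_fun_comp_neg (f : ℂ → ℂ) (z : ℂ) :
    fderiv ℝ (fun w => f (-w)) z = -fderiv ℝ f (-z) := by
  have := (ContinuousLinearEquiv.neg ℝ (M := ℂ)).comp_right_fderiv (f := f) (x := z)
  have h2 : (f ∘ (ContinuousLinearEquiv.neg ℝ (M := ℂ))) = fun w => f (-w) := by ext; simp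
  rw [h2] at this
  rw [this]; ext; simp

namespace Collar

theorem map_nhds_eq {n : ℕ} (col : Collar n) {i : Fin n} {ζ : ℂ} (hζ : |ζ.im| < col.ε) :
    Filter.map (col.Γ i) (nhds ζ) = nhds (col.Γ i ζ) := by
  obtain ⟨L, hL⟩ := exists_equiv_fderiv (col.dbar_lt_dz (i := i) hζ)
  have h1 : HasStrictFDerivAt (col.Γ i) (L : ℂ →L[ℝ] ℂ) ζ := by
    rw [hL]
    exact (col.smooth i).contDiffAt.hasStrictFDerivAt (by simp)
  exact h1.map_nhds_eq_of_equiv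

theorem isOpen_strip {n : ℕ} (col : Collar n) : IsOpen {ζ : ℂ | |ζ.im| < col.ε} :=
  isOpen_lt (by fun_prop) continuous_const

theorem push_congr {n : ℕ} (col : Collar n) {Φ Ψ : Fin n → ℂ → ℂ}
    (hp : ∀ i, Function.Periodic (Φ i) (2 * Real.pi : ℝ))
    (hq : ∀ i, Function.Periodic (Ψ i) (2 * Real.pi : ℝ)) {i : Fin n} {ζ : ℂ}
    (hζ : |ζ.im| < col.ε) (h : Φ i =ᶠ[nhds ζ] Ψ i) :
    col.push Φ =ᶠ[nhds (col.Γ i ζ)] col.push Ψ := by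
  rw [Filter.EventuallyEq, ← col.map_nhds_eq hζ, Filter.eventually_map]
  filter_upwards [h, col.isOpen_strip.mem_nhds hζ] with ξ h1 h2
  rw [col.push_apply hp h2, col.push_apply hq h2, h1]

/-- The collar with the curves selected by `o` traversed backwards. -/
def reorient {n : ℕ} (col : Collar n) (o : Fin n → Prop) [DecidablePred o] : Collar n where
  Γ i ζ := if o i then col.Γ i (-ζ) else col.Γ i ζ
  ε := col.ε
  ε_pos := col.ε_pos
  ε_le := col.ε_le
  smooth i := by
    by_cases h : o i
    · simpa [h, Function.comp_def] using (col.smooth i).comp contDiff_neg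
    · simpa [h] using col.smooth i
  periodic i z := by
    by_cases h : o i
    · have := (col.periodic i).sub_eq (-z)
      simp only [h, if_true]
      rw [neg_add', this]
    · simp only [h, if_false]; exact col.periodic i z
  inj i j z w hz hw h := by
    have hz' : |(-z).im| < col.ε := by simpa using hz
    have hw' : |(-w).im| < col.ε := by simpa using hw
    by_cases hi : o i <;> by_cases hj : o j <;> simp only [hi, hj, if_true, if_false] at h
    · obtain ⟨h1, k, hk⟩ := col.inj _ _ _ _ hz' hw' h
      exact ⟨h1, -k, by push_cast at hk ⊢; linear_combination -hk⟩
    · exact absurd ((col.inj _ _ _ _ hz' hw h).1 ▸ hi) hj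
    · exact absurd ((col.inj _ _ _ _ hz hw' h).1 ▸ hj) hi
    · exact col.inj _ _ _ _ hz hw h
  flat N := by
    obtain ⟨C, h0, hC⟩ := col.flat N
    refine ⟨C, h0, fun i z => ?_⟩
    by_cases h : o i
    · have := hC i (-z)
      simp only [h, if_true, dbar]
      rw [fderiv_fun_comp_neg]
      simp only [dbar, neg_im, abs_neg] at this
      refine le_trans (le_of_eq ?_) this
      rw [← norm_neg]; congr 1; simp only [_root_.neg_apply]; ring
    · simpa only [h, if_false] using hC i z
  c := col.c
  c_pos := col.c_pos
  le_dz i z hz := by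
    by_cases h : o i
    · refine le_trans (col.le_dz i (-z) (by simpa using hz)) (le_of_eq ?_)
      simp only [h, if_true, dz]
      rw [fderiv_fun_comp_neg, ← norm_neg]; congr 1; simp only [_root_.neg_apply]; ring
    · simpa only [h, if_false] using col.le_dz i z hz
  dbar_le i z hz := by
    by_cases h : o i
    · have := col.dbar_le i (-z) (by simpa using hz)
      simp only [h, if_true, dbar, dz] at this ⊢
      rw [fderiv_fun_comp_neg]
      convert this using 1
      · rw [← norm_neg]; congr 1; simp only [_root_.neg_apply]; ring
      · rw [← norm_neg]; congr 2; simp only [_root_.neg_apply]; ring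
    · simpa only [h, if_false] using col.dbar_le i z hz

/-- The collar parametrises a neighbourhood of the boundary of `Ω`, with the upper half strip
lying inside. -/
structure Bounds {n : ℕ} (col : Collar n) (Ω : Set ℂ) : Prop where
  inside : ∀ i (ζ : ℂ), 0 < ζ.im → ζ.im < col.ε → col.Γ i ζ ∈ Ω
  outside : ∀ i (ζ : ℂ), -col.ε < ζ.im → ζ.im < 0 → col.Γ i ζ ∈ (closure Ω)ᶜ
  frontier_eq : frontier Ω = ⋃ i, range fun t : ℝ => col.Γ i t

/-- An open connected set avoiding one of the curves cannot contain both of its sides. -/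
theorem not_both_sides {n : ℕ} (col : Collar n) (i : Fin n) {Ω : Set ℂ} (hΩ : IsOpen Ω)
    (hc : IsPreconnected Ω) (hb : Bornology.IsBounded Ω)
    (hγ : ∀ t : ℝ, col.Γ i t ∉ Ω)
    (h1 : ∀ ζ : ℂ, 0 < ζ.im → ζ.im < col.ε → col.Γ i ζ ∈ Ω)
    (h2 : ∀ ζ : ℂ, -col.ε < ζ.im → ζ.im < 0 → col.Γ i ζ ∈ Ω) : False := by
  classical
  have hε := col.ε_pos
  obtain ⟨θ, hθs, hθ1, hθ0, -⟩ := exists_cutoff (a := col.ε / 4) (b := col.ε / 2)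
    (by positivity) (by linarith)
  set P : Fin n → ℂ → ℂ := fun j ζ => if j = i then (θ ζ.im : ℂ) else 0 with hP
  set Q : Fin n → ℂ → ℂ := fun j ζ => if 0 < ζ.im then P j ζ else 0 with hQ
  have hPp : ∀ j, Function.Periodic (P j) (2 * Real.pi : ℝ) := fun j ζ => by simp [hP]
  have hQp : ∀ j, Function.Periodic (Q j) (2 * Real.pi : ℝ) := fun j ζ => by simp [hQ, hP]
  have hP0 : ∀ j (ζ : ℂ), col.ε / 2 ≤ |ζ.im| → P j ζ = 0 := fun j ζ h => by simp [hP, hθ0 _ h]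
  have hQ0 : ∀ j (ζ : ℂ), col.ε / 2 ≤ |ζ.im| → Q j ζ = 0 := fun j ζ h => by simp [hQ, hP0 j ζ h]
  have hPs : ∀ j, ContDiff ℝ (⊤ : ℕ∞) (P j) := fun j => by
    by_cases h : j = i
    · simpa [hP, h] using contDiff_comp_im hθs
    · simpa [hP, h] using contDiff_const
  have hXs : ContDiff ℝ (⊤ : ℕ∞) (col.push P) := col.push_contDiff hPp (by linarith) hP0 hPs
  have hpos : ∀ j (ζ : ℂ), 0 < ζ.im → Q j =ᶠ[nhds ζ] P j := fun j ζ h => by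
    filter_upwards [(isOpen_lt continuous_const Complex.continuous_im).mem_nhds h] with ξ hξ
    have : 0 < ξ.im := hξ
    simp [hQ, this]
  have hneg : ∀ j (ζ : ℂ), ζ.im < 0 → Q j =ᶠ[nhds ζ] fun _ => 0 := fun j ζ h => by
    filter_upwards [(isOpen_lt Complex.continuous_im continuous_const).mem_nhds h] with ξ hξ
    have : ξ.im < 0 := hξ
    simp [hQ, not_lt.2 this.le]
  have hQne : ∀ j, j ≠ i → ∀ ζ : ℂ, Q j =ᶠ[nhds ζ] fun _ => 0 := fun j h ζ =>
    Filter.Eventually.of_forall fun ξ => by simp [hQ, hP, h]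
  have h0p : ∀ _ : Fin n, Function.Periodic (fun _ : ℂ => (0 : ℂ)) (2 * Real.pi : ℝ) :=
    fun _ _ => rfl
  have hpush0 : ∀ z, col.push (fun _ _ => 0) z = 0 := fun z => by
    by_cases h : ∃ i, ∃ ζ : ℂ, |ζ.im| < col.ε ∧ col.Γ i ζ = z
    · obtain ⟨j, ζ, hζ, rfl⟩ := h
      rw [col.push_apply h0p hζ]
    · exact col.push_of_not _ h
  -- the derivative of the cut-off vanishes near the curve
  have hd0 : ∀ ζ : ℂ, |ζ.im| < col.ε / 4 → dbar (col.push P) (col.Γ i ζ) = 0 := fun ζ hζ => by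
    have hζ' : |ζ.im| < col.ε := by linarith
    have : col.push P =ᶠ[nhds (col.Γ i ζ)] fun _ => 1 := by
      rw [Filter.EventuallyEq, ← col.map_nhds_eq hζ', Filter.eventually_map]
      filter_upwards [col.isOpen_strip.mem_nhds hζ',
        (isOpen_lt (f := fun ξ : ℂ => |ξ.im|) (by fun_prop) continuous_const).mem_nhds hζ]
        with ξ h3 h4
      have h4' : |ξ.im| < col.ε / 4 := h4
      rw [col.push_apply hPp h3]
      simp [hP, hθ1 _ h4'.le]
    rw [dbar_congr this]; simp [dbar]
  have hdX : ContDiff ℝ (⊤ : ℕ∞) (dbar (col.push P)) := contDiff_dbar hXs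
  have hdX0 : ∀ ζ : ℂ, col.ε / 2 < |ζ.im| → |ζ.im| < col.ε →
      dbar (col.push P) (col.Γ i ζ) = 0 := fun ζ h3 h4 => by
    have : col.push P =ᶠ[nhds (col.Γ i ζ)] fun _ => 0 := by
      rw [Filter.EventuallyEq, ← col.map_nhds_eq h4, Filter.eventually_map]
      filter_upwards [col.isOpen_strip.mem_nhds h4,
        (isOpen_lt (g := fun ξ : ℂ => |ξ.im|) continuous_const (by fun_prop)).mem_nhds h3]
        with ξ h5 h6
      have h6' : col.ε / 2 < |ξ.im| := h6
      rw [col.push_apply hPp h5]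
      exact hP0 _ _ h6'.le
    rw [dbar_congr this]; simp [dbar]
  set R : Fin n → ℂ → ℂ := fun j ζ =>
    if j = i ∧ 0 < ζ.im ∧ ζ.im < 3 * col.ε / 4 then dbar (col.push P) (col.Γ i ζ) else 0 with hR
  have hRp : ∀ j, Function.Periodic (R j) (2 * Real.pi : ℝ) := fun j ζ => by
    simp only [hR, col.periodic i ζ]
    simp
  have hR0 : ∀ j (ζ : ℂ), 3 * col.ε / 4 ≤ |ζ.im| → R j ζ = 0 := fun j ζ h => by
    simp only [hR]
    rw [if_neg]
    rintro ⟨-, h3, h4⟩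
    rw [abs_of_pos h3] at h
    linarith
  have hRs : ∀ ζ : ℂ, ζ.im < col.ε / 4 → R i ζ = 0 := fun ζ h => by
    simp only [hR]
    split_ifs with h3
    · exact hd0 ζ (by rwa [abs_of_pos h3.2.1])
    · rfl
  have hRc : ∀ j, Continuous (R j) := fun j => by
    by_cases hj : j = i
    · subst hj
      rw [continuous_iff_continuousAt]
      intro ζ
      rcases lt_or_ge ζ.im (col.ε / 4) with h | h
      · refine continuousAt_const.congr (f := fun _ => (0 : ℂ)) ?_
        filter_upwards [(isOpen_lt Complex.continuous_im continuous_const).mem_nhds h] with ξ hξ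
        exact (hRs ξ hξ).symm
      rcases lt_or_ge ζ.im (3 * col.ε / 4) with h' | h'
      · refine ContinuousAt.congr (f := fun ξ => dbar (col.push P) (col.Γ j ξ)) ?_ ?_
        · exact (hdX.continuous.comp (col.smooth j).continuous).continuousAt
        · filter_upwards [(isOpen_lt Complex.continuous_im continuous_const).mem_nhds h',
            (isOpen_lt continuous_const Complex.continuous_im).mem_nhds
              (show 0 < ζ.im by linarith)] with ξ h3 h4
          have h3' : ξ.im < 3 * col.ε / 4 := h3
          have h4' : 0 < ξ.im := h4
          simp [hR, h3', h4']
      · refine continuousAt_const.congr (f := fun _ => (0 : ℂ)) ?_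
        filter_upwards [(isOpen_lt continuous_const Complex.continuous_im).mem_nhds
              (show col.ε / 2 < ζ.im by linarith)] with ξ h3
        have h3' : col.ε / 2 < ξ.im := h3
        simp only [hR]
        split_ifs with h4
        · rw [hdX0 ξ (by rwa [abs_of_pos h4.2.1]) (by rw [abs_of_pos h4.2.1]; linarith [h4.2.2])]
        · rfl
    · have : R j = fun _ => 0 := by ext; simp [hR, hj]
      rw [this]; exact continuous_const
  set f : ℂ → ℂ := col.push R with hf
  have hfc : Continuous f := col.push_continuous hRp (ρ := 3 * col.ε / 4) (by linarith) hR0 hRc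
  have hfs : HasCompactSupport f := col.push_hasCompactSupport hR0
  set S : Set ℂ := range fun t : ℝ => col.Γ i t with hS
  have hSim : ∀ ζ : ℂ, |ζ.im| < col.ε → (col.Γ i ζ ∈ S ↔ ζ.im = 0) := fun ζ hζ => by
    constructor
    · rintro ⟨t, ht⟩
      obtain ⟨-, k, hk⟩ := col.inj i i t ζ (by simpa using hε) hζ ht
      rw [hk]; simp
    · intro h
      have e : ((ζ.re : ℝ) : ℂ) = ζ := Complex.ext (by simp) (by simp [h])
      exact ⟨ζ.re, by simp only [e]⟩
  have hScl : IsClosed S := by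
    have : S = (col.Γ i) '' ((fun t : ℝ => (t : ℂ)) '' Icc 0 (2 * Real.pi)) := by
      ext z; constructor
      · rintro ⟨t, rfl⟩
        obtain ⟨k, hk, him⟩ := exists_re_mem_Icc t
        refine ⟨_, ⟨_, hk, rfl⟩, ?_⟩
        change _ = col.Γ i t
        rw [← periodic_add_int_mul (col.periodic i) k t]
        congr 1
        exact Complex.ext (by simp) (by simp)
      · rintro ⟨_, ⟨t, -, rfl⟩, rfl⟩; exact ⟨t, rfl⟩
    rw [this]
    exact ((isCompact_Icc.image continuous_ofReal).image (col.smooth i).continuous).isClosed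
  set X := col.push Q with hX
  have hloc : ∀ z ∉ S, ∃ G : ℂ → ℂ, ContDiff ℝ 1 G ∧ X =ᶠ[nhds z] G ∧ f z = dbar G z := by
    intro z hz
    have z0 : dbar (fun _ => (0 : ℂ)) z = 0 := by simp [dbar]
    by_cases hsh : z ∈ col.shell (3 * col.ε / 4)
    · obtain ⟨j, ζ, hζ, rfl⟩ := col.exists_of_mem_shell hsh
      have hζ' : |ζ.im| < col.ε := by linarith
      have key0 : Q j =ᶠ[nhds ζ] (fun _ => 0) → R j ζ = 0 → ∃ G : ℂ → ℂ, ContDiff ℝ 1 G ∧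
          X =ᶠ[nhds (col.Γ j ζ)] G ∧ f (col.Γ j ζ) = dbar G (col.Γ j ζ) := fun h3 h4 => by
        refine ⟨fun _ => 0, contDiff_const, ?_, ?_⟩
        · filter_upwards [col.push_congr hQp h0p hζ' h3] with w hw
          rw [hX, hw, hpush0]
        · rw [z0, hf, col.push_apply hRp hζ', h4]
      by_cases hj : j = i
      · subst hj
        have him : ζ.im ≠ 0 := fun h => hz ((hSim ζ hζ').2 h)
        rcases lt_or_gt_of_ne him with h | h
        · exact key0 (hneg j ζ h) (hRs ζ (by linarith))
        · refine ⟨col.push P, hXs.of_le (mod_cast le_top), col.push_congr hQp hPp hζ' (hpos j ζ h), ?_⟩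
          rw [hf, col.push_apply hRp hζ']
          simp only [hR, h, true_and]
          split_ifs with h5
          · rfl
          · rw [hdX0 ζ _ hζ']
            rw [abs_of_pos h]; linarith
      · exact key0 (hQne j hj ζ) (by simp [hR, hj])
    · refine ⟨fun _ => 0, contDiff_const, col.push_eventually_zero (ρ := 3 * col.ε / 4)
        (fun j ζ h => hQ0 j ζ (by linarith)) hsh, ?_⟩
      rw [z0, hf, col.push_eq_zero hR0 hsh]
  set Y : ℂ → ℂ := fun z => X z - cauchyT f z with hY
  have hYd : DifferentiableOn ℂ Y Sᶜ := by
    refine differentiableOn_sub_cauchyT hScl.isOpen_compl (fun z hz => ?_) hfc hfs fun z hz => ?_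
    · obtain ⟨G, hG, h3, -⟩ := hloc z hz
      exact (hG.contDiffAt.congr_of_eventuallyEq h3).contDiffWithinAt
    · obtain ⟨G, hG, h3, h4⟩ := hloc z hz
      rw [dbar_congr h3, h4]
  have hfnear : ∀ ζ : ℂ, |ζ.im| < col.ε / 4 → f =ᶠ[nhds (col.Γ i ζ)] 0 := fun ζ hζ => by
    have hζ' : |ζ.im| < col.ε := by linarith
    filter_upwards [col.push_congr hRp h0p (i := i) hζ' (by
      filter_upwards [(isOpen_lt Complex.continuous_im continuous_const).mem_nhds
        (lt_of_le_of_lt (le_abs_self _) hζ)] with ξ hξ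
      exact hRs ξ hξ)] with w hw
    rw [hf, hw, hpush0]; rfl
  have hKd : DifferentiableOn ℂ (cauchyT f) (tsupport f)ᶜ := fun z hz =>
    (differentiableAt_cauchyT hfc hfs (notMem_tsupport_iff_eventuallyEq.1 hz)).differentiableWithinAt
  have hKd2 := hKd.deriv (isClosed_tsupport f).isOpen_compl
  have hmem : ∀ ζ : ℂ, |ζ.im| < col.ε / 4 → col.Γ i ζ ∈ (tsupport f)ᶜ := fun ζ hζ =>
    notMem_tsupport_iff_eventuallyEq.2 (hfnear ζ hζ)
  set E : ℂ → ℂ := fun z => if z ∈ S then -deriv (cauchyT f) z else deriv Y z with hE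
  have hXnear : ∀ ζ : ℂ, |ζ.im| < col.ε / 4 → ζ.im ≠ 0 →
      X =ᶠ[nhds (col.Γ i ζ)] fun _ => if 0 < ζ.im then 1 else 0 := fun ζ hζ h0 => by
    have hζ' : |ζ.im| < col.ε := by linarith
    rw [Filter.EventuallyEq, ← col.map_nhds_eq hζ', Filter.eventually_map]
    have hsgn : ∀ᶠ ξ : ℂ in nhds ζ, (0 < ξ.im ↔ 0 < ζ.im) := by
      rcases lt_or_gt_of_ne h0 with h | h
      · filter_upwards [(isOpen_lt Complex.continuous_im continuous_const).mem_nhds h] with ξ hξ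
        exact ⟨fun h' => absurd h' (not_lt.2 (le_of_lt hξ)), fun h' => absurd h' (not_lt.2 h.le)⟩
      · filter_upwards [(isOpen_lt continuous_const Complex.continuous_im).mem_nhds h] with ξ hξ
        exact ⟨fun _ => h, fun _ => hξ⟩
    filter_upwards [hsgn, col.isOpen_strip.mem_nhds hζ',
        (isOpen_lt (f := fun ξ : ℂ => |ξ.im|) (by fun_prop) continuous_const).mem_nhds hζ]
        with ξ h3 h4 h5
    have h5' : |ξ.im| < col.ε / 4 := h5
    rw [hX, col.push_apply hQp h4]
    simp only [hQ, hP, h3, if_true, hθ1 _ h5'.le, ofReal_one]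
  have hEd : Differentiable ℂ E := by
    intro z
    by_cases hz : z ∈ S
    · obtain ⟨t, rfl⟩ := hz
      have ht : |(t : ℂ).im| < col.ε / 4 := by simpa using hε
      have h3 : E =ᶠ[nhds (col.Γ i t)] fun w => -deriv (cauchyT f) w := by
        rw [Filter.EventuallyEq, ← col.map_nhds_eq (by simpa using hε), Filter.eventually_map]
        filter_upwards [(isOpen_lt (f := fun ξ : ℂ => |ξ.im|) (by fun_prop)
          continuous_const).mem_nhds ht] with ξ h5
        have h5' : |ξ.im| < col.ε / 4 := h5
        simp only [hE]
        split_ifs with h6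
        · rfl
        · have him : ξ.im ≠ 0 := fun h => h6 ((hSim ξ (by linarith)).2 h)
          have h7 : Y =ᶠ[nhds (col.Γ i ξ)] fun w => (if 0 < ξ.im then 1 else 0) - cauchyT f w := by
            filter_upwards [hXnear ξ h5' him] with w hw
            rw [hY]; simp only [hw]
          rw [h7.deriv_eq, deriv_const_sub]
      refine DifferentiableAt.congr_of_eventuallyEq ?_ h3
      exact ((hKd2 _ (hmem t ht)).differentiableAt
        ((isClosed_tsupport f).isOpen_compl.mem_nhds (hmem t ht))).neg
    · have h3 : E =ᶠ[nhds z] deriv Y := by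
        filter_upwards [hScl.isOpen_compl.mem_nhds hz] with w hw
        exact if_neg hw
      exact (((hYd.deriv hScl.isOpen_compl) z hz).differentiableAt
        (hScl.isOpen_compl.mem_nhds hz)).congr_of_eventuallyEq h3
  obtain ⟨r, hr⟩ := (hb.union (col.isCompact_shell (col.ε / 2)).isBounded).subset_ball 0
  obtain ⟨F, hF⟩ := (hEd.differentiableOn (s := ball 0 r)).isExactOn_ball
  have hΩS : Ω ⊆ Sᶜ := by
    rintro z hz ⟨t, rfl⟩; exact hγ t hz
  have hdiff : ∀ z ∈ Ω, HasDerivAt (fun z => Y z - F z) 0 z := fun z hz => by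
    have h3 := ((hYd z (hΩS hz)).differentiableAt
      (hScl.isOpen_compl.mem_nhds (hΩS hz))).hasDerivAt
    have h4 := hF z (hr (Or.inl hz))
    have h5 : E z = deriv Y z := if_neg (hΩS hz)
    rw [h5] at h4
    have := h3.fun_sub h4
    rwa [sub_self] at this
  have hconst : ∀ x ∈ Ω, ∀ y ∈ Ω, Y x - F x = Y y - F y := fun x hx y hy =>
    hΩ.is_const_of_deriv_eq_zero hc (fun z hz => (hdiff z hz).differentiableAt.differentiableWithinAt)
      (fun z hz => (hdiff z hz).deriv) hx hy
  set D : ℝ → ℂ := fun s => (cauchyT f (col.Γ i (s * I)) + F (col.Γ i (s * I))) -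
    (cauchyT f (col.Γ i (-s * I)) + F (col.Γ i (-s * I))) with hD
  have hDc : ContinuousAt D 0 := by
    have hK := continuous_cauchyT hfc hfs
    have hFc : ContinuousAt F (col.Γ i 0) := (hF _ (hr (Or.inr (col.mem_shell (by
      simpa using (half_pos hε).le))))).continuousAt
    have hG := (col.smooth i).continuous
    have e1 : ContinuousAt (fun s : ℝ => F (col.Γ i (s * I))) 0 :=
      ContinuousAt.comp (g := F) (f := fun s : ℝ => col.Γ i (s * I)) (by simpa using hFc)
        (by fun_prop)
    have e2 : ContinuousAt (fun s : ℝ => F (col.Γ i (-s * I))) 0 :=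
      ContinuousAt.comp (g := F) (f := fun s : ℝ => col.Γ i (-s * I)) (by simpa using hFc)
        (by fun_prop)
    exact ((Continuous.continuousAt (by fun_prop)).add e1).sub
      ((Continuous.continuousAt (by fun_prop)).add e2)
  have hD0 : D 0 = 0 := by simp [hD]
  have hD1 : ∀ᶠ s in nhdsWithin (0 : ℝ) (Ioi 0), D s = 1 := by
    filter_upwards [Ioo_mem_nhdsGT (show (0 : ℝ) < col.ε / 4 by positivity)] with s hs
    have i1 : ((s : ℂ) * I).im = s := by simp
    have i2 : (-(s : ℂ) * I).im = -s := by simp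
    have h3 := hconst _ (h1 (s * I) (by rw [i1]; exact hs.1) (by rw [i1]; linarith [hs.2]))
      _ (h2 (-s * I) (by rw [i2]; linarith [hs.2]) (by rw [i2]; linarith [hs.1]))
    have h4 := (hXnear (s * I) (by rw [i1, abs_of_pos hs.1]; exact hs.2)
      (by rw [i1]; exact hs.1.ne')).self_of_nhds
    have h5 := (hXnear (-s * I) (by rw [i2, abs_neg, abs_of_pos hs.1]; exact hs.2)
      (by rw [i2]; linarith [hs.1])).self_of_nhds
    rw [i1, if_pos hs.1] at h4
    rw [i2, if_neg (by linarith [hs.1])] at h5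
    simp only [hY, h4, h5] at h3
    simp only [hD]
    linear_combination -h3
  have h9 : Filter.Tendsto D (nhdsWithin 0 (Ioi 0)) (nhds 0) := by
    rw [← hD0]; exact hDc.tendsto.mono_left nhdsWithin_le_nhds
  have := tendsto_nhds_unique h9 (tendsto_const_nhds.congr' (hD1.mono fun _ h => h.symm))
  exact zero_ne_one this
end Collar

theorem subset_or_subset_compl_closure {Ω s : Set ℂ} (hΩ : IsOpen Ω) (hs : IsPreconnected s)
    (h : Disjoint s (frontier Ω)) : s ⊆ Ω ∨ s ⊆ (closure Ω)ᶜ := by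
  refine hs.subset_or_subset hΩ isClosed_closure.isOpen_compl
    (disjoint_compl_right.mono_left subset_closure) fun z hz => ?_
  by_contra h2
  rw [mem_union, not_or, notMem_compl_iff] at h2
  refine disjoint_left.1 h hz ?_
  rw [hΩ.frontier_eq]
  exact ⟨h2.2, h2.1⟩

namespace Collar

theorem notMem_range_of_im_ne {n : ℕ} (col : Collar n) {i j : Fin n} {ζ : ℂ}
    (hζ : |ζ.im| < col.ε) (h0 : ζ.im ≠ 0) : col.Γ i ζ ∉ range fun t : ℝ => col.Γ j t := by
  rintro ⟨t, ht⟩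
  obtain ⟨-, k, hk⟩ := col.inj j i t ζ (by simpa using col.ε_pos) hζ ht
  apply h0; rw [hk]; simp

theorem exists_bounds {n : ℕ} (col₀ : Collar n) {Ω : Set ℂ} (hΩ : IsOpen Ω) (hc : IsConnected Ω)
    (hb : Bornology.IsBounded Ω)
    (hf : frontier Ω = ⋃ i, range fun t : ℝ => col₀.Γ i t) :
    ∃ col : Collar n, col.Bounds Ω := by
  classical
  have hε := col₀.ε_pos
  have hnot : ∀ i (ζ : ℂ), |ζ.im| < col₀.ε → ζ.im ≠ 0 → col₀.Γ i ζ ∉ frontier Ω := by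
    intro i ζ h1 h2 h3
    rw [hf] at h3
    obtain ⟨j, hj⟩ := mem_iUnion.1 h3
    exact col₀.notMem_range_of_im_ne h1 h2 hj
  have hpc1 : ∀ i, IsPreconnected (col₀.Γ i '' {ζ : ℂ | 0 < ζ.im ∧ ζ.im < col₀.ε}) := fun i => by
    refine IsPreconnected.image ?_ _ (col₀.smooth i).continuous.continuousOn
    exact ((convex_halfSpace_im_gt 0).inter (convex_halfSpace_im_lt col₀.ε)).isPreconnected
  have hpc2 : ∀ i, IsPreconnected (col₀.Γ i '' {ζ : ℂ | -col₀.ε < ζ.im ∧ ζ.im < 0}) := fun i => by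
    refine IsPreconnected.image ?_ _ (col₀.smooth i).continuous.continuousOn
    exact ((convex_halfSpace_im_gt (-col₀.ε)).inter (convex_halfSpace_im_lt 0)).isPreconnected
  have hup : ∀ i, (∀ ζ : ℂ, 0 < ζ.im → ζ.im < col₀.ε → col₀.Γ i ζ ∈ Ω) ∨
      (∀ ζ : ℂ, 0 < ζ.im → ζ.im < col₀.ε → col₀.Γ i ζ ∈ (closure Ω)ᶜ) := fun i => by
    rcases subset_or_subset_compl_closure hΩ (hpc1 i) (disjoint_left.2 (by
      rintro _ ⟨ζ, ⟨h1, h2⟩, rfl⟩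
      exact hnot i ζ (by rwa [abs_of_pos h1]) h1.ne')) with h | h
    · exact Or.inl fun ζ h1 h2 => h ⟨ζ, ⟨h1, h2⟩, rfl⟩
    · exact Or.inr fun ζ h1 h2 => h ⟨ζ, ⟨h1, h2⟩, rfl⟩
  have hdn : ∀ i, (∀ ζ : ℂ, -col₀.ε < ζ.im → ζ.im < 0 → col₀.Γ i ζ ∈ Ω) ∨
      (∀ ζ : ℂ, -col₀.ε < ζ.im → ζ.im < 0 → col₀.Γ i ζ ∈ (closure Ω)ᶜ) := fun i => by
    rcases subset_or_subset_compl_closure hΩ (hpc2 i) (disjoint_left.2 (by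
      rintro _ ⟨ζ, ⟨h1, h2⟩, rfl⟩
      exact hnot i ζ (by rw [abs_of_neg h2]; linarith) h2.ne)) with h | h
    · exact Or.inl fun ζ h1 h2 => h ⟨ζ, ⟨h1, h2⟩, rfl⟩
    · exact Or.inr fun ζ h1 h2 => h ⟨ζ, ⟨h1, h2⟩, rfl⟩
  have hγ : ∀ i (t : ℝ), col₀.Γ i t ∈ frontier Ω := fun i t => by
    rw [hf]; exact mem_iUnion.2 ⟨i, t, rfl⟩
  have hγΩ : ∀ i (t : ℝ), col₀.Γ i t ∉ Ω := fun i t h => by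
    have := hγ i t
    rw [hΩ.frontier_eq] at this
    exact this.2 h
  have hone : ∀ i, ¬ ((∀ ζ : ℂ, 0 < ζ.im → ζ.im < col₀.ε → col₀.Γ i ζ ∈ (closure Ω)ᶜ) ∧
      (∀ ζ : ℂ, -col₀.ε < ζ.im → ζ.im < 0 → col₀.Γ i ζ ∈ (closure Ω)ᶜ)) := by
    rintro i ⟨h1, h2⟩
    have h3 : col₀.Γ i (0 : ℝ) ∈ closure Ω := frontier_subset_closure (hγ i 0)
    have h4 : Ωᶜ ∈ nhds (col₀.Γ i (0 : ℝ)) := by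
      rw [← col₀.map_nhds_eq (by simpa using hε), Filter.mem_map]
      filter_upwards [col₀.isOpen_strip.mem_nhds (show |((0 : ℝ) : ℂ).im| < col₀.ε by
        simpa using hε)] with ξ hξ
      have hξ' : |ξ.im| < col₀.ε := hξ
      rcases lt_trichotomy ξ.im 0 with h | h | h
      · exact fun h5 => h2 ξ (abs_lt.1 hξ').1 h (subset_closure h5)
      · have e : ((ξ.re : ℝ) : ℂ) = ξ := Complex.ext (by simp) (by simp [h])
        rw [← e]
        exact hγΩ i ξ.re
      · exact fun h5 => h1 ξ h (abs_lt.1 hξ').2 (subset_closure h5)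
    obtain ⟨w, hw1, hw2⟩ := mem_closure_iff_nhds.1 h3 _ h4
    exact hw1 hw2
  let o : Fin n → Prop := fun i => ¬ ∀ ζ : ℂ, 0 < ζ.im → ζ.im < col₀.ε → col₀.Γ i ζ ∈ Ω
  refine ⟨col₀.reorient o, ?_, ?_, ?_⟩
  · intro i ζ h1 h2
    change ζ.im < col₀.ε at h2
    change (if o i then col₀.Γ i (-ζ) else col₀.Γ i ζ) ∈ Ω
    split_ifs with h
    · have h5 := (hup i).resolve_left h
      rcases hdn i with h6 | h6
      · exact h6 _ (by simpa using h2) (by simpa using h1)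
      · exact absurd ⟨h5, h6⟩ (hone i)
    · exact not_not.1 h ζ h1 h2
  · intro i ζ h1 h2
    change -col₀.ε < ζ.im at h1
    change (if o i then col₀.Γ i (-ζ) else col₀.Γ i ζ) ∈ (closure Ω)ᶜ
    split_ifs with h
    · exact (hup i).resolve_left h _ (by simpa using h2) (by simp; linarith)
    · rcases hdn i with h6 | h6
      · exact (col₀.not_both_sides i hΩ hc.isPreconnected hb (hγΩ i) (not_not.1 h) h6).elim
      · exact h6 ζ h1 h2
  · rw [hf]
    refine iUnion_congr fun i => ?_
    change _ = range fun t : ℝ => if o i then col₀.Γ i (-t) else col₀.Γ i t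
    split_ifs with h
    · ext z; constructor
      · rintro ⟨t, rfl⟩; exact ⟨-t, by simp⟩
      · rintro ⟨t, rfl⟩; exact ⟨-t, by simp⟩
    · rfl

namespace Bounds

variable {n : ℕ} {col : Collar n} {Ω : Set ℂ}

theorem mem_frontier (h : col.Bounds Ω) (i : Fin n) (t : ℝ) : col.Γ i t ∈ frontier Ω := by
  rw [h.frontier_eq]; exact mem_iUnion.2 ⟨i, t, rfl⟩

theorem notMem (h : col.Bounds Ω) (hΩ : IsOpen Ω) (i : Fin n) (t : ℝ) : col.Γ i t ∉ Ω := by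
  have := h.mem_frontier i t
  rw [hΩ.frontier_eq] at this
  exact this.2

theorem mem_iff (h : col.Bounds Ω) (hΩ : IsOpen Ω) {i : Fin n} {ζ : ℂ} (hζ : |ζ.im| < col.ε) :
    col.Γ i ζ ∈ Ω ↔ 0 < ζ.im := by
  refine ⟨fun h1 => ?_, fun h1 => h.inside i ζ h1 (abs_lt.1 hζ).2⟩
  by_contra h2
  rcases lt_or_eq_of_le (not_lt.1 h2) with h3 | h3
  · exact h.outside i ζ (abs_lt.1 hζ).1 h3 (subset_closure h1)
  · have e : ((ζ.re : ℝ) : ℂ) = ζ := Complex.ext (by simp) (by simp [h3])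
    rw [← e] at h1
    exact h.notMem hΩ i ζ.re h1

theorem mem_closure_iff (h : col.Bounds Ω) {i : Fin n} {ζ : ℂ}
    (hζ : |ζ.im| < col.ε) : col.Γ i ζ ∈ closure Ω ↔ 0 ≤ ζ.im := by
  constructor
  · intro h1
    by_contra h2
    exact h.outside i ζ (abs_lt.1 hζ).1 (not_le.1 h2) h1
  · intro h1
    rcases lt_or_eq_of_le h1 with h3 | h3
    · exact subset_closure (h.inside i ζ h3 (abs_lt.1 hζ).2)
    · have e : ((ζ.re : ℝ) : ℂ) = ζ := Complex.ext (by simp) (by simp [← h3])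
      rw [← e]
      exact frontier_subset_closure (h.mem_frontier i ζ.re)

theorem eq_of_mem_frontier (h : col.Bounds Ω) {z : ℂ} (hz : z ∈ frontier Ω) :
    ∃ i, ∃ t ∈ Icc 0 (2 * Real.pi), col.Γ i (t : ℝ) = z := by
  rw [h.frontier_eq] at hz
  obtain ⟨i, t, rfl⟩ := mem_iUnion.1 hz
  obtain ⟨k, hk, -⟩ := exists_re_mem_Icc t
  refine ⟨i, _, hk, ?_⟩
  have := periodic_add_int_mul (col.periodic i) k t
  change _ = col.Γ i t
  rw [← this]
  congr 1
  exact Complex.ext (by simp) (by simp)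

end Bounds
end Collar

theorem det_real_clm (L : ℂ →L[ℝ] ℂ) : L.det = (L 1).re * (L I).im - (L I).re * (L 1).im := by
  rw [ContinuousLinearMap.det, ← LinearMap.det_toMatrix basisOneI, Matrix.det_fin_two]
  simp [LinearMap.toMatrix_apply]

theorem det_fderiv_eq (f : ℂ → ℂ) (z : ℂ) :
    (fderiv ℝ f z).det = ‖dz f z‖ ^ 2 - ‖dbar f z‖ ^ 2 := by
  rw [det_real_clm]
  have h1 := fderiv_apply_eq f z 1
  have h2 := fderiv_apply_eq f z I
  rw [h1, h2, Complex.sq_norm, Complex.sq_norm, normSq_apply, normSq_apply]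
  simp
  ring

theorem setIntegral_reProdIm {F : ℂ → ℂ} (hF : Continuous F) {a b c d : ℝ} (hab : a ≤ b)
    (hcd : c ≤ d) :
    ∫ ζ in Ioc a b ×ℂ Ioc c d, F ζ = ∫ s in c..d, ∫ t in a..b, F (t + s * I) := by
  have h1 := Complex.volume_preserving_equiv_real_prod.symm.setIntegral_preimage_emb
    Complex.measurableEquivRealProd.symm.measurableEmbedding F (Ioc a b ×ℂ Ioc c d)
  have h2 : Complex.measurableEquivRealProd.symm ⁻¹' (Ioc a b ×ℂ Ioc c d) =
      Ioc a b ×ˢ Ioc c d := by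
    ext p
    simp [Complex.measurableEquivRealProd_symm_apply, mem_reProdIm]
  rw [← h1, h2]
  have h3 : ∀ p : ℝ × ℝ, F (Complex.measurableEquivRealProd.symm p) = F (p.1 + p.2 * I) := by
    intro p; congr 1
    simp [Complex.measurableEquivRealProd_symm_apply, Complex.mk_eq_add_mul_I]
  simp_rw [h3]
  have hc : Continuous fun p : ℝ × ℝ => F (p.1 + p.2 * I) := by fun_prop
  rw [Measure.volume_eq_prod, setIntegral_prod]
  · rw [← intervalIntegral_swap_of_continuous (F := fun t s => F (t + s * I)) hc,
      intervalIntegral.integral_of_le hab]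
    refine integral_congr_ae (Filter.Eventually.of_forall fun t => ?_)
    simp only [intervalIntegral.integral_of_le hcd]
  · rw [← Measure.volume_eq_prod]
    exact (hc.continuousOn.integrableOn_compact (isCompact_Icc.prod isCompact_Icc)).mono_set
      (Set.prod_mono Ioc_subset_Icc_self Ioc_subset_Icc_self)

theorem exists_re_mem_Ioc (z : ℂ) : ∃ k : ℤ, (z + k * (2 * Real.pi : ℝ)).re ∈
    Ioc 0 (2 * Real.pi) ∧ (z + k * (2 * Real.pi : ℝ)).im = z.im := by
  obtain ⟨k, hk, -⟩ := existsUnique_add_zsmul_mem_Ioc Real.two_pi_pos z.re 0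
  refine ⟨k, ?_, by simp⟩
  have h1 : (z + k * (2 * Real.pi : ℝ)).re = z.re + k • (2 * Real.pi) := by
    simp
  rw [h1]
  simpa using hk

namespace Collar

theorem injOn_period {n : ℕ} (col : Collar n) (i : Fin n) {ρ : ℝ} (hρ : ρ < col.ε) :
    InjOn (col.Γ i) (Ioc 0 (2 * Real.pi) ×ℂ Ioc (-ρ) ρ) := by
  rintro z ⟨hz1, hz2⟩ w ⟨hw1, hw2⟩ h
  simp only [mem_preimage] at hz1 hz2 hw1 hw2
  obtain ⟨-, k, hk⟩ := col.inj i i z w (by rw [abs_lt]; exact ⟨by linarith [hz2.1], by linarith [hz2.2]⟩)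
    (by rw [abs_lt]; exact ⟨by linarith [hw2.1], by linarith [hw2.2]⟩) h
  have h1 : w.re = z.re + k * (2 * Real.pi) := by
    have := congrArg Complex.re hk
    simpa using this
  have h2 : k = 0 := by
    have := Real.pi_pos
    have h3 : (k : ℝ) < 1 := by
      by_contra h4
      nlinarith [hz1.1, hw1.2]
    have h4 : (-1 : ℝ) < k := by
      by_contra h4
      nlinarith [hz1.2, hw1.1]
    have h5 : k < 1 := by exact_mod_cast h3
    have h6 : -1 < k := by exact_mod_cast h4
    omega
  rw [hk, h2]; simp

theorem continuous_det {n : ℕ} (col : Collar n) (i : Fin n) :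
    Continuous fun ζ => (fderiv ℝ (col.Γ i) ζ).det := by
  simp_rw [det_fderiv_eq]
  have h1 := continuous_dz ((col.smooth i).of_le (m := 1) (mod_cast le_top))
  have h2 := continuous_dbar ((col.smooth i).of_le (m := 1) (mod_cast le_top))
  fun_prop

theorem det_pos {n : ℕ} (col : Collar n) {i : Fin n} {ζ : ℂ} (hζ : |ζ.im| < col.ε) :
    0 < (fderiv ℝ (col.Γ i) ζ).det := by
  rw [det_fderiv_eq]
  have := col.dbar_lt_dz (i := i) hζ
  have := norm_nonneg (dbar (col.Γ i) ζ)
  nlinarith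

/-- Integration in collar coordinates. -/
theorem integral_eq_sum {n : ℕ} (col : Collar n) {f : ℂ → ℂ} (hf : Continuous f) {ρ ρ' : ℝ}
    (hρ0 : 0 ≤ ρ) (hρ : ρ < ρ') (hρ' : ρ' < col.ε) (h0 : ∀ z ∉ col.shell ρ, f z = 0) :
    ∫ z, f z = ∑ i, ∫ s in -ρ'..ρ', ∫ t in (0 : ℝ)..2 * Real.pi,
      ((fderiv ℝ (col.Γ i) (t + s * I)).det : ℂ) * f (col.Γ i (t + s * I)) := by
  set S : Set ℂ := Ioc 0 (2 * Real.pi) ×ℂ Ioc (-ρ') ρ' with hS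
  have hSm : MeasurableSet S := (measurable_re measurableSet_Ioc).inter (measurable_im measurableSet_Ioc)
  have him : ∀ ζ ∈ S, |ζ.im| < col.ε := by
    rintro ζ ⟨-, h2⟩
    simp only [mem_preimage] at h2
    rw [abs_lt]; exact ⟨by linarith [h2.1], by linarith [h2.2]⟩
  have hD : ∀ i, ∀ ζ ∈ S, HasFDerivWithinAt (col.Γ i) (fderiv ℝ (col.Γ i) ζ) S ζ := fun i ζ _ =>
    (((col.smooth i).differentiable (by simp)) ζ).hasFDerivAt.hasFDerivWithinAt
  have hinj : ∀ i, InjOn (col.Γ i) S := fun i => col.injOn_period i hρ'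
  have hUm : ∀ i, MeasurableSet (col.Γ i '' S) := fun i =>
    measurable_image_of_fderivWithin hSm (hD i) (hinj i)
  have hdisj : Pairwise (Function.onFun Disjoint fun i => col.Γ i '' S) := by
    intro i j hij
    refine disjoint_left.2 ?_
    rintro _ ⟨ζ, hζ, rfl⟩ ⟨ξ, hξ, h⟩
    exact hij (col.inj j i ξ ζ (him _ hξ) (him _ hζ) h).1.symm
  have hfs : HasCompactSupport f := HasCompactSupport.intro (col.isCompact_shell ρ) h0
  have hfi : Integrable f := hf.integrable_of_hasCompactSupport hfs
  have h1 : ∫ z, f z = ∫ z in ⋃ i, col.Γ i '' S, f z := by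
    rw [setIntegral_eq_integral_of_forall_compl_eq_zero]
    intro z hz
    apply h0
    intro hzs
    obtain ⟨i, ζ, hζ, rfl⟩ := col.exists_of_mem_shell hzs
    obtain ⟨k, hk1, hk2⟩ := exists_re_mem_Ioc ζ
    refine hz (mem_iUnion.2 ⟨i, _, ⟨hk1, ?_⟩, periodic_add_int_mul (col.periodic i) k ζ⟩)
    simp only [mem_preimage]
    rw [hk2]
    rw [abs_le] at hζ
    exact ⟨by linarith [hζ.1], by linarith [hζ.2]⟩
  rw [h1, integral_iUnion_fintype hUm hdisj fun i => hfi.integrableOn]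
  refine Finset.sum_congr rfl fun i _ => ?_
  rw [integral_image_eq_integral_abs_det_fderiv_smul volume hSm (hD i) (hinj i)]
  have hcont : Continuous fun ζ => ((fderiv ℝ (col.Γ i) ζ).det : ℂ) * f (col.Γ i ζ) :=
    (continuous_ofReal.comp (col.continuous_det i)).mul (hf.comp (col.smooth i).continuous)
  rw [← setIntegral_reProdIm hcont Real.two_pi_pos.le (by linarith)]
  refine setIntegral_congr_fun hSm fun ζ hζ => ?_
  simp only [abs_of_pos (col.det_pos (i := i) (him ζ hζ)), real_smul]

theorem dbar_push_im_mul_det {n : ℕ} (col : Collar n) {ω : ℝ → ℝ} (hω : ContDiff ℝ (⊤ : ℕ∞) ω)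
    {i : Fin n} {ζ : ℂ} (hζ : |ζ.im| < col.ε) :
    ((fderiv ℝ (col.Γ i) ζ).det : ℂ) * dbar (col.push fun _ ξ => (ω ξ.im : ℂ)) (col.Γ i ζ) =
      I / 2 * deriv ω ζ.im * fderiv ℝ (col.Γ i) ζ 1 := by
  have hp : ∀ _ : Fin n, Function.Periodic (fun ξ : ℂ => (ω ξ.im : ℂ)) (2 * Real.pi : ℝ) :=
    fun _ => periodic_comp_im fun s => (ω s : ℂ)
  set P := col.push fun _ ξ => (ω ξ.im : ℂ) with hP
  have hPd : DifferentiableAt ℝ P (col.Γ i ζ) :=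
    (col.push_contDiffAt hp hζ (m := ⊤) (contDiff_comp_im hω).contDiffAt).differentiableAt (by simp)
  have hΓd : DifferentiableAt ℝ (col.Γ i) ζ := (col.smooth i).differentiable (by simp) ζ
  have e : (fun ξ => P (col.Γ i ξ)) =ᶠ[nhds ζ] fun ξ : ℂ => (ω ξ.im : ℂ) := by
    filter_upwards [col.isOpen_strip.mem_nhds hζ] with ξ hξ
    exact col.push_apply hp hξ
  have hω' : HasFDerivAt (fun ξ : ℂ => (ω ξ.im : ℂ))
      (ofRealCLM.comp ((deriv ω ζ.im) • imCLM)) ζ := by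
    have h1 : HasDerivAt ω (deriv ω ζ.im) ζ.im :=
      (hω.differentiable (by simp) _).hasDerivAt
    have h2 : HasFDerivAt (fun ξ : ℂ => ω ξ.im) ((deriv ω ζ.im) • imCLM) ζ :=
      h1.comp_hasFDerivAt ζ imCLM.hasFDerivAt
    exact ofRealCLM.hasFDerivAt.comp ζ h2
  have d1 : dbar (fun ξ : ℂ => (ω ξ.im : ℂ)) ζ = I / 2 * deriv ω ζ.im := by
    rw [dbar, hω'.fderiv]; simp; ring
  have d2 : dz (fun ξ : ℂ => (ω ξ.im : ℂ)) ζ = -(I / 2 * deriv ω ζ.im) := by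
    rw [dz, hω'.fderiv]; simp; ring
  have h1 := dbar_comp hPd hΓd
  have h2 := dz_comp hPd hΓd
  rw [dbar_congr e, d1] at h1
  rw [dz_congr e, d2] at h2
  rw [det_fderiv_eq, fderiv_apply_eq, map_one, mul_one, mul_one]
  have n1 : ((‖dz (col.Γ i) ζ‖ ^ 2 : ℝ) : ℂ) = dz (col.Γ i) ζ * conj (dz (col.Γ i) ζ) := by
    rw [Complex.mul_conj, Complex.normSq_eq_norm_sq]
  have n2 : ((‖dbar (col.Γ i) ζ‖ ^ 2 : ℝ) : ℂ) = dbar (col.Γ i) ζ * conj (dbar (col.Γ i) ζ) := by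
    rw [Complex.mul_conj, Complex.normSq_eq_norm_sq]
  rw [ofReal_sub, n1, n2]
  linear_combination -dz (col.Γ i) ζ * h1 + dbar (col.Γ i) ζ * h2

end Collar

namespace Collar

theorem dbar_ofReal {n : ℕ} (col : Collar n) (i : Fin n) (t : ℝ) : dbar (col.Γ i) t = 0 := by
  obtain ⟨C, -, hC⟩ := col.flat 1
  simpa using hC i t

theorem fderiv_one_ofReal {n : ℕ} (col : Collar n) (i : Fin n) (t : ℝ) :
    fderiv ℝ (col.Γ i) t 1 = dz (col.Γ i) t := by
  rw [fderiv_apply_eq, col.dbar_ofReal]; simp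

/-- The integral over the boundary curves. -/
def bint {n : ℕ} (col : Collar n) (h : ℂ → ℂ) : ℂ :=
  ∑ i, ∫ t in (0 : ℝ)..2 * Real.pi, h (col.Γ i t) * dz (col.Γ i) t

theorem exists_notMem_shell {n : ℕ} (col : Collar n) {a : ℂ}
    (ha : ∀ i (t : ℝ), col.Γ i t ≠ a) : ∃ ρ, 0 < ρ ∧ ρ < col.ε ∧ a ∉ col.shell ρ := by
  have hε := col.ε_pos
  by_cases h : a ∈ col.shell (col.ε / 2)
  · obtain ⟨i, ζ, hζ, rfl⟩ := col.exists_of_mem_shell h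
    have h0 : ζ.im ≠ 0 := by
      intro h0
      have e : ((ζ.re : ℝ) : ℂ) = ζ := Complex.ext (by simp) (by simp [h0])
      exact ha i ζ.re (by rw [e])
    have h1 := abs_pos.2 h0
    refine ⟨|ζ.im| / 2, by linarith, by linarith, fun h2 => ?_⟩
    obtain ⟨j, ξ, hξ, h3⟩ := col.exists_of_mem_shell h2
    obtain ⟨-, k, hk⟩ := col.inj j i ξ ζ (by linarith) (by linarith) h3
    have : ζ.im = ξ.im := by rw [hk]; simp
    rw [← this] at hξ
    linarith
  · exact ⟨col.ε / 2, by linarith, by linarith, h⟩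

variable {n : ℕ} {col : Collar n} {Ω : Set ℂ}

theorem Bounds.im_pos_of_mem_shell (hB : col.Bounds Ω) (hΩ : IsOpen Ω) {ρ : ℝ} (hρ : ρ < col.ε)
    {z : ℂ} (hz : z ∈ Ω) (hs : z ∈ col.shell ρ) :
    ∃ i, ∃ ζ : ℂ, 0 < ζ.im ∧ ζ.im ≤ ρ ∧ col.Γ i ζ = z := by
  obtain ⟨i, ζ, hζ, rfl⟩ := col.exists_of_mem_shell hs
  exact ⟨i, ζ, (hB.mem_iff hΩ (hζ.trans_lt hρ)).1 hz, (le_abs_self _).trans hζ, rfl⟩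

theorem continuousAt_indicator_of_eventually {Ω : Set ℂ} (hΩ : IsOpen Ω) {f : ℂ → ℂ}
    (hf : ContinuousOn f Ω) (h0 : ∀ z ∈ frontier Ω, ∀ᶠ w in nhds z, f w = 0) :
    Continuous (Ω.indicator f) := by
  rw [continuous_iff_continuousAt]
  intro z
  by_cases hz : z ∈ Ω
  · refine (hf.continuousAt (hΩ.mem_nhds hz)).congr ?_
    filter_upwards [hΩ.mem_nhds hz] with w hw
    rw [indicator_of_mem hw]
  · refine continuousAt_const.congr (f := fun _ => (0 : ℂ)) ?_
    by_cases hz' : z ∈ closure Ω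
    · filter_upwards [h0 z (by rw [hΩ.frontier_eq]; exact ⟨hz', hz⟩)] with w hw
      by_cases h : w ∈ Ω <;> simp [h, hw]
    · filter_upwards [isClosed_closure.isOpen_compl.mem_nhds hz'] with w hw
      rw [indicator_of_notMem fun h => hw (subset_closure h)]

theorem contDiff_indicator_of_eventually {Ω : Set ℂ} (hΩ : IsOpen Ω) {f : ℂ → ℂ} {m : ℕ∞}
    (hf : ContDiffOn ℝ m f Ω) (h0 : ∀ z ∈ frontier Ω, ∀ᶠ w in nhds z, f w = 0) :
    ContDiff ℝ m (Ω.indicator f) := by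
  rw [contDiff_iff_contDiffAt]
  intro z
  by_cases hz : z ∈ Ω
  · refine (hf.contDiffAt (hΩ.mem_nhds hz)).congr_of_eventuallyEq ?_
    filter_upwards [hΩ.mem_nhds hz] with w hw
    rw [indicator_of_mem hw]
  · refine (contDiffAt_const (c := (0 : ℂ))).congr_of_eventuallyEq ?_
    by_cases hz' : z ∈ closure Ω
    · filter_upwards [h0 z (by rw [hΩ.frontier_eq]; exact ⟨hz', hz⟩)] with w hw
      by_cases h : w ∈ Ω <;> simp [h, hw]
    · filter_upwards [isClosed_closure.isOpen_compl.mem_nhds hz'] with w hw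
      rw [indicator_of_notMem fun h => hw (subset_closure h)]

theorem Bounds.eventually_frontier (hB : col.Bounds Ω) {z : ℂ}
    (hz : z ∈ frontier Ω) {p : ℂ → Prop} {ρ : ℝ} (hρ0 : 0 < ρ)
    (h : ∀ i (ζ : ℂ), |ζ.im| < ρ → |ζ.im| < col.ε → p (col.Γ i ζ)) : ∀ᶠ w in nhds z, p w := by
  obtain ⟨i, t, -, rfl⟩ := hB.eq_of_mem_frontier hz
  rw [← col.map_nhds_eq (by simpa using col.ε_pos), Filter.eventually_map]
  filter_upwards [col.isOpen_strip.mem_nhds (show |(t : ℂ).im| < col.ε by simpa using col.ε_pos),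
    (isOpen_lt (f := fun ξ : ℂ => |ξ.im|) (by fun_prop) continuous_const).mem_nhds
      (show |(t : ℂ).im| < ρ by simpa using hρ0)] with ξ h1 h2
  exact h i ξ h2 h1

theorem contDiffOn_of_holomorphic {Ω : Set ℂ} (hΩ : IsOpen Ω) {h : ℂ → ℂ}
    (hh : DifferentiableOn ℂ h Ω) {m : ℕ∞} : ContDiffOn ℝ m h Ω :=
  ((hh.contDiffOn hΩ : ContDiffOn ℂ m h Ω).restrict_scalars ℝ)

theorem Bounds.cauchy_shell (hB : col.Bounds Ω) (hΩ : IsOpen Ω) (hb : Bornology.IsBounded Ω)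
    {h : ℂ → ℂ} (hh : DifferentiableOn ℂ h Ω) {a : ℂ} (ha : a ∈ Ω) {δ : ℝ} (hδ : 0 < δ)
    (hδε : δ < col.ε) (haδ : a ∉ col.shell δ) {ω : ℝ → ℝ} (hω : ContDiff ℝ (⊤ : ℕ∞) ω)
    (hω1 : ∀ s, |s| ≤ δ / 2 → ω s = 1) (hω0 : ∀ s, δ ≤ |s| → ω s = 0) (J : Fin n → ℝ → ℂ)
    (hJc : ∀ i, Continuous (J i))
    (hJ : ∀ i s, 0 < s → s ≤ δ → J i s = ∫ t in (0 : ℝ)..2 * Real.pi,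
      h (col.Γ i (t + s * I)) / (col.Γ i (t + s * I) - a) * fderiv ℝ (col.Γ i) (t + s * I) 1) :
    h a = I / (2 * Real.pi) * ∫ s in (0 : ℝ)..δ, ((deriv ω s : ℝ) : ℂ) * ∑ i, J i s := by
  have hε := col.ε_pos
  have hp : ∀ _ : Fin n, Function.Periodic (fun ξ : ℂ => (ω ξ.im : ℂ)) (2 * Real.pi : ℝ) :=
    fun _ => periodic_comp_im fun s => (ω s : ℂ)
  have hP0 : ∀ (_ : Fin n) (ζ : ℂ), δ ≤ |ζ.im| → (ω ζ.im : ℂ) = 0 := fun _ ζ h => by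
    simp [hω0 _ h]
  set P := col.push fun _ ξ => (ω ξ.im : ℂ) with hP
  have hPs : ContDiff ℝ (⊤ : ℕ∞) P := col.push_contDiff hp hδε hP0 fun _ => contDiff_comp_im hω
  have hPd : ∀ z, DifferentiableAt ℝ P z := fun z => hPs.differentiable (by simp) z
  have hP1 : ∀ z ∈ frontier Ω, ∀ᶠ w in nhds z, P w = 1 := fun z hz =>
    hB.eventually_frontier hz (ρ := δ / 2) (by positivity) fun i ζ h1 h2 => by
      rw [hP, col.push_apply hp h2, hω1 _ h1.le, ofReal_one]
  have hdP0 : ∀ z ∉ col.shell δ, dbar P z = 0 := fun z hz => by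
    rw [dbar_congr (col.push_eventually_zero hP0 hz)]; simp [dbar]
  have hdP1 : ∀ z ∈ frontier Ω, ∀ᶠ w in nhds z, dbar P w = 0 := fun z hz => by
    filter_upwards [eventually_eventually_nhds.2 (hP1 z hz)] with w hw
    rw [dbar_congr hw]; simp [dbar]
  have hdPc : Continuous (dbar P) := continuous_dbar (hPs.of_le (mod_cast le_top))
  have hhd : ∀ w ∈ Ω, DifferentiableAt ℂ h w := fun w hw =>
    (hh w hw).differentiableAt (hΩ.mem_nhds hw)
  set X : ℂ → ℂ := Ω.indicator fun w => h w * (1 - P w) with hX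
  have hXs : ContDiff ℝ ((1 : ℕ∞) : WithTop ℕ∞) X := by
    refine contDiff_indicator_of_eventually hΩ ?_ fun z hz => ?_
    · exact (contDiffOn_of_holomorphic hΩ hh).mul
        (contDiff_const.sub (hPs.of_le (mod_cast le_top))).contDiffOn
    · filter_upwards [hP1 z hz] with w hw
      rw [hw]; ring
  have hXc : HasCompactSupport X := by
    refine HasCompactSupport.intro hb.isCompact_closure fun z hz => ?_
    rw [hX, indicator_of_notMem fun h => hz (subset_closure h)]
  have hdX : dbar X = Ω.indicator fun w => -(h w * dbar P w) := by
    ext z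
    by_cases hz : z ∈ Ω
    · have e : X =ᶠ[nhds z] fun w => h w * (1 - P w) := by
        filter_upwards [hΩ.mem_nhds hz] with w hw
        rw [hX, indicator_of_mem hw]
      have hd : DifferentiableAt ℝ (fun w => 1 - P w) z := (hPd z).const_sub 1
      rw [indicator_of_mem hz, dbar_congr e,
        dbar_mul ((hhd z hz).restrictScalars ℝ) hd, dbar_eq_zero_of_differentiableAt (hhd z hz),
        dbar_sub (by fun_prop) (hPd z)]
      simp [dbar]
    · rw [indicator_of_notMem hz]
      have e : X =ᶠ[nhds z] fun _ => 0 := by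
        by_cases hz' : z ∈ closure Ω
        · filter_upwards [hP1 z (by rw [hΩ.frontier_eq]; exact ⟨hz', hz⟩)] with w hw
          by_cases h : w ∈ Ω <;> simp [hX, h, hw]
        · filter_upwards [isClosed_closure.isOpen_compl.mem_nhds hz'] with w hw
          rw [hX, indicator_of_notMem fun h => hw (subset_closure h)]
      rw [dbar_congr e]; simp [dbar]
  have hXa : X a = h a := by
    rw [hX, indicator_of_mem ha, hP, col.push_eq_zero hP0 haδ]; ring
  rw [← hXa, ← cauchyT_dbar (by exact_mod_cast hXs) hXc, cauchyT, hdX]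
  set f : ℂ → ℂ := fun w => (Ω.indicator fun w => -(h w * dbar P w)) w / (a - w) with hf
  have hfΩ : f = Ω.indicator fun w => -(h w * dbar P w) / (a - w) := by
    ext w
    by_cases hw : w ∈ Ω <;> simp [hf, hw]
  have hfc : Continuous f := by
    rw [hfΩ]
    refine continuousAt_indicator_of_eventually hΩ (fun w hw => ?_) fun z hz => ?_
    · by_cases hwa : w = a
      · refine ContinuousAt.continuousWithinAt (continuousAt_const.congr (f := fun _ => (0 : ℂ)) ?_)
        filter_upwards [(col.isCompact_shell δ).isClosed.isOpen_compl.mem_nhds (hwa ▸ haδ)] with v hv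
        rw [hdP0 v hv]; simp
      · have h1 := (hhd w hw).continuousAt
        have h2 : a - w ≠ 0 := sub_ne_zero.2 (Ne.symm hwa)
        have h3 := hdPc.continuousAt (x := w)
        exact ((h1.mul h3).neg.div (by fun_prop) h2).continuousWithinAt
    · filter_upwards [hdP1 z hz] with w hw
      rw [hw]; simp
  have hf0 : ∀ z ∉ col.shell δ, f z = 0 := fun z hz => by
    rw [hfΩ]
    by_cases hw : z ∈ Ω <;> simp [hw, hdP0 z hz]
  set ρ := (δ + col.ε) / 2 with hρ
  have hρ1 : δ < ρ := by rw [hρ]; linarith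
  have hρ2 : ρ < col.ε := by rw [hρ]; linarith
  rw [col.integral_eq_sum hfc hδ.le hρ1 hρ2 hf0]
  have hω' : ∀ s, δ < s → deriv ω s = 0 := fun s hs => by
    have : ω =ᶠ[nhds s] fun _ => 0 := by
      filter_upwards [eventually_gt_nhds hs] with u hu
      exact hω0 u (hu.le.trans (le_abs_self _))
    rw [this.deriv_eq]; simp
  have hωc : Continuous (deriv ω) := (hω.of_le (m := 1) (mod_cast le_top)).continuous_deriv le_rfl
  have hinner : ∀ i, ∫ s in -ρ..ρ, ∫ t in (0 : ℝ)..2 * Real.pi,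
      ((fderiv ℝ (col.Γ i) (t + s * I)).det : ℂ) * f (col.Γ i (t + s * I)) =
      I / 2 * ∫ s in (0 : ℝ)..δ, ((deriv ω s : ℝ) : ℂ) * J i s := fun i => by
    have hsp : ∀ s : ℝ, |s| < col.ε → ∫ t in (0 : ℝ)..2 * Real.pi,
        ((fderiv ℝ (col.Γ i) (t + s * I)).det : ℂ) * f (col.Γ i (t + s * I)) =
        if 0 < s ∧ s ≤ δ then I / 2 * (((deriv ω s : ℝ) : ℂ) * J i s) else 0 := fun s hs => by
      have him : ∀ t : ℝ, ((t : ℂ) + s * I).im = s := fun t => by simp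
      have hs' : ∀ t : ℝ, |((t : ℂ) + s * I).im| < col.ε := fun t => by rw [him]; exact hs
      by_cases h0 : 0 < s
      · have key : ∀ t : ℝ, ((fderiv ℝ (col.Γ i) (t + s * I)).det : ℂ) *
            f (col.Γ i (t + s * I)) = I / 2 * ((deriv ω s : ℝ) : ℂ) * (h (col.Γ i (t + s * I)) /
            (col.Γ i (t + s * I) - a) * fderiv ℝ (col.Γ i) (t + s * I) 1) := fun t => by
          have hm : col.Γ i (t + s * I) ∈ Ω := (hB.mem_iff hΩ (hs' t)).2 (by rwa [him])
          have h1 := col.dbar_push_im_mul_det hω (i := i) (hs' t)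
          rw [him] at h1
          rw [hfΩ, indicator_of_mem hm, ← neg_sub (col.Γ i (t + s * I)) a, neg_div_neg_eq]
          linear_combination (h (col.Γ i (t + s * I)) / (col.Γ i (t + s * I) - a)) * h1
        simp_rw [key]
        rw [intervalIntegral.integral_const_mul]
        by_cases h1 : s ≤ δ
        · rw [if_pos ⟨h0, h1⟩, hJ i s h0 h1]; ring
        · rw [if_neg fun h2 => h1 h2.2, hω' s (not_le.1 h1)]; simp
      · rw [if_neg fun h2 => h0 h2.1]
        have key : ∀ t : ℝ, f (col.Γ i (t + s * I)) = 0 := fun t => by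
          rw [hfΩ, indicator_of_notMem]
          rw [hB.mem_iff hΩ (hs' t), him]; exact h0
        simp [key]
    have e1 : ∫ s in -ρ..ρ, ∫ t in (0 : ℝ)..2 * Real.pi,
        ((fderiv ℝ (col.Γ i) (t + s * I)).det : ℂ) * f (col.Γ i (t + s * I)) =
        ∫ s in -ρ..ρ, (Ioc 0 δ).indicator (fun s => I / 2 * (((deriv ω s : ℝ) : ℂ) * J i s)) s := by
      refine intervalIntegral.integral_congr fun s hs => ?_
      rw [uIcc_of_le (by linarith)] at hs
      simp only [hsp s (abs_lt.2 ⟨by linarith [hs.1], by linarith [hs.2]⟩)]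
      by_cases h3 : 0 < s ∧ s ≤ δ
      · rw [if_pos h3, indicator_of_mem (show s ∈ Ioc 0 δ from h3)]
      · rw [if_neg h3, indicator_of_notMem (show s ∉ Ioc 0 δ from h3)]
    rw [e1, intervalIntegral.integral_of_le (by linarith), setIntegral_indicator measurableSet_Ioc,
      inter_eq_right.2 (Ioc_subset_Ioc (by linarith) hρ1.le),
      ← intervalIntegral.integral_of_le hδ.le, intervalIntegral.integral_const_mul]
  simp_rw [hinner]
  rw [← Finset.mul_sum]
  simp_rw [Finset.mul_sum]
  rw [intervalIntegral.integral_finsetSum]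
  · simp_rw [Finset.mul_sum]
    refine Finset.sum_congr rfl fun i _ => ?_
    have := Real.pi_pos.ne'
    field_simp
  · intro i _
    exact (((continuous_ofReal.comp hωc).mul (hJc i)).intervalIntegrable _ _)

theorem Bounds.cauchy_formula (hB : col.Bounds Ω) (hΩ : IsOpen Ω) (hb : Bornology.IsBounded Ω)
    {h : ℂ → ℂ} (hh : DiffContOnCl ℂ h Ω) {a : ℂ} (ha : a ∈ Ω) :
    col.bint (fun z => h z / (z - a)) = 2 * Real.pi * I * h a := by
  have hε := col.ε_pos
  have hpi := Real.pi_pos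
  obtain ⟨δ₀, hδ0, hδε, haδ⟩ := col.exists_notMem_shell (a := a)
    fun i t h => hB.notMem hΩ i t (h ▸ ha)
  set c : ℝ → ℝ := fun s => max 0 (min s δ₀) with hc
  have hcc : Continuous c := by fun_prop
  have hc0 : ∀ s, 0 ≤ c s := fun s => le_max_left _ _
  have hc1 : ∀ s, c s ≤ δ₀ := fun s => max_le hδ0.le (min_le_right _ _)
  have him : ∀ (t s : ℝ), ((t : ℂ) + c s * I).im = c s := fun t s => by simp
  have hmem : ∀ i (t s : ℝ), col.Γ i (t + c s * I) ∈ closure Ω := fun i t s => by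
    rw [hB.mem_closure_iff (by rw [him, abs_of_nonneg (hc0 s)]; exact (hc1 s).trans_lt hδε), him]
    exact hc0 s
  have hne : ∀ i (t s : ℝ), col.Γ i (t + c s * I) - a ≠ 0 := fun i t s h => by
    apply haδ
    rw [← sub_eq_zero.1 h]
    exact col.mem_shell (by rw [him, abs_of_nonneg (hc0 s)]; exact hc1 s)
  set J : Fin n → ℝ → ℂ := fun i s => ∫ t in (0 : ℝ)..2 * Real.pi,
    h (col.Γ i (t + c s * I)) / (col.Γ i (t + c s * I) - a) *
      fderiv ℝ (col.Γ i) (t + c s * I) 1 with hJ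
  have hJc : ∀ i, Continuous (J i) := fun i => by
    refine intervalIntegral.continuous_parametric_intervalIntegral_of_continuous' ?_ _ _
    have e0 : Continuous fun p : ℝ × ℝ => ((p.2 : ℂ) + c p.1 * I) := by fun_prop
    have e1 : Continuous fun p : ℝ × ℝ => col.Γ i ((p.2 : ℂ) + c p.1 * I) :=
      (col.smooth i).continuous.comp e0
    have e2 : Continuous fun p : ℝ × ℝ => h (col.Γ i ((p.2 : ℂ) + c p.1 * I)) :=
      hh.continuousOn.comp_continuous e1 fun p => hmem i p.2 p.1
    have e3 : Continuous fun p : ℝ × ℝ => fderiv ℝ (col.Γ i) ((p.2 : ℂ) + c p.1 * I) 1 :=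
      (((col.smooth i).continuous_fderiv (by simp)).comp e0).clm_apply continuous_const
    exact (e2.div (e1.sub continuous_const) fun p => hne i p.2 p.1).mul e3
  obtain ⟨χ, hχs, hχ1, hχ0, -⟩ := exists_cutoff (a := 1 / 2) (b := 1) (by norm_num) (by norm_num)
  have hχc : Continuous (deriv χ) := (hχs.of_le (m := 1) (mod_cast le_top)).continuous_deriv le_rfl
  obtain ⟨C, hC⟩ := isCompact_Icc.exists_bound_of_continuousOn (s := Icc (0 : ℝ) 1)
    hχc.continuousOn
  have hC0 : 0 ≤ C := (norm_nonneg _).trans (hC 0 ⟨le_rfl, zero_le_one⟩)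
  set S : ℝ → ℂ := fun s => ∑ i, J i s with hS
  have hSc : Continuous S := continuous_finsetSum _ fun i _ => hJc i
  have key : h a + I / (2 * Real.pi) * S 0 = 0 := by
    rw [← norm_le_zero_iff]
    refine le_of_forall_pos_le_add fun η hη => ?_
    have hη' : 0 < η / (C + 1) := by positivity
    obtain ⟨d, hd, hd'⟩ := Metric.continuousAt_iff.1 (hSc.continuousAt (x := 0)) (η / (C + 1)) hη'
    set δ := min δ₀ (d / 2) with hδ
    have hδpos : 0 < δ := lt_min hδ0 (by positivity)
    have hδle : δ ≤ δ₀ := min_le_left _ _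
    have hδd : δ < d := (min_le_right _ _).trans_lt (by linarith)
    set ω : ℝ → ℝ := fun s => χ (s / δ) with hω
    have hωs : ContDiff ℝ (⊤ : ℕ∞) ω := hχs.comp (contDiff_id.div_const δ)
    have h1 := hB.cauchy_shell hΩ hb hh.differentiableOn ha hδpos (hδle.trans_lt hδε)
      (fun h2 => haδ (by
        obtain ⟨i, ζ, hζ, rfl⟩ := col.exists_of_mem_shell h2
        exact col.mem_shell (hζ.trans hδle))) hωs
      (fun s hs => hχ1 _ (by
        rw [abs_div, abs_of_pos hδpos, div_le_iff₀ hδpos]; linarith))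
      (fun s hs => hχ0 _ (by
        rw [abs_div, abs_of_pos hδpos, le_div_iff₀ hδpos]; linarith)) J hJc
      (fun i s h2 h3 => by
        have : c s = s := by
          simp only [hc]; rw [min_eq_left (h3.trans hδle), max_eq_right h2.le]
        simp only [hJ, this])
    have hderiv : ∀ s, deriv ω s = deriv χ (s / δ) / δ := fun s => by
      simp only [hω]
      have h2 : HasDerivAt χ (deriv χ (s / δ)) (s / δ) :=
        (hχs.differentiable (by simp) _).hasDerivAt
      have h3 : HasDerivAt (fun s : ℝ => s / δ) (1 / δ) s := (hasDerivAt_id s).div_const δ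
      have h4 : HasDerivAt (fun s : ℝ => χ (s / δ)) (deriv χ (s / δ) * (1 / δ)) s := h2.comp s h3
      rw [h4.deriv]; ring
    have hωc : Continuous (deriv ω) :=
      (hωs.of_le (m := 1) (mod_cast le_top)).continuous_deriv le_rfl
    have hintegral : ∫ s in (0 : ℝ)..δ, ((deriv ω s : ℝ) : ℂ) = -1 := by
      rw [intervalIntegral.integral_ofReal, intervalIntegral.integral_deriv_eq_sub
        (fun s _ => hωs.differentiable (by simp) s) (hωc.intervalIntegrable _ _)]
      simp only [hω]
      rw [div_self hδpos.ne', hχ0 1 (by simp), hχ1 (0 / δ) (by simp)]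
      simp
    have h4 : h a + I / (2 * Real.pi) * S 0 =
        I / (2 * Real.pi) * ∫ s in (0 : ℝ)..δ, ((deriv ω s : ℝ) : ℂ) * (S s - S 0) := by
      simp_rw [mul_sub]
      rw [intervalIntegral.integral_sub, intervalIntegral.integral_mul_const, hintegral, h1]
      · ring
      · exact ((continuous_ofReal.comp hωc).mul hSc).intervalIntegrable _ _
      · exact ((continuous_ofReal.comp hωc).mul continuous_const).intervalIntegrable _ _
    have h5 : ‖∫ s in (0 : ℝ)..δ, ((deriv ω s : ℝ) : ℂ) * (S s - S 0)‖ ≤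
        (C / δ * (η / (C + 1))) * |δ - 0| := by
      refine intervalIntegral.norm_integral_le_of_norm_le_const fun s hs => ?_
      rw [uIoc_of_le hδpos.le] at hs
      rw [norm_mul]
      refine mul_le_mul ?_ ?_ (norm_nonneg _) (by positivity)
      · rw [norm_real, hderiv, norm_div, Real.norm_of_nonneg hδpos.le]
        gcongr
        exact hC _ ⟨div_nonneg hs.1.le hδpos.le, (div_le_one hδpos).2 hs.2⟩
      · rw [← dist_eq_norm]
        refine (hd' ?_).le
        rw [dist_zero_right, Real.norm_of_nonneg hs.1.le]
        linarith [hs.2]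
    rw [h4, norm_mul, zero_add]
    have h6 : ‖I / (2 * (Real.pi : ℂ))‖ ≤ 1 := by
      rw [norm_div, norm_I, norm_mul, norm_real, Real.norm_of_nonneg hpi.le, norm_ofNat]
      rw [div_le_one (by positivity)]
      linarith [Real.pi_gt_three]
    have h7 : (C / δ * (η / (C + 1))) * |δ - 0| ≤ η := by
      rw [sub_zero, abs_of_pos hδpos]
      have : C / δ * (η / (C + 1)) * δ = η * (C / (C + 1)) := by field_simp
      rw [this]
      refine mul_le_of_le_one_right hη.le ?_
      rw [div_le_one (by positivity)]; linarith
    calc _ ≤ 1 * η := mul_le_mul h6 (h5.trans h7) (norm_nonneg _) zero_le_one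
      _ = η := one_mul _
  have hS0 : S 0 = col.bint (fun z => h z / (z - a)) := by
    simp only [hS, hJ, bint]
    have : c 0 = 0 := by simp [hc, hδ0.le]
    simp only [this, ofReal_zero, zero_mul, add_zero, fderiv_one_ofReal]
  rw [← hS0]
  have hpi' : (Real.pi : ℂ) ≠ 0 := by exact_mod_cast hpi.ne'
  field_simp at key
  linear_combination (-I) * key + (S 0) * I_sq

end Collar

/-- `f` decays at `Ωᶜ` faster than every power of the distance, with the given constants. -/
def Flat (Ω : Set ℂ) (f : ℂ → ℂ) (M : ℕ → ℝ) : Prop :=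
  ∀ j w, ∀ z ∉ Ω, ‖f w‖ ≤ M j * ‖w - z‖ ^ j

theorem Flat.eq_zero {Ω : Set ℂ} {f : ℂ → ℂ} {M : ℕ → ℝ} (hf : Flat Ω f M) {w : ℂ} (hw : w ∉ Ω) :
    f w = 0 := by
  have := hf 1 w w hw
  simpa using this

theorem Flat.hasCompactSupport {Ω : Set ℂ} {f : ℂ → ℂ} {M : ℕ → ℝ} (hf : Flat Ω f M)
    (hb : Bornology.IsBounded Ω) : HasCompactSupport f :=
  HasCompactSupport.intro hb.isCompact_closure fun _ hz =>
    hf.eq_zero fun h => hz (subset_closure h)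

theorem Flat.norm_div_le {Ω : Set ℂ} {f : ℂ → ℂ} {M : ℕ → ℝ} (hf : Flat Ω f M) (w : ℂ) {z : ℂ}
    (hz : z ∉ Ω) (j k : ℕ) (hM : 0 ≤ M (j + k)) :
    ‖f w / (z - w) ^ j‖ ≤ M (j + k) * ‖w - z‖ ^ k := by
  by_cases h : w = z
  · rw [h, hf.eq_zero hz]; simp; positivity
  · have h1 : 0 < ‖w - z‖ := norm_pos_iff.2 (sub_ne_zero.2 h)
    rw [norm_div, norm_pow, norm_sub_rev z w, div_le_iff₀ (by positivity), mul_assoc, ← pow_add,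
      add_comm k j]
    exact hf _ w z hz

theorem Flat.continuous_div {Ω : Set ℂ} {f : ℂ → ℂ} {M : ℕ → ℝ} (hf : Flat Ω f M)
    (hfc : Continuous f) {X : Type*} [TopologicalSpace X] {p q : X → ℂ} (hp : Continuous p)
    (hq : Continuous q) (hpΩ : ∀ x, p x ∉ Ω) : Continuous fun x => f (q x) / (p x - q x) := by
  rw [continuous_iff_continuousAt]
  intro x
  by_cases h : p x = q x
  · have h0 : f (q x) / (p x - q x) = 0 := by rw [h]; simp
    rw [ContinuousAt, h0]
    have h1 : Filter.Tendsto (fun y => |M 2| * ‖q y - p y‖) (nhds x) (nhds 0) := by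
      have : Continuous fun y => |M 2| * ‖q y - p y‖ := by fun_prop
      have := this.tendsto x
      simpa [h] using this
    refine squeeze_zero_norm (fun y => ?_) h1
    have hf' : Flat Ω f fun j => |M j| := fun j w z hz => (hf j w z hz).trans (by
      gcongr; exact le_abs_self _)
    simpa using hf'.norm_div_le (q y) (hpΩ y) 1 1 (abs_nonneg _)
  · exact (hfc.comp hq).continuousAt.div (hp.sub hq).continuousAt (sub_ne_zero.2 h)

theorem integrable_uncurry_of_continuous {F : ℝ × ℂ → ℂ} (hF : Continuous F) {K : Set ℂ}
    (hK : IsCompact K) (h0 : ∀ t, ∀ w ∉ K, F (t, w) = 0) (a b : ℝ) :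
    Integrable F ((volume.restrict (Ioc a b)).prod volume) := by
  have h1 : IntegrableOn F (Icc a b ×ˢ K) ((volume : Measure ℝ).prod (volume : Measure ℂ)) :=
    hF.continuousOn.integrableOn_compact (isCompact_Icc.prod hK)
  have h2 : IntegrableOn F (Ioc a b ×ˢ univ) ((volume : Measure ℝ).prod (volume : Measure ℂ)) := by
    refine (h1.mono_set (Set.prod_mono Ioc_subset_Icc_self subset_rfl)).of_forall_sdiff_eq_zero
      (measurableSet_Ioc.prod MeasurableSet.univ) fun p hp => ?_
    refine h0 p.1 p.2 fun h => hp.2 ⟨hp.1.1, h⟩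
  rwa [IntegrableOn, ← Measure.prod_restrict, Measure.restrict_univ] at h2

namespace Collar

variable {n : ℕ} {col : Collar n} {Ω : Set ℂ}

/-- In the collars the distance to the other side is comparable with the imaginary part. -/
theorem Bounds.exists_dist (hB : col.Bounds Ω) (hΩ : IsOpen Ω) : ∃ κ, 0 < κ ∧
    ∀ i (ζ : ℂ), |ζ.im| ≤ col.ε / 2 →
      (∀ z ∉ Ω, κ * ζ.im ≤ ‖col.Γ i ζ - z‖) ∧
      (∀ z ∈ closure Ω, κ * -ζ.im ≤ ‖col.Γ i ζ - z‖) := by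
  have hε := col.ε_pos
  obtain ⟨θ, hθs, hθ1, hθ0, hθ⟩ := exists_cutoff (a := col.ε / 2) (b := 3 * col.ε / 4)
    (by positivity) (by linarith)
  set ω : ℝ → ℝ := fun s => s * θ s with hω
  have hωs : ContDiff ℝ (⊤ : ℕ∞) ω := contDiff_id.mul hθs
  have hp : ∀ _ : Fin n, Function.Periodic (fun ξ : ℂ => (ω ξ.im : ℂ)) (2 * Real.pi : ℝ) :=
    fun _ => periodic_comp_im fun s => (ω s : ℂ)
  have h0 : ∀ (_ : Fin n) (ζ : ℂ), 3 * col.ε / 4 ≤ |ζ.im| → (ω ζ.im : ℂ) = 0 := fun _ ζ h => by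
    simp [hω, hθ0 _ h]
  set P := col.push fun _ ξ => (ω ξ.im : ℂ) with hP
  have hPs : ContDiff ℝ (⊤ : ℕ∞) P :=
    col.push_contDiff hp (by linarith) h0 fun _ => contDiff_comp_im hωs
  obtain ⟨L, hL⟩ := ContDiff.lipschitzWith_of_hasCompactSupport
    (col.push_hasCompactSupport h0) hPs (by simp)
  have hsign : ∀ z, (z ∉ Ω → (P z).re ≤ 0) ∧ (z ∈ closure Ω → 0 ≤ (P z).re) := fun z => by
    by_cases hz : z ∈ col.shell (3 * col.ε / 4)
    · obtain ⟨i, ζ, hζ, rfl⟩ := col.exists_of_mem_shell hz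
      have hζ' : |ζ.im| < col.ε := by linarith
      rw [hB.mem_iff hΩ hζ', hB.mem_closure_iff hζ', hP, col.push_apply hp hζ', ofReal_re]
      exact ⟨fun h => mul_nonpos_of_nonpos_of_nonneg (not_lt.1 h) (hθ _).1,
        fun h => mul_nonneg h (hθ _).1⟩
    · rw [hP, col.push_eq_zero h0 hz]; simp
  have hval : ∀ i (ζ : ℂ), |ζ.im| ≤ col.ε / 2 → P (col.Γ i ζ) = ζ.im := fun i ζ hζ => by
    rw [hP, col.push_apply hp (by linarith)]
    simp [hω, hθ1 _ hζ]
  have hlip : ∀ w z, |(P w).re - (P z).re| ≤ (L + 1) * ‖w - z‖ := fun w z => by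
    rw [← sub_re]
    refine (abs_re_le_norm _).trans ?_
    have := hL.dist_le_mul w z
    rw [dist_eq_norm, dist_eq_norm] at this
    refine this.trans ?_
    gcongr
    simp
  refine ⟨((L : ℝ) + 1)⁻¹, by positivity, fun i ζ hζ => ⟨fun z hz => ?_, fun z hz => ?_⟩⟩
  · rw [inv_mul_le_iff₀ (by positivity)]
    have h1 := (abs_le.1 (hlip (col.Γ i ζ) z)).2
    have h2 := (hsign z).1 hz
    rw [hval i ζ hζ, ofReal_re] at h1
    linarith
  · rw [inv_mul_le_iff₀ (by positivity)]
    have h1 := (abs_le.1 (hlip (col.Γ i ζ) z)).1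
    have h2 := (hsign z).2 hz
    rw [hval i ζ hζ, ofReal_re] at h1
    linarith

theorem continuous_ofReal_apply (col : Collar n) (i : Fin n) :
    Continuous fun t : ℝ => col.Γ i t := (col.smooth i).continuous.comp continuous_ofReal

theorem continuous_dz_ofReal (col : Collar n) (i : Fin n) :
    Continuous fun t : ℝ => dz (col.Γ i) t :=
  (continuous_dz ((col.smooth i).of_le (mod_cast le_top))).comp continuous_ofReal

theorem Bounds.sub_ne_zero (hB : col.Bounds Ω) (hΩ : IsOpen Ω) {a : ℂ} (ha : a ∈ Ω) (i : Fin n)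
    (t : ℝ) : col.Γ i t - a ≠ 0 := fun h => hB.notMem hΩ i t (by rwa [_root_.sub_eq_zero.1 h])

/-- Boundary values of `cauchyT f`, `f` flat, are annihilated by the Cauchy integral. -/
theorem Bounds.bint_cauchyT (hB : col.Bounds Ω) (hΩ : IsOpen Ω) (hb : Bornology.IsBounded Ω)
    {f : ℂ → ℂ} {M : ℕ → ℝ} (hf : Flat Ω f M) (hfc : Continuous f) {a : ℂ} (ha : a ∈ Ω) :
    col.bint (fun z => cauchyT f z / (z - a)) = 0 := by
  have hc := hf.hasCompactSupport hb
  have hγ := col.continuous_ofReal_apply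
  have hγ' := col.continuous_dz_ofReal
  have hone : DiffContOnCl ℂ (fun _ : ℂ => (1 : ℂ)) Ω := diffContOnCl_const
  have hpi := Real.pi_pos
  have hintegral : ∀ i, Integrable (Function.uncurry fun (t : ℝ) (w : ℂ) =>
      f w / (col.Γ i t - w) * (dz (col.Γ i) t / (col.Γ i t - a)))
      ((volume.restrict (Ioc 0 (2 * Real.pi))).prod volume) := fun i => by
    refine integrable_uncurry_of_continuous ?_ hb.isCompact_closure (fun t w hw => ?_) _ _
    · refine (hf.continuous_div hfc ((hγ i).comp continuous_fst) continuous_snd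
        fun p => hB.notMem hΩ i p.1).mul ?_
      exact ((hγ' i).comp continuous_fst).div (((hγ i).comp continuous_fst).sub continuous_const)
        fun p => hB.sub_ne_zero hΩ ha i p.1
    · simp [hf.eq_zero fun h => hw (subset_closure h)]
  have h1 : ∀ i, ∫ t in (0 : ℝ)..2 * Real.pi, cauchyT f (col.Γ i t) / (col.Γ i t - a) *
      dz (col.Γ i) t = (Real.pi : ℂ)⁻¹ * ∫ w, ∫ t in (0 : ℝ)..2 * Real.pi,
        f w / (col.Γ i t - w) * (dz (col.Γ i) t / (col.Γ i t - a)) := fun i => by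
    simp_rw [intervalIntegral.integral_of_le (show (0 : ℝ) ≤ 2 * Real.pi by positivity)]
    rw [← integral_integral_swap (hintegral i), ← integral_const_mul]
    refine integral_congr_ae (Filter.Eventually.of_forall fun t => ?_)
    simp only [integral_mul_const, cauchyT]
    ring
  have h2 : ∀ i, Integrable fun w => ∫ t in (0 : ℝ)..2 * Real.pi,
        f w / (col.Γ i t - w) * (dz (col.Γ i) t / (col.Γ i t - a)) := fun i => by
    simp_rw [intervalIntegral.integral_of_le (show (0 : ℝ) ≤ 2 * Real.pi by positivity)]
    exact (hintegral i).integral_prod_right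
  rw [bint]
  simp_rw [h1]
  rw [← Finset.mul_sum, ← integral_finsetSum _ fun i _ => h2 i, mul_eq_zero]
  right
  refine integral_eq_zero_of_ae ?_
  filter_upwards [compl_mem_ae_iff.2 (measure_singleton a)] with w hwa
  have hwa' : w - a ≠ 0 := _root_.sub_ne_zero.2 hwa
  by_cases hw : w ∈ Ω
  · have e1 := hB.cauchy_formula hΩ hb hone hw
    have e2 := hB.cauchy_formula hΩ hb hone ha
    have hi : ∀ b ∈ Ω, ∀ i, IntervalIntegrable (fun t : ℝ => 1 / (col.Γ i t - b) * dz (col.Γ i) t)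
        volume 0 (2 * Real.pi) := fun b hb' i =>
      ((continuous_const.div ((hγ i).sub continuous_const)
        fun t => hB.sub_ne_zero hΩ hb' i t).mul (hγ' i)).intervalIntegrable _ _
    have e3 : ∀ i, ∫ t in (0 : ℝ)..2 * Real.pi,
        f w / (col.Γ i t - w) * (dz (col.Γ i) t / (col.Γ i t - a)) = f w / (w - a) *
        ((∫ t in (0 : ℝ)..2 * Real.pi, 1 / (col.Γ i t - w) * dz (col.Γ i) t) -
          ∫ t in (0 : ℝ)..2 * Real.pi, 1 / (col.Γ i t - a) * dz (col.Γ i) t) := fun i => by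
      rw [← intervalIntegral.integral_sub (hi w hw i) (hi a ha i),
        ← intervalIntegral.integral_const_mul]
      refine intervalIntegral.integral_congr fun t _ => ?_
      have k1 := hB.sub_ne_zero hΩ hw i t
      have k2 := hB.sub_ne_zero hΩ ha i t
      field_simp
      ring
    simp only [bint] at e1 e2
    simp only [e3, Pi.zero_apply]
    rw [← Finset.mul_sum, Finset.sum_sub_distrib, e1, e2]
    simp
  · simp [hf.eq_zero hw]

end Collar

theorem continuousOn_dbar {f : ℂ → ℂ} {Ω : Set ℂ} (hΩ : IsOpen Ω) (hf : ContDiffOn ℝ 1 f Ω) :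
    ContinuousOn (dbar f) Ω := by
  have h := hf.continuousOn_fderiv_of_isOpen hΩ le_rfl
  unfold dbar
  fun_prop

theorem Flat.continuous_indicator {Ω : Set ℂ} (hΩ : IsOpen Ω) {f : ℂ → ℂ} (hf : ContinuousOn f Ω)
    {M : ℕ → ℝ} (h : Flat Ω (Ω.indicator f) M) : Continuous (Ω.indicator f) := by
  rw [continuous_iff_continuousAt]
  intro z
  by_cases hz : z ∈ Ω
  · refine (hf.continuousAt (hΩ.mem_nhds hz)).congr ?_
    filter_upwards [hΩ.mem_nhds hz] with w hw
    rw [indicator_of_mem hw]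
  · rw [ContinuousAt, h.eq_zero hz]
    have h1 : Filter.Tendsto (fun w => M 1 * ‖w - z‖) (nhds z) (nhds 0) := by
      have : Continuous fun w => M 1 * ‖w - z‖ := by fun_prop
      simpa using this.tendsto z
    exact squeeze_zero_norm (fun w => by simpa using h 1 w z hz) h1

namespace Collar

variable {n : ℕ} {col : Collar n} {Ω : Set ℂ}

theorem Bounds.contDiffOn_push (hB : col.Bounds Ω) (hΩ : IsOpen Ω) {Φ : Fin n → ℂ → ℂ}
    (hp : ∀ i, Function.Periodic (Φ i) (2 * Real.pi : ℝ))
    (hs : ∀ i (ζ : ℂ), col.ε / 2 ≤ |ζ.im| → Φ i ζ = 0) {m : ℕ∞}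
    (hc : ∀ i (ζ : ℂ), 0 < ζ.im → ζ.im ≤ col.ε / 2 → ContDiffAt ℝ m (Φ i) ζ) :
    ContDiffOn ℝ m (col.push Φ) Ω := by
  have hε := col.ε_pos
  intro z hz
  refine ContDiffAt.contDiffWithinAt ?_
  by_cases hz' : z ∈ col.shell (col.ε / 2)
  · obtain ⟨i, ζ, h1, h2, rfl⟩ := hB.im_pos_of_mem_shell hΩ (by linarith) hz hz'
    exact col.push_contDiffAt hp (by rw [abs_of_pos h1]; linarith) (hc i ζ h1 h2)
  · exact contDiffAt_const.congr_of_eventuallyEq (col.push_eventually_zero hs hz')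

/-- A push-forward with almost analytic data has a flat `dbar` derivative. -/
theorem Bounds.exists_flat (hB : col.Bounds Ω) (hΩ : IsOpen Ω) {D : ℕ → ℝ} (hD : ∀ j, 0 ≤ D j) :
    ∃ C : ℕ → ℝ, (∀ j, 0 ≤ C j) ∧ ∀ (Φ : Fin n → ℂ → ℂ) (A : ℝ), 0 ≤ A →
      (∀ i, Function.Periodic (Φ i) (2 * Real.pi : ℝ)) →
      (∀ i (ζ : ℂ), col.ε / 2 ≤ |ζ.im| → Φ i ζ = 0) →
      (∀ i (ζ : ℂ), 0 < ζ.im → ζ.im ≤ col.ε / 2 → ContDiffAt ℝ 1 (Φ i) ζ) →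
      (∀ i (ζ : ℂ), 0 < ζ.im → ζ.im ≤ col.ε / 2 → ∀ j, ‖dbar (Φ i) ζ‖ ≤ A * D j * ζ.im ^ j) →
      (∀ i (ζ : ℂ), 0 < ζ.im → ζ.im ≤ col.ε / 2 → ‖fderiv ℝ (Φ i) ζ‖ * ζ.im ≤ A * D 0) →
      Flat Ω (Ω.indicator (dbar (col.push Φ))) (fun j => A * C j) ∧
      Continuous (Ω.indicator (dbar (col.push Φ))) := by
  have hε := col.ε_pos
  obtain ⟨κ, hκ, hdist⟩ := hB.exists_dist hΩ
  obtain ⟨C₀, hC0, hpush⟩ := col.exists_norm_dbar_push_le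
  choose F hF0 hF using col.flat
  refine ⟨fun j => C₀ * (D j + D 0 * F (j + 1)) / κ ^ j, fun j => ?_, ?_⟩
  · have := hD j; have := hD 0; have := hF0 (j + 1); positivity
  intro Φ A hA hp hs hc h1 h2
  have hflat : Flat Ω (Ω.indicator (dbar (col.push Φ)))
      (fun j => A * (C₀ * (D j + D 0 * F (j + 1)) / κ ^ j)) := fun j w z hz => by
    have hDj := hD j
    have hD0 := hD 0
    have hFj := hF0 (j + 1)
    by_cases hw : w ∈ Ω
    · rw [indicator_of_mem hw]
      by_cases hw' : w ∈ col.shell (col.ε / 2)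
      · obtain ⟨i, ζ, k1, k2, rfl⟩ := hB.im_pos_of_mem_shell hΩ (by linarith) hw hw'
        have k3 : |ζ.im| = ζ.im := abs_of_pos k1
        refine (hpush Φ hp i ζ (by rw [k3]; linarith) (hc i ζ k1 k2)).trans ?_
        have k4 := (hdist i ζ (by rw [k3]; exact k2)).1 z hz
        have k5 : ζ.im ^ j ≤ (‖col.Γ i ζ - z‖ / κ) ^ j := by
          gcongr
          rwa [le_div_iff₀ hκ, mul_comm]
        have k6 := hF (j + 1) i ζ
        rw [k3] at k6
        have k7 : ‖fderiv ℝ (Φ i) ζ‖ * ‖dbar (col.Γ i) ζ‖ ≤ A * D 0 * F (j + 1) * ζ.im ^ j := by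
          calc _ ≤ ‖fderiv ℝ (Φ i) ζ‖ * (F (j + 1) * ζ.im ^ (j + 1)) := by gcongr
            _ = (‖fderiv ℝ (Φ i) ζ‖ * ζ.im) * (F (j + 1) * ζ.im ^ j) := by ring
            _ ≤ (A * D 0) * (F (j + 1) * ζ.im ^ j) := by
              exact mul_le_mul_of_nonneg_right (h2 i ζ k1 k2) (by positivity)
            _ = _ := by ring
        calc _ ≤ C₀ * (A * D j * ζ.im ^ j + A * D 0 * F (j + 1) * ζ.im ^ j) := by
              gcongr
              exact h1 i ζ k1 k2 j
          _ = A * (C₀ * (D j + D 0 * F (j + 1))) * ζ.im ^ j := by ring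
          _ ≤ A * (C₀ * (D j + D 0 * F (j + 1))) * (‖col.Γ i ζ - z‖ / κ) ^ j := by gcongr
          _ = _ := by rw [div_pow]; ring
      · rw [dbar_congr (col.push_eventually_zero hs hw')]
        simp only [dbar, fderiv_fun_const, Pi.zero_apply, _root_.zero_apply, mul_zero, add_zero,
          zero_div, norm_zero]
        positivity
    · rw [indicator_of_notMem hw, norm_zero]; positivity
  exact ⟨hflat, hflat.continuous_indicator hΩ
    (continuousOn_dbar hΩ (hB.contDiffOn_push hΩ hp hs (m := 1) hc))⟩

/-- `V - cauchyT f` belongs to the disc algebra of `Ω` when `f` is the `dbar` derivative of `V`. -/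
theorem diffContOnCl_sub_cauchyT (hΩ : IsOpen Ω) (hb : Bornology.IsBounded Ω) {V : ℂ → ℂ}
    (hV : ContDiffOn ℝ 1 V Ω) (hVc : ContinuousOn V (closure Ω)) {M : ℕ → ℝ}
    (hf : Flat Ω (Ω.indicator (dbar V)) M) (hfc : Continuous (Ω.indicator (dbar V))) :
    DiffContOnCl ℂ (fun z => V z - cauchyT (Ω.indicator (dbar V)) z) Ω :=
  ⟨differentiableOn_sub_cauchyT hΩ hV hfc (hf.hasCompactSupport hb) fun z hz => by
    rw [indicator_of_mem hz], hVc.sub (continuous_cauchyT hfc (hf.hasCompactSupport hb)).continuousOn⟩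

theorem exists_bound_strip_family {E : Type*} [NormedAddCommGroup E] {f : Fin n → ℂ → E}
    (hf : ∀ i, Continuous (f i)) (hp : ∀ i, Function.Periodic (f i) (2 * Real.pi : ℝ)) (R : ℝ) :
    ∃ S, 0 ≤ S ∧ ∀ i (ζ : ℂ), |ζ.im| ≤ R → ‖f i ζ‖ ≤ S := by
  choose S hS using fun i => exists_bound_of_periodic_strip (hf i) (hp i) R
  refine ⟨∑ i, |S i|, Finset.sum_nonneg fun i _ => abs_nonneg _, fun i ζ h => ?_⟩
  exact (hS i ζ h).trans ((le_abs_self _).trans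
    (Finset.single_le_sum (f := fun i => |S i|) (fun i _ => abs_nonneg _) (Finset.mem_univ i)))

theorem periodic_fderiv {f : ℂ → ℂ} {c : ℂ} (h : Function.Periodic f c) :
    Function.Periodic (fderiv ℝ f) c := fun z => by
  rw [← fderiv_comp_add_right, funext h]

/-- Almost analytic functions on the strip, cut off away from the real line. -/
structure IsSymbol (col : Collar n) (τ : Fin n → ℂ → ℂ) : Prop where
  smooth : ∀ i, ContDiff ℝ (⊤ : ℕ∞) (τ i)
  periodic : ∀ i, Function.Periodic (τ i) (2 * Real.pi : ℝ)
  eq_zero : ∀ i (ζ : ℂ), col.ε / 2 ≤ |ζ.im| → τ i ζ = 0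
  flat : ∀ j : ℕ, ∃ D, 0 ≤ D ∧ ∀ i (ζ : ℂ), 0 < ζ.im → ζ.im ≤ col.ε / 2 →
    ‖dbar (τ i) ζ‖ ≤ D * ζ.im ^ j

theorem IsSymbol.exists_bound {τ : Fin n → ℂ → ℂ} (hτ : col.IsSymbol τ) :
    ∃ S, 0 ≤ S ∧ (∀ i (ζ : ℂ), |ζ.im| ≤ col.ε / 2 → ‖τ i ζ‖ ≤ S) ∧
      ∀ i (ζ : ℂ), |ζ.im| ≤ col.ε / 2 → ‖fderiv ℝ (τ i) ζ‖ ≤ S := by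
  obtain ⟨S, hS0, hS⟩ := exists_bound_strip_family (fun i => (hτ.smooth i).continuous) hτ.periodic
    (col.ε / 2)
  obtain ⟨S', hS0', hS'⟩ := exists_bound_strip_family
    (fun i => (hτ.smooth i).continuous_fderiv (by simp)) (fun i => periodic_fderiv (hτ.periodic i))
    (col.ε / 2)
  exact ⟨S + S', by positivity, fun i ζ h => (hS i ζ h).trans (by linarith),
    fun i ζ h => (hS' i ζ h).trans (by linarith)⟩

theorem exists_isSymbol (col : Collar n) {b : Fin n → ℝ → ℂ}
    (hb : ∀ i, ContDiff ℝ (⊤ : ℕ∞) (b i)) (hbp : ∀ i, Function.Periodic (b i) (2 * Real.pi)) :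
    ∃ τ, col.IsSymbol τ ∧ ∀ i (t : ℝ), τ i t = b i t := by
  have hε := col.ε_pos
  choose β hβs hβp hβ hβd using fun i => exists_almost_analytic_extension (hb i) (hbp i)
  choose N hN0 hN using hβd
  obtain ⟨θ, hθs, hθ1, hθ0, hθ⟩ := exists_cutoff (a := col.ε / 4) (b := col.ε / 2)
    (by positivity) (by linarith)
  set Φ : Fin n → ℂ → ℂ := fun i ζ => θ ζ.im * β i ζ with hΦ
  have hΦs : ∀ i, ContDiff ℝ (⊤ : ℕ∞) (Φ i) := fun i => (contDiff_comp_im hθs).mul (hβs i)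
  have hΦp : ∀ i, Function.Periodic (Φ i) (2 * Real.pi : ℝ) := fun i =>
    (periodic_comp_im fun s => (θ s : ℂ)).mul (hβp i)
  obtain ⟨S, hS0, hS⟩ := exists_bound_strip_family
    (fun i => (hΦs i).continuous_fderiv (by simp)) (fun i => periodic_fderiv (hΦp i)) (col.ε / 2)
  refine ⟨Φ, ⟨hΦs, hΦp, fun i ζ h => by simp [hΦ, hθ0 _ h], fun j => ?_⟩, fun i t => by
    simp [hΦ, hβ, hθ1 0 (by simp; linarith)]⟩
  have hNs : 0 ≤ ∑ i, N i j := Finset.sum_nonneg fun i _ => hN0 i j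
  refine ⟨(∑ i, N i j) + S * (4 / col.ε) ^ j, by positivity, fun i ζ k1 k2 => ?_⟩
  have k3 : |ζ.im| = ζ.im := abs_of_pos k1
  rw [add_mul]
  by_cases k4 : ζ.im < col.ε / 4
  · have e : Φ i =ᶠ[nhds ζ] β i := by
      filter_upwards [(isOpen_lt (f := fun ξ : ℂ => |ξ.im|) (by fun_prop)
        continuous_const).mem_nhds (show |ζ.im| < col.ε / 4 by rwa [k3])] with ξ hξ
      simp [hΦ, hθ1 _ (le_of_lt hξ)]
    rw [dbar_congr e]
    have k5 := hN i j ζ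
    rw [k3] at k5
    have k6 : N i j ≤ ∑ i, N i j := Finset.single_le_sum (f := fun i => N i j)
      (fun i _ => hN0 i j) (Finset.mem_univ i)
    calc _ ≤ N i j * ζ.im ^ j := k5
      _ ≤ (∑ i, N i j) * ζ.im ^ j := by gcongr
      _ ≤ _ := le_add_of_nonneg_right (by positivity)
  · refine (norm_dbar_le _ _).trans ((hS i ζ (by rwa [k3])).trans ?_)
    have k5 : 1 ≤ (4 / col.ε * ζ.im) ^ j := by
      refine one_le_pow₀ ?_
      rw [div_mul_eq_mul_div, le_div_iff₀ hε]
      linarith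
    calc S = S * 1 := (mul_one _).symm
      _ ≤ S * (4 / col.ε * ζ.im) ^ j := by gcongr
      _ = (S * (4 / col.ε) ^ j) * ζ.im ^ j := by rw [mul_pow]; ring
      _ ≤ _ := le_add_of_nonneg_left (by positivity)

/-- Smooth functions on the boundary curves extend almost analytically. -/
theorem Bounds.exists_lift (hB : col.Bounds Ω) (hΩ : IsOpen Ω)
    {b : Fin n → ℝ → ℂ} (hb : ∀ i, ContDiff ℝ (⊤ : ℕ∞) (b i))
    (hbp : ∀ i, Function.Periodic (b i) (2 * Real.pi)) :
    ∃ V : ℂ → ℂ, ContDiff ℝ (⊤ : ℕ∞) V ∧ (∀ i (t : ℝ), V (col.Γ i t) = b i t) ∧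
      (∃ M : ℕ → ℝ, (∀ j, 0 ≤ M j) ∧ Flat Ω (Ω.indicator (dbar V)) M) ∧
      Continuous (Ω.indicator (dbar V)) := by
  have hε := col.ε_pos
  obtain ⟨τ, hτ, hτb⟩ := col.exists_isSymbol hb hbp
  obtain ⟨S, hS0, -, hS⟩ := hτ.exists_bound
  choose D hD0 hD using hτ.flat
  obtain ⟨C, hC0, hC⟩ := hB.exists_flat hΩ (D := fun j => D j + S) fun j => add_nonneg (hD0 j) hS0
  have hh1 : ∀ i (ζ : ℂ), 0 < ζ.im → ζ.im ≤ col.ε / 2 → ∀ j,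
      ‖dbar (τ i) ζ‖ ≤ 1 * (D j + S) * ζ.im ^ j := fun i ζ k1 k2 j => by
    refine (hD j i ζ k1 k2).trans ?_
    gcongr
    linarith
  have hh2 : ∀ i (ζ : ℂ), 0 < ζ.im → ζ.im ≤ col.ε / 2 →
      ‖fderiv ℝ (τ i) ζ‖ * ζ.im ≤ 1 * (D 0 + S) := fun i ζ k1 k2 => by
    have k6 : ζ.im ≤ 1 := by linarith [col.ε_le]
    calc ‖fderiv ℝ (τ i) ζ‖ * ζ.im ≤ S * 1 := by
          gcongr
          exact hS i ζ (by rwa [abs_of_pos k1])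
      _ ≤ _ := by linarith [hD0 0]
  obtain ⟨h1, h2⟩ := hC τ 1 zero_le_one hτ.periodic hτ.eq_zero
    (fun i ζ _ _ => ((hτ.smooth i).of_le (mod_cast le_top)).contDiffAt) hh1 hh2
  refine ⟨col.push τ, col.push_contDiff hτ.periodic (by linarith) hτ.eq_zero hτ.smooth,
    fun i t => ?_, ⟨_, fun j => ?_, h1⟩, h2⟩
  · rw [col.push_apply hτ.periodic (by simpa using hε), hτb]
  · have := hC0 j; positivity

end Collar

theorem fderiv_conj_comp_conj {h : ℂ → ℂ} {ζ : ℂ} (hh : DifferentiableAt ℝ h (conj ζ)) (v : ℂ) :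
    fderiv ℝ (fun ξ => conj (h (conj ξ))) ζ v = conj (fderiv ℝ h (conj ζ) (conj v)) := by
  have h1 : HasFDerivAt (fun ξ : ℂ => conj ξ) (conjCLE : ℂ →L[ℝ] ℂ) ζ :=
    conjCLE.hasFDerivAt
  have h2 : HasFDerivAt (fun ξ : ℂ => conj ξ) (conjCLE : ℂ →L[ℝ] ℂ) (h (conj ζ)) :=
    conjCLE.hasFDerivAt
  have h3 : HasFDerivAt (fun ξ => conj (h (conj ξ)))
      ((conjCLE : ℂ →L[ℝ] ℂ).comp ((fderiv ℝ h (conj ζ)).comp (conjCLE : ℂ →L[ℝ] ℂ))) ζ :=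
    h2.comp ζ (hh.hasFDerivAt.comp ζ h1)
  rw [h3.fderiv]
  simp

theorem dbar_conj_comp_conj {h : ℂ → ℂ} {ζ : ℂ} (hh : DifferentiableAt ℝ h (conj ζ)) :
    dbar (fun ξ => conj (h (conj ξ))) ζ = conj (dbar h (conj ζ)) := by
  simp only [dbar, fderiv_conj_comp_conj hh, map_div₀, map_add, map_mul, conj_I, map_one, map_neg,
    map_ofNat]
  ring

theorem dz_conj_comp_conj {h : ℂ → ℂ} {ζ : ℂ} (hh : DifferentiableAt ℝ h (conj ζ)) :
    dz (fun ξ => conj (h (conj ξ))) ζ = conj (dz h (conj ζ)) := by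
  simp only [dz, fderiv_conj_comp_conj hh, map_div₀, map_sub, map_mul, conj_I, map_one, map_neg,
    map_ofNat]
  ring

/-- Continuous functions on the complement of `Ω`, holomorphic outside the closure. -/
structure IsOuter (Ω : Set ℂ) (e : ℂ → ℂ) : Prop where
  continuousOn : ContinuousOn e Ωᶜ
  differentiableOn : DifferentiableOn ℂ e (closure Ω)ᶜ

namespace Collar

variable {n : ℕ} {col : Collar n} {Ω : Set ℂ}

/-- Reflection across the boundary curves of a function on the complement of the domain. -/
def reflect (col : Collar n) (e : ℂ → ℂ) (i : Fin n) (ζ : ℂ) : ℂ :=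
  conj (e (col.Γ i ⟨ζ.re, -|ζ.im|⟩))

theorem reflect_periodic (col : Collar n) (e : ℂ → ℂ) (i : Fin n) :
    Function.Periodic (col.reflect e i) (2 * Real.pi : ℝ) := fun ζ => by
  have h : (⟨(ζ + (2 * Real.pi : ℝ)).re, -|(ζ + (2 * Real.pi : ℝ)).im|⟩ : ℂ) =
      ⟨ζ.re, -|ζ.im|⟩ + (2 * Real.pi : ℝ) := by
    apply Complex.ext <;> simp
  rw [reflect, reflect, h, col.periodic i]

theorem reflect_ofReal (col : Collar n) (e : ℂ → ℂ) (i : Fin n) (t : ℝ) :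
    col.reflect e i t = conj (e (col.Γ i t)) := by
  rw [reflect]
  congr 3
  apply Complex.ext <;> simp

theorem reflect_eventuallyEq (col : Collar n) (e : ℂ → ℂ) (i : Fin n) {ζ : ℂ} (h : 0 < ζ.im) :
    col.reflect e i =ᶠ[nhds ζ] fun ξ => conj (e (col.Γ i (conj ξ))) := by
  filter_upwards [(isOpen_lt continuous_const Complex.continuous_im).mem_nhds h] with ξ hξ
  rw [reflect]
  congr 3
  apply Complex.ext
  · simp
  · simp [abs_of_pos (show 0 < ξ.im from hξ)]

theorem Bounds.conj_notMem_closure (hB : col.Bounds Ω) (i : Fin n) {ζ : ℂ} (h : 0 < ζ.im)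
    (h' : ζ.im ≤ col.ε / 2) : col.Γ i (conj ζ) ∈ (closure Ω)ᶜ := by
  have hε := col.ε_pos
  rw [mem_compl_iff, hB.mem_closure_iff (by rw [conj_im, abs_neg, abs_of_pos h]; linarith), conj_im]
  linarith

theorem Bounds.reflect_contDiffAt (hB : col.Bounds Ω) {e : ℂ → ℂ} (he : IsOuter Ω e) (i : Fin n)
    {ζ : ℂ} (h : 0 < ζ.im) (h' : ζ.im ≤ col.ε / 2) : ContDiffAt ℝ (⊤ : ℕ∞) (col.reflect e i) ζ := by
  refine ContDiffAt.congr_of_eventuallyEq ?_ (col.reflect_eventuallyEq e i h)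
  have h1 : ContDiffAt ℝ (⊤ : ℕ∞) e (col.Γ i (conj ζ)) :=
    (contDiffOn_of_holomorphic isClosed_closure.isOpen_compl he.differentiableOn).contDiffAt
      (isClosed_closure.isOpen_compl.mem_nhds (hB.conj_notMem_closure i h h'))
  have h2 : ContDiffAt ℝ (⊤ : ℕ∞) (fun ξ => col.Γ i (conj ξ)) ζ :=
    ((col.smooth i).comp conjCLE.contDiff).contDiffAt
  have h3 : ContDiffAt ℝ (⊤ : ℕ∞) (fun ξ => e (col.Γ i (conj ξ))) ζ := h1.comp ζ h2
  exact conjCLE.contDiff.contDiffAt.comp ζ h3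

theorem Bounds.reflect_continuousAt (hB : col.Bounds Ω) (hΩ : IsOpen Ω) {e : ℂ → ℂ}
    (he : IsOuter Ω e) (i : Fin n) {ζ : ℂ} (h : |ζ.im| < col.ε) :
    ContinuousAt (col.reflect e i) ζ := by
  have hfold : Continuous fun ξ : ℂ => (⟨ξ.re, -|ξ.im|⟩ : ℂ) := by
    have : (fun ξ : ℂ => (⟨ξ.re, -|ξ.im|⟩ : ℂ)) = fun ξ : ℂ => (ξ.re : ℂ) + ((-|ξ.im| : ℝ) : ℂ) * I := by
      funext ξ; apply Complex.ext <;> simp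
    rw [this]; fun_prop
  have hmem : ∀ ξ : ℂ, |ξ.im| < col.ε → col.Γ i ⟨ξ.re, -|ξ.im|⟩ ∈ Ωᶜ := fun ξ hξ => by
    rw [mem_compl_iff, hB.mem_iff hΩ (by simpa using hξ)]
    simp
  have hO : {ξ : ℂ | |ξ.im| < col.ε} ∈ nhds ζ :=
    (isOpen_lt (f := fun ξ : ℂ => |ξ.im|) (by fun_prop) continuous_const).mem_nhds h
  have h1 : ContinuousOn (fun ξ : ℂ => e (col.Γ i ⟨ξ.re, -|ξ.im|⟩)) {ξ : ℂ | |ξ.im| < col.ε} :=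
    he.continuousOn.comp ((col.smooth i).continuous.comp hfold).continuousOn fun ξ hξ => hmem ξ hξ
  exact continuous_conj.continuousAt.comp (h1.continuousAt hO)

/-- The almost antianalytic extension to `Ω` of the boundary values `conj e * τ`. -/
def lift (col : Collar n) (τ : Fin n → ℂ → ℂ) (e : ℂ → ℂ) : ℂ → ℂ :=
  col.push fun i ζ => τ i ζ * col.reflect e i ζ

section

variable {τ : Fin n → ℂ → ℂ}

theorem lift_periodic (hτ : col.IsSymbol τ) (e : ℂ → ℂ) (i : Fin n) :
    Function.Periodic (fun ζ => τ i ζ * col.reflect e i ζ) (2 * Real.pi : ℝ) :=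
  (hτ.periodic i).mul (col.reflect_periodic e i)

theorem lift_eq_zero (hτ : col.IsSymbol τ) (e : ℂ → ℂ) (i : Fin n) (ζ : ℂ)
    (h : col.ε / 2 ≤ |ζ.im|) : τ i ζ * col.reflect e i ζ = 0 := by
  rw [hτ.eq_zero i ζ h, zero_mul]

theorem lift_ofReal (hτ : col.IsSymbol τ) (e : ℂ → ℂ) (i : Fin n) (t : ℝ) :
    col.lift τ e (col.Γ i t) = τ i t * conj (e (col.Γ i t)) := by
  rw [lift, col.push_apply (lift_periodic hτ e) (by simpa using col.ε_pos), reflect_ofReal]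

theorem Bounds.lift_continuous (hB : col.Bounds Ω) (hΩ : IsOpen Ω) (hτ : col.IsSymbol τ)
    {e : ℂ → ℂ} (he : IsOuter Ω e) : Continuous (col.lift τ e) := by
  have hε := col.ε_pos
  refine col.push_continuous (lift_periodic hτ e) (ρ := col.ε / 2) (by linarith)
    (lift_eq_zero hτ e) fun i => continuous_iff_continuousAt.2 fun ζ => ?_
  by_cases h : |ζ.im| < col.ε
  · exact (hτ.smooth i).continuous.continuousAt.mul (hB.reflect_continuousAt hΩ he i h)
  · refine continuousAt_const (y := (0 : ℂ)) |>.congr ?_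
    have h1 : {ξ : ℂ | col.ε / 2 < |ξ.im|} ∈ nhds ζ :=
      (isOpen_lt (g := fun ξ : ℂ => |ξ.im|) continuous_const (by fun_prop)).mem_nhds
        (show col.ε / 2 < |ζ.im| by linarith [not_lt.1 h])
    filter_upwards [h1] with ξ hξ
    exact (lift_eq_zero hτ e i ξ (le_of_lt hξ)).symm

theorem Bounds.lift_contDiffOn (hB : col.Bounds Ω) (hΩ : IsOpen Ω) (hτ : col.IsSymbol τ)
    {e : ℂ → ℂ} (he : IsOuter Ω e) : ContDiffOn ℝ (⊤ : ℕ∞) (col.lift τ e) Ω :=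
  hB.contDiffOn_push hΩ (lift_periodic hτ e) (lift_eq_zero hτ e) fun i _ k1 k2 =>
    (hτ.smooth i).contDiffAt.mul (hB.reflect_contDiffAt he i k1 k2)

theorem Bounds.exists_norm_deriv_reflect (hB : col.Bounds Ω) (hΩ : IsOpen Ω) :
    ∃ C : ℕ → ℝ, (∀ j, 0 ≤ C j) ∧ ∀ e B, IsOuter Ω e → (∀ z ∉ Ω, ‖e z‖ ≤ B) →
      ∀ i (ζ : ℂ), 0 < ζ.im → ζ.im ≤ col.ε / 2 →
        (∀ j, ‖dbar (col.reflect e i) ζ‖ ≤ B * C j * ζ.im ^ j) ∧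
        ‖dz (col.reflect e i) ζ‖ * ζ.im ≤ B * C 0 := by
  have hε := col.ε_pos
  obtain ⟨κ, hκ, hdist⟩ := hB.exists_dist hΩ
  obtain ⟨S, hS0, hS⟩ := exists_bound_strip_family
    (fun i => (col.smooth i).continuous_fderiv (by simp))
    (fun i => periodic_fderiv (col.periodic i)) (col.ε / 2)
  choose F hF0 hF using col.flat
  refine ⟨fun j => 2 / κ * (F (j + 1) + S), fun j => ?_, ?_⟩
  · have := hF0 (j + 1); positivity
  intro e B he heB i ζ k1 k2
  have k3 : |ζ.im| = ζ.im := abs_of_pos k1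
  have hw := hB.conj_notMem_closure i k1 k2
  have hΓ : DifferentiableAt ℝ (col.Γ i) (conj ζ) := (col.smooth i).differentiable (by simp) _
  have hd : DifferentiableAt ℂ e (col.Γ i (conj ζ)) :=
    he.differentiableOn.differentiableAt (isClosed_closure.isOpen_compl.mem_nhds hw)
  have hB0 : 0 ≤ B := (norm_nonneg _).trans (heB _ fun h => hw (subset_closure h))
  have hsub : closedBall (col.Γ i (conj ζ)) (κ * ζ.im / 2) ⊆ (closure Ω)ᶜ := fun z hz hz' => by
    have h1 := (hdist i (conj ζ) (by rw [conj_im, abs_neg, k3]; exact k2)).2 z hz'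
    rw [mem_closedBall, dist_eq_norm, norm_sub_rev] at hz
    rw [conj_im, neg_neg] at h1
    have : 0 < κ * ζ.im := by positivity
    linarith
  have hde : ‖deriv e (col.Γ i (conj ζ))‖ ≤ B / (κ * ζ.im / 2) := by
    refine Complex.norm_deriv_le_of_forall_mem_sphere_norm_le (by positivity) ?_ fun z hz =>
      heB z fun h => hsub (sphere_subset_closedBall hz) (subset_closure h)
    exact (he.differentiableOn.mono hsub).diffContOnCl_ball subset_rfl
  have hde' : ‖deriv e (col.Γ i (conj ζ))‖ ≤ B * (2 / κ) / ζ.im := by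
    refine hde.trans (le_of_eq ?_)
    field_simp
  have hh : DifferentiableAt ℝ (fun ξ => e (col.Γ i ξ)) (conj ζ) :=
    (hd.restrictScalars ℝ).comp _ hΓ
  have e1 : dbar (col.reflect e i) ζ =
      conj (deriv e (col.Γ i (conj ζ)) * dbar (col.Γ i) (conj ζ)) := by
    rw [dbar_congr (col.reflect_eventuallyEq e i k1),
      dbar_conj_comp_conj (h := fun ξ => e (col.Γ i ξ)) hh,
      dbar_comp (hd.restrictScalars ℝ) hΓ, dbar_eq_zero_of_differentiableAt hd, dz_eq_deriv hd,
      zero_mul, add_zero]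
  have e2 : dz (col.reflect e i) ζ =
      conj (deriv e (col.Γ i (conj ζ)) * dz (col.Γ i) (conj ζ)) := by
    rw [dz_congr (col.reflect_eventuallyEq e i k1),
      dz_conj_comp_conj (h := fun ξ => e (col.Γ i ξ)) hh,
      dz_comp (hd.restrictScalars ℝ) hΓ, dbar_eq_zero_of_differentiableAt hd, dz_eq_deriv hd,
      zero_mul, add_zero]
  constructor
  · intro j
    have h1 := hF (j + 1) i (conj ζ)
    rw [conj_im, abs_neg, k3] at h1
    have h2 := hF0 (j + 1)
    rw [e1, RCLike.norm_conj, norm_mul]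
    calc _ ≤ B * (2 / κ) / ζ.im * (F (j + 1) * ζ.im ^ (j + 1)) := by gcongr
      _ = B * (2 / κ * F (j + 1)) * ζ.im ^ j := by field_simp; ring
      _ ≤ B * (2 / κ * (F (j + 1) + S)) * ζ.im ^ j := by
        have : F (j + 1) ≤ F (j + 1) + S := by linarith
        gcongr
  · have h1 : ‖dz (col.Γ i) (conj ζ)‖ ≤ S := (norm_dz_le _ _).trans
      (hS i _ (by rw [conj_im, abs_neg, k3]; exact k2))
    have h2 := hF0 (0 + 1)
    rw [e2, RCLike.norm_conj, norm_mul]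
    calc _ ≤ B * (2 / κ) / ζ.im * S * ζ.im := by gcongr
      _ = B * (2 / κ * S) := by field_simp
      _ ≤ B * (2 / κ * (F (0 + 1) + S)) := by
        have : S ≤ F (0 + 1) + S := by linarith
        gcongr

/-- The `dbar` derivative of the reflection is flat, with constants controlled by the supremum. -/
theorem Bounds.exists_flat_lift (hB : col.Bounds Ω) (hΩ : IsOpen Ω) (hτ : col.IsSymbol τ) :
    ∃ C : ℕ → ℝ, (∀ j, 0 ≤ C j) ∧ ∀ e B, IsOuter Ω e → (∀ z ∉ Ω, ‖e z‖ ≤ B) → 0 ≤ B →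
      Flat Ω (Ω.indicator (dbar (col.lift τ e))) (fun j => B * C j) ∧
      Continuous (Ω.indicator (dbar (col.lift τ e))) := by
  have hε := col.ε_pos
  obtain ⟨S, hS0, hS, hS'⟩ := hτ.exists_bound
  choose D hD0 hD using hτ.flat
  obtain ⟨R, hR0, hR⟩ := hB.exists_norm_deriv_reflect hΩ
  obtain ⟨C, hC0, hC⟩ := hB.exists_flat hΩ (D := fun j => D j + S * R j + (S + S * R 0))
    fun j => by
      have := hD0 j; have := hR0 j; have := hR0 0
      positivity
  refine ⟨C, hC0, fun e B he heB hB0 => ?_⟩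
  have hval : ∀ i (ζ : ℂ), 0 < ζ.im → ζ.im ≤ col.ε / 2 → ‖col.reflect e i ζ‖ ≤ B :=
    fun i ζ k1 k2 => by
      rw [(col.reflect_eventuallyEq e i k1).self_of_nhds, RCLike.norm_conj]
      exact heB _ fun h => hB.conj_notMem_closure i k1 k2 (subset_closure h)
  have hrd : ∀ i (ζ : ℂ), 0 < ζ.im → ζ.im ≤ col.ε / 2 → DifferentiableAt ℝ (col.reflect e i) ζ :=
    fun i ζ k1 k2 => (hB.reflect_contDiffAt he i k1 k2).differentiableAt (by simp)
  have hτd : ∀ i ζ, DifferentiableAt ℝ (τ i) ζ := fun i ζ =>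
    (hτ.smooth i).differentiable (by simp) ζ
  have hh1 : ∀ i (ζ : ℂ), 0 < ζ.im → ζ.im ≤ col.ε / 2 → ∀ j,
      ‖dbar (fun ζ => τ i ζ * col.reflect e i ζ) ζ‖ ≤ B * (D j + S * R j) * ζ.im ^ j :=
    fun i ζ k1 k2 j => by
      have k3 : |ζ.im| = ζ.im := abs_of_pos k1
      have := hD0 j; have := hR0 j
      rw [dbar_mul (hτd i ζ) (hrd i ζ k1 k2)]
      refine (norm_add_le _ _).trans ?_
      rw [norm_mul, norm_mul]
      calc _ ≤ (D j * ζ.im ^ j) * B + S * (B * R j * ζ.im ^ j) := by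
            gcongr
            · exact hD j i ζ k1 k2
            · exact hval i ζ k1 k2
            · exact hS i ζ (by rwa [k3])
            · exact (hR e B he heB i ζ k1 k2).1 j
        _ = _ := by ring
  refine hC _ B hB0 (lift_periodic hτ e) (lift_eq_zero hτ e) (fun i ζ k1 k2 => ?_)
    (fun i ζ k1 k2 j => ?_) (fun i ζ k1 k2 => ?_)
  · exact ((hτ.smooth i).contDiffAt.mul (hB.reflect_contDiffAt he i k1 k2)).of_le
      (mod_cast le_top)
  · refine (hh1 i ζ k1 k2 j).trans ?_
    have := hR0 0
    refine mul_le_mul_of_nonneg_right (mul_le_mul_of_nonneg_left ?_ hB0) (by positivity)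
    exact le_add_of_nonneg_right (by positivity)
  · have k3 : |ζ.im| = ζ.im := abs_of_pos k1
    have k4 : ζ.im ≤ 1 := by linarith [col.ε_le]
    have := hD0 0; have := hR0 0
    have j1 : ‖dz (fun ζ => τ i ζ * col.reflect e i ζ) ζ‖ * ζ.im ≤ B * (S + S * R 0) := by
      rw [dz_mul (hτd i ζ) (hrd i ζ k1 k2)]
      calc _ ≤ (‖dz (τ i) ζ‖ * ‖col.reflect e i ζ‖ + ‖τ i ζ‖ * ‖dz (col.reflect e i) ζ‖) * ζ.im := by
            gcongr
            refine (norm_add_le _ _).trans ?_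
            rw [norm_mul, norm_mul]
        _ = ‖dz (τ i) ζ‖ * ‖col.reflect e i ζ‖ * ζ.im +
            ‖τ i ζ‖ * (‖dz (col.reflect e i) ζ‖ * ζ.im) := by ring
        _ ≤ S * B * 1 + S * (B * R 0) := by
            refine add_le_add ?_ ?_
            · gcongr
              · exact (norm_dz_le _ _).trans (hS' i ζ (by rwa [k3]))
              · exact hval i ζ k1 k2
            · exact mul_le_mul (hS i ζ (by rwa [k3])) (hR e B he heB i ζ k1 k2).2
                (by positivity) hS0
        _ = _ := by ring
    calc _ ≤ (‖dz (fun ζ => τ i ζ * col.reflect e i ζ) ζ‖ +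
            ‖dbar (fun ζ => τ i ζ * col.reflect e i ζ) ζ‖) * ζ.im := by
          gcongr
          exact norm_fderiv_le_dz_dbar _ _
      _ = ‖dz (fun ζ => τ i ζ * col.reflect e i ζ) ζ‖ * ζ.im +
            ‖dbar (fun ζ => τ i ζ * col.reflect e i ζ) ζ‖ * ζ.im := by ring
      _ ≤ B * (S + S * R 0) + B * (D 0 + S * R 0) * ζ.im ^ 0 * 1 := by
          gcongr
          exact hh1 i ζ k1 k2 0
      _ = _ := by ring

end

end Collar

/-- Smooth functions whose derivatives of order at most `k` are bounded by `A`. -/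
def CB (k : ℕ) (A : ℝ) (φ : ℝ → ℂ) : Prop :=
  ContDiff ℝ (⊤ : ℕ∞) φ ∧ ∀ l ≤ k, ∀ t, ‖iteratedDeriv l φ t‖ ≤ A

theorem contDiff_deriv {φ : ℝ → ℂ} (h : ContDiff ℝ (⊤ : ℕ∞) φ) :
    ContDiff ℝ (⊤ : ℕ∞) (deriv φ) :=
  (contDiff_infty_iff_deriv.1 h).2

theorem CB.norm_le {k : ℕ} {A : ℝ} {φ : ℝ → ℂ} (h : CB k A φ) (t : ℝ) : ‖φ t‖ ≤ A := by
  simpa using h.2 0 (Nat.zero_le _) t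

theorem CB.mono {k l : ℕ} {A B : ℝ} {φ : ℝ → ℂ} (h : CB k A φ) (hl : l ≤ k) (hA : A ≤ B) :
    CB l B φ :=
  ⟨h.1, fun j hj t => (h.2 j (hj.trans hl) t).trans hA⟩

theorem CB.nonneg {k : ℕ} {A : ℝ} {φ : ℝ → ℂ} (h : CB k A φ) : 0 ≤ A :=
  (norm_nonneg _).trans (h.norm_le 0)

theorem cb_zero {A : ℝ} {φ : ℝ → ℂ} (h : ContDiff ℝ (⊤ : ℕ∞) φ) (hA : ∀ t, ‖φ t‖ ≤ A) :
    CB 0 A φ :=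
  ⟨h, fun l hl t => by rw [Nat.le_zero.1 hl]; simpa using hA t⟩

theorem cb_succ {k : ℕ} {A : ℝ} {φ : ℝ → ℂ} (h : ContDiff ℝ (⊤ : ℕ∞) φ) (hA : ∀ t, ‖φ t‖ ≤ A)
    (h' : CB k A (deriv φ)) : CB (k + 1) A φ := by
  refine ⟨h, fun l hl t => ?_⟩
  cases l with
  | zero => simpa using hA t
  | succ l =>
    rw [iteratedDeriv_succ']
    exact h'.2 l (by omega) t

theorem CB.deriv {k : ℕ} {A : ℝ} {φ : ℝ → ℂ} (h : CB (k + 1) A φ) : CB k A (deriv φ) := by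
  refine ⟨contDiff_deriv h.1, fun l hl t => ?_⟩
  rw [← iteratedDeriv_succ']
  exact h.2 (l + 1) (by omega) t

theorem CB.add {k : ℕ} {A B : ℝ} {φ ψ : ℝ → ℂ} (h : CB k A φ) (h' : CB k B ψ) :
    CB k (A + B) (fun t => φ t + ψ t) := by
  refine ⟨h.1.add h'.1, fun l hl t => ?_⟩
  rw [iteratedDeriv_fun_add (h.1.of_le (mod_cast le_top)).contDiffAt
    (h'.1.of_le (mod_cast le_top)).contDiffAt]
  exact (norm_add_le _ _).trans (add_le_add (h.2 l hl t) (h'.2 l hl t))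

theorem CB.clm {k : ℕ} {A : ℝ} {φ : ℝ → ℂ} (h : CB k A φ) (L : ℂ →L[ℝ] ℂ)
    (hL : ∀ z, ‖L z‖ = ‖z‖) : CB k A (fun t => L (φ t)) := by
  induction k generalizing φ with
  | zero => exact cb_zero (L.contDiff.comp h.1) fun t => by rw [hL]; exact h.norm_le t
  | succ k ih =>
    refine cb_succ (L.contDiff.comp h.1) (fun t => by rw [hL]; exact h.norm_le t) ?_
    have : _root_.deriv (fun t => L (φ t)) = fun t => L (_root_.deriv φ t) := by
      funext t
      exact (L.hasFDerivAt.comp_hasDerivAt t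
        (h.1.differentiable (by simp) t).hasDerivAt).deriv
    rw [this]
    exact ih h.deriv

theorem CB.conj {k : ℕ} {A : ℝ} {φ : ℝ → ℂ} (h : CB k A φ) :
    CB k A (fun t => conj (φ t)) :=
  h.clm (conjCLE : ℂ →L[ℝ] ℂ) fun z => by simp

theorem CB.neg {k : ℕ} {A : ℝ} {φ : ℝ → ℂ} (h : CB k A φ) :
    CB k A (fun t => -φ t) :=
  h.clm (-ContinuousLinearMap.id ℝ ℂ) fun z => by simp

theorem CB.sub {k : ℕ} {A B : ℝ} {φ ψ : ℝ → ℂ} (h : CB k A φ) (hsub : CB k B ψ) :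
    CB k (A + B) (fun t => φ t - ψ t) := by
  simpa only [sub_eq_add_neg] using h.add hsub.neg

/-- Smooth functions with all derivatives bounded. -/
def AllCB (g : ℝ → ℂ) : Prop :=
  ∀ k, ∃ A, CB k A g

theorem allCB_of_periodic {g : ℝ → ℂ} (hg : ContDiff ℝ (⊤ : ℕ∞) g)
    (hp : Function.Periodic g (2 * Real.pi)) : AllCB g := by
  have hd : ∀ {g : ℝ → ℂ}, ContDiff ℝ (⊤ : ℕ∞) g → Function.Periodic g (2 * Real.pi) →
      ∃ A, 0 ≤ A ∧ ∀ t, ‖g t‖ ≤ A := fun {g} h hp => by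
    obtain ⟨A, hA⟩ := exists_bound_of_periodic h.continuous hp
    exact ⟨A, (norm_nonneg _).trans (hA 0), hA⟩
  intro k
  induction k generalizing g with
  | zero =>
    obtain ⟨A, -, hA⟩ := hd hg hp
    exact ⟨A, cb_zero hg hA⟩
  | succ k ih =>
    obtain ⟨A, hA0, hA⟩ := hd hg hp
    obtain ⟨B, hB⟩ := ih (contDiff_deriv hg) (periodic_deriv hp)
    have := hB.nonneg
    exact ⟨A + B, cb_succ hg (fun t => (hA t).trans (by linarith)) (hB.mono le_rfl (by linarith))⟩

theorem AllCB.deriv {g : ℝ → ℂ} (h : AllCB g) : AllCB (deriv g) := fun k => by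
  obtain ⟨A, hA⟩ := h (k + 1)
  exact ⟨A, hA.deriv⟩

theorem AllCB.contDiff {g : ℝ → ℂ} (h : AllCB g) : ContDiff ℝ (⊤ : ℕ∞) g := (h 0).choose_spec.1

theorem AllCB.exists_mul (k : ℕ) {g : ℝ → ℂ} (hg : AllCB g) :
    ∃ C, 0 ≤ C ∧ ∀ A φ, CB k A φ → CB k (C * A) (fun t => g t * φ t) := by
  induction k generalizing g with
  | zero =>
    obtain ⟨C, hC⟩ := hg 0
    refine ⟨C, hC.nonneg, fun A φ h => cb_zero (hg.contDiff.mul h.1) fun t => ?_⟩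
    rw [norm_mul]
    exact mul_le_mul (hC.norm_le t) (h.norm_le t) (norm_nonneg _) hC.nonneg
  | succ k ih =>
    obtain ⟨C, hC⟩ := hg 0
    obtain ⟨C1, hC1, h1⟩ := ih hg
    obtain ⟨C2, hC2, h2⟩ := ih hg.deriv
    have := hC.nonneg
    refine ⟨C + C1 + C2, by positivity, fun A φ h => ?_⟩
    have hA := h.nonneg
    refine cb_succ (hg.contDiff.mul h.1) (fun t => ?_) ?_
    · rw [norm_mul]
      refine (mul_le_mul (hC.norm_le t) (h.norm_le t) (norm_nonneg _) hC.nonneg).trans ?_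
      gcongr
      linarith
    · have e : _root_.deriv (fun t => g t * φ t) =
          fun t => _root_.deriv g t * φ t + g t * _root_.deriv φ t := by
        funext t
        exact deriv_fun_mul (hg.contDiff.differentiable (by simp) t)
          (h.1.differentiable (by simp) t)
      rw [e]
      refine ((h2 A φ (h.mono (Nat.le_succ k) le_rfl)).add (h1 A _ h.deriv)).mono le_rfl ?_
      nlinarith

theorem CB.const_mul {k : ℕ} {A : ℝ} {φ : ℝ → ℂ} (h : CB k A φ) (c : ℂ) :
    CB k (‖c‖ * A) (fun t => c * φ t) := by
  refine ⟨contDiff_const.mul h.1, fun l hl t => ?_⟩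
  rw [iteratedDeriv_const_mul_field, norm_mul]
  exact mul_le_mul_of_nonneg_left (h.2 l hl t) (norm_nonneg _)

/-- A sequence of functions where the derivative of each is a multiple of the next. -/
def IsTower (g : ℝ → ℂ) (φ : ℕ → ℝ → ℂ) : Prop :=
  ∀ m t, HasDerivAt (φ m) (-m * (g t * φ (m + 1) t)) t

theorem IsTower.contDiff {g : ℝ → ℂ} (hg : ContDiff ℝ (⊤ : ℕ∞) g) {φ : ℕ → ℝ → ℂ}
    (h : IsTower g φ) (m : ℕ) : ContDiff ℝ (⊤ : ℕ∞) (φ m) := by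
  refine contDiff_infty.2 fun n => ?_
  induction n generalizing m with
  | zero =>
    exact contDiff_zero.2 (continuous_iff_continuousAt.2 fun t => (h m t).continuousAt)
  | succ n ih =>
    push_cast
    refine contDiff_succ_iff_deriv.2 ⟨fun t => (h m t).differentiableAt, fun h => by simp at h, ?_⟩
    rw [show deriv (φ m) = fun t => -(m : ℂ) * (g t * φ (m + 1) t) from
      funext fun t => (h m t).deriv]
    exact contDiff_const.mul ((hg.of_le (mod_cast le_top)).mul (ih (m + 1)))

theorem IsTower.exists_bound (k m : ℕ) {g : ℝ → ℂ} (hg : AllCB g) :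
    ∃ C, 0 ≤ C ∧ ∀ A φ, IsTower g φ → (∀ l, m ≤ l → l ≤ m + k → ∀ t, ‖φ l t‖ ≤ A) →
      CB k (C * A) (φ m) := by
  induction k generalizing m with
  | zero =>
    exact ⟨1, zero_le_one, fun A φ h hA => cb_zero (h.contDiff hg.contDiff m) fun t => by
      rw [one_mul]; exact hA m le_rfl le_rfl t⟩
  | succ k ih =>
    obtain ⟨C1, hC1, h1⟩ := ih (m + 1)
    obtain ⟨C2, hC2, h2⟩ := hg.exists_mul k
    refine ⟨1 + m * (C2 * C1), by positivity, fun A φ h hA => ?_⟩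
    have hA0 : 0 ≤ A := (norm_nonneg _).trans (hA m le_rfl (by omega) 0)
    refine cb_succ (h.contDiff hg.contDiff m) (fun t => ?_) ?_
    · refine (hA m le_rfl (by omega) t).trans (le_mul_of_one_le_left hA0 ?_)
      have : 0 ≤ m * (C2 * C1) := by positivity
      linarith
    · rw [show deriv (φ m) = fun t => -(m : ℂ) * (g t * φ (m + 1) t) from
        funext fun t => (h m t).deriv]
      refine ((h2 _ _ (h1 A φ h fun l hl hl' => hA l (by omega) (by omega))).const_mul _).mono le_rfl ?_
      rw [norm_neg, norm_natCast]
      nlinarith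

theorem norm_pow_succ_sub_pow_succ_le {x y : ℂ} {L : ℝ} (hx : ‖x‖ ≤ L) (hy : ‖y‖ ≤ L) (m : ℕ) :
    ‖x ^ (m + 1) - y ^ (m + 1)‖ ≤ (m + 1) * L ^ m * ‖x - y‖ := by
  have hL : 0 ≤ L := (norm_nonneg _).trans hx
  induction m with
  | zero => simp
  | succ m ih =>
    have e : x ^ (m + 1 + 1) - y ^ (m + 1 + 1) =
        x * (x ^ (m + 1) - y ^ (m + 1)) + (x - y) * y ^ (m + 1) := by ring
    rw [e]
    calc _ ≤ ‖x‖ * ‖x ^ (m + 1) - y ^ (m + 1)‖ + ‖x - y‖ * ‖y‖ ^ (m + 1) := by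
          refine (norm_add_le _ _).trans (le_of_eq ?_)
          rw [norm_mul, norm_mul, norm_pow]
      _ ≤ L * ((m + 1) * L ^ m * ‖x - y‖) + ‖x - y‖ * L ^ (m + 1) := by gcongr
      _ = _ := by push_cast; ring

/-- Rounding to finitely many points, away from the boundary. -/
structure IsGrid (Ω : Set ℂ) (η : ℝ) (S : Finset ℂ) (α : ℂ → ℂ) : Prop where
  measurable : Measurable α
  mem : ∀ a ∈ S, a ∈ Ω
  near : ∀ w ∈ Ω, α w ∈ S → ∀ z ∉ Ω, ‖w - α w‖ ≤ 2 * η ∧ 4 * η ≤ ‖z - α w‖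
  far : ∀ w ∈ Ω, α w ∉ S → infDist w Ωᶜ ≤ 7 * η

theorem exists_isGrid {Ω : Set ℂ} (hb : Bornology.IsBounded Ω) {η : ℝ}
    (hη : 0 < η) : ∃ S α, IsGrid Ω η S α := by
  classical
  set e := TopologicalSpace.denseSeq ℂ with he
  have hne : Ωᶜ.Nonempty := by
    by_contra h
    rw [not_nonempty_iff_eq_empty, compl_empty_iff] at h
    rw [h] at hb
    exact NormedSpace.unbounded_univ ℝ ℂ hb
  have hcov : closure Ω ⊆ ⋃ k, ball (e k) η := fun w _ => by
    obtain ⟨k, hk⟩ := (TopologicalSpace.denseRange_denseSeq ℂ).exists_dist_lt w hη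
    exact mem_iUnion.2 ⟨k, hk⟩
  obtain ⟨t, ht⟩ := hb.isCompact_closure.elim_finite_subcover _ (fun k => isOpen_ball) hcov
  obtain ⟨N, hN⟩ := t.exists_nat_subset_range
  set A := SimpleFunc.nearestPt e N
  have hA : ∀ w ∈ Ω, dist (A w) w < η := fun w hw => by
    obtain ⟨k, hk, hk'⟩ := mem_iUnion₂.1 (ht (subset_closure hw))
    have h1 := SimpleFunc.edist_nearestPt_le e w (k := k) (N := N)
      (Finset.mem_range.1 (hN hk)).le
    rw [edist_dist, edist_dist, ENNReal.ofReal_le_ofReal_iff dist_nonneg] at h1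
    refine h1.trans_lt ?_
    rw [dist_comm]; exact hk'
  refine ⟨A.range.filter fun a => 4 * η < infDist a Ωᶜ, A, A.measurable, fun a ha => ?_,
    fun w hw h z hz => ⟨?_, ?_⟩, fun w hw h => ?_⟩
  · by_contra h
    have := (Finset.mem_filter.1 ha).2
    rw [infDist_zero_of_mem (show a ∈ Ωᶜ from h)] at this
    linarith
  · rw [← dist_eq_norm, dist_comm]; linarith [hA w hw]
  · rw [← dist_eq_norm, dist_comm]
    exact (Finset.mem_filter.1 h).2.le.trans (infDist_le_dist_of_mem hz)
  · have h1 : infDist (A w) Ωᶜ ≤ 4 * η := by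
      by_contra h2
      exact h (Finset.mem_filter.2 ⟨SimpleFunc.mem_range_self A w, not_le.1 h2⟩)
    have h2 := infDist_le_infDist_add_dist (s := Ωᶜ) (x := w) (y := A w)
    rw [dist_comm] at h2
    linarith [hA w hw]

open Classical in
/-- The difference of powers of the Cauchy kernel and of its rounded version. -/
def ker (S : Finset ℂ) (α : ℂ → ℂ) (m : ℕ) (z w : ℂ) : ℂ :=
  ((z - w) ^ m)⁻¹ - if α w ∈ S then ((z - α w) ^ m)⁻¹ else 0

/-- The difference of the Cauchy transform and its rational approximation, with powers. -/
def errT (S : Finset ℂ) (α : ℂ → ℂ) (f : ℂ → ℂ) (m : ℕ) (z : ℂ) : ℂ :=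
  (Real.pi : ℂ)⁻¹ * ∫ w, f w * ker S α m z w

theorem Flat.norm_le_infDist {Ω : Set ℂ} (hΩ : IsOpen Ω) {f : ℂ → ℂ} {M : ℕ → ℝ}
    (hf : Flat Ω f M) (w : ℂ) {z : ℂ} (hz : z ∉ Ω) (j : ℕ) :
    ‖f w‖ ≤ M j * infDist w Ωᶜ ^ j := by
  obtain ⟨y, hy, hy'⟩ := hΩ.isClosed_compl.exists_infDist_eq_dist ⟨z, hz⟩ w
  rw [hy', dist_eq_norm]
  exact hf j w y hy

theorem Flat.norm_mul_ker_le {Ω : Set ℂ} (hΩ : IsOpen Ω) {f : ℂ → ℂ} {M : ℕ → ℝ}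
    (hf : Flat Ω f M) (hM : ∀ j, 0 ≤ M j) {η : ℝ} (hη : 0 < η) {S : Finset ℂ} {α : ℂ → ℂ}
    (hg : IsGrid Ω η S α) (m : ℕ) {z w : ℂ} (hz : z ∉ Ω) (hw : w ∈ Ω) :
    ‖f w * ker S α m z w‖ ≤ η * ((7 + m * 4 ^ m) * M (m + 1)) := by
  have hxy : z - w ≠ 0 := sub_ne_zero.2 fun h => hz (h ▸ hw)
  have hx0 : 0 < ‖z - w‖ := norm_pos_iff.2 hxy
  have hM1 := hM (m + 1)
  rw [ker]
  split_ifs with h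
  · obtain ⟨h1, h2⟩ := hg.near w hw h z hz
    cases m with
    | zero => simp; positivity
    | succ m =>
      set x := z - w with hx
      set y := z - α w with hy
      have h3 : ‖y - x‖ ≤ 2 * η := by rwa [hx, hy, sub_sub_sub_cancel_left]
      have h4 : ‖x‖ ≤ ‖y‖ + 2 * η := by
        have := norm_sub_le y (y - x); rw [sub_sub_cancel] at this; linarith
      have h5 : ‖y‖ ≤ ‖x‖ + 2 * η := by
        have := norm_add_le x (y - x); rw [add_sub_cancel] at this; linarith
      have hy0 : 0 < ‖y‖ := by linarith
      have h6 : ‖x‖ / 2 ≤ ‖y‖ := by linarith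
      have h7 : ‖y‖ ≤ 2 * ‖x‖ := by linarith
      have e : (x ^ (m + 1))⁻¹ - (y ^ (m + 1))⁻¹ =
          (y ^ (m + 1) - x ^ (m + 1)) / (x ^ (m + 1) * y ^ (m + 1)) := by
        rw [inv_sub_inv (pow_ne_zero _ hxy) (pow_ne_zero _ (norm_pos_iff.1 hy0))]
      have h8 : ‖(x ^ (m + 1))⁻¹ - (y ^ (m + 1))⁻¹‖ ≤
          (m + 1) * (2 * ‖x‖) ^ m * (2 * η) / (‖x‖ ^ (m + 1) * (‖x‖ / 2) ^ (m + 1)) := by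
        rw [e, norm_div, norm_mul, norm_pow, norm_pow]
        have := norm_pow_succ_sub_pow_succ_le h7 (show ‖x‖ ≤ 2 * ‖x‖ by linarith) m
        gcongr
        refine this.trans ?_
        gcongr
      have h9 : ‖f w‖ ≤ M (m + 1 + 1) * ‖x‖ ^ (m + 1 + 1) := by
        have := hf (m + 1 + 1) w z hz
        rwa [norm_sub_rev] at this
      rw [norm_mul]
      calc _ ≤ (M (m + 1 + 1) * ‖x‖ ^ (m + 1 + 1)) *
            ((m + 1) * (2 * ‖x‖) ^ m * (2 * η) / (‖x‖ ^ (m + 1) * (‖x‖ / 2) ^ (m + 1))) := by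
            gcongr
        _ = η * (((m + 1) * 4 ^ (m + 1)) * M (m + 1 + 1)) := by
            have : (4 : ℝ) ^ (m + 1) = 2 ^ (m + 1) * 2 ^ (m + 1) := by
              rw [← mul_pow]; norm_num
            rw [this, mul_pow, div_pow]
            field_simp
            ring
        _ ≤ _ := by
            push_cast
            gcongr
            linarith
  · have h1 := hg.far w hw h
    have h2 := hf.norm_le_infDist hΩ w hz (m + 1)
    have h3 : infDist w Ωᶜ ≤ ‖z - w‖ := by
      rw [← dist_eq_norm, dist_comm]; exact infDist_le_dist_of_mem hz
    rw [sub_zero, norm_mul, norm_inv, norm_pow, ← div_eq_mul_inv, div_le_iff₀ (by positivity)]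
    have h0 : 0 ≤ infDist w Ωᶜ := infDist_nonneg
    calc _ ≤ M (m + 1) * (infDist w Ωᶜ ^ m * infDist w Ωᶜ) := by rw [← pow_succ]; exact h2
      _ ≤ M (m + 1) * (‖z - w‖ ^ m * (7 * η)) := by gcongr
      _ = η * (7 * M (m + 1)) * ‖z - w‖ ^ m := by ring
      _ ≤ _ := by
        gcongr
        have : (0 : ℝ) ≤ m * 4 ^ m := by positivity
        linarith

theorem Flat.norm_mul_ker_empty_le {Ω : Set ℂ} {f : ℂ → ℂ} {M : ℕ → ℝ} (hf : Flat Ω f M)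
    (hM : ∀ j, 0 ≤ M j) (α : ℂ → ℂ) (m : ℕ) {z : ℂ} (w : ℂ) (hz : z ∉ Ω) :
    ‖f w * ker ∅ α m z w‖ ≤ M m := by
  have := hf.norm_div_le w hz m 0 (hM _)
  simpa [ker, div_eq_mul_inv] using this

section

variable {Ω : Set ℂ} {f : ℂ → ℂ} {S : Finset ℂ} {α : ℂ → ℂ}

theorem measurable_ker (S : Finset ℂ) (hα : Measurable α) (m : ℕ) (z : ℂ) :
    Measurable (ker S α m z) := by
  unfold ker
  refine Measurable.sub (by fun_prop) (Measurable.ite (hα S.measurableSet) ?_ measurable_const)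
  fun_prop

theorem integrable_mul_ker (hΩ : IsOpen Ω) (hb : Bornology.IsBounded Ω) (hf : Continuous f)
    (h0 : ∀ w ∉ Ω, f w = 0) (hα : Measurable α) {m : ℕ} {z : ℂ} {A : ℝ}
    (hA : ∀ w ∈ Ω, ‖f w * ker S α m z w‖ ≤ A) : Integrable fun w => f w * ker S α m z w := by
  have h1 : Integrable (Ω.indicator fun _ => A) :=
    (integrable_indicator_iff hΩ.measurableSet).2
      (integrableOn_const (hb.measure_lt_top.ne))
  refine h1.mono' (hf.measurable.mul (measurable_ker S hα m z)).aestronglyMeasurable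
    (Filter.Eventually.of_forall fun w => ?_)
  by_cases hw : w ∈ Ω
  · rw [indicator_of_mem hw]; exact hA w hw
  · rw [indicator_of_notMem hw, h0 w hw]; simp

theorem norm_errT_le (hΩ : IsOpen Ω) (hb : Bornology.IsBounded Ω)
    (h0 : ∀ w ∉ Ω, f w = 0) {m : ℕ} {z : ℂ} {A : ℝ}
    (hA : ∀ w ∈ Ω, ‖f w * ker S α m z w‖ ≤ A) :
    ‖errT S α f m z‖ ≤ Real.pi⁻¹ * volume.real Ω * A := by
  have h1 : Integrable (Ω.indicator fun _ => A) :=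
    (integrable_indicator_iff hΩ.measurableSet).2
      (integrableOn_const (hb.measure_lt_top.ne))
  rw [errT, norm_mul, norm_inv, Complex.norm_real, Real.norm_of_nonneg Real.pi_pos.le, mul_assoc]
  refine mul_le_mul_of_nonneg_left ?_ (by positivity)
  refine (norm_integral_le_of_norm_le h1 (Filter.Eventually.of_forall fun w => ?_)).trans ?_
  · by_cases hw : w ∈ Ω
    · rw [indicator_of_mem hw]; exact hA w hw
    · rw [indicator_of_notMem hw, h0 w hw]; simp
  · rw [integral_indicator hΩ.measurableSet, setIntegral_const, smul_eq_mul]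

theorem hasDerivAt_ker (hS : ∀ a ∈ S, a ∈ Ω) (m : ℕ) {z w : ℂ} (hz : z ∉ Ω) (hw : w ∈ Ω) :
    HasDerivAt (fun z => ker S α m z w) (-m * ker S α (m + 1) z w) z := by
  have key : ∀ a ∈ Ω, HasDerivAt (fun z => ((z - a) ^ m)⁻¹) (-m * ((z - a) ^ (m + 1))⁻¹) z :=
    fun a ha => by
      have hne : z - a ≠ 0 := sub_ne_zero.2 fun h => hz (h ▸ ha)
      have h1 := (((hasDerivAt_id z).sub_const a).pow m).inv (pow_ne_zero _ hne)
      refine h1.congr_deriv ?_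
      simp only [id]
      cases m with
      | zero => simp
      | succ m =>
        simp only [Nat.add_sub_cancel, mul_one]
        rw [Pi.pow_apply]
        field_simp
        ring
  unfold ker
  split_ifs with h
  · refine ((key w hw).sub (key _ (hS _ h))).congr_deriv ?_
    ring
  · refine ((key w hw).sub_const 0).congr_deriv ?_
    ring

theorem isTower_errT (hΩ : IsOpen Ω) (hb : Bornology.IsBounded Ω) (hf : Continuous f)
    (h0 : ∀ w ∉ Ω, f w = 0) (hα : Measurable α) (hS : ∀ a ∈ S, a ∈ Ω) {A : ℕ → ℝ}
    (hA : ∀ m, ∀ z ∉ Ω, ∀ w ∈ Ω, ‖f w * ker S α m z w‖ ≤ A m) {γ γ' : ℝ → ℂ}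
    (hγ : ∀ t, HasDerivAt γ (γ' t) t) (hγΩ : ∀ t, γ t ∉ Ω) {G : ℝ} (hG : ∀ t, ‖γ' t‖ ≤ G) :
    IsTower γ' fun m t => errT S α f m (γ t) := fun m t => by
  have h1 : Integrable (Ω.indicator fun _ => m * G * A (m + 1)) :=
    (integrable_indicator_iff hΩ.measurableSet).2
      (integrableOn_const (hb.measure_lt_top.ne))
  have h2 := (hasDerivAt_integral_of_dominated_loc_of_deriv_le (μ := volume) (x₀ := t)
    (s := univ) (F := fun t w => f w * ker S α m (γ t) w)
    (F' := fun t w => -m * (γ' t * (f w * ker S α (m + 1) (γ t) w))) Filter.univ_mem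
    (Filter.Eventually.of_forall fun s =>
      (hf.measurable.mul (measurable_ker S hα m (γ s))).aestronglyMeasurable)
    (integrable_mul_ker hΩ hb hf h0 hα (hA m _ (hγΩ t)))
    ((hf.measurable.mul (measurable_ker S hα (m + 1) (γ t))).const_mul _ |>.const_mul
      _).aestronglyMeasurable
    (Filter.Eventually.of_forall fun w s _ => ?_) h1
    (Filter.Eventually.of_forall fun w s _ => ?_)).2
  · have h3 := h2.const_mul (Real.pi : ℂ)⁻¹
    refine h3.congr_deriv ?_
    simp only [integral_const_mul, errT]
    ring
  · by_cases hw : w ∈ Ω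
    · rw [indicator_of_mem hw, norm_mul, norm_mul, norm_neg, Complex.norm_natCast, ← mul_assoc]
      have h4 := hA (m + 1) _ (hγΩ s) w hw
      have h5 := hG s
      have : 0 ≤ G := (norm_nonneg _).trans h5
      gcongr
    · rw [indicator_of_notMem hw, h0 w hw]; simp
  · by_cases hw : w ∈ Ω
    · have h6 : HasDerivAt (fun s => ker S α m (γ s) w)
          (-m * ker S α (m + 1) (γ s) w * γ' s) s :=
        (hasDerivAt_ker hS m (hγΩ s) hw).comp s (hγ s)
      refine (h6.const_mul (f w)).congr_deriv ?_
      ring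
    · rw [h0 w hw]
      simpa using hasDerivAt_const s (0 : ℂ)

end

theorem IsOuter.sub {Ω : Set ℂ} {e e' : ℂ → ℂ} (h : IsOuter Ω e) (h' : IsOuter Ω e') :
    IsOuter Ω fun z => e z - e' z :=
  ⟨h.continuousOn.sub h'.continuousOn, h.differentiableOn.sub h'.differentiableOn⟩

theorem IsOuter.add {Ω : Set ℂ} {e e' : ℂ → ℂ} (h : IsOuter Ω e) (h' : IsOuter Ω e') :
    IsOuter Ω fun z => e z + e' z :=
  ⟨h.continuousOn.add h'.continuousOn, h.differentiableOn.add h'.differentiableOn⟩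

theorem isOuter_cauchyT {Ω : Set ℂ} {f : ℂ → ℂ} (hf : Continuous f) (hc : HasCompactSupport f)
    (h0 : ∀ w ∉ Ω, f w = 0) : IsOuter Ω (cauchyT f) := by
  refine ⟨(continuous_cauchyT hf hc).continuousOn, fun z hz => ?_⟩
  refine (differentiableAt_cauchyT hf hc ?_).differentiableWithinAt
  filter_upwards [isClosed_closure.isOpen_compl.mem_nhds hz] with w hw
  exact h0 w fun h => hw (subset_closure h)

/-- The rational approximation of the Cauchy transform. -/
def ratT (S : Finset ℂ) (α : ℂ → ℂ) (f : ℂ → ℂ) (z : ℂ) : ℂ :=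
  ∑ a ∈ S, ((Real.pi : ℂ)⁻¹ * ∫ w in α ⁻¹' {a}, f w) / (z - a)

theorem errT_one (S : Finset ℂ) {α : ℂ → ℂ} (hα : Measurable α) {f : ℂ → ℂ} (hf : Continuous f)
    (hc : HasCompactSupport f) (z : ℂ) : errT S α f 1 z = cauchyT f z - ratT S α f z := by
  classical
  have hfi : Integrable f := hf.integrable_of_hasCompactSupport hc
  have e : ∀ w, f w * ker S α 1 z w =
      f w / (z - w) - ∑ a ∈ S, (α ⁻¹' {a}).indicator f w * (z - a)⁻¹ := fun w => by
    simp only [ker, pow_one, mul_sub, div_eq_mul_inv]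
    congr 1
    split_ifs with h
    · rw [Finset.sum_eq_single (α w)]
      · rw [indicator_of_mem (by simp)]
      · intro b _ hb
        rw [indicator_of_notMem (by simpa using hb.symm), zero_mul]
      · exact fun h' => absurd h h'
    · rw [mul_zero, Finset.sum_eq_zero]
      intro a ha
      rw [indicator_of_notMem (fun h' => h (by rw [show α w = a from h']; exact ha)), zero_mul]
  have hm : ∀ a, MeasurableSet (α ⁻¹' {a}) := fun a => hα (measurableSet_singleton a)
  have hi : ∀ a ∈ S, Integrable fun w => (α ⁻¹' {a}).indicator f w * (z - a)⁻¹ := fun a _ =>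
    (hfi.indicator (hm a)).mul_const _
  simp only [errT, e, cauchyT, ratT]
  rw [integral_sub (integrable_div_sub hf hc z) (integrable_finsetSum _ hi),
    integral_finsetSum _ hi, mul_sub, Finset.mul_sum]
  congr 1
  refine Finset.sum_congr rfl fun a _ => ?_
  rw [integral_mul_const, integral_indicator (hm a)]
  ring

theorem isOuter_errT {Ω : Set ℂ} {S : Finset ℂ} (hS : ∀ a ∈ S, a ∈ Ω) {α : ℂ → ℂ}
    (hα : Measurable α) {f : ℂ → ℂ} (hf : Continuous f)
    (hc : HasCompactSupport f) (h0 : ∀ w ∉ Ω, f w = 0) : IsOuter Ω (errT S α f 1) := by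
  have hd : ∀ z ∉ Ω, DifferentiableAt ℂ (ratT S α f) z := fun z hz => by
    unfold ratT
    refine DifferentiableAt.fun_sum fun a ha => ?_
    exact (differentiableAt_const _).div (differentiableAt_id.sub_const a)
      (sub_ne_zero.2 fun h => hz (show z ∈ Ω from h ▸ hS a ha))
  rw [show errT S α f 1 = _ from funext (errT_one S hα hf hc)]
  refine (isOuter_cauchyT hf hc h0).sub ⟨fun z hz => ?_, fun z hz => ?_⟩
  · exact (hd z hz).continuousAt.continuousWithinAt
  · exact (hd z fun h => hz (subset_closure h)).differentiableWithinAt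

namespace Collar

variable {n : ℕ} {col : Collar n} {Ω : Set ℂ}

theorem contDiff_dz_ofReal (col : Collar n) (i : Fin n) :
    ContDiff ℝ (⊤ : ℕ∞) fun t : ℝ => dz (col.Γ i) t := by
  have h : ContDiff ℝ (⊤ : ℕ∞) (fderiv ℝ (col.Γ i)) := (col.smooth i).fderiv_right (by simp)
  have h2 : ContDiff ℝ (⊤ : ℕ∞) fun t : ℝ => fderiv ℝ (col.Γ i) t := h.comp ofRealCLM.contDiff
  unfold dz
  fun_prop

theorem periodic_ofReal (col : Collar n) (i : Fin n) :
    Function.Periodic (fun t : ℝ => col.Γ i t) (2 * Real.pi) := fun t => by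
  have := col.periodic i t
  push_cast at this ⊢
  exact this

theorem periodic_dz_ofReal (col : Collar n) (i : Fin n) :
    Function.Periodic (fun t : ℝ => dz (col.Γ i) t) (2 * Real.pi) := fun t => by
  have := periodic_dz (col.periodic i) t
  push_cast at this ⊢
  exact this

theorem hasDerivAt_ofReal (col : Collar n) (i : Fin n) (t : ℝ) :
    HasDerivAt (fun t : ℝ => col.Γ i t) (dz (col.Γ i) t) t := by
  have h := ((col.smooth i).differentiable (by simp) (t : ℂ)).hasFDerivAt.comp_hasDerivAt t
    (ofRealCLM.hasDerivAt (x := t))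
  refine h.congr_deriv ?_
  simpa using fderiv_one_ofReal col i t

/-- Bounds for boundary derivatives of the error of the rational approximation. -/
theorem Bounds.exists_cb_errT (hB : col.Bounds Ω) (hΩ : IsOpen Ω) (hb : Bornology.IsBounded Ω)
    (k : ℕ) : ∃ C, 0 ≤ C ∧ ∀ (f : ℂ → ℂ) (S : Finset ℂ) (α : ℂ → ℂ) (A : ℕ → ℝ), Continuous f →
      (∀ w ∉ Ω, f w = 0) → Measurable α → (∀ a ∈ S, a ∈ Ω) →
      (∀ m, ∀ z ∉ Ω, ∀ w ∈ Ω, ‖f w * ker S α m z w‖ ≤ A m) →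
      ∀ i, CB k (C * ∑ m ∈ Finset.range (k + 2), |A m|) fun t => errT S α f 1 (col.Γ i t) := by
  have hall : ∀ i, AllCB fun t : ℝ => dz (col.Γ i) t := fun i =>
    allCB_of_periodic (col.contDiff_dz_ofReal i) (col.periodic_dz_ofReal i)
  choose C hC0 hC using fun i => IsTower.exists_bound k 1 (hall i)
  have hV : 0 ≤ Real.pi⁻¹ * volume.real Ω := by positivity
  refine ⟨(∑ i, C i) * (Real.pi⁻¹ * volume.real Ω),
    mul_nonneg (Finset.sum_nonneg fun i _ => hC0 i) hV, ?_⟩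
  intro f S α A hf h0 hα hS hA i
  obtain ⟨G, hG⟩ := hall i 0
  have ht := isTower_errT hΩ hb hf h0 hα hS hA (col.hasDerivAt_ofReal i)
    (fun t => hB.notMem hΩ i t) hG.norm_le
  have hsum : 0 ≤ ∑ m ∈ Finset.range (k + 2), |A m| := Finset.sum_nonneg fun _ _ => abs_nonneg _
  refine (hC i (Real.pi⁻¹ * volume.real Ω * ∑ m ∈ Finset.range (k + 2), |A m|) _ ht
    fun l hl hl' t => ?_).mono le_rfl ?_
  · refine (norm_errT_le hΩ hb h0 (hA l _ (hB.notMem hΩ i t))).trans ?_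
    gcongr
    exact (le_abs_self _).trans (Finset.single_le_sum (f := fun m => |A m|)
      (fun _ _ => abs_nonneg _) (Finset.mem_range.2 (by omega)))
  · rw [← mul_assoc]
    gcongr
    exact Finset.single_le_sum (f := C) (fun i _ => hC0 i) (Finset.mem_univ i)

end Collar

/-- Solving `E = e₀ + Λ E` by iteration. -/
theorem exists_eq_add_of_contraction {Ω : Set ℂ} {Λ : (ℂ → ℂ) → ℂ → ℂ}
    (h1 : ∀ e B, IsOuter Ω e → (∀ z ∉ Ω, ‖e z‖ ≤ B) →
      IsOuter Ω (Λ e) ∧ ∀ z ∉ Ω, ‖Λ e z‖ ≤ B / 2)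
    (h2 : ∀ e e' B, IsOuter Ω e → IsOuter Ω e' → (∀ z ∉ Ω, ‖e z‖ ≤ B) → (∀ z ∉ Ω, ‖e' z‖ ≤ B) →
      ∀ z ∉ Ω, Λ (fun z => e z - e' z) z = Λ e z - Λ e' z)
    {e₀ : ℂ → ℂ} {B : ℝ} (he : IsOuter Ω e₀) (heB : ∀ z ∉ Ω, ‖e₀ z‖ ≤ B) :
    ∃ E, IsOuter Ω E ∧ (∀ z ∉ Ω, ‖E z‖ ≤ 2 * B) ∧ ∀ z ∉ Ω, E z = e₀ z + Λ E z := by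
  by_cases hne : ∃ z, z ∉ Ω
  swap
  · push Not at hne
    exact ⟨e₀, he, fun z hz => absurd (hne z) hz, fun z hz => absurd (hne z) hz⟩
  have hB0 : 0 ≤ B := (norm_nonneg _).trans (heB _ hne.choose_spec)
  set E : ℕ → ℂ → ℂ := fun k => Nat.rec e₀ (fun _ e z => e₀ z + Λ e z) k with hE
  have hE0 : E 0 = e₀ := rfl
  have hEs : ∀ k, E (k + 1) = fun z => e₀ z + Λ (E k) z := fun k => rfl
  have hout : ∀ k, IsOuter Ω (E k) ∧ ∀ z ∉ Ω, ‖E k z‖ ≤ 2 * B := fun k => by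
    induction k with
    | zero => exact ⟨he, fun z hz => (heB z hz).trans (by linarith)⟩
    | succ k ih =>
      rw [hEs]
      obtain ⟨j1, j2⟩ := h1 _ _ ih.1 ih.2
      exact ⟨he.add j1, fun z hz => (norm_add_le _ _).trans
        (by linarith [heB z hz, j2 z hz])⟩
  have hdiff : ∀ k, ∀ z ∉ Ω, ‖E (k + 1) z - E k z‖ ≤ B / 2 / 2 ^ k := fun k => by
    induction k with
    | zero =>
      intro z hz
      rw [hEs, hE0, add_sub_cancel_left]
      simpa using (h1 _ _ he heB).2 z hz
    | succ k ih =>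
      intro z hz
      rw [hEs (k + 1), hEs k, add_sub_add_left_eq_sub, ← hEs k,
        ← h2 _ _ _ (hout (k + 1)).1 (hout k).1 (hout (k + 1)).2 (hout k).2 z hz]
      refine ((h1 _ _ ((hout (k + 1)).1.sub (hout k).1) ih).2 z hz).trans (le_of_eq ?_)
      rw [pow_succ]; field_simp
  have hdist : ∀ z ∉ Ω, ∀ k, dist (E k z) (E (k + 1) z) ≤ B / 2 / 2 ^ k := fun z hz k => by
    rw [dist_comm, dist_eq_norm]; exact hdiff k z hz
  choose! L hL using fun z (hz : z ∉ Ω) =>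
    cauchySeq_tendsto_of_complete (cauchySeq_of_le_geometric_two (hdist z hz))
  have hlim : ∀ z ∉ Ω, ∀ k, ‖E k z - L z‖ ≤ B / 2 ^ k := fun z hz k => by
    rw [← dist_eq_norm]
    exact dist_le_of_le_geometric_two_of_tendsto (hdist z hz) (hL z hz) k
  have hunif : TendstoUniformlyOn E L Filter.atTop Ωᶜ := by
    rw [Metric.tendstoUniformlyOn_iff]
    intro ε hε
    have : Filter.Tendsto (fun k : ℕ => B / 2 ^ k) Filter.atTop (nhds 0) :=
      tendsto_const_nhds.div_atTop (tendsto_pow_atTop_atTop_of_one_lt one_lt_two)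
    filter_upwards [this.eventually (gt_mem_nhds hε)] with k hk z hz
    rw [dist_comm, dist_eq_norm]
    exact (hlim z hz k).trans_lt hk
  have hLo : IsOuter Ω L := by
    refine ⟨hunif.continuousOn (Filter.Eventually.of_forall fun k =>
      (hout k).1.continuousOn).frequently, ?_⟩
    exact ((hunif.mono (compl_subset_compl.2 subset_closure)).tendstoLocallyUniformlyOn).differentiableOn
      (Filter.Eventually.of_forall fun k => (hout k).1.differentiableOn)
      isClosed_closure.isOpen_compl
  have hLB : ∀ z ∉ Ω, ‖L z‖ ≤ 2 * B := fun z hz =>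
    le_of_tendsto (hL z hz).norm (Filter.Eventually.of_forall fun k => (hout k).2 z hz)
  refine ⟨L, hLo, hLB, fun z hz => ?_⟩
  have h3 : Filter.Tendsto (fun k => E (k + 1) z) Filter.atTop (nhds (L z)) :=
    (hL z hz).comp (Filter.tendsto_add_atTop_nat 1)
  refine tendsto_nhds_unique h3 ?_
  simp only [hEs]
  refine tendsto_const_nhds.add ?_
  rw [tendsto_iff_norm_sub_tendsto_zero]
  have h4 : Filter.Tendsto (fun k : ℕ => B / 2 ^ k / 2) Filter.atTop (nhds 0) := by
    have : Filter.Tendsto (fun k : ℕ => B / 2 ^ k) Filter.atTop (nhds 0) :=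
      tendsto_const_nhds.div_atTop (tendsto_pow_atTop_atTop_of_one_lt one_lt_two)
    simpa using this.div_const 2
  refine squeeze_zero (fun _ => norm_nonneg _) (fun k => ?_) h4
  rw [← h2 _ _ _ (hout k).1 hLo (hout k).2 hLB z hz]
  exact (h1 _ _ ((hout k).1.sub hLo) (fun z hz => hlim z hz k)).2 z hz

theorem ratT_sub {S : Finset ℂ} {α f g : ℂ → ℂ} (hf : Continuous f) (hfc : HasCompactSupport f)
    (hg : Continuous g) (hgc : HasCompactSupport g) (z : ℂ) :
    ratT S α (fun w => f w - g w) z = ratT S α f z - ratT S α g z := by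
  simp only [ratT]
  rw [← Finset.sum_sub_distrib]
  refine Finset.sum_congr rfl fun a _ => ?_
  rw [integral_sub (hf.integrable_of_hasCompactSupport hfc).integrableOn
    (hg.integrable_of_hasCompactSupport hgc).integrableOn]
  ring

theorem errT_one_sub {S : Finset ℂ} {α f g : ℂ → ℂ} (hα : Measurable α) (hf : Continuous f)
    (hfc : HasCompactSupport f) (hg : Continuous g) (hgc : HasCompactSupport g) (z : ℂ) :
    errT S α (fun w => f w - g w) 1 z = errT S α f 1 z - errT S α g 1 z := by
  rw [errT_one (f := fun w => f w - g w) S hα (hf.sub hg) (hfc.sub hgc), errT_one S hα hf hfc, errT_one S hα hg hgc,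
    cauchyT_sub hf hfc hg hgc, ratT_sub hf hfc hg hgc]
  ring

theorem errT_empty (α : ℂ → ℂ) {f : ℂ → ℂ} (z : ℂ) : errT ∅ α f 1 z = cauchyT f z := by
  simp [errT, ker, cauchyT, div_eq_mul_inv]

namespace Collar

variable {n : ℕ} {col : Collar n} {Ω : Set ℂ} {τ : Fin n → ℂ → ℂ}

theorem push_sub (col : Collar n) (Φ Ψ : Fin n → ℂ → ℂ) (z : ℂ) :
    col.push (fun i ζ => Φ i ζ - Ψ i ζ) z = col.push Φ z - col.push Ψ z := by
  unfold push
  split <;> simp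

/-- The density on `Ω` of the antiholomorphic derivative of the lift of `e`. -/
def dens (col : Collar n) (τ : Fin n → ℂ → ℂ) (Ω : Set ℂ) (e : ℂ → ℂ) : ℂ → ℂ :=
  Ω.indicator (dbar (col.lift τ e))

theorem Bounds.dens_sub (hB : col.Bounds Ω) (hΩ : IsOpen Ω) (hτ : col.IsSymbol τ) {e e' : ℂ → ℂ}
    (he : IsOuter Ω e) (he' : IsOuter Ω e') (w : ℂ) :
    col.dens τ Ω (fun z => e z - e' z) w = col.dens τ Ω e w - col.dens τ Ω e' w := by
  unfold dens
  by_cases hw : w ∈ Ω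
  · simp only [indicator_of_mem hw]
    have h : col.lift τ (fun z => e z - e' z) = fun z => col.lift τ e z - col.lift τ e' z := by
      ext z
      unfold lift
      rw [← push_sub]
      congr 1
      ext i ζ
      simp only [reflect, map_sub]
      ring
    have hd : ∀ {e}, IsOuter Ω e → DifferentiableAt ℝ (col.lift τ e) w := fun he =>
      ((hB.lift_contDiffOn hΩ hτ he).contDiffAt (hΩ.mem_nhds hw)).differentiableAt (by simp)
    rw [h, dbar_sub (hd he) (hd he')]
  · simp [indicator_of_notMem hw]

/-- The Cauchy transform of the density of `e`. -/
def kap (col : Collar n) (τ : Fin n → ℂ → ℂ) (Ω : Set ℂ) (e : ℂ → ℂ) : ℂ → ℂ :=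
  cauchyT (col.dens τ Ω e)

theorem Bounds.diffContOnCl_lift_sub_kap (hB : col.Bounds Ω) (hΩ : IsOpen Ω)
    (hb : Bornology.IsBounded Ω) (hτ : col.IsSymbol τ) {e : ℂ → ℂ} (he : IsOuter Ω e) {B : ℝ}
    (heB : ∀ z ∉ Ω, ‖e z‖ ≤ B) (hB0 : 0 ≤ B) :
    DiffContOnCl ℂ (fun z => col.lift τ e z - col.kap τ Ω e z) Ω := by
  obtain ⟨C, -, hC⟩ := hB.exists_flat_lift hΩ hτ
  obtain ⟨h1, h2⟩ := hC e B he heB hB0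
  exact diffContOnCl_sub_cauchyT hΩ hb ((hB.lift_contDiffOn hΩ hτ he).of_le (by simp))
    (hB.lift_continuous hΩ hτ he).continuousOn h1 h2

theorem Bounds.exists_dens (hB : col.Bounds Ω) (hΩ : IsOpen Ω) (hb : Bornology.IsBounded Ω)
    (hτ : col.IsSymbol τ) : ∃ C : ℕ → ℝ, (∀ j, 0 ≤ C j) ∧ ∀ e B, IsOuter Ω e →
      (∀ z ∉ Ω, ‖e z‖ ≤ B) → 0 ≤ B →
      Flat Ω (col.dens τ Ω e) (fun j => B * C j) ∧ Continuous (col.dens τ Ω e) ∧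
      HasCompactSupport (col.dens τ Ω e) ∧ (∀ w ∉ Ω, col.dens τ Ω e w = 0) ∧
      IsOuter Ω (col.kap τ Ω e) ∧
      ∀ z ∉ Ω, ‖col.kap τ Ω e z‖ ≤ Real.pi⁻¹ * volume.real Ω * (B * C 1) := by
  obtain ⟨C, hC0, hC⟩ := hB.exists_flat_lift hΩ hτ
  refine ⟨C, hC0, fun e B he heB hB0 => ?_⟩
  obtain ⟨h1, h2⟩ := hC e B he heB hB0
  have h3 := h1.hasCompactSupport hb
  refine ⟨h1, h2, h3, fun w => h1.eq_zero, isOuter_cauchyT h2 h3 fun w => h1.eq_zero,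
    fun z hz => ?_⟩
  rw [kap, ← errT_empty id]
  exact norm_errT_le hΩ hb (fun w => h1.eq_zero) fun w _ =>
    h1.norm_mul_ker_empty_le (fun j => mul_nonneg hB0 (hC0 j)) id 1 w hz

theorem exists_notMem_of_bounded (hb : Bornology.IsBounded Ω) : ∃ z : ℂ, z ∉ Ω := by
  by_contra! h
  exact NormedSpace.unbounded_univ ℝ ℂ (by rwa [← eq_univ_of_forall h])

theorem Bounds.exists_neumann (hB : col.Bounds Ω) (hΩ : IsOpen Ω) (hb : Bornology.IsBounded Ω)
    (hτ : col.IsSymbol τ) : ∃ η S α, 0 < η ∧ IsGrid Ω η S α ∧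
      ∀ e₀ B, IsOuter Ω e₀ → (∀ z ∉ Ω, ‖e₀ z‖ ≤ B) →
      ∃ E, IsOuter Ω E ∧ (∀ z ∉ Ω, ‖E z‖ ≤ 2 * B) ∧
        ∀ z ∉ Ω, E z = e₀ z + errT S α (col.dens τ Ω (col.kap τ Ω E)) 1 z := by
  obtain ⟨C, hC0, hC⟩ := hB.exists_dens hΩ hb hτ
  set v := Real.pi⁻¹ * volume.real Ω with hv
  have hv0 : 0 ≤ v := by positivity
  have hP : 0 ≤ v * (11 * (v * C 1 * C 2)) := by have := hC0 1; have := hC0 2; positivity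
  set η := (2 * (v * (11 * (v * C 1 * C 2)) + 1))⁻¹ with hη
  have hη0 : 0 < η := by positivity
  obtain ⟨S, α, hg⟩ := exists_isGrid hb hη0
  obtain ⟨z₀, hz₀⟩ := exists_notMem_of_bounded hb
  have hnn : ∀ {e : ℂ → ℂ} {B : ℝ}, (∀ z ∉ Ω, ‖e z‖ ≤ B) → 0 ≤ B := fun h =>
    (norm_nonneg _).trans (h z₀ hz₀)
  refine ⟨η, S, α, hη0, hg, fun e₀ B he heB => ?_⟩
  refine exists_eq_add_of_contraction
    (Λ := fun e => errT S α (col.dens τ Ω (col.kap τ Ω e)) 1) ?_ ?_ he heB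
  · intro e B he heB
    have hB0 := hnn heB
    obtain ⟨-, -, -, -, k1, k2⟩ := hC e B he heB hB0
    have h0 : 0 ≤ v * (B * C 1) := hnn k2
    obtain ⟨m1, m2, m3, m4, -, -⟩ := hC _ _ k1 k2 h0
    refine ⟨isOuter_errT hg.mem hg.measurable m2 m3 m4, fun z hz => ?_⟩
    refine (norm_errT_le hΩ hb m4 fun w hw => m1.norm_mul_ker_le hΩ
      (fun j => mul_nonneg h0 (hC0 j)) hη0 hg 1 hz hw).trans ?_
    calc v * (η * ((7 + (1 : ℕ) * 4 ^ 1) * (v * (B * C 1) * C (1 + 1))))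
        = (v * (11 * (v * C 1 * C 2))) * η * B := by push_cast; ring
      _ ≤ (1 / 2) * B := by
          refine mul_le_mul_of_nonneg_right ?_ hB0
          rw [hη, ← div_eq_mul_inv, div_le_iff₀ (by positivity)]
          linarith
      _ = B / 2 := by ring
  · intro e e' B he he' heB heB' z _
    have hB0 := hnn heB
    obtain ⟨-, k1, k2, -, k3, k4⟩ := hC e B he heB hB0
    obtain ⟨-, k1', k2', -, k3', k4'⟩ := hC e' B he' heB' hB0
    obtain ⟨-, m2, m3, -, -, -⟩ := hC _ _ k3 k4 (hnn k4)
    obtain ⟨-, n2, n3, -, -, -⟩ := hC _ _ k3' k4' (hnn k4)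
    have h1 : col.kap τ Ω (fun z => e z - e' z) = fun z => col.kap τ Ω e z - col.kap τ Ω e' z := by
      ext z
      unfold kap
      rw [← cauchyT_sub k1 k2 k1' k2']
      congr 1
      ext w
      exact hB.dens_sub hΩ hτ he he' w
    have h2 : col.dens τ Ω (fun z => col.kap τ Ω e z - col.kap τ Ω e' z) =
        fun w => col.dens τ Ω (col.kap τ Ω e) w - col.dens τ Ω (col.kap τ Ω e') w := by
      ext w
      exact hB.dens_sub hΩ hτ k3 k3' w
    simp only [h1, h2]
    exact errT_one_sub hg.measurable m2 m3 n2 n3 z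

/-- Admissible functions: holomorphic functions on `Ω` with smooth boundary values, whose
reflection in the boundary is meromorphic on `Ω` with finitely many simple poles. -/
structure IsReflective (col : Collar n) (Ω : Set ℂ) (τ : Fin n → ℂ → ℂ) (s : ℂ → ℂ) : Prop where
  diffContOnCl : DiffContOnCl ℂ s Ω
  contDiff : ∀ i, ContDiff ℝ (⊤ : ℕ∞) fun t : ℝ => s (col.Γ i t)
  exists_eq : ∃ (M : ℂ → ℂ) (S : Finset ℂ) (c : ℂ → ℂ), DiffContOnCl ℂ M Ω ∧ (∀ a ∈ S, a ∈ Ω) ∧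
    ∀ i (t : ℝ), τ i t * conj (s (col.Γ i t)) =
      M (col.Γ i t) + ∑ a ∈ S, c a / (col.Γ i t - a)

theorem IsReflective.add {s s' : ℂ → ℂ} (h : col.IsReflective Ω τ s)
    (h' : col.IsReflective Ω τ s') : col.IsReflective Ω τ fun z => s z + s' z := by
  classical
  obtain ⟨M, S, c, hM, hS, hc⟩ := h.exists_eq
  obtain ⟨M', S', c', hM', hS', hc'⟩ := h'.exists_eq
  refine ⟨h.diffContOnCl.add h'.diffContOnCl, fun i => (h.contDiff i).add (h'.contDiff i),
    fun z => M z + M' z, S ∪ S',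
    fun a => (if a ∈ S then c a else 0) + if a ∈ S' then c' a else 0, hM.add hM', fun a ha => ?_,
    fun i t => ?_⟩
  · rcases Finset.mem_union.1 ha with h | h
    exacts [hS a h, hS' a h]
  · simp only [add_div, Finset.sum_add_distrib, map_add, mul_add, hc, hc', ite_div, zero_div,
      Finset.sum_ite_mem, Finset.union_inter_cancel_left, Finset.union_inter_cancel_right]
    ring

theorem IsReflective.const_mul {s : ℂ → ℂ} (h : col.IsReflective Ω τ s) (k : ℂ) :
    col.IsReflective Ω τ fun z => k * s z := by
  obtain ⟨M, S, c, hM, hS, hc⟩ := h.exists_eq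
  refine ⟨h.diffContOnCl.const_smul k, fun i => contDiff_const.mul (h.contDiff i),
    fun z => conj k * M z, S, fun a => conj k * c a, hM.const_smul (conj k), hS, fun i t => ?_⟩
  simp only [map_mul, mul_left_comm _ (conj k), hc, mul_add, mul_div_assoc, Finset.mul_sum]

theorem IsReflective.zero : col.IsReflective Ω τ fun _ => 0 :=
  ⟨diffContOnCl_const, fun i => contDiff_const, fun _ => 0, ∅, 0, diffContOnCl_const, by simp,
    by simp⟩

end Collar

namespace Collar

variable {n : ℕ} {col : Collar n} {Ω : Set ℂ} {τ : Fin n → ℂ → ℂ}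

theorem IsSymbol.allCB (hτ : col.IsSymbol τ) (i : Fin n) : AllCB fun t : ℝ => τ i t :=
  allCB_of_periodic ((hτ.smooth i).comp Complex.ofRealCLM.contDiff) fun t => by
    have := hτ.periodic i t
    push_cast at this ⊢
    exact this

/-- Rational approximation of a flat density with small boundary error. -/
theorem Bounds.exists_isGrid_cb (hB : col.Bounds Ω) (hΩ : IsOpen Ω) (hb : Bornology.IsBounded Ω)
    {f : ℂ → ℂ} (hfc : Continuous f) {M : ℕ → ℝ} (hM : ∀ j, 0 ≤ M j) (hf : Flat Ω f M) (k : ℕ)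
    {δ : ℝ} (hδ : 0 < δ) : ∃ S α, Measurable α ∧ (∀ a ∈ S, a ∈ Ω) ∧
      (∀ z ∉ Ω, ‖errT S α f 1 z‖ ≤ δ) ∧ ∀ i, CB k δ fun t => errT S α f 1 (col.Γ i t) := by
  obtain ⟨C, hC0, hC⟩ := hB.exists_cb_errT hΩ hb k
  set v := Real.pi⁻¹ * volume.real Ω with hv
  have hv0 : 0 ≤ v := by positivity
  set A : ℕ → ℝ := fun m => (7 + m * 4 ^ m) * M (m + 1) with hA
  have hA0 : ∀ m, 0 ≤ A m := fun m => mul_nonneg (by positivity) (hM _)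
  have hS0 : 0 ≤ ∑ m ∈ Finset.range (k + 2), A m := Finset.sum_nonneg fun m _ => hA0 m
  have hA1 := hA0 1
  set D := C * (∑ m ∈ Finset.range (k + 2), A m) + v * A 1 + 1 with hD
  have hD0 : 0 < D := by positivity
  obtain ⟨S, α, hg⟩ := exists_isGrid hb (show 0 < δ / D by positivity)
  have hk : ∀ m, ∀ z ∉ Ω, ∀ w ∈ Ω, ‖f w * ker S α m z w‖ ≤ δ / D * A m := fun m z hz w hw =>
    hf.norm_mul_ker_le hΩ hM (by positivity) hg m hz hw
  have hfin : ∀ x, x ≤ D → x * (δ / D) ≤ δ := fun x hx => by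
    rw [mul_div_assoc', div_le_iff₀ hD0, mul_comm δ]
    exact mul_le_mul_of_nonneg_right hx hδ.le
  refine ⟨S, α, hg.measurable, hg.mem, fun z hz => ?_, fun i => ?_⟩
  · refine (norm_errT_le hΩ hb (fun w => hf.eq_zero) (hk 1 z hz)).trans ?_
    rw [mul_comm (δ / D), ← mul_assoc]
    refine hfin _ ?_
    have : 0 ≤ C * ∑ m ∈ Finset.range (k + 2), A m := by positivity
    linarith
  · refine (hC f S α _ hfc (fun w => hf.eq_zero) hg.measurable hg.mem hk i).mono le_rfl ?_
    have h1 : ∀ m, |δ / D * A m| = A m * (δ / D) := fun m => by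
      rw [abs_of_nonneg (mul_nonneg (by positivity) (hA0 m)), mul_comm]
    simp only [h1]
    rw [← Finset.sum_mul, ← mul_assoc]
    refine hfin _ ?_
    have : 0 ≤ v * A 1 := by positivity
    linarith

theorem Bounds.exists_cb_kap (hB : col.Bounds Ω) (hΩ : IsOpen Ω) (hb : Bornology.IsBounded Ω)
    (hτ : col.IsSymbol τ) (k : ℕ) : ∃ C, 0 ≤ C ∧ ∀ e B, IsOuter Ω e →
      (∀ z ∉ Ω, ‖e z‖ ≤ B) → 0 ≤ B →
      ∀ i, CB k (C * B) fun t => col.kap τ Ω e (col.Γ i t) := by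
  obtain ⟨C, hC0, hC⟩ := hB.exists_dens hΩ hb hτ
  obtain ⟨D, hD0, hD⟩ := hB.exists_cb_errT hΩ hb k
  refine ⟨D * ∑ m ∈ Finset.range (k + 2), C m,
    mul_nonneg hD0 (Finset.sum_nonneg fun m _ => hC0 m), fun e B he heB hB0 i => ?_⟩
  obtain ⟨h1, h2, -, h4, -, -⟩ := hC e B he heB hB0
  have := hD _ ∅ id _ h2 h4 measurable_id (by simp) (fun m z hz w _ =>
    h1.norm_mul_ker_empty_le (fun j => mul_nonneg hB0 (hC0 j)) id m w hz) i
  simp only [errT_empty] at this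
  refine this.mono le_rfl (le_of_eq ?_)
  simp only [abs_of_nonneg (mul_nonneg hB0 (hC0 _)), ← Finset.mul_sum]
  ring

theorem Bounds.exists_cb_errT_dens (hB : col.Bounds Ω) (hΩ : IsOpen Ω)
    (hb : Bornology.IsBounded Ω) (hτ : col.IsSymbol τ) (k : ℕ) {η : ℝ} (hη : 0 < η)
    {S : Finset ℂ} {α : ℂ → ℂ} (hg : IsGrid Ω η S α) : ∃ C, 0 ≤ C ∧ ∀ e B, IsOuter Ω e →
      (∀ z ∉ Ω, ‖e z‖ ≤ B) → 0 ≤ B →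
      ∀ i, CB k (C * B) fun t => errT S α (col.dens τ Ω e) 1 (col.Γ i t) := by
  obtain ⟨C, hC0, hC⟩ := hB.exists_dens hΩ hb hτ
  obtain ⟨D, hD0, hD⟩ := hB.exists_cb_errT hΩ hb k
  have hA0 : ∀ m : ℕ, 0 ≤ η * ((7 + m * 4 ^ m) * C (m + 1)) := fun m =>
    mul_nonneg hη.le (mul_nonneg (by positivity) (hC0 _))
  refine ⟨D * ∑ m ∈ Finset.range (k + 2), η * ((7 + m * 4 ^ m) * C (m + 1)),
    mul_nonneg hD0 (Finset.sum_nonneg fun m _ => hA0 m), fun e B he heB hB0 i => ?_⟩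
  obtain ⟨h1, h2, -, h4, -, -⟩ := hC e B he heB hB0
  have := hD _ S α _ h2 h4 hg.measurable hg.mem (fun m z hz w hw =>
    h1.norm_mul_ker_le hΩ (fun j => mul_nonneg hB0 (hC0 j)) hη hg m hz hw) i
  refine this.mono le_rfl (le_of_eq ?_)
  have h5 : ∀ m : ℕ, |η * ((7 + m * 4 ^ m) * (B * C (m + 1)))| =
      η * ((7 + m * 4 ^ m) * C (m + 1)) * B := fun m => by
    rw [← abs_of_nonneg (mul_nonneg (hA0 m) hB0)]
    ring_nf
  simp only [h5, ← Finset.sum_mul]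
  ring

/-- Admissible functions are dense among the holomorphic functions with smooth boundary values. -/
theorem Bounds.exists_isReflective (hB : col.Bounds Ω) (hΩ : IsOpen Ω)
    (hb : Bornology.IsBounded Ω) (hτ : col.IsSymbol τ) (hτ1 : ∀ i (t : ℝ), ‖τ i t‖ = 1)
    {h : ℂ → ℂ} (hh : ∀ i, ContDiff ℝ (⊤ : ℕ∞) fun t : ℝ => h (col.Γ i t))
    (hh' : DiffContOnCl ℂ h Ω) (k : ℕ) {δ : ℝ} (hδ : 0 < δ) :
    ∃ s, col.IsReflective Ω τ s ∧ ∀ i, CB k δ fun t : ℝ => s (col.Γ i t) - h (col.Γ i t) := by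
  obtain ⟨C, hC0, hC⟩ := hB.exists_dens hΩ hb hτ
  obtain ⟨η, S, α, hη, hg, hN⟩ := hB.exists_neumann hΩ hb hτ
  choose L hL0 hL using hB.exists_cb_errT_dens hΩ hb hτ (hη := hη) (hg := hg)
  choose K hK0 hK using hB.exists_cb_kap hΩ hb hτ
  choose Q hQ0 hQ using fun l i => AllCB.exists_mul l (hτ.allCB i)
  set v := Real.pi⁻¹ * volume.real Ω with hv
  have hv0 : 0 ≤ v := by positivity
  obtain ⟨V, hV, hVb, ⟨M, hM0, hM⟩, hVc⟩ := hB.exists_lift hΩ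
    (b := fun i t => τ i t * conj (h (col.Γ i t)))
    (fun i => (hτ.allCB i).contDiff.mul (Complex.conjCLE.contDiff.comp (hh i)))
    (fun i t => by
      have h1 := hτ.periodic i t
      have h2 := col.periodic_ofReal i t
      push_cast at h1 h2 ⊢
      simp only [h1, h2])
  set f := Ω.indicator (dbar V) with hf
  have hP : 0 ≤ K k * 2 + (∑ i, Q k i) * (1 + L k * (v * (2 * C 1))) := by
    have h1 := hC0 1
    have h2 := hL0 k
    have h3 := hK0 k
    have h4 : 0 ≤ ∑ i, Q k i := Finset.sum_nonneg fun i _ => hQ0 k i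
    positivity
  set P := K k * 2 + (∑ i, Q k i) * (1 + L k * (v * (2 * C 1))) + 1 with hPdef
  have hP0 : 0 < P := by linarith
  obtain ⟨S', α', hα', hS', he, hecb⟩ := hB.exists_isGrid_cb hΩ hb hVc hM0 hM k
    (show 0 < δ / P by positivity)
  have hfc := hM.hasCompactSupport hb
  obtain ⟨E, hEo, hE, hEeq⟩ := hN _ _ (isOuter_errT hS' hα' hVc hfc fun w => hM.eq_zero) he
  have hE0 : 0 ≤ 2 * (δ / P) := by positivity
  obtain ⟨d1, d2, d3, d4, d5, d6⟩ := hC E _ hEo hE hE0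
  have hkB : 0 ≤ v * (2 * (δ / P) * C 1) := mul_nonneg hv0 (mul_nonneg hE0 (hC0 1))
  obtain ⟨c1, c2, c3, c4, c5, c6⟩ := hC _ _ d5 d6 hkB
  have hEΓ : ∀ i (t : ℝ), E (col.Γ i t) = errT S' α' f 1 (col.Γ i t) +
      errT S α (col.dens τ Ω (col.kap τ Ω E)) 1 (col.Γ i t) := fun i t =>
    hEeq _ (hB.notMem hΩ i t)
  have hEcb : ∀ l A, (∀ i, CB l A fun t => errT S' α' f 1 (col.Γ i t)) → ∀ i,
      CB l (Q l i * (A + L l * (v * (2 * (δ / P) * C 1))))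
        fun t => τ i t * conj (E (col.Γ i t)) := fun l A hA i => by
    refine hQ l i _ _ (CB.conj ?_)
    simp only [hEΓ]
    exact (hA i).add (hL l _ _ d5 d6 hkB i)
  have hs : ∀ i (t : ℝ), (h (col.Γ i t) - (col.lift τ E (col.Γ i t) - col.kap τ Ω E (col.Γ i t))) -
      h (col.Γ i t) = col.kap τ Ω E (col.Γ i t) - τ i t * conj (E (col.Γ i t)) := fun i t => by
    rw [lift_ofReal hτ]
    ring
  have hcb : ∀ i, CB k δ fun t : ℝ => (h (col.Γ i t) - (col.lift τ E (col.Γ i t) -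
      col.kap τ Ω E (col.Γ i t))) - h (col.Γ i t) := fun i => by
    simp only [hs]
    refine ((hK k E _ hEo hE hE0 i).sub (hEcb k _ hecb i)).mono le_rfl ?_
    have h1 : Q k i ≤ ∑ i, Q k i :=
      Finset.single_le_sum (f := fun i => Q k i) (fun i _ => hQ0 k i) (Finset.mem_univ i)
    have h2 : 0 ≤ δ / P + L k * (v * (2 * (δ / P) * C 1)) :=
      add_nonneg (by positivity) (mul_nonneg (hL0 k) hkB)
    calc _ ≤ K k * (2 * (δ / P)) + (∑ i, Q k i) * (δ / P + L k * (v * (2 * (δ / P) * C 1))) :=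
          add_le_add le_rfl (mul_le_mul_of_nonneg_right h1 h2)
      _ = (P - 1) * (δ / P) := by rw [hPdef]; ring
      _ ≤ P * (δ / P) := mul_le_mul_of_nonneg_right (by linarith) (by positivity)
      _ = δ := mul_div_cancel₀ _ hP0.ne'
  classical
  have hu := hB.diffContOnCl_lift_sub_kap hΩ hb hτ hEo hE hE0
  refine ⟨fun z => h z - (col.lift τ E z - col.kap τ Ω E z), ⟨hh'.sub hu, fun i => ?_, ?_⟩, hcb⟩
  · have := (hcb i).1.add (hh i)
    simpa only [sub_add_cancel] using this
  · have hm1 := diffContOnCl_sub_cauchyT hΩ hb (hV.contDiffOn.of_le (by simp))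
      hV.continuous.continuousOn hM hVc
    have hm2 := hB.diffContOnCl_lift_sub_kap hΩ hb hτ d5 d6 hkB
    refine ⟨fun z => (V z - cauchyT f z) + (col.lift τ (col.kap τ Ω E) z -
      col.kap τ Ω (col.kap τ Ω E) z), S' ∪ S,
      fun a => (if a ∈ S' then (Real.pi : ℂ)⁻¹ * ∫ w in α' ⁻¹' {a}, f w else 0) + if a ∈ S then
        (Real.pi : ℂ)⁻¹ * ∫ w in α ⁻¹' {a}, col.dens τ Ω (col.kap τ Ω E) w else 0,
      hm1.add hm2, fun a ha => ?_, fun i t => ?_⟩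
    · rcases Finset.mem_union.1 ha with h | h
      exacts [hS' a h, hg.mem a h]
    · have hτE : τ i t * conj (τ i t * conj (E (col.Γ i t))) = E (col.Γ i t) := by
        rw [map_mul, Complex.conj_conj, ← mul_assoc, Complex.mul_conj, normSq_eq_norm_sq, hτ1]
        simp
      simp only [add_div, Finset.sum_add_distrib, ite_div, zero_div,
        Finset.sum_ite_mem, Finset.union_inter_cancel_left, Finset.union_inter_cancel_right]
      have r1 := errT_one S' hα' hVc hfc (col.Γ i t)
      have r2 := errT_one S hg.measurable c2 c3 (col.Γ i t)
      have r3 := hEΓ i t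
      simp only [ratT] at r1 r2
      rw [hVb, lift_ofReal hτ, lift_ofReal hτ, map_sub, map_sub, mul_sub, mul_sub, hτE, r3, r1, r2]
      simp only [kap]
      ring

end Collar

namespace Collar

variable {n : ℕ} {col : Collar n} {Ω : Set ℂ} {τ : Fin n → ℂ → ℂ}

/-- Smoothness of the boundary values. -/
def SmoothBdry (col : Collar n) (h : ℂ → ℂ) : Prop :=
  ∀ i, ContDiff ℝ (⊤ : ℕ∞) fun t : ℝ => h (col.Γ i t)

/-- The periods of the differential `h dz` along the boundary curves. -/
def per (col : Collar n) (h : ℂ → ℂ) (i : Fin n) : ℂ :=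
  ∫ t in (0 : ℝ)..2 * Real.pi, h (col.Γ i t) * dz (col.Γ i) t

theorem continuous_per_integrand (col : Collar n) {h : ℂ → ℂ} (hh : col.SmoothBdry h) (i : Fin n) :
    Continuous fun t : ℝ => h (col.Γ i t) * dz (col.Γ i) t :=
  (hh i).continuous.mul (col.contDiff_dz_ofReal i).continuous

theorem per_add {h g : ℂ → ℂ} (hh : col.SmoothBdry h) (hg : col.SmoothBdry g) :
    col.per (fun z => h z + g z) = col.per h + col.per g := by
  ext i
  simp only [per, add_mul, Pi.add_apply]
  exact intervalIntegral.integral_add ((col.continuous_per_integrand hh i).intervalIntegrable _ _)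
    ((col.continuous_per_integrand hg i).intervalIntegrable _ _)

theorem per_const_mul (col : Collar n) (c : ℂ) (h : ℂ → ℂ) :
    col.per (fun z => c * h z) = c • col.per h := by
  ext i
  simp only [per, mul_assoc, Pi.smul_apply, smul_eq_mul]
  exact intervalIntegral.integral_const_mul _ _

theorem per_one (col : Collar n) : col.per (fun _ => 1) = 0 := by
  ext i
  simp only [per, one_mul, Pi.zero_apply]
  rw [intervalIntegral.integral_eq_sub_of_hasDerivAt (fun t _ => col.hasDerivAt_ofReal i t)
    ((col.contDiff_dz_ofReal i).continuous.intervalIntegrable _ _)]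
  have := col.periodic_ofReal i 0
  simp only [zero_add] at this
  rw [this, sub_self]

theorem exists_norm_per_le (col : Collar n) : ∃ L, 0 < L ∧ ∀ h A, 0 ≤ A →
    (∀ i (t : ℝ), ‖h (col.Γ i t)‖ ≤ A) → ‖col.per h‖ ≤ L * A := by
  choose G hG using fun i => allCB_of_periodic (col.contDiff_dz_ofReal i)
    (col.periodic_dz_ofReal i) 0
  have hG0 : ∀ i, 0 ≤ G i := fun i => (hG i).nonneg
  have hS : 0 ≤ ∑ i, G i := Finset.sum_nonneg fun i _ => hG0 i
  have hπ := Real.pi_pos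
  refine ⟨(∑ i, G i) * (2 * Real.pi) + 1, by positivity, fun h A hA0 hA => ?_⟩
  rw [pi_norm_le_iff_of_nonneg (by positivity)]
  intro i
  have h1 : ∀ t ∈ Set.uIoc 0 (2 * Real.pi), ‖h (col.Γ i t) * dz (col.Γ i) t‖ ≤ A * ∑ i, G i :=
    fun t _ => by
    rw [norm_mul]
    exact mul_le_mul (hA i t) (((hG i).norm_le t).trans (Finset.single_le_sum (f := G)
      (fun i _ => hG0 i) (Finset.mem_univ i))) (norm_nonneg _) hA0
  refine (intervalIntegral.norm_integral_le_of_norm_le_const h1).trans ?_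
  rw [sub_zero, abs_of_pos (by positivity)]
  nlinarith

theorem IsReflective.smoothBdry {s : ℂ → ℂ} (h : col.IsReflective Ω τ s) : col.SmoothBdry s :=
  h.contDiff

/-- The space of admissible functions. -/
def reflective (col : Collar n) (Ω : Set ℂ) (τ : Fin n → ℂ → ℂ) : Submodule ℂ (ℂ → ℂ) where
  carrier := {s | col.IsReflective Ω τ s}
  add_mem' h h' := h.add h'
  zero_mem' := IsReflective.zero
  smul_mem' c _ h := h.const_mul c

/-- The period map on admissible functions. -/
def perL (col : Collar n) (Ω : Set ℂ) (τ : Fin n → ℂ → ℂ) :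
    col.reflective Ω τ →ₗ[ℂ] (Fin n → ℂ) where
  toFun s := col.per s
  map_add' s s' := per_add s.2.smoothBdry s'.2.smoothBdry
  map_smul' c s := col.per_const_mul c s

theorem SmoothBdry.add {h g : ℂ → ℂ} (hh : col.SmoothBdry h) (hg : col.SmoothBdry g) :
    col.SmoothBdry fun z => h z + g z := fun i => (hh i).add (hg i)

theorem SmoothBdry.sub {h g : ℂ → ℂ} (hh : col.SmoothBdry h) (hg : col.SmoothBdry g) :
    col.SmoothBdry fun z => h z - g z := fun i => (hh i).sub (hg i)

theorem SmoothBdry.mul {h g : ℂ → ℂ} (hh : col.SmoothBdry h) (hg : col.SmoothBdry g) :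
    col.SmoothBdry fun z => h z * g z := fun i => (hh i).mul (hg i)

theorem smoothBdry_const (c : ℂ) : col.SmoothBdry fun _ => c := fun _ => contDiff_const

theorem per_sub {h g : ℂ → ℂ} (hh : col.SmoothBdry h) (hg : col.SmoothBdry g) :
    col.per (fun z => h z - g z) = col.per h - col.per g := by
  have := per_add (hh.sub hg) hg
  simp only [sub_add_cancel] at this
  rw [this, add_sub_cancel_right]

theorem Bounds.per_mem_range (hB : col.Bounds Ω) (hΩ : IsOpen Ω)
    (hb : Bornology.IsBounded Ω) (hτ : col.IsSymbol τ) (hτ1 : ∀ i (t : ℝ), ‖τ i t‖ = 1)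
    {h : ℂ → ℂ} (hh : col.SmoothBdry h) (hh' : DiffContOnCl ℂ h Ω) :
    col.per h ∈ LinearMap.range (col.perL Ω τ) := by
  obtain ⟨L, hL0, hL⟩ := col.exists_norm_per_le
  have hcl : IsClosed (LinearMap.range (col.perL Ω τ) : Set (Fin n → ℂ)) :=
    Submodule.closed_of_finiteDimensional _
  rw [← SetLike.mem_coe, ← hcl.closure_eq, Metric.mem_closure_iff]
  intro ε hε
  obtain ⟨s, hs, hsh⟩ := hB.exists_isReflective hΩ hb hτ hτ1 hh hh' 0
    (show 0 < ε / (2 * L) by positivity)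
  refine ⟨col.per s, ⟨⟨s, hs⟩, rfl⟩, ?_⟩
  rw [dist_comm, dist_eq_norm, ← per_sub hs.smoothBdry hh]
  calc _ ≤ L * (ε / (2 * L)) := hL _ _ (by positivity) fun i t => (hsh i).norm_le t
    _ = ε / 2 := by field_simp
    _ < ε := by linarith

theorem SmoothBdry.allCB {h : ℂ → ℂ} (hh : col.SmoothBdry h) (i : Fin n) :
    AllCB fun t : ℝ => h (col.Γ i t) :=
  allCB_of_periodic (hh i) fun t => by
    have := col.periodic_ofReal i t
    push_cast at this ⊢
    exact congrArg h this

theorem _root_.CB.sum {ι : Type*} {k : ℕ} {A : ι → ℝ} {φ : ι → ℝ → ℂ} (S : Finset ι)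
    (h : ∀ j ∈ S, CB k (A j) (φ j)) : CB k (∑ j ∈ S, A j) fun t => ∑ j ∈ S, φ j t := by
  classical
  induction S using Finset.induction_on with
  | empty => exact ⟨contDiff_const, fun l _ t => by simp⟩
  | insert a S ha ih =>
    simp only [Finset.sum_insert ha]
    exact (h a (Finset.mem_insert_self a S)).add
      (ih fun j hj => h j (Finset.mem_insert_of_mem hj))

/-- A bounded linear right inverse of the period map. -/
theorem exists_rightInverse_per (col : Collar n) (Ω : Set ℂ) (τ : Fin n → ℂ → ℂ) :
    ∃ σ : (Fin n → ℂ) →ₗ[ℂ] col.reflective Ω τ,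
      (∀ y ∈ LinearMap.range (col.perL Ω τ), col.per (σ y) = y) ∧
      ∀ k, ∃ K, 0 < K ∧ ∀ y i, CB k (K * ‖y‖) fun t => (σ y : ℂ → ℂ) (col.Γ i t) := by
  obtain ⟨σ, hσ⟩ := (col.perL Ω τ).rangeRestrict.exists_rightInverse_of_surjective
    (LinearMap.range_rangeRestrict _)
  obtain ⟨W', hW'⟩ := Submodule.exists_isCompl (LinearMap.range (col.perL Ω τ))
  refine ⟨σ ∘ₗ Submodule.projectionOnto _ _ hW', fun y hy => ?_, fun k => ?_⟩
  · have h2 := congrArg Subtype.val (LinearMap.congr_fun hσ ⟨y, hy⟩)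
    have h3 : Submodule.projectionOnto _ _ hW' y = ⟨y, hy⟩ :=
      Submodule.projectionOnto_apply_left hW' ⟨y, hy⟩
    simp only [LinearMap.comp_apply]
    rw [h3]
    exact h2
  · set ρ := σ ∘ₗ Submodule.projectionOnto _ _ hW'
    choose A hA using fun j i : Fin n =>
      SmoothBdry.allCB (IsReflective.smoothBdry (ρ (Pi.single j 1)).2) i k
    have hA0 : ∀ j i, 0 ≤ A j i := fun j i => (hA j i).nonneg
    have hS : 0 ≤ ∑ i, ∑ j, A j i :=
      Finset.sum_nonneg fun j _ => Finset.sum_nonneg fun i _ => hA0 i j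
    refine ⟨∑ i, ∑ j, A j i + 1, by positivity, fun y i => ?_⟩
    have hy : ∀ z, (ρ y : ℂ → ℂ) z = ∑ j, y j * (ρ (Pi.single j 1) : ℂ → ℂ) z := fun z => by
      conv_lhs => rw [pi_eq_sum_univ' y]
      simp
    simp only [hy]
    refine (CB.sum Finset.univ fun j _ => (hA j i).const_mul (y j)).mono le_rfl ?_
    calc ∑ j, ‖y j‖ * A j i ≤ ∑ j, ‖y‖ * A j i := Finset.sum_le_sum fun j _ =>
          mul_le_mul_of_nonneg_right (norm_le_pi_norm y j) (hA0 j i)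
      _ = (∑ j, A j i) * ‖y‖ := by rw [← Finset.mul_sum, mul_comm]
      _ ≤ _ := by
          refine mul_le_mul_of_nonneg_right ?_ (norm_nonneg y)
          have := Finset.single_le_sum (f := fun i => ∑ j, A j i)
            (fun i _ => Finset.sum_nonneg fun j _ => hA0 j i) (Finset.mem_univ i)
          linarith

/-- Admissible functions close to one whose square has vanishing periods. -/
theorem Bounds.exists_sq_per_eq_zero (hB : col.Bounds Ω) (hΩ : IsOpen Ω)
    (hb : Bornology.IsBounded Ω) (hτ : col.IsSymbol τ) (hτ1 : ∀ i (t : ℝ), ‖τ i t‖ = 1) (k : ℕ)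
    {δ : ℝ} (hδ : 0 < δ) : ∃ s, col.IsReflective Ω τ s ∧
      (∀ i, CB k δ fun t : ℝ => s (col.Γ i t) - 1) ∧ col.per (fun z => s z * s z) = 0 := by
  obtain ⟨L, hL0, hL⟩ := col.exists_norm_per_le
  obtain ⟨σ, hσ, hσK⟩ := col.exists_rightInverse_per Ω τ
  obtain ⟨K, hK0, hK⟩ := hσK k
  have hKn : ∀ y i (t : ℝ), ‖(σ y : ℂ → ℂ) (col.Γ i t)‖ ≤ K * ‖y‖ := fun y i => (hK y i).norm_le
  set r := min (δ / 2 / K) (4 * (L * K * K))⁻¹ with hr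
  have hr0 : 0 < r := lt_min (by positivity) (by positivity)
  have hr1 : K * r ≤ δ / 2 := by
    have := min_le_left (δ / 2 / K) (4 * (L * K * K))⁻¹
    rw [← hr, le_div_iff₀ hK0] at this
    linarith
  have hr2 : L * K * K * r ≤ 1 / 4 := by
    have := min_le_right (δ / 2 / K) (4 * (L * K * K))⁻¹
    rw [← hr] at this
    calc L * K * K * r ≤ L * K * K * (4 * (L * K * K))⁻¹ :=
          mul_le_mul_of_nonneg_left this (by positivity)
      _ = 1 / 4 := by field_simp
  set ε := min (min (δ / 2) (4 * (L * K))⁻¹) (min 1 (r / (3 * L))) with hε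
  have hε0 : 0 < ε :=
    lt_min (lt_min (by positivity) (by positivity)) (lt_min one_pos (by positivity))
  have hε1 : ε ≤ δ / 2 := (min_le_left _ _).trans (min_le_left _ _)
  have hε2 : L * K * ε ≤ 1 / 4 := by
    calc L * K * ε ≤ L * K * (4 * (L * K))⁻¹ :=
          mul_le_mul_of_nonneg_left ((min_le_left _ _).trans (min_le_right _ _)) (by positivity)
      _ = 1 / 4 := by field_simp
  have hε3 : ε ≤ 1 := (min_le_right _ _).trans (min_le_left _ _)
  have hε4 : L * (3 * ε) ≤ r := by
    have : ε ≤ r / (3 * L) := (min_le_right _ _).trans (min_le_right _ _)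
    rw [le_div_iff₀ (by positivity)] at this
    linarith
  obtain ⟨s, hs, hs1⟩ := hB.exists_isReflective hΩ hb hτ hτ1 (h := fun _ => 1)
    (fun i => contDiff_const) diffContOnCl_const k hε0
  have hsn : ∀ i (t : ℝ), ‖s (col.Γ i t) - 1‖ ≤ ε := fun i => (hs1 i).norm_le
  have hσr : ∀ y, col.IsReflective Ω τ (σ y) := fun y => (σ y).2
  have hσs : ∀ y, col.SmoothBdry (σ y) := fun y => (hσr y).smoothBdry
  have hss := hs.smoothBdry
  have h1s : col.SmoothBdry fun _ => 1 := smoothBdry_const 1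
  have hbase : col.SmoothBdry fun z => s z * s z - 1 := (hss.mul hss).sub h1s
  -- the nonlinear part
  set R : (Fin n → ℂ) → ℂ → ℂ := fun y z => (s z * s z - 1) +
    (2 * (s z - 1) + (σ y : ℂ → ℂ) z) * (σ y : ℂ → ℂ) z with hR
  have hRs : ∀ y, col.SmoothBdry (R y) := fun y =>
    hbase.add ((((smoothBdry_const 2).mul (hss.sub h1s)).add (hσs y)).mul (hσs y))
  have hRd : ∀ y, DiffContOnCl ℂ (R y) Ω := fun y => by
    have e1 := hs.diffContOnCl
    have e2 := (hσr y).diffContOnCl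
    exact ⟨((e1.1.mul e1.1).sub_const 1).add
      ((((e1.1.sub_const 1).const_mul 2).add e2.1).mul e2.1),
      ((e1.2.mul e1.2).sub continuousOn_const).add
      (((continuousOn_const.mul (e1.2.sub continuousOn_const)).add e2.2).mul e2.2)⟩
  set T : (Fin n → ℂ) → (Fin n → ℂ) := fun y => (-2⁻¹ : ℂ) • col.per (R y) with hT
  set W := LinearMap.range (col.perL Ω τ) with hW
  have hTW : ∀ y, T y ∈ W := fun y =>
    W.smul_mem _ (hB.per_mem_range hΩ hb hτ hτ1 (hRs y) (hRd y))
  have hlip : ∀ y y', ‖y‖ ≤ r → ‖y'‖ ≤ r → ‖T y - T y'‖ ≤ 1 / 2 * ‖y - y'‖ := fun y y' hy hy' => by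
    have e0 : 0 ≤ (2 * ε + K * r + K * r) * (K * ‖y - y'‖) := by positivity
    have e1 := hL (fun z => R y z - R y' z) _ e0 fun i t => by
      have : R y (col.Γ i t) - R y' (col.Γ i t) = (2 * (s (col.Γ i t) - 1) +
          (σ y : ℂ → ℂ) (col.Γ i t) + (σ y' : ℂ → ℂ) (col.Γ i t)) *
          (σ (y - y') : ℂ → ℂ) (col.Γ i t) := by
        simp only [hR, map_sub, Submodule.coe_sub, Pi.sub_apply]
        ring
      rw [this, norm_mul]
      refine mul_le_mul ((norm_add₃_le).trans ?_) (hKn _ i t) (norm_nonneg _) (by positivity)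
      refine add_le_add (add_le_add ?_ ?_) ?_
      · rw [norm_mul, Complex.norm_ofNat]
        exact mul_le_mul_of_nonneg_left (hsn i t) zero_le_two
      · exact (hKn y i t).trans (mul_le_mul_of_nonneg_left hy hK0.le)
      · exact (hKn y' i t).trans (mul_le_mul_of_nonneg_left hy' hK0.le)
    rw [per_sub (hRs y) (hRs y')] at e1
    rw [hT, ← smul_sub, norm_smul]
    have e2 : ‖(-2⁻¹ : ℂ)‖ = 1 / 2 := by simp
    rw [e2]
    refine mul_le_mul_of_nonneg_left (e1.trans ?_) (by norm_num)
    calc L * ((2 * ε + K * r + K * r) * (K * ‖y - y'‖)) =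
        (2 * (L * K * ε) + 2 * (L * K * K * r)) * ‖y - y'‖ := by ring
      _ ≤ 1 * ‖y - y'‖ := mul_le_mul_of_nonneg_right (by linarith) (norm_nonneg _)
      _ = ‖y - y'‖ := one_mul _
  have hT0 : ‖T 0‖ ≤ r / 2 := by
    have e1 := hL (R 0) (3 * ε) (by positivity) fun i t => by
      have : R 0 (col.Γ i t) = (s (col.Γ i t) - 1) * ((s (col.Γ i t) - 1) + 2) := by
        simp only [hR, map_zero, Submodule.coe_zero, Pi.zero_apply]
        ring
      rw [this, norm_mul, mul_comm]
      refine mul_le_mul ((norm_add_le _ _).trans ?_) (hsn i t) (norm_nonneg _) (by norm_num)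
      rw [Complex.norm_ofNat]
      linarith [hsn i t]
    rw [hT, norm_smul]
    have e2 : ‖(-2⁻¹ : ℂ)‖ = 1 / 2 := by simp
    rw [e2]
    linarith
  have hmaps : MapsTo T (W ∩ closedBall 0 r) (W ∩ closedBall 0 r) := fun y hy => by
    have hy' : ‖y‖ ≤ r := by simpa using hy.2
    refine ⟨hTW y, mem_closedBall_zero_iff.2 ?_⟩
    have := hlip y 0 hy' (by simpa using hr0.le)
    rw [sub_zero] at this
    have h3 := norm_le_norm_add_norm_sub' (T y) (T 0)
    linarith
  obtain ⟨y, ⟨hyW, hyr⟩, hy, -⟩ := ContractingWith.exists_fixedPoint' (K := 1 / 2) (f := T)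
    (s := W ∩ closedBall 0 r)
    (((Submodule.closed_of_finiteDimensional W).inter isClosed_closedBall).isComplete) hmaps
    ⟨by rw [← NNReal.coe_lt_coe]; norm_num, LipschitzWith.of_dist_le_mul fun a b => by
      rw [Subtype.dist_eq, Subtype.dist_eq, dist_eq_norm, dist_eq_norm]
      simpa using hlip a b (by simpa using a.2.2) (by simpa using b.2.2)⟩
    (x := 0) ⟨W.zero_mem, by simpa using hr0.le⟩ (edist_ne_top _ _)
  have hyr' : ‖y‖ ≤ r := by simpa using hyr
  refine ⟨fun z => s z + (σ y : ℂ → ℂ) z, hs.add (hσr y), fun i => ?_, ?_⟩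
  · have := (hs1 i).add (hK y i)
    simp only [sub_add_eq_add_sub] at this
    refine this.mono le_rfl ?_
    have := mul_le_mul_of_nonneg_left hyr' hK0.le
    linarith
  · have e1 : (fun z => (s z + (σ y : ℂ → ℂ) z) * (s z + (σ y : ℂ → ℂ) z)) =
        fun z => R y z + (2 * (σ y : ℂ → ℂ) z + 1) := by
      ext z
      simp only [hR]
      ring
    rw [e1, per_add (hRs y) (((smoothBdry_const 2).mul (hσs y)).add h1s),
      per_add ((smoothBdry_const 2).mul (hσs y)) h1s, per_const_mul, hσ y hyW, per_one, add_zero]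
    have e2 : (-2⁻¹ : ℂ) • col.per (R y) = y := hy
    have e3 : col.per (R y) = (-2 : ℂ) • y := by
      conv_rhs => rw [← e2, smul_smul]
      norm_num
    rw [e3, ← add_smul]
    norm_num

end Collar

theorem exists_lipschitz_of_contDiff {Ω : Set ℂ} (hb : Bornology.IsBounded Ω) {V : ℂ → ℂ}
    (hV : ContDiff ℝ (⊤ : ℕ∞) V) :
    ∃ L, 0 ≤ L ∧ ∀ z ∈ closure Ω, ∀ w ∈ closure Ω, ‖V z - V w‖ ≤ L * ‖z - w‖ := by
  obtain ⟨R, hR⟩ := hb.closure.subset_closedBall (0 : ℂ)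
  obtain ⟨L, hL⟩ := (isCompact_closedBall (0 : ℂ) R).exists_bound_of_continuousOn
    (hV.continuous_fderiv (by simp)).continuousOn
  refine ⟨|L|, abs_nonneg _, fun z hz w hw => ?_⟩
  exact (convex_closedBall (0 : ℂ) R).norm_image_sub_le_of_norm_fderiv_le
    (fun x _ => (hV.differentiable (by simp)) x) (fun x hx => (hL x hx).trans (le_abs_self L))
    (hR hw) (hR hz)

namespace Collar

variable {n : ℕ} {col : Collar n} {Ω : Set ℂ}

/-- Separation of distinct boundary curves. -/
theorem Bounds.exists_one_le (hB : col.Bounds Ω) (hΩ : IsOpen Ω) (hb : Bornology.IsBounded Ω)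
    (i : Fin n) : ∃ L, 0 ≤ L ∧ ∀ j ≠ i, ∀ t t' : ℝ, 1 ≤ L * ‖col.Γ i t - col.Γ j t'‖ := by
  obtain ⟨V, hV, hVb, -⟩ := hB.exists_lift hΩ (b := fun j _ => if j = i then 1 else 0)
    (fun j => contDiff_const) (fun j t => rfl)
  obtain ⟨L, hL0, hL⟩ := exists_lipschitz_of_contDiff hb hV
  refine ⟨L, hL0, fun j hj t t' => ?_⟩
  have := hL _ (frontier_subset_closure (hB.mem_frontier i t)) _
    (frontier_subset_closure (hB.mem_frontier j t'))
  rw [hVb, hVb] at this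
  simpa [hj] using this

theorem exists_near_parameter (col : Collar n) (i : Fin n) (t t' : ℝ) :
    ∃ t'' : ℝ, col.Γ i t'' = col.Γ i t' ∧ |t - t''| ≤ Real.pi ∧ exp (I * t'') = exp (I * t') := by
  have hπ := Real.pi_pos
  set k := round ((t - t') / (2 * Real.pi)) with hk
  have h1 : ((t' + k * (2 * Real.pi) : ℝ) : ℂ) = t' + k * (2 * Real.pi : ℝ) := by push_cast; ring
  refine ⟨t' + k * (2 * Real.pi), ?_, ?_, ?_⟩
  · rw [h1]
    exact (col.periodic i).int_mul k _
  · have h2 := abs_sub_round ((t - t') / (2 * Real.pi))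
    rw [← hk] at h2
    have h3 : t - (t' + k * (2 * Real.pi)) = ((t - t') / (2 * Real.pi) - k) * (2 * Real.pi) := by
      field_simp
      ring
    rw [h3, abs_mul, abs_of_pos (show 0 < 2 * Real.pi by positivity)]
    nlinarith
  · rw [h1, mul_add, Complex.exp_add]
    have : I * (k * ((2 * Real.pi : ℝ) : ℂ)) = k * (2 * Real.pi * I) := by push_cast; ring
    rw [this, Complex.exp_int_mul_two_pi_mul_I, mul_one]

/-- Distances along a boundary curve are controlled by distances in the plane. -/
theorem Bounds.exists_param_le (hB : col.Bounds Ω) (hΩ : IsOpen Ω) (hb : Bornology.IsBounded Ω)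
    (i : Fin n) : ∃ L, 0 ≤ L ∧ ∀ t t' : ℝ, ∃ t'' : ℝ, col.Γ i t'' = col.Γ i t' ∧
      |t - t''| ≤ L * ‖col.Γ i t - col.Γ i t'‖ := by
  have hπ := Real.pi_pos
  obtain ⟨V, hV, hVb, -⟩ := hB.exists_lift hΩ (b := fun _ t => exp (I * t))
    (fun j => (contDiff_const.mul Complex.ofRealCLM.contDiff).cexp) (fun j t => by
      have : I * ((t + 2 * Real.pi : ℝ) : ℂ) = I * t + 2 * Real.pi * I := by push_cast; ring
      simp only [this, Complex.exp_add, Complex.exp_two_pi_mul_I, mul_one])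
  obtain ⟨L, hL0, hL⟩ := exists_lipschitz_of_contDiff hb hV
  refine ⟨Real.pi / 2 * L, by positivity, fun t t' => ?_⟩
  obtain ⟨t'', h1, h2, h3⟩ := col.exists_near_parameter i t t'
  refine ⟨t'', h1, ?_⟩
  have h4 := hL _ (frontier_subset_closure (hB.mem_frontier i t)) _
    (frontier_subset_closure (hB.mem_frontier i t'))
  rw [hVb, hVb, ← h3] at h4
  have h5 : exp (I * t) - exp (I * t'') = exp (t'' * I) * (exp (I * (t - t'' : ℝ)) - 1) := by
    rw [mul_sub, ← Complex.exp_add, mul_one, mul_comm (t'' : ℂ) I]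
    congr 2
    push_cast
    ring
  rw [h5, norm_mul, Complex.norm_exp_ofReal_mul_I, one_mul,
    Complex.norm_exp_I_mul_ofReal_sub_one, norm_mul, Real.norm_ofNat, Real.norm_eq_abs] at h4
  have h6 := Real.mul_abs_le_abs_sin (x := (t - t'') / 2) (by
    rw [abs_div, abs_two]
    linarith)
  rw [abs_div, abs_two] at h6
  have h7 : 2 / Real.pi * |t - t''| ≤ L * ‖col.Γ i t - col.Γ i t'‖ := by
    refine le_trans ?_ h4
    linarith [h6]
  calc |t - t''| = Real.pi / 2 * (2 / Real.pi * |t - t''|) := by field_simp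
    _ ≤ Real.pi / 2 * (L * ‖col.Γ i t - col.Γ i t'‖) :=
        mul_le_mul_of_nonneg_left h7 (by positivity)
    _ = _ := by ring

/-- Functions with complex derivative at most `ε` on the closure of the domain. -/
def SmallDeriv (Ω : Set ℂ) (F : ℂ → ℂ) (ε : ℝ) : Prop :=
  ∀ z ∈ closure Ω, DifferentiableAt ℂ F z ∧ ‖deriv F z‖ ≤ ε

theorem SmallDeriv.norm_sub_le {F : ℂ → ℂ} {ε : ℝ} (h : SmallDeriv Ω F ε) {c c' : ℝ → ℂ} {G : ℝ}
    {a b : ℝ} (hc : ∀ t ∈ uIcc a b, HasDerivAt c (c' t) t) (hcΩ : ∀ t ∈ uIcc a b, c t ∈ closure Ω)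
    (hG : ∀ t ∈ uIcc a b, ‖c' t‖ ≤ G) : ‖F (c b) - F (c a)‖ ≤ ε * G * |b - a| := by
  have hd : ∀ t ∈ uIcc a b, HasDerivWithinAt (fun t => F (c t)) (deriv F (c t) * c' t)
      (uIcc a b) t := fun t ht =>
    ((h _ (hcΩ t ht)).1.hasDerivAt.comp_of_eq t (hc t ht) rfl).hasDerivWithinAt
  refine (convex_uIcc a b).norm_image_sub_le_of_norm_hasDerivWithin_le hd (fun t ht => ?_)
    left_mem_uIcc right_mem_uIcc
  rw [norm_mul]
  have := (h _ (hcΩ t ht)).2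
  exact mul_le_mul this (hG t ht) (norm_nonneg _) ((norm_nonneg _).trans this)

theorem exists_norm_sub_le_of_mem (hΩ : IsOpen Ω) (hc : IsPreconnected Ω) {p q : ℂ} (hp : p ∈ Ω)
    (hq : q ∈ Ω) : ∃ C, 0 ≤ C ∧ ∀ F ε, SmallDeriv Ω F ε → ‖F q - F p‖ ≤ C * ε := by
  refine hc.induction₂ (fun p q => ∃ C, 0 ≤ C ∧ ∀ F ε, SmallDeriv Ω F ε → ‖F q - F p‖ ≤ C * ε)
    ?_ ?_ ?_ hp hq
  · intro x hx
    obtain ⟨r, hr, hrΩ⟩ := Metric.isOpen_iff.1 hΩ x hx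
    filter_upwards [mem_nhdsWithin_of_mem_nhds (Metric.ball_mem_nhds x hr)] with y hy
    refine ⟨‖y - x‖, norm_nonneg _, fun F ε h => ?_⟩
    rw [mul_comm]
    exact (convex_ball x r).norm_image_sub_le_of_norm_deriv_le
      (fun z hz => (h z (subset_closure (hrΩ hz))).1)
      (fun z hz => (h z (subset_closure (hrΩ hz))).2) (mem_ball_self hr) hy
  · rintro x y z _ _ _ ⟨C, hC0, hC⟩ ⟨D, hD0, hD⟩
    refine ⟨D + C, by positivity, fun F ε h => ?_⟩
    have := norm_add_le (F z - F y) (F y - F x)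
    rw [sub_add_sub_cancel] at this
    linarith [hC F ε h, hD F ε h]
  · rintro x y _ _ ⟨C, hC0, hC⟩
    exact ⟨C, hC0, fun F ε h => by rw [norm_sub_rev]; exact hC F ε h⟩

theorem exists_norm_dz_le (col : Collar n) : ∃ G, 0 ≤ G ∧ ∀ i (t : ℝ), ‖dz (col.Γ i) t‖ ≤ G := by
  choose G hG using fun i => allCB_of_periodic (col.contDiff_dz_ofReal i)
    (col.periodic_dz_ofReal i) 0
  exact ⟨∑ i, G i, Finset.sum_nonneg fun i _ => (hG i).nonneg, fun i t => ((hG i).norm_le t).trans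
    (Finset.single_le_sum (f := G) (fun i _ => (hG i).nonneg) (Finset.mem_univ i))⟩

theorem Bounds.norm_sub_le_param (hB : col.Bounds Ω) {G : ℝ}
    (hG : ∀ i (t : ℝ), ‖dz (col.Γ i) t‖ ≤ G) {F : ℂ → ℂ} {ε : ℝ} (h : SmallDeriv Ω F ε) (i : Fin n)
    (t t' : ℝ) : ‖F (col.Γ i t) - F (col.Γ i t')‖ ≤ ε * G * |t - t'| :=
  h.norm_sub_le (c := fun t => col.Γ i t) (fun t _ => col.hasDerivAt_ofReal i t)
    (fun t _ => frontier_subset_closure (hB.mem_frontier i t)) fun t _ => hG i t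

/-- Oscillation on the boundary. -/
theorem Bounds.exists_norm_sub_le_frontier (hB : col.Bounds Ω) (hΩ : IsOpen Ω)
    (hc : IsConnected Ω) : ∃ p ∈ Ω, ∃ C, 0 ≤ C ∧ ∀ F ε, SmallDeriv Ω F ε → 0 ≤ ε →
      ∀ i (t : ℝ), ‖F (col.Γ i t) - F p‖ ≤ C * ε := by
  obtain ⟨p, hp⟩ := hc.nonempty
  have hε := col.ε_pos
  obtain ⟨G, hG0, hG⟩ := col.exists_norm_dz_le
  have hlt : ∀ s ∈ uIcc (0 : ℝ) (col.ε / 2), 0 ≤ s ∧ |((s : ℂ) * I).im| < col.ε := fun s hs => by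
    rw [uIcc_of_le (by positivity)] at hs
    refine ⟨hs.1, ?_⟩
    have h1 : (s * I : ℂ).im = s := by simp
    rw [h1, abs_of_nonneg hs.1]
    linarith [hs.2]
  have hpath : ∀ i, ∃ C, 0 ≤ C ∧ ∀ F ε, SmallDeriv Ω F ε → ‖F (col.Γ i ((0 : ℝ) : ℂ)) - F p‖ ≤ C * ε := fun i => by
    have hd : ∀ s : ℝ, HasDerivAt (fun s : ℝ => col.Γ i (s * I))
        (fderiv ℝ (col.Γ i) (s * I) I) s := fun s => by
      have h1 : HasDerivAt (fun s : ℝ => (s : ℂ) * I) I s := by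
        simpa using (Complex.ofRealCLM.hasDerivAt (x := s)).mul_const I
      exact (((col.smooth i).differentiable (by simp)) _).hasFDerivAt.comp_hasDerivAt s h1
    have hcont : Continuous fun s : ℝ => fderiv ℝ (col.Γ i) (s * I) I :=
      (((col.smooth i).continuous_fderiv (by simp)).comp (by fun_prop)).clm_apply continuous_const
    obtain ⟨K, hK⟩ := (isCompact_uIcc (a := (0 : ℝ)) (b := col.ε / 2)).exists_bound_of_continuousOn
      hcont.continuousOn
    have hK0 : 0 ≤ K := (norm_nonneg _).trans (hK 0 left_mem_uIcc)
    have hq : col.Γ i ((col.ε / 2 : ℝ) * I) ∈ Ω := by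
      refine hB.inside i _ ?_ ?_
      · simpa using hε
      · simpa using half_lt_self hε
    obtain ⟨D, hD0, hD⟩ := exists_norm_sub_le_of_mem hΩ hc.isPreconnected hp hq
    refine ⟨K * (col.ε / 2) + D, by positivity, fun F ε h => ?_⟩
    have h1 := h.norm_sub_le (c := fun s : ℝ => col.Γ i (s * I)) (fun s _ => hd s) (fun s hs => by
      rw [hB.mem_closure_iff (hlt s hs).2]
      simpa using (hlt s hs).1) hK
    have h2 := norm_add_le (F (col.Γ i ((0 : ℝ) : ℂ)) - F (col.Γ i ((col.ε / 2 : ℝ) * I)))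
      (F (col.Γ i ((col.ε / 2 : ℝ) * I)) - F p)
    rw [sub_add_sub_cancel] at h2
    rw [sub_zero, abs_of_pos (half_pos hε)] at h1
    have h3 := hD F ε h
    simp only [Complex.ofReal_zero, zero_mul] at h1 h2 ⊢
    rw [norm_sub_rev (F (col.Γ i 0)) (F (col.Γ i ((col.ε / 2 : ℝ) * I)))] at h2
    linarith
  choose C hC0 hC using hpath
  have hS : 0 ≤ ∑ i, C i := Finset.sum_nonneg fun i _ => hC0 i
  refine ⟨p, hp, ∑ i, C i + G * Real.pi, by positivity, fun F ε h hε0 i t => ?_⟩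
  obtain ⟨t', h1, h2, -⟩ := col.exists_near_parameter i t 0
  have h3 := hB.norm_sub_le_param hG h i t t'
  rw [h1] at h3
  have h4 := norm_add_le (F (col.Γ i t) - F (col.Γ i ((0 : ℝ) : ℂ))) (F (col.Γ i ((0 : ℝ) : ℂ)) - F p)
  rw [sub_add_sub_cancel] at h4
  have h5 := Finset.single_le_sum (f := C) (fun i _ => hC0 i) (Finset.mem_univ i)
  have h6 := hC i F ε h
  have h7 : C i * ε ≤ (∑ i, C i) * ε := mul_le_mul_of_nonneg_right h5 hε0
  have h8 : ε * G * |t - t'| ≤ ε * G * Real.pi := mul_le_mul_of_nonneg_left h2 (by positivity)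
  calc _ ≤ ε * G * Real.pi + (∑ i, C i) * ε := by linarith
    _ = _ := by ring

theorem SmallDeriv.norm_sub_le_of_frontier (hΩ : IsOpen Ω) (hb : Bornology.IsBounded Ω) {F : ℂ → ℂ}
    {ε K : ℝ} (h : SmallDeriv Ω F ε) (hK : ε ≤ K) {z' : ℂ} (hz' : z' ∈ closure Ω)
    (hfr : ∀ z ∈ frontier Ω, ‖F z - F z'‖ ≤ K * ‖z - z'‖) {z : ℂ} (hz : z ∈ closure Ω) :
    ‖F z - F z'‖ ≤ K * ‖z - z'‖ := by
  have hd : DiffContOnCl ℂ (dslope F z') Ω := by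
    refine ⟨fun x hx => ?_, fun x hx => ?_⟩
    · rcases eq_or_ne x z' with rfl | hne
      · exact (Complex.differentiableOn_dslope (hΩ.mem_nhds hx)).2
          (fun y hy => (h y (subset_closure hy)).1.differentiableWithinAt) x hx
      · exact ((differentiableAt_dslope_of_ne hne).2
          (h x (subset_closure hx)).1).differentiableWithinAt
    · rcases eq_or_ne x z' with rfl | hne
      · exact (continuousAt_dslope_same.2 (h x hx).1).continuousWithinAt
      · exact ((continuousAt_dslope_of_ne hne).2 (h x hx).1.continuousAt).continuousWithinAt
  rcases eq_or_ne z z' with rfl | hne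
  · simp
  have := Complex.norm_le_of_forall_mem_frontier_norm_le hb hd (C := K) (fun x hx => by
    rcases eq_or_ne x z' with rfl | hne
    · rw [dslope_same]
      exact (h x hz').2.trans hK
    · rw [dslope_of_ne _ hne, slope_def_field, norm_div,
        div_le_iff₀ (norm_pos_iff.2 (_root_.sub_ne_zero.2 hne))]
      exact hfr x hx) hz
  rwa [dslope_of_ne _ hne, slope_def_field, norm_div,
    div_le_iff₀ (norm_pos_iff.2 (_root_.sub_ne_zero.2 hne))] at this

/-- On the closure of the domain, functions with small derivative have small Lipschitz constant. -/
theorem Bounds.exists_lipschitz (hB : col.Bounds Ω) (hΩ : IsOpen Ω) (hc : IsConnected Ω)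
    (hb : Bornology.IsBounded Ω) : ∃ C, 0 ≤ C ∧ ∀ F ε, SmallDeriv Ω F ε → 0 ≤ ε →
      ∀ z ∈ closure Ω, ∀ z' ∈ closure Ω, ‖F z - F z'‖ ≤ C * ε * ‖z - z'‖ := by
  obtain ⟨G, hG0, hG⟩ := col.exists_norm_dz_le
  obtain ⟨p, -, D, hD0, hD⟩ := hB.exists_norm_sub_le_frontier hΩ hc
  choose L hL0 hL using hB.exists_one_le hΩ hb
  choose P hP0 hP using hB.exists_param_le hΩ hb
  have hSL : 0 ≤ ∑ i, L i := Finset.sum_nonneg fun i _ => hL0 i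
  have hSP : 0 ≤ ∑ i, P i := Finset.sum_nonneg fun i _ => hP0 i
  refine ⟨1 + 2 * D * ∑ i, L i + G * ∑ i, P i, by positivity, fun F ε h hε => ?_⟩
  set K := (1 + 2 * D * ∑ i, L i + G * ∑ i, P i) * ε with hKdef
  have hKε : ε ≤ K := by
    refine le_mul_of_one_le_left hε ?_
    have : 0 ≤ 2 * D * ∑ i, L i := by positivity
    have : 0 ≤ G * ∑ i, P i := by positivity
    linarith
  have hff : ∀ z ∈ frontier Ω, ∀ z' ∈ frontier Ω, ‖F z - F z'‖ ≤ K * ‖z - z'‖ := by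
    intro z hz z' hz'
    rw [hB.frontier_eq] at hz hz'
    obtain ⟨i, t, rfl⟩ := mem_iUnion.1 hz
    obtain ⟨j, t', rfl⟩ := mem_iUnion.1 hz'
    have h0 := norm_nonneg (col.Γ i t - col.Γ j t')
    have hS1 : L i ≤ ∑ i, L i :=
      Finset.single_le_sum (f := L) (fun i _ => hL0 i) (Finset.mem_univ i)
    have hS2 : P i ≤ ∑ i, P i :=
      Finset.single_le_sum (f := P) (fun i _ => hP0 i) (Finset.mem_univ i)
    have e1 : 0 ≤ ε * ‖col.Γ i t - col.Γ j t'‖ := by positivity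
    have e2 : 0 ≤ 2 * D * (∑ i, L i) * (ε * ‖col.Γ i t - col.Γ j t'‖) := by positivity
    have e3 : 0 ≤ G * (∑ i, P i) * (ε * ‖col.Γ i t - col.Γ j t'‖) := by positivity
    have hK : K * ‖col.Γ i t - col.Γ j t'‖ = ε * ‖col.Γ i t - col.Γ j t'‖
        + 2 * D * (∑ i, L i) * (ε * ‖col.Γ i t - col.Γ j t'‖)
        + G * (∑ i, P i) * (ε * ‖col.Γ i t - col.Γ j t'‖) := by
      rw [hKdef]
      ring
    show ‖F (col.Γ i t) - F (col.Γ j t')‖ ≤ K * ‖col.Γ i t - col.Γ j t'‖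
    rw [hK]
    rcases eq_or_ne j i with rfl | hne
    · obtain ⟨t'', h1, h2⟩ := hP j t t'
      have h3 := hB.norm_sub_le_param hG h j t t''
      rw [h1] at h3
      have h4 : ε * G * |t - t''| ≤ ε * G * ((∑ i, P i) * ‖col.Γ j t - col.Γ j t'‖) :=
        mul_le_mul_of_nonneg_left (h2.trans (mul_le_mul_of_nonneg_right hS2 h0)) (by positivity)
      linarith
    · have h1 : 1 ≤ (∑ i, L i) * ‖col.Γ i t - col.Γ j t'‖ :=
        (hL i j hne t t').trans (mul_le_mul_of_nonneg_right hS1 h0)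
      have h2 := norm_sub_le (F (col.Γ i t) - F p) (F (col.Γ j t') - F p)
      rw [sub_sub_sub_cancel_right] at h2
      have h3 := hD F ε h hε i t
      have h4 := hD F ε h hε j t'
      have h5 : 2 * (D * ε) * 1 ≤ 2 * (D * ε) * ((∑ i, L i) * ‖col.Γ i t - col.Γ j t'‖) :=
        mul_le_mul_of_nonneg_left h1 (by positivity)
      linarith
  intro z hz z' hz'
  refine h.norm_sub_le_of_frontier hΩ hb hKε hz' (fun x hx => ?_) hz
  rw [norm_sub_rev, norm_sub_rev x]
  exact h.norm_sub_le_of_frontier hΩ hb hKε (frontier_subset_closure hx)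
    (fun y hy => hff y hy x hx) hz'

end Collar

/-- One-sided vanishing to infinite order at the boundary. -/
def EdgeFlat {F : Type} [NormedAddCommGroup F] (Ω : Set ℂ) (φ : ℂ → F) : Prop :=
  ∀ N : ℕ, ∃ C, 0 ≤ C ∧ ∀ w ∈ Ω, ‖φ w‖ ≤ C * infDist w Ωᶜ ^ N

theorem EdgeFlat.eq_zero {F : Type} [NormedAddCommGroup F] {Ω : Set ℂ} (hΩ : IsOpen Ω) {φ : ℂ → F}
    (h : EdgeFlat Ω φ) (hφ : Continuous φ) {z : ℂ} (hz : z ∈ frontier Ω) : φ z = 0 := by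
  obtain ⟨C, -, hC⟩ := h 1
  have h1 : IsClosed {w | ‖φ w‖ ≤ C * infDist w Ωᶜ ^ 1} :=
    isClosed_le hφ.norm (continuous_const.mul ((continuous_infDist_pt _).pow 1))
  have h2 : ‖φ z‖ ≤ C * infDist z Ωᶜ ^ 1 :=
    closure_minimal (fun w hw => hC w hw) h1 (frontier_subset_closure hz)
  have h3 : z ∈ Ωᶜ := fun h => hz.2 (hΩ.interior_eq.symm ▸ h)
  rw [infDist_zero_of_mem h3] at h2
  simpa using h2

theorem EdgeFlat.fderiv {F : Type} [NormedAddCommGroup F] [NormedSpace ℝ F] {Ω : Set ℂ}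
    (hΩ : IsOpen Ω) (hb : Bornology.IsBounded Ω) (hne : (Ωᶜ).Nonempty) {φ : ℂ → F}
    (h : EdgeFlat Ω φ) (hφ : ContDiff ℝ (⊤ : ℕ∞) φ) : EdgeFlat Ω (fderiv ℝ φ) := by
  intro N
  obtain ⟨R, hR⟩ := hb.subset_closedBall (0 : ℂ)
  obtain ⟨C, hC0, hC⟩ := h (2 * (N + 1))
  have hφ' : ContDiff ℝ (⊤ : ℕ∞) (_root_.fderiv ℝ φ) := (contDiff_infty_iff_fderiv.1 hφ).2
  obtain ⟨K, hK⟩ := (isCompact_closedBall (0 : ℂ) (R + 1)).exists_bound_of_continuousOn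
    (hφ'.continuous_fderiv (by simp)).continuousOn
  obtain ⟨z₀, hz₀⟩ := hne
  set D := |R| + ‖z₀‖ + 1 with hD
  have hD1 : 1 ≤ D := by
    have := abs_nonneg R
    have := norm_nonneg z₀
    linarith
  have hdD : ∀ w ∈ Ω, infDist w Ωᶜ ≤ D := fun w hw => by
    refine (infDist_le_dist_of_mem hz₀).trans ?_
    have h1 := hR hw
    rw [mem_closedBall_zero_iff] at h1
    rw [dist_eq_norm]
    linarith [norm_sub_le w z₀, le_abs_self R]
  set M := 2 * (N + 1) with hM
  refine ⟨|K| + 2 * (C * (D ^ M + (2 * D) ^ M)), by positivity, fun w hw => ?_⟩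
  set d := infDist w Ωᶜ with hd
  have hd0 : 0 ≤ d := infDist_nonneg
  set δ := min d 1 with hδ
  have hδ0 : 0 ≤ δ := le_min hd0 zero_le_one
  have hδ1 : δ ≤ 1 := min_le_right _ _
  have hδd : δ ≤ d := min_le_left _ _
  have hdδ : d ≤ D * δ := by
    rcases le_total d 1 with h1 | h1
    · rw [hδ, min_eq_left h1]
      exact le_mul_of_one_le_left hd0 hD1
    · rw [hδ, min_eq_right h1, mul_one]
      exact hdD w hw
  suffices hs : ‖_root_.fderiv ℝ φ w‖ ≤ (|K| + 2 * (C * (D ^ M + (2 * D) ^ M))) * δ ^ (N + 1) by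
    refine hs.trans (mul_le_mul_of_nonneg_left ?_ (by positivity))
    calc δ ^ (N + 1) ≤ δ ^ N := pow_le_pow_of_le_one hδ0 hδ1 (Nat.le_succ N)
      _ ≤ d ^ N := pow_le_pow_left₀ hδ0 hδd N
  have hdpos : 0 < d := (hΩ.isClosed_compl.notMem_iff_infDist_pos ⟨z₀, hz₀⟩).1 (not_not.2 hw)
  have hδpos : 0 < δ := lt_min hdpos one_pos
  set r := δ ^ (N + 1) / 2 with hr
  have hr0 : 0 < r := by positivity
  have hδN : δ ^ (N + 1) ≤ δ := pow_le_of_le_one hδ0 hδ1 (Nat.succ_ne_zero N)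
  have hrd : r < d := by
    have : r ≤ δ / 2 := by
      rw [hr]
      linarith
    linarith
  have hr1 : r ≤ 1 := by
    rw [hr]
    linarith
  have hsub : closedBall w r ⊆ closedBall (0 : ℂ) (R + 1) := fun x hx => by
    have h1 := hR hw
    rw [mem_closedBall_zero_iff] at h1 ⊢
    rw [mem_closedBall, dist_eq_norm] at hx
    linarith [norm_le_norm_add_norm_sub' x w]
  have hlip : ∀ x ∈ closedBall w r, ‖_root_.fderiv ℝ φ x - _root_.fderiv ℝ φ w‖ ≤ |K| * r :=
    fun x hx => by
    have h1 := (convex_closedBall w r).norm_image_sub_le_of_norm_fderiv_le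
      (fun y _ => (hφ'.differentiable (by simp)) y)
      (fun y hy => (hK y (hsub hy)).trans (le_abs_self K)) (mem_closedBall_self hr0.le) hx
    rw [mem_closedBall, dist_eq_norm] at hx
    exact h1.trans (mul_le_mul_of_nonneg_left hx (abs_nonneg K))
  refine ContinuousLinearMap.opNorm_le_of_unit_norm (by positivity) fun u hu => ?_
  have hv : ‖r • u‖ = r := by rw [norm_smul, hu, mul_one, Real.norm_of_nonneg hr0.le]
  have hwv : w + r • u ∈ closedBall w r := by
    rw [mem_closedBall, dist_eq_norm, add_sub_cancel_left, hv]
  have h1 := (convex_closedBall w r).norm_image_sub_le_of_norm_fderiv_le'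
    (fun y _ => (hφ.differentiable (by simp)) y) hlip (mem_closedBall_self hr0.le) hwv
  rw [add_sub_cancel_left, hv, map_smul] at h1
  have hwvΩ : w + r • u ∈ Ω := ball_infDist_compl_subset (x := w) (by
    rw [mem_ball, dist_eq_norm, add_sub_cancel_left, hv]
    exact hrd)
  have hpow : ∀ x ∈ Ω, ∀ B, infDist x Ωᶜ ≤ B * δ → ‖φ x‖ ≤ C * (B ^ M * δ ^ M) := fun x hx B hB =>
    (hC x hx).trans (mul_le_mul_of_nonneg_left (by
      rw [← mul_pow]
      exact pow_le_pow_left₀ infDist_nonneg hB M) hC0)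
  have h2 := hpow w hw D hdδ
  have h3 := hpow _ hwvΩ (2 * D) (by
    refine (infDist_le_infDist_add_dist (y := w)).trans ?_
    rw [dist_eq_norm, add_sub_cancel_left, hv]
    linarith)
  have h4 : r * ‖_root_.fderiv ℝ φ w u‖ ≤ |K| * r * r + C * ((D ^ M + (2 * D) ^ M) * δ ^ M) := by
    have h5 : r • _root_.fderiv ℝ φ w u = φ (w + r • u) - φ w
        - (φ (w + r • u) - φ w - r • _root_.fderiv ℝ φ w u) := by abel
    have h6 : ‖r • _root_.fderiv ℝ φ w u‖ = r * ‖_root_.fderiv ℝ φ w u‖ := by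
      rw [norm_smul, Real.norm_of_nonneg hr0.le]
    rw [← h6, h5]
    refine (norm_sub_le _ _).trans ?_
    linarith [norm_sub_le (φ (w + r • u)) (φ w)]
  have h7 : δ ^ M = 2 * r * δ ^ (N + 1) := by
    rw [hr, hM, two_mul (N + 1), pow_add]
    ring
  have h8 : r * ‖_root_.fderiv ℝ φ w u‖
      ≤ r * (|K| * r + 2 * (C * (D ^ M + (2 * D) ^ M)) * δ ^ (N + 1)) := by
    refine h4.trans (le_of_eq ?_)
    rw [h7]
    ring
  have h9 := le_of_mul_le_mul_left h8 hr0
  have h10 : |K| * r ≤ |K| * δ ^ (N + 1) := mul_le_mul_of_nonneg_left (by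
    rw [hr]
    have : 0 < δ ^ (N + 1) := by positivity
    linarith) (abs_nonneg K)
  linarith

theorem hasFDerivAt_indicator {F : Type} [NormedAddCommGroup F] [NormedSpace ℝ F] {Ω : Set ℂ}
    (hΩ : IsOpen Ω) {φ : ℂ → F} (hφ : Differentiable ℝ φ) (h0 : ∀ z ∈ frontier Ω, φ z = 0)
    (h1 : ∀ z ∈ frontier Ω, fderiv ℝ φ z = 0) (z : ℂ) :
    HasFDerivAt (Ω.indicator φ) (Ω.indicator (fderiv ℝ φ) z) z := by
  by_cases hz : z ∈ Ω
  · rw [indicator_of_mem hz]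
    refine (hφ z).hasFDerivAt.congr_of_eventuallyEq ?_
    filter_upwards [hΩ.mem_nhds hz] with w hw using indicator_of_mem hw _
  rw [indicator_of_notMem hz]
  by_cases hz' : z ∈ closure Ω
  · have hf : z ∈ frontier Ω := ⟨hz', by rwa [hΩ.interior_eq]⟩
    have h2 := (hφ z).hasFDerivAt
    rw [h1 z hf, hasFDerivAt_iff_isLittleO] at h2
    rw [hasFDerivAt_iff_isLittleO]
    refine Asymptotics.IsLittleO.of_norm_left (Asymptotics.IsBigO.trans_isLittleO
      (Asymptotics.IsBigO.of_norm_le fun w => ?_) h2.norm_left)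
    rw [indicator_of_notMem hz, h0 z hf]
    by_cases hw : w ∈ Ω <;> simp [hw]
  · refine (hasFDerivAt_const (0 : F) z).congr_of_eventuallyEq ?_
    filter_upwards [isClosed_closure.isOpen_compl.mem_nhds hz'] with w hw
    exact indicator_of_notMem (fun h => hw (subset_closure h)) _

theorem EdgeFlat.contDiff_nat {Ω : Set ℂ} (hΩ : IsOpen Ω) (hb : Bornology.IsBounded Ω)
    (hne : (Ωᶜ).Nonempty) (m : ℕ) : ∀ {F : Type} [NormedAddCommGroup F] [NormedSpace ℝ F]
    {φ : ℂ → F}, EdgeFlat Ω φ → ContDiff ℝ (⊤ : ℕ∞) φ → ContDiff ℝ m (Ω.indicator φ) := by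
  have key : ∀ {F : Type} [NormedAddCommGroup F] [NormedSpace ℝ F] {φ : ℂ → F}, EdgeFlat Ω φ →
      ContDiff ℝ (⊤ : ℕ∞) φ → ∀ z, HasFDerivAt (Ω.indicator φ) (Ω.indicator (_root_.fderiv ℝ φ) z) z :=
    fun h hφ => hasFDerivAt_indicator hΩ (hφ.differentiable (by simp))
      (fun z hz => h.eq_zero hΩ hφ.continuous hz)
      fun z hz => (h.fderiv hΩ hb hne hφ).eq_zero hΩ (hφ.continuous_fderiv (by simp)) hz
  induction m with
  | zero =>
    intro F _ _ φ h hφ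
    exact contDiff_zero.2 (continuous_iff_continuousAt.2 fun z => (key h hφ z).continuousAt)
  | succ m ih =>
    intro F _ _ φ h hφ
    have := contDiff_succ_iff_hasFDerivAt.2
      ⟨_, ih (h.fderiv hΩ hb hne hφ) (contDiff_infty_iff_fderiv.1 hφ).2, key h hφ⟩
    exact_mod_cast this

theorem EdgeFlat.contDiff_indicator {Ω : Set ℂ} (hΩ : IsOpen Ω) (hb : Bornology.IsBounded Ω)
    (hne : (Ωᶜ).Nonempty) {F : Type} [NormedAddCommGroup F] [NormedSpace ℝ F]
    {φ : ℂ → F} (h : EdgeFlat Ω φ) (hφ : ContDiff ℝ (⊤ : ℕ∞) φ) :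
    ContDiff ℝ (⊤ : ℕ∞) (Ω.indicator φ) :=
  contDiff_infty.2 fun m => h.contDiff_nat hΩ hb hne m hφ

theorem hasDerivAt_integral_div_sub {u γ : ℝ → ℂ} (hu : Continuous u) (hγ : Continuous γ) {a : ℂ}
    {r : ℝ} (hr : 0 < r) (h : ∀ t, 2 * r ≤ ‖γ t - a‖) (b c : ℝ) :
    HasDerivAt (fun x => ∫ t in b..c, u t / (γ t - x)) (∫ t in b..c, u t / (γ t - a) ^ 2) a := by
  have hx : ∀ x ∈ ball a r, ∀ t, r ≤ ‖γ t - x‖ := fun x hx t => by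
    rw [mem_ball, dist_eq_norm] at hx
    have := norm_add_le (γ t - x) (x - a)
    rw [sub_add_sub_cancel] at this
    linarith [h t]
  have hne : ∀ x ∈ ball a r, ∀ t, γ t - x ≠ 0 := fun x hx' t =>
    norm_pos_iff.1 (hr.trans_le (hx x hx' t))
  have hcont : ∀ x ∈ ball a r, Continuous fun t => u t / (γ t - x) := fun x hx =>
    hu.div (hγ.sub continuous_const) (hne x hx)
  have ha := mem_ball_self (x := a) hr
  refine (intervalIntegral.hasDerivAt_integral_of_dominated_loc_of_deriv_le
    (F := fun x t => u t / (γ t - x)) (F' := fun x t => u t / (γ t - x) ^ 2)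
    (bound := fun t => ‖u t‖ / r ^ 2) (ball_mem_nhds a hr) ?_
    ((hcont a ha).intervalIntegrable _ _) ?_ ?_ ?_ ?_).2
  · filter_upwards [ball_mem_nhds a hr] with x hx
    exact (hcont x hx).aestronglyMeasurable
  · exact (hu.div ((hγ.sub continuous_const).pow 2)
      fun t => pow_ne_zero 2 (hne a ha t)).aestronglyMeasurable
  · refine Filter.Eventually.of_forall fun t _ x hx' => ?_
    rw [norm_div, norm_pow]
    have := hx x hx' t
    gcongr
  · exact (hu.norm.div_const _).intervalIntegrable _ _
  · refine Filter.Eventually.of_forall fun t _ x hx' => ?_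
    have h1 : HasDerivAt (fun x => γ t - x) (-1) x := by
      simpa using (hasDerivAt_id x).const_sub (γ t)
    refine ((h1.fun_inv (hne x hx' t)).const_mul (u t)).congr_deriv ?_
    rw [neg_neg, mul_one_div]

namespace Collar

variable {n : ℕ} {col : Collar n} {Ω : Set ℂ}

theorem exists_primitive_bdry (col : Collar n) {s : ℂ → ℂ} (hs : col.SmoothBdry s)
    (hper : col.per s = 0) : ∃ H : Fin n → ℝ → ℂ, (∀ i, ContDiff ℝ (⊤ : ℕ∞) (H i)) ∧
      (∀ i, Function.Periodic (H i) (2 * Real.pi)) ∧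
      ∀ i (t : ℝ), HasDerivAt (H i) (s (col.Γ i t) * dz (col.Γ i) t) t := by
  have hc := fun i => col.continuous_per_integrand hs i
  have hd : ∀ i (t : ℝ), HasDerivAt (fun t => ∫ x in (0 : ℝ)..t, s (col.Γ i x) * dz (col.Γ i) x)
      (s (col.Γ i t) * dz (col.Γ i) t) t := fun i t =>
    intervalIntegral.integral_hasDerivAt_right ((hc i).intervalIntegrable _ _)
      ((hc i).stronglyMeasurableAtFilter _ _) (hc i).continuousAt
  refine ⟨fun i t => ∫ x in (0 : ℝ)..t, s (col.Γ i x) * dz (col.Γ i) x, fun i => ?_, fun i t => ?_,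
    hd⟩
  · rw [contDiff_infty_iff_deriv]
    refine ⟨fun t => (hd i t).differentiableAt, ?_⟩
    rw [show deriv _ = _ from funext fun t => (hd i t).deriv]
    exact (hs i).mul (col.contDiff_dz_ofReal i)
  · have hp : Function.Periodic (fun x : ℝ => s (col.Γ i x) * dz (col.Γ i) x) (2 * Real.pi) :=
      fun x => by
      have h1 := col.periodic_dz_ofReal i x
      have h2 := col.periodic_ofReal i x
      simp only at h1 h2 ⊢
      rw [h1, h2]
    have h1 := hp.intervalIntegral_add_eq t 0
    rw [zero_add] at h1
    have h2 : ∫ x in (0 : ℝ)..2 * Real.pi, s (col.Γ i x) * dz (col.Γ i) x = 0 := congrFun hper i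
    show ∫ x in (0 : ℝ)..t + 2 * Real.pi, _ = ∫ x in (0 : ℝ)..t, _
    rw [← intervalIntegral.integral_add_adjacent_intervals ((hc i).intervalIntegrable 0 t)
      ((hc i).intervalIntegrable t _), h1, h2, add_zero]

theorem Bounds.exists_two_mul_le (hB : col.Bounds Ω) (hΩ : IsOpen Ω) {a : ℂ} (ha : a ∈ Ω) :
    ∃ r, 0 < r ∧ ∀ i (t : ℝ), 2 * r ≤ ‖col.Γ i t - a‖ := by
  obtain ⟨r, hr, h⟩ := Metric.isOpen_iff.1 hΩ a ha
  refine ⟨r / 2, half_pos hr, fun i t => ?_⟩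
  by_contra! hlt
  refine hB.notMem hΩ i t (h ?_)
  rw [mem_ball, dist_eq_norm]
  linarith

theorem integral_mul_div_sq (col : Collar n) {H h : ℝ → ℂ} (i : Fin n)
    (hp : Function.Periodic H (2 * Real.pi)) (hh : Continuous h)
    (hd : ∀ t, HasDerivAt H (h t) t) {a : ℂ} (ha : ∀ t : ℝ, col.Γ i t - a ≠ 0) :
    ∫ t in (0 : ℝ)..2 * Real.pi, H t * dz (col.Γ i) t / (col.Γ i t - a) ^ 2
      = ∫ t in (0 : ℝ)..2 * Real.pi, h t / (col.Γ i t - a) := by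
  have hH : Continuous H := continuous_iff_continuousAt.2 fun t => (hd t).continuousAt
  have hγ := (col.continuous_ofReal_apply i).sub (continuous_const (y := a))
  have h1 : ∀ t, HasDerivAt (fun t : ℝ => H t / (col.Γ i t - a))
      (h t / (col.Γ i t - a) - H t * dz (col.Γ i) t / (col.Γ i t - a) ^ 2) t := fun t => by
    refine ((hd t).fun_div ((col.hasDerivAt_ofReal i t).sub_const a) (ha t)).congr_deriv ?_
    have := ha t
    field_simp
  have c1 : Continuous fun t : ℝ => h t / (col.Γ i t - a) := hh.div hγ ha
  have c2 : Continuous fun t : ℝ => H t * dz (col.Γ i) t / (col.Γ i t - a) ^ 2 :=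
    (hH.mul (col.continuous_dz_ofReal i)).div (hγ.pow 2) fun t => pow_ne_zero 2 (ha t)
  have h2 := intervalIntegral.integral_eq_sub_of_hasDerivAt (a := 0) (b := 2 * Real.pi)
    (fun t _ => h1 t) ((c1.sub c2).intervalIntegrable _ _)
  rw [intervalIntegral.integral_sub (c1.intervalIntegrable _ _) (c2.intervalIntegrable _ _)] at h2
  have h3 := hp 0
  have h4 := col.periodic_ofReal i 0
  simp only [zero_add] at h3 h4
  rw [h3, h4, sub_self] at h2
  exact (_root_.sub_eq_zero.1 h2).symm

theorem Flat.edgeFlat {V : ℂ → ℂ} {M : ℕ → ℝ} (hΩ : IsOpen Ω) (hM : ∀ j, 0 ≤ M j)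
    (hf : Flat Ω (Ω.indicator V) M) {z : ℂ} (hz : z ∉ Ω) : EdgeFlat Ω V := fun N =>
  ⟨M N, hM N, fun w hw => by
    have := hf.norm_le_infDist hΩ w hz N
    rwa [indicator_of_mem hw] at this⟩

/-- A holomorphic function whose differential has no periods has a primitive, smooth up to the
boundary. -/
theorem Bounds.exists_primitive (hB : col.Bounds Ω) (hΩ : IsOpen Ω) (hb : Bornology.IsBounded Ω)
    {s : ℂ → ℂ} (hs : DiffContOnCl ℂ s Ω) (hss : col.SmoothBdry s) (hper : col.per s = 0) :
    ∃ G : ℂ → ℂ, ContDiff ℝ (⊤ : ℕ∞) G ∧ ∀ z ∈ Ω, HasDerivAt G (s z) z := by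
  obtain ⟨H, hH, hHp, hHd⟩ := col.exists_primitive_bdry hss hper
  obtain ⟨V, hV, hVH, ⟨M, hM, hf⟩, hfc⟩ := hB.exists_lift hΩ hH hHp
  obtain ⟨z₀, hz₀⟩ := exists_notMem_of_bounded hb
  have hfs : ContDiff ℝ (⊤ : ℕ∞) (Ω.indicator (dbar V)) :=
    (Flat.edgeFlat hΩ hM hf hz₀).contDiff_indicator hΩ hb ⟨z₀, hz₀⟩ (contDiff_dbar hV)
  set W := cauchyT (Ω.indicator (dbar V)) with hW
  have hWs : ContDiff ℝ (⊤ : ℕ∞) W := contDiff_cauchyT hfs (hf.hasCompactSupport hb)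
  have hG : DiffContOnCl ℂ (fun z => V z - W z) Ω := diffContOnCl_sub_cauchyT hΩ hb
    (hV.of_le (mod_cast le_top)).contDiffOn hV.continuous.continuousOn hf hfc
  refine ⟨fun z => V z - W z, hV.sub hWs, fun a ha => ?_⟩
  have hpi := Real.pi_pos
  have key : ∀ x ∈ Ω, V x - W x = (2 * Real.pi * I)⁻¹ *
      ∑ i, ∫ t in (0 : ℝ)..2 * Real.pi, H i t * dz (col.Γ i) t / (col.Γ i t - x) := fun x hx => by
    have h1 := hB.cauchy_formula hΩ hb hG hx
    have h2 := hB.bint_cauchyT hΩ hb hf hfc hx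
    rw [← hW] at h2
    have h3 : col.bint (fun z => (V z - W z) / (z - x))
        = col.bint (fun z => V z / (z - x)) - col.bint (fun z => W z / (z - x)) := by
      unfold bint
      rw [← Finset.sum_sub_distrib]
      refine Finset.sum_congr rfl fun i _ => ?_
      have hc : ∀ {φ : ℂ → ℂ}, Continuous φ → Continuous fun t : ℝ =>
          φ (col.Γ i t) / (col.Γ i t - x) * dz (col.Γ i) t := fun hφ =>
        ((hφ.comp (col.continuous_ofReal_apply i)).div
          ((col.continuous_ofReal_apply i).sub continuous_const)
          (hB.sub_ne_zero hΩ hx i)).mul (col.continuous_dz_ofReal i)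
      rw [← intervalIntegral.integral_sub ((hc hV.continuous).intervalIntegrable _ _)
        ((hc hWs.continuous).intervalIntegrable _ _)]
      congr 1
      ext t
      ring
    rw [h3, h2, sub_zero] at h1
    rw [eq_inv_mul_iff_mul_eq₀ Complex.two_pi_I_ne_zero, ← h1, bint]
    refine Finset.sum_congr rfl fun i _ => ?_
    congr 1
    ext t
    rw [hVH]
    ring
  obtain ⟨r, hr, hra⟩ := hB.exists_two_mul_le hΩ ha
  have hd : HasDerivAt (fun x => (2 * Real.pi * I)⁻¹ *
      ∑ i, ∫ t in (0 : ℝ)..2 * Real.pi, H i t * dz (col.Γ i) t / (col.Γ i t - x))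
      ((2 * Real.pi * I)⁻¹ * ∑ i, ∫ t in (0 : ℝ)..2 * Real.pi,
        H i t * dz (col.Γ i) t / (col.Γ i t - a) ^ 2) a :=
    (HasDerivAt.fun_sum fun i _ => hasDerivAt_integral_div_sub
      ((hH i).continuous.mul (col.continuous_dz_ofReal i)) (col.continuous_ofReal_apply i) hr (hra i)
      0 (2 * Real.pi)).const_mul _
  refine (hd.congr_of_eventuallyEq ?_).congr_deriv ?_
  · filter_upwards [hΩ.mem_nhds ha] with x hx using key x hx
  · rw [inv_mul_eq_iff_eq_mul₀ Complex.two_pi_I_ne_zero, ← hB.cauchy_formula hΩ hb hs ha, bint]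
    refine Finset.sum_congr rfl fun i _ => ?_
    rw [col.integral_mul_div_sq i (hHp i) (col.continuous_per_integrand hss i) (hHd i)
      (hB.sub_ne_zero hΩ ha i)]
    congr 1
    ext t
    ring

end Collar

theorem CB.mul {k : ℕ} {A B : ℝ} {φ ψ : ℝ → ℂ} (h : CB k A φ) (h' : CB k B ψ) :
    CB k (2 ^ k * (A * B)) (fun t => φ t * ψ t) := by
  induction k generalizing φ ψ with
  | zero =>
    refine cb_zero (h.1.mul h'.1) fun t => ?_
    rw [norm_mul, pow_zero, one_mul]
    exact mul_le_mul (h.norm_le t) (h'.norm_le t) (norm_nonneg _) h.nonneg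
  | succ k ih =>
    have hAB := mul_nonneg h.nonneg h'.nonneg
    refine cb_succ (h.1.mul h'.1) (fun t => ?_) ?_
    · rw [norm_mul]
      exact (mul_le_mul (h.norm_le t) (h'.norm_le t) (norm_nonneg _) h.nonneg).trans
        (le_mul_of_one_le_left hAB (one_le_pow₀ one_le_two))
    · have h1 := (ih h.deriv (h'.mono (Nat.le_succ k) le_rfl)).add
        (ih (h.mono (Nat.le_succ k) le_rfl) h'.deriv)
      rw [show _root_.deriv (fun t => φ t * ψ t)
          = fun t => _root_.deriv φ t * ψ t + φ t * _root_.deriv ψ t from funext fun t =>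
        deriv_fun_mul (h.1.differentiable (by simp) t) (h'.1.differentiable (by simp) t)]
      refine h1.mono le_rfl (le_of_eq ?_)
      ring

/-- The partial derivative in the real direction. -/
def ddx (F : ℂ → ℂ) (z : ℂ) : ℂ := fderiv ℝ F z 1

/-- Smooth functions on the plane, holomorphic on `Ω`. -/
structure SmoothHol (Ω : Set ℂ) (F : ℂ → ℂ) : Prop where
  contDiff : ContDiff ℝ (⊤ : ℕ∞) F
  differentiableOn : DifferentiableOn ℂ F Ω

theorem contDiff_ddx {F : ℂ → ℂ} (h : ContDiff ℝ (⊤ : ℕ∞) F) : ContDiff ℝ (⊤ : ℕ∞) (ddx F) :=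
  (contDiff_infty_iff_fderiv.1 h).2.clm_apply contDiff_const

theorem ddx_eq_deriv {F : ℂ → ℂ} {z : ℂ} (h : DifferentiableAt ℂ F z) : ddx F z = deriv F z := by
  rw [ddx, (h.hasDerivAt.hasFDerivAt.restrictScalars ℝ).fderiv]
  simp

namespace SmoothHol

variable {Ω : Set ℂ} {F : ℂ → ℂ}

theorem differentiableAt (h : SmoothHol Ω F) (hΩ : IsOpen Ω) {z : ℂ} (hz : z ∈ closure Ω) :
    DifferentiableAt ℂ F z := by
  refine differentiableAt_of_dbar_eq_zero (h.contDiff.differentiable (by simp) z) ?_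
  have h1 : IsClosed {w | dbar F w = 0} :=
    isClosed_eq (contDiff_dbar h.contDiff).continuous continuous_const
  exact closure_minimal (fun w hw => dbar_eq_zero_of_differentiableAt
    (h.differentiableOn.differentiableAt (hΩ.mem_nhds hw))) h1 hz

theorem ddx (h : SmoothHol Ω F) (hΩ : IsOpen Ω) : SmoothHol Ω (ddx F) := by
  refine ⟨contDiff_ddx h.contDiff, (h.differentiableOn.deriv hΩ).congr fun z hz => ?_⟩
  exact ddx_eq_deriv (h.differentiableAt hΩ (subset_closure hz))

theorem iterate (h : SmoothHol Ω F) (hΩ : IsOpen Ω) (k : ℕ) : SmoothHol Ω (_root_.ddx^[k] F) := by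
  induction k with
  | zero => exact h
  | succ k ih =>
    rw [Function.iterate_succ_apply']
    exact ih.ddx hΩ

theorem iterate_eq (h : SmoothHol Ω F) (hΩ : IsOpen Ω) (k : ℕ) {z : ℂ} (hz : z ∈ Ω) :
    _root_.ddx^[k] F z = iteratedDeriv k F z := by
  induction k generalizing z with
  | zero => simp
  | succ k ih =>
    rw [Function.iterate_succ_apply', iteratedDeriv_succ,
      ddx_eq_deriv ((h.iterate hΩ k).differentiableAt hΩ (subset_closure hz))]
    refine Filter.EventuallyEq.deriv_eq ?_
    filter_upwards [hΩ.mem_nhds hz] with w hw using ih hw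

theorem diffContOnCl (h : SmoothHol Ω F) : DiffContOnCl ℂ F Ω :=
  ⟨h.differentiableOn, h.contDiff.continuous.continuousOn⟩

theorem norm_iterate_le (h : SmoothHol Ω F) (hΩ : IsOpen Ω) (hb : Bornology.IsBounded Ω) (k : ℕ)
    {A : ℝ} (hA : ∀ z ∈ frontier Ω, ‖_root_.ddx^[k] F z‖ ≤ A) {z : ℂ} (hz : z ∈ closure Ω) :
    ‖_root_.ddx^[k] F z‖ ≤ A :=
  Complex.norm_le_of_forall_mem_frontier_norm_le hb (h.iterate hΩ k).diffContOnCl hA hz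

theorem norm_iteratedFDeriv_le (h : SmoothHol Ω F) (hΩ : IsOpen Ω) (k : ℕ)
    {A : ℝ} (hA : ∀ z ∈ Ω, ‖_root_.ddx^[k] F z‖ ≤ A) {z : ℂ} (hz : z ∈ closure Ω) :
    ‖iteratedFDeriv ℝ k F z‖ ≤ A := by
  have h1 : IsClosed {w | ‖iteratedFDeriv ℝ k F w‖ ≤ A} :=
    isClosed_le (h.contDiff.continuous_iteratedFDeriv (mod_cast le_top)).norm continuous_const
  refine closure_minimal (fun w hw => ?_) h1 hz
  have h2 : ContDiffAt ℂ k F w :=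
    (h.differentiableOn.contDiffOn hΩ).contDiffAt (hΩ.mem_nhds hw)
  have h3 := h2.restrictScalars_iteratedFDeriv (𝕜 := ℝ)
  show ‖iteratedFDeriv ℝ k F w‖ ≤ A
  rw [← h3, Function.comp_apply, ContinuousMultilinearMap.norm_restrictScalars,
    norm_iteratedFDeriv_eq_norm_iteratedDeriv, ← h.iterate_eq hΩ k hw]
  exact hA w hw

end SmoothHol

namespace Collar

variable {n : ℕ} {col : Collar n} {Ω : Set ℂ}

theorem dz_ofReal_ne_zero (col : Collar n) (i : Fin n) (t : ℝ) : dz (col.Γ i) t ≠ 0 :=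
  norm_pos_iff.1 (col.c_pos.trans_le (col.le_dz i t (by simpa using col.ε_pos)))

theorem allCB_inv_dz (col : Collar n) (i : Fin n) : AllCB fun t : ℝ => (dz (col.Γ i) t)⁻¹ := by
  refine allCB_of_periodic ((col.contDiff_dz_ofReal i).inv (col.dz_ofReal_ne_zero i)) fun t => ?_
  have := col.periodic_dz_ofReal i t
  simp only at this ⊢
  rw [this]

theorem Bounds.exists_cb_ddx (hB : col.Bounds Ω) (hΩ : IsOpen Ω) (i : Fin n) (k : ℕ) :
    ∃ C, 0 ≤ C ∧ ∀ F A, SmoothHol Ω F → CB (k + 1) A (fun t : ℝ => F (col.Γ i t)) →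
      CB k (C * A) fun t : ℝ => ddx F (col.Γ i t) := by
  obtain ⟨C, hC0, hC⟩ := (col.allCB_inv_dz i).exists_mul k
  refine ⟨C, hC0, fun F A hF h => ?_⟩
  have h1 := hC A _ h.deriv
  convert h1 using 2 with t
  have hd := hF.differentiableAt hΩ (frontier_subset_closure (hB.mem_frontier i t))
  have h2 : HasDerivAt (fun t : ℝ => F (col.Γ i t)) (deriv F (col.Γ i t) * dz (col.Γ i) t) t :=
    hd.hasDerivAt.comp_of_eq t (col.hasDerivAt_ofReal i t) rfl
  rw [h2.deriv, ddx_eq_deriv hd]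
  have := col.dz_ofReal_ne_zero i t
  field_simp

theorem Bounds.exists_cb_iterate (hB : col.Bounds Ω) (hΩ : IsOpen Ω) (i : Fin n) (j : ℕ) :
    ∀ k, ∃ C, 0 ≤ C ∧ ∀ F A, SmoothHol Ω F → CB (k + j) A (fun t : ℝ => F (col.Γ i t)) →
      CB k (C * A) fun t : ℝ => ddx^[j] F (col.Γ i t) := by
  induction j with
  | zero => exact fun k => ⟨1, zero_le_one, fun F A _ h => by simpa using h⟩
  | succ j ih =>
    intro k
    obtain ⟨C, hC0, hC⟩ := hB.exists_cb_ddx hΩ i (k + j)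
    obtain ⟨D, hD0, hD⟩ := ih k
    refine ⟨D * C, by positivity, fun F A hF h => ?_⟩
    rw [Function.iterate_succ_apply, mul_assoc]
    exact hD _ _ (hF.ddx hΩ) (hC F A hF h)

/-- Bounds for derivatives from bounds for the boundary values. -/
theorem Bounds.exists_norm_iterate_le (hB : col.Bounds Ω) (hΩ : IsOpen Ω)
    (hb : Bornology.IsBounded Ω) (m : ℕ) : ∃ C, 0 ≤ C ∧ ∀ F A, 0 ≤ A → SmoothHol Ω F →
      (∀ i, CB m A fun t : ℝ => F (col.Γ i t)) → ∀ j ≤ m, ∀ z ∈ closure Ω,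
        ‖ddx^[j] F z‖ ≤ C * A := by
  choose C hC0 hC using fun i j => hB.exists_cb_iterate hΩ i j 0
  have hS : ∀ i, ∀ j ∈ Finset.range (m + 1), C i j ≤ ∑ i, ∑ j ∈ Finset.range (m + 1), C i j :=
    fun i j hj => (Finset.single_le_sum (f := C i) (fun j _ => hC0 i j) hj).trans
      (Finset.single_le_sum (f := fun i => ∑ j ∈ Finset.range (m + 1), C i j)
        (fun i _ => Finset.sum_nonneg fun j _ => hC0 i j) (Finset.mem_univ i))
  refine ⟨∑ i, ∑ j ∈ Finset.range (m + 1), C i j,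
    Finset.sum_nonneg fun i _ => Finset.sum_nonneg fun j _ => hC0 i j,
    fun F A hA hF h j hj z hz => hF.norm_iterate_le hΩ hb j (fun w hw => ?_) hz⟩
  rw [hB.frontier_eq] at hw
  obtain ⟨i, t, rfl⟩ := mem_iUnion.1 hw
  exact ((hC i j F A hF ((h i).mono (by omega) le_rfl)).norm_le t).trans
    (mul_le_mul_of_nonneg_right (hS i j (Finset.mem_range.2 (by omega))) hA)

end Collar

namespace Collar

variable {n : ℕ} {col : Collar n} {Ω : Set ℂ} {τ : Fin n → ℂ → ℂ}

theorem smallDeriv_of_norm_ddx_le (hΩ : IsOpen Ω) {F : ℂ → ℂ} (hF : SmoothHol Ω F)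
    {ε : ℝ} (h : ∀ z ∈ closure Ω, ‖ddx F z‖ ≤ ε) : SmallDeriv Ω F ε := fun z hz => by
  have hd := hF.differentiableAt hΩ hz
  exact ⟨hd, by rw [← ddx_eq_deriv hd]; exact h z hz⟩

/-- Existence of a reflective conformal map close to the identity. -/
theorem Bounds.exists_map (hB : col.Bounds Ω) (hΩ : IsOpen Ω) (hc : IsConnected Ω)
    (hb : Bornology.IsBounded Ω) (hτ : col.IsSymbol τ) (hτ1 : ∀ i (t : ℝ), ‖τ i t‖ = 1) (m : ℕ)
    {δ : ℝ} (hδ : 0 < δ) : ∃ g s : ℂ → ℂ, col.IsReflective Ω τ s ∧ ContDiff ℝ (⊤ : ℕ∞) g ∧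
      (∀ z ∈ closure Ω, HasDerivAt g (s z * s z) z) ∧ (∀ z ∈ closure Ω, s z ≠ 0) ∧
      InjOn g (closure Ω) ∧
      ∀ k ≤ m, ∀ z ∈ closure Ω, ‖iteratedFDeriv ℝ k (fun w => g w - w) z‖ ≤ δ := by
  obtain ⟨p, hp⟩ := hc.nonempty
  obtain ⟨C, hC0, hC⟩ := hB.exists_norm_iterate_le hΩ hb m
  obtain ⟨L, hL0, hL⟩ := hB.exists_lipschitz hΩ hc hb
  obtain ⟨D, hD⟩ := hb.closure.subset_closedBall p
  set μ := min 1 δ / 2 with hμ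
  have hμ0 : 0 < μ := half_pos (lt_min one_pos hδ)
  have hμ1 : μ < 1 := by linarith [min_le_left 1 δ]
  have hμδ : μ ≤ δ := by linarith [min_le_right 1 δ]
  set η := μ / ((1 + C) * (1 + L) * (1 + |D|)) with hη
  have hη0 : 0 < η := by positivity
  have hηeq : (1 + C) * (1 + L) * (1 + |D|) * η = μ := by
    rw [hη]
    field_simp
  have hD0 := abs_nonneg D
  have hε1 : C * η ≤ μ := by
    rw [← hηeq]
    refine mul_le_mul_of_nonneg_right ?_ hη0.le
    nlinarith [mul_nonneg hC0 hL0, mul_nonneg hC0 hD0, mul_nonneg hL0 hD0,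
      mul_nonneg (mul_nonneg hC0 hL0) hD0]
  have hε2 : L * (C * η) ≤ μ := by
    rw [← hηeq, ← mul_assoc]
    refine mul_le_mul_of_nonneg_right ?_ hη0.le
    nlinarith [mul_nonneg hC0 hL0, mul_nonneg hC0 hD0, mul_nonneg hL0 hD0,
      mul_nonneg (mul_nonneg hC0 hL0) hD0]
  have hε3 : L * (C * η) * |D| ≤ μ := by
    rw [← hηeq, show L * (C * η) * |D| = L * C * |D| * η by ring]
    refine mul_le_mul_of_nonneg_right ?_ hη0.le
    nlinarith [mul_nonneg hC0 hL0, mul_nonneg hC0 hD0, mul_nonneg hL0 hD0,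
      mul_nonneg (mul_nonneg hC0 hL0) hD0]
  have hε0 : 0 ≤ C * η := by positivity
  set ρ := min 1 (η / (2 ^ m + 2)) with hρ
  have hρ0 : 0 < ρ := lt_min one_pos (by positivity)
  have hρ1 : ρ ≤ 1 := min_le_left _ _
  have hρη : (2 ^ m + 2) * ρ ≤ η := by
    have := min_le_right 1 (η / (2 ^ m + 2))
    rw [← hρ, le_div_iff₀ (by positivity)] at this
    linarith
  obtain ⟨s, hs, hs1, hsper⟩ := hB.exists_sq_per_eq_zero hΩ hb hτ hτ1 m hρ0
  obtain ⟨G, hG, hGd⟩ := hB.exists_primitive hΩ hb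
    (hs.diffContOnCl.smul hs.diffContOnCl) (s := fun z => s z * s z)
    (SmoothBdry.mul hs.contDiff hs.contDiff) hsper
  set g := fun z => G z - (G p - p) with hg
  have hgs : ContDiff ℝ (⊤ : ℕ∞) g := hG.sub contDiff_const
  have hgH : SmoothHol Ω g := ⟨hgs, fun z hz =>
    ((hGd z hz).sub_const _).differentiableAt.differentiableWithinAt⟩
  have hgd : ∀ z ∈ closure Ω, HasDerivAt g (s z * s z) z := fun z hz => by
    have h1 := hgH.differentiableAt hΩ hz
    have h2 : EqOn (ddx g) (fun z => s z * s z) Ω := fun w hw => by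
      rw [ddx_eq_deriv (hgH.differentiableAt hΩ (subset_closure hw))]
      exact ((hGd w hw).sub_const _).deriv
    have h3 := h2.of_subset_closure (contDiff_ddx hgs).continuous.continuousOn
      (hs.diffContOnCl.continuousOn.mul hs.diffContOnCl.continuousOn) subset_closure subset_rfl
    have h4 : ddx g z = s z * s z := h3 hz
    rw [← h4, ddx_eq_deriv h1]
    exact h1.hasDerivAt
  set F := fun z => g z - z with hF
  have hFH : SmoothHol Ω F := ⟨hgs.sub contDiff_id, hgH.differentiableOn.sub differentiableOn_id⟩
  have hFd : ∀ z ∈ closure Ω, ddx F z = s z * s z - 1 := fun z hz => by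
    rw [ddx_eq_deriv (hFH.differentiableAt hΩ hz)]
    exact ((hgd z hz).sub (hasDerivAt_id z)).deriv
  have hcb : ∀ i, CB m η fun t : ℝ => ddx F (col.Γ i t) := fun i => by
    have h1 := ((hs1 i).mul (hs1 i)).add ((hs1 i).const_mul 2)
    have h2 : (fun t : ℝ => ddx F (col.Γ i t)) = fun t : ℝ =>
        (s (col.Γ i t) - 1) * (s (col.Γ i t) - 1) + 2 * (s (col.Γ i t) - 1) := by
      ext t
      rw [hFd _ (frontier_subset_closure (hB.mem_frontier i t))]
      ring
    rw [h2]
    refine h1.mono le_rfl (le_trans ?_ hρη)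
    have h3 : ρ * ρ ≤ ρ := mul_le_of_le_one_left hρ0.le hρ1
    have h4 : (2 : ℝ) ^ m * (ρ * ρ) ≤ 2 ^ m * ρ := mul_le_mul_of_nonneg_left h3 (by positivity)
    rw [Complex.norm_ofNat]
    linarith
  have hder := hC (ddx F) η hη0.le (hFH.ddx hΩ) hcb
  have hsmall : SmallDeriv Ω F (C * η) := smallDeriv_of_norm_ddx_le hΩ hFH fun z hz =>
    hder 0 (Nat.zero_le _) z hz
  have hlip := hL F (C * η) hsmall hε0
  refine ⟨g, s, hs, hgs, hgd, fun z hz h0 => ?_, fun z hz z' hz' hzz => ?_, fun k hk z hz => ?_⟩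
  · have h1 := hder 0 (Nat.zero_le _) z hz
    rw [Function.iterate_zero, id, hFd z hz, h0, mul_zero, zero_sub, norm_neg, norm_one] at h1
    linarith
  · have h1 := hlip z hz z' hz'
    have h2 : F z - F z' = -(z - z') := by
      simp only [hF, hzz]
      ring
    rw [h2, norm_neg] at h1
    by_contra hne
    have h3 := norm_pos_iff.2 (_root_.sub_ne_zero.2 hne)
    nlinarith
  · refine hFH.norm_iteratedFDeriv_le hΩ k (fun w hw => ?_) hz
    cases k with
    | zero =>
      have h1 := hlip w (subset_closure hw) p (subset_closure hp)
      have h2 : F p = 0 := by simp [hF, hg]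
      have h3 := hD (subset_closure hw)
      rw [mem_closedBall, dist_eq_norm] at h3
      rw [h2, sub_zero] at h1
      have h4 : L * (C * η) * ‖w - p‖ ≤ L * (C * η) * |D| :=
        mul_le_mul_of_nonneg_left (h3.trans (le_abs_self D)) (by positivity)
      simp only [Function.iterate_zero, id]
      linarith
    | succ k =>
      rw [Function.iterate_succ_apply]
      linarith [hder k (by omega) w (subset_closure hw)]

end Collar

theorem eq_of_quadratic_bound {E : ℝ → ℝ} {a b C : ℝ}
    (h : ∀ x ∈ Icc a b, ∀ y ∈ Icc a b, x ≤ y → |E y - E x| ≤ C * (y - x) ^ 2) :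
    ∀ x ∈ Icc a b, E x = E a := by
  have h' : ∀ x ∈ Icc a b, ∀ y ∈ Icc a b, |E y - E x| ≤ C * (y - x) ^ 2 := fun x hx y hy => by
    rcases le_total x y with hxy | hxy
    · exact h x hx y hy hxy
    · rw [abs_sub_comm, show (y - x) ^ 2 = (x - y) ^ 2 by ring]
      exact h y hy x hx hxy
  have hd : ∀ x ∈ Icc a b, HasDerivWithinAt E 0 (Icc a b) x := fun x hx => by
    rw [hasDerivWithinAt_iff_isLittleO]
    have h1 : (fun y => E y - E x - (y - x) • (0 : ℝ)) =O[nhdsWithin x (Icc a b)]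
        fun y => (y - x) ^ 2 := by
      refine Asymptotics.IsBigO.of_bound C ?_
      filter_upwards [self_mem_nhdsWithin] with y hy
      rw [smul_zero, sub_zero, Real.norm_eq_abs, Real.norm_eq_abs, abs_of_nonneg (sq_nonneg (y - x))]
      exact h' x hx y hy
    refine h1.trans_isLittleO ?_
    have h2 : (fun y => y - x) =o[nhds x] fun _ => (1 : ℝ) := by
      rw [Asymptotics.isLittleO_one_iff]
      have : Filter.Tendsto (fun y => y - x) (nhds x) (nhds (x - x)) :=
        (continuous_id.sub continuous_const).tendsto x
      rwa [sub_self] at this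
    have h3 := (h2.mono (nhdsWithin_le_nhds (s := Icc a b))).mul_isBigO
      (Asymptotics.isBigO_refl (fun y => y - x) (nhdsWithin x (Icc a b)))
    simpa [sq] using h3
  intro x hx
  refine constant_of_has_deriv_right_zero (fun y hy => (hd y hy).continuousWithinAt)
    (fun y hy => ?_) x hx
  exact (hd y ⟨hy.1, hy.2.le⟩).mono_of_mem_nhdsWithin
    (Filter.mem_of_superset (Icc_mem_nhdsGE hy.2) (Icc_subset_Icc_left hy.1))

theorem ofReal_norm_sub_le_hausdorffMeasure {γ : ℝ → ℂ} (hγ : Continuous γ) {x y : ℝ} (hxy : x ≤ y) :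
    ENNReal.ofReal ‖γ y - γ x‖ ≤ μH[1] (γ '' Ioc x y) := by
  rcases eq_or_ne (γ y - γ x) 0 with h0 | h0
  · simp [h0]
  set u := conj (γ y - γ x) / ‖γ y - γ x‖ with hu
  have hn : (‖γ y - γ x‖ : ℂ) ≠ 0 := by simpa using h0
  have hu1 : ‖u‖ = 1 := by
    rw [hu, norm_div, RCLike.norm_conj, Complex.norm_real, norm_norm, div_self (norm_ne_zero_iff.2 h0)]
  have huD : (u * (γ y - γ x)).re = ‖γ y - γ x‖ := by
    have : u * (γ y - γ x) = (‖γ y - γ x‖ : ℝ) := by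
      rw [hu, div_mul_eq_mul_div, Complex.conj_mul', sq, mul_div_assoc, div_self hn, mul_one]
    rw [this, Complex.ofReal_re]
  have hlip : LipschitzWith 1 fun z : ℂ => (u * z).re := LipschitzWith.of_dist_le_mul fun z w => by
    rw [NNReal.coe_one, one_mul, Real.dist_eq, dist_eq_norm, ← Complex.sub_re, ← mul_sub]
    refine (Complex.abs_re_le_norm _).trans (le_of_eq ?_)
    rw [norm_mul, hu1, one_mul]
  have h1 := (hlip.lipschitzOnWith (s := γ '' Ioc x y)).hausdorffMeasure_image_le zero_le_one
  rw [ENNReal.coe_one, ENNReal.one_rpow, one_mul, image_image, hausdorffMeasure_real] at h1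
  refine le_trans ?_ h1
  have h2 := intermediate_value_Ioc hxy (f := fun t => (u * γ t).re)
    (Complex.continuous_re.comp (continuous_const.mul hγ)).continuousOn
  refine le_trans (le_of_eq ?_) (measure_mono h2)
  rw [Real.volume_Ioc, ← huD, mul_sub, Complex.sub_re]

theorem hausdorffMeasure_image_Ioc_le {γ γ' : ℝ → ℂ} (hd : ∀ t, HasDerivAt γ (γ' t) t) {x y K : ℝ}
    (hK0 : 0 ≤ K) (hK : ∀ t ∈ Icc x y, ‖γ' t‖ ≤ K) :
    μH[1] (γ '' Ioc x y) ≤ ENNReal.ofReal (K * (y - x)) := by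
  have h1 : LipschitzOnWith K.toNNReal γ (Ioc x y) :=
    (convex_Ioc x y).lipschitzOnWith_of_nnnorm_hasDerivWithin_le
      (fun t _ => (hd t).hasDerivWithinAt) fun t ht => by
        rw [← NNReal.coe_le_coe, coe_nnnorm, Real.coe_toNNReal _ hK0]
        exact hK t (Ioc_subset_Icc_self ht)
  have h2 := h1.hausdorffMeasure_image_le zero_le_one
  rwa [ENNReal.rpow_one, hausdorffMeasure_real, Real.volume_Ioc, ← ENNReal.ofReal,
    ← ENNReal.ofReal_mul hK0] at h2

section

variable {γ γ' : ℝ → ℂ} {a b K : ℝ}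

theorem hausdorffMeasure_image_Ioc (hd : ∀ t, HasDerivAt γ (γ' t) t) (hγ' : Continuous γ')
    (hK : ∀ t ∈ Icc a b, ∀ x ∈ Icc a b, ‖γ' t - γ' x‖ ≤ K * |t - x|)
    (hinj : InjOn γ (Ioc a b)) {x y : ℝ} (hax : a ≤ x) (hxy : x ≤ y) (hyb : y ≤ b) :
    μH[1] (γ '' Ioc x y) = ENNReal.ofReal (∫ t in x..y, ‖γ' t‖) := by
  have hγ : Continuous γ := continuous_iff_continuousAt.2 fun t => (hd t).continuousAt
  have hK' : ∀ x ∈ Icc a b, ∀ y ∈ Icc a b, x ≤ y → ∀ t ∈ Icc x y,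
      ‖γ' t - γ' x‖ ≤ |K| * (y - x) := fun x hx y hy hxy t ht => by
    have h1 := hK t ⟨hx.1.trans ht.1, ht.2.trans hy.2⟩ x hx
    rw [abs_of_nonneg (sub_nonneg.2 ht.1)] at h1
    refine h1.trans (mul_le_mul (le_abs_self K) (by linarith [ht.2]) (by linarith [ht.1])
      (abs_nonneg K))
  have hup : ∀ x ∈ Icc a b, ∀ y ∈ Icc a b, x ≤ y →
      μH[1] (γ '' Ioc x y) ≤ ENNReal.ofReal ((‖γ' x‖ + |K| * (y - x)) * (y - x)) :=
    fun x hx y hy hxy => by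
    have h0 := mul_nonneg (abs_nonneg K) (sub_nonneg.2 hxy)
    refine hausdorffMeasure_image_Ioc_le hd (by positivity) fun t ht => ?_
    linarith [hK' x hx y hy hxy t ht, norm_le_norm_add_norm_sub' (γ' t) (γ' x)]
  have hfin : ∀ x ∈ Icc a b, ∀ y ∈ Icc a b, x ≤ y → μH[1] (γ '' Ioc x y) ≠ ⊤ :=
    fun x hx y hy hxy => ((hup x hx y hy hxy).trans_lt ENNReal.ofReal_lt_top).ne
  have hlow : ∀ x ∈ Icc a b, ∀ y ∈ Icc a b, x ≤ y →
      ‖γ' x‖ * (y - x) - |K| * (y - x) ^ 2 ≤ (μH[1] (γ '' Ioc x y)).toReal :=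
    fun x hx y hy hxy => by
    have h1 := ofReal_norm_sub_le_hausdorffMeasure hγ hxy
    rw [ENNReal.ofReal_le_iff_le_toReal (hfin x hx y hy hxy)] at h1
    refine le_trans ?_ h1
    have h2 : ‖γ y - γ x - (y - x) • γ' x‖ ≤ |K| * (y - x) * ‖y - x‖ := by
      have h3 := (convex_Icc x y).norm_image_sub_le_of_norm_hasDerivWithin_le
        (f := fun t => γ t - (t : ℂ) * γ' x) (f' := fun t => γ' t - γ' x) (fun t _ =>
          ((hd t).sub (((Complex.ofRealCLM.hasDerivAt (x := t)).mul_const (γ' x)).congr_deriv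
            (by simp))).hasDerivWithinAt) (hK' x hx y hy hxy) (left_mem_Icc.2 hxy)
        (right_mem_Icc.2 hxy)
      have e : γ y - γ x - (y - x) • γ' x = γ y - y * γ' x - (γ x - x * γ' x) := by
        rw [Complex.real_smul]
        push_cast
        ring
      rw [e]
      exact h3
    have h4 : ‖(y - x) • γ' x‖ = ‖γ' x‖ * (y - x) := by
      rw [norm_smul, Real.norm_of_nonneg (sub_nonneg.2 hxy), mul_comm]
    rw [Real.norm_of_nonneg (sub_nonneg.2 hxy)] at h2
    have h5 := norm_le_norm_add_norm_sub ((γ y - γ x)) ((y - x) • γ' x)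
    rw [h4] at h5
    linarith
  have hadd : ∀ x ∈ Icc a b, ∀ y ∈ Icc a b, x ≤ y → (μH[1] (γ '' Ioc a y)).toReal =
      (μH[1] (γ '' Ioc a x)).toReal + (μH[1] (γ '' Ioc x y)).toReal := fun x hx y hy hxy => by
    have ha : a ∈ Icc a b := ⟨le_rfl, hx.1.trans hx.2⟩
    have hm : MeasurableSet (γ '' Ioc x y) :=
      measurableSet_Ioc.image_of_continuousOn_injOn hγ.continuousOn
        (hinj.mono (Ioc_subset_Ioc hx.1 hy.2))
    rw [← Ioc_union_Ioc_eq_Ioc hx.1 hxy, image_union, measure_union ?_ hm,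
      ENNReal.toReal_add (hfin a ha x hx hx.1) (hfin x hx y hy hxy)]
    refine Set.disjoint_left.2 ?_
    rintro _ ⟨s, hs, rfl⟩ ⟨t, ht, hts⟩
    have := hinj ⟨hx.1.trans_lt ht.1, ht.2.trans hy.2⟩ ⟨hs.1, hs.2.trans hx.2⟩ hts
    linarith [hs.2, ht.1]
  have hi : ∀ x y, IntervalIntegrable (fun t => ‖γ' t‖) volume x y := fun x y =>
    hγ'.norm.intervalIntegrable _ _
  have hintegral : ∀ x ∈ Icc a b, ∀ y ∈ Icc a b, x ≤ y →
      |(∫ t in x..y, ‖γ' t‖) - ‖γ' x‖ * (y - x)| ≤ |K| * (y - x) ^ 2 := fun x hx y hy hxy => by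
    have h1 := intervalIntegral.norm_integral_le_of_norm_le_const (a := x) (b := y)
      (f := fun t => ‖γ' t‖ - ‖γ' x‖) (C := |K| * (y - x)) fun t ht => by
        rw [uIoc_of_le hxy] at ht
        exact (abs_norm_sub_norm_le _ _).trans (hK' x hx y hy hxy t (Ioc_subset_Icc_self ht))
    rw [intervalIntegral.integral_sub (hi x y) (by simp), intervalIntegral.integral_const,
      abs_of_nonneg (sub_nonneg.2 hxy), Real.norm_eq_abs, smul_eq_mul] at h1
    rw [mul_comm ‖γ' x‖, sq, ← mul_assoc]
    exact h1
  have hE := eq_of_quadratic_bound (C := 2 * |K|)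
    (E := fun x => (μH[1] (γ '' Ioc a x)).toReal - ∫ t in a..x, ‖γ' t‖) fun x hx y hy hxy => by
      have h1 := hadd x hx y hy hxy
      have h2 := intervalIntegral.integral_add_adjacent_intervals (hi a x) (hi x y)
      have h3 := hlow x hx y hy hxy
      have h4 := ENNReal.toReal_mono ENNReal.ofReal_ne_top (hup x hx y hy hxy)
      have h0 := mul_nonneg (abs_nonneg K) (sub_nonneg.2 hxy)
      have h00 := norm_nonneg (γ' x)
      rw [ENNReal.toReal_ofReal (mul_nonneg (by positivity) (sub_nonneg.2 hxy))] at h4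
      have h5 := abs_le.1 (hintegral x hx y hy hxy)
      rw [abs_le]
      constructor <;> nlinarith
  have hx : x ∈ Icc a b := ⟨hax, hxy.trans hyb⟩
  have hy : y ∈ Icc a b := ⟨hax.trans hxy, hyb⟩
  have h1 := hE x hx
  have h2 := hE y hy
  have h3 := hadd x hx y hy hxy
  have h4 := intervalIntegral.integral_add_adjacent_intervals (hi a x) (hi x y)
  beta_reduce at h1 h2
  rw [← ENNReal.ofReal_toReal (hfin x hx y hy hxy)]
  congr 1
  linarith

theorem setIntegral_image_Ioc (hd : ∀ t, HasDerivAt γ (γ' t) t) (hγ' : Continuous γ')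
    (hK : ∀ t ∈ Icc a b, ∀ x ∈ Icc a b, ‖γ' t - γ' x‖ ≤ K * |t - x|)
    (hinj : InjOn γ (Ioc a b)) (hab : a ≤ b) (f : ℂ → ℂ) :
    ∫ z in γ '' Ioc a b, f z ∂(μH[1]) = ∫ t in a..b, ‖γ' t‖ * f (γ t) := by
  have hγ : Continuous γ := continuous_iff_continuousAt.2 fun t => (hd t).continuousAt
  have he : MeasurableEmbedding ((Ioc a b).domRestrict γ) :=
    hγ.continuousOn.measurableEmbedding measurableSet_Ioc hinj
  have hr : range ((Ioc a b).domRestrict γ) = γ '' Ioc a b := Set.range_domRestrict _ _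
  set e := (Ioc a b).domRestrict γ with hedef
  have hρ : Measurable fun t => ‖γ' t‖₊ := hγ'.nnnorm.measurable
  have hI : ∀ x y, (Ioc x y ∩ Ioc a b : Set ℝ) = Ioc (max x a) (min y b) := fun x y =>
    Ioc_inter_Ioc
  have hev : ∀ s : Set ℝ, MeasurableSet s →
      Measure.map Subtype.val (Measure.comap e (μH[1])) s = μH[1] (γ '' (s ∩ Ioc a b)) := fun s hs => by
    rw [Measure.map_apply measurable_subtype_coe hs, he.comap_apply]
    congr 1
    ext z
    constructor
    · rintro ⟨t, ht, rfl⟩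
      exact ⟨t, ⟨ht, t.2⟩, rfl⟩
    · rintro ⟨t, ht, rfl⟩
      exact ⟨⟨t, ht.2⟩, ht.1, rfl⟩
  have hfin : IsFiniteMeasure (Measure.map Subtype.val (Measure.comap e (μH[1] : Measure ℂ))) := by
    refine ⟨?_⟩
    rw [hev _ MeasurableSet.univ, univ_inter,
      hausdorffMeasure_image_Ioc hd hγ' hK hinj le_rfl hab le_rfl]
    exact ENNReal.ofReal_lt_top
  have hν : Measure.map Subtype.val (Measure.comap e (μH[1])) =
      (volume.restrict (Ioc a b)).withDensity fun t => (‖γ' t‖₊ : ENNReal) := by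
    refine Measure.ext_of_Ioc _ _ fun x y hxy => ?_
    rw [hev _ measurableSet_Ioc, withDensity_apply _ measurableSet_Ioc,
      Measure.restrict_restrict measurableSet_Ioc, hI]
    rcases le_total (max x a) (min y b) with h | h
    · rw [hausdorffMeasure_image_Ioc hd hγ' hK hinj (le_max_right _ _) h (min_le_right _ _),
        intervalIntegral.integral_of_le h, ofReal_integral_eq_lintegral_ofReal
          (hγ'.norm.integrableOn_Ioc) (Filter.Eventually.of_forall fun t => norm_nonneg _)]
      refine lintegral_congr fun t => ?_
      rw [ofReal_norm, enorm_eq_nnnorm]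
    · rw [Ioc_eq_empty (not_lt.2 h)]
      simp
  have h1 : ∫ z in γ '' Ioc a b, f z ∂(μH[1]) = ∫ t, f (e t) ∂(Measure.comap e (μH[1])) := by
    rw [← hr, ← he.map_comap, he.integral_map]
  have h2 := (MeasurableEmbedding.subtype_coe (measurableSet_Ioc (a := a) (b := b))).integral_map
    (μ := Measure.comap e (μH[1])) (fun t => f (γ t))
  rw [h1, intervalIntegral.integral_of_le hab]
  refine h2.symm.trans ?_
  rw [hν, integral_withDensity_eq_integral_smul hρ]
  refine integral_congr_ae (Filter.Eventually.of_forall fun t => ?_)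
  beta_reduce
  rw [NNReal.smul_def, Complex.real_smul, coe_nnnorm]

end

theorem exists_lipschitz_Icc {h : ℝ → ℂ} (hh : ContDiff ℝ (⊤ : ℕ∞) h) (a b : ℝ) :
    ∃ K, ∀ t ∈ Icc a b, ∀ x ∈ Icc a b, ‖h t - h x‖ ≤ K * |t - x| := by
  obtain ⟨K, hK⟩ := (isCompact_Icc (a := a) (b := b)).exists_bound_of_continuousOn
    (hh.continuous_deriv (by simp)).continuousOn
  refine ⟨K, fun t ht x hx => ?_⟩
  exact (convex_Icc a b).norm_image_sub_le_of_norm_deriv_le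
    (fun y _ => hh.differentiable (by simp) y) hK hx ht

theorem isOpen_image_of_hasDerivAt {g g' : ℂ → ℂ} {Ω : Set ℂ} (hΩ : IsOpen Ω)
    (hg : ∀ z ∈ Ω, HasDerivAt g (g' z) z) (h0 : ∀ z ∈ Ω, g' z ≠ 0) : IsOpen (g '' Ω) := by
  have hd : DifferentiableOn ℂ g Ω := fun z hz => (hg z hz).differentiableAt.differentiableWithinAt
  rw [isOpen_iff_mem_nhds]
  rintro _ ⟨z, hz, rfl⟩
  have h1 : HasStrictDerivAt g (g' z) z := by
    have := (hd.analyticAt (hΩ.mem_nhds hz)).hasStrictDerivAt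
    rwa [(hg z hz).deriv] at this
  rw [← h1.map_nhds_eq (h0 z hz)]
  exact Filter.image_mem_map (hΩ.mem_nhds hz)

theorem frontier_image_eq {g : ℂ → ℂ} {Ω : Set ℂ} (hΩ : IsOpen Ω) (hb : Bornology.IsBounded Ω)
    (hg : ContinuousOn g (closure Ω)) (hinj : InjOn g (closure Ω)) (ho : IsOpen (g '' Ω)) :
    frontier (g '' Ω) = g '' frontier Ω := by
  rw [frontier, frontier, ho.interior_eq, hΩ.interior_eq,
    ← image_closure_of_isCompact hb.isCompact_closure hg, hinj.image_sdiff_subset subset_closure]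

namespace Collar

variable {n : ℕ} {col : Collar n} {Ω : Set ℂ} {τ : Fin n → ℂ → ℂ}

theorem Bounds.bint_eq_zero (hB : col.Bounds Ω) (hΩ : IsOpen Ω) (hne : Ω.Nonempty)
    (hb : Bornology.IsBounded Ω) {h : ℂ → ℂ} (hh : DiffContOnCl ℂ h Ω) : col.bint h = 0 := by
  obtain ⟨p, hp⟩ := hne
  have h1 : DiffContOnCl ℂ (fun z => (z - p) * h z) Ω :=
    ((differentiable_id.sub_const p).diffContOnCl).smul hh
  have h2 := hB.cauchy_formula hΩ hb h1 hp
  rw [_root_.sub_self, zero_mul, mul_zero] at h2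
  rw [← h2]
  refine Finset.sum_congr rfl fun i _ => intervalIntegral.integral_congr fun t _ => ?_
  beta_reduce
  rw [mul_div_cancel_left₀ _ (hB.sub_ne_zero hΩ hp i t)]

theorem Bounds.continuous_comp (hB : col.Bounds Ω) {h : ℂ → ℂ} (hh : ContinuousOn h (closure Ω))
    (i : Fin n) : Continuous fun t : ℝ => h (col.Γ i t) :=
  hh.comp_continuous (col.continuous_ofReal_apply i) fun t =>
    frontier_subset_closure (hB.mem_frontier i t)

theorem Bounds.sum_integral_eq (hB : col.Bounds Ω) (hΩ : IsOpen Ω) (hne : Ω.Nonempty)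
    (hb : Bornology.IsBounded Ω) {H M : ℂ → ℂ} (hH : DiffContOnCl ℂ H Ω)
    (hM : DiffContOnCl ℂ M Ω) {S : Finset ℂ} (hS : ∀ a ∈ S, a ∈ Ω) (c : ℂ → ℂ) :
    ∑ i, ∫ t in (0 : ℝ)..2 * Real.pi,
      H (col.Γ i t) * (M (col.Γ i t) + ∑ a ∈ S, c a / (col.Γ i t - a)) * dz (col.Γ i) t =
      ∑ a ∈ S, c a * (2 * Real.pi * I * H a) := by
  have hHM : DiffContOnCl ℂ (fun z => H z * M z) Ω := hH.smul hM
  have h1 : ∀ i, Continuous fun t : ℝ => H (col.Γ i t) * M (col.Γ i t) * dz (col.Γ i) t := fun i =>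
    (hB.continuous_comp hHM.continuousOn i).mul (col.continuous_dz_ofReal i)
  have h2 : ∀ i, ∀ a ∈ S, Continuous fun t : ℝ =>
      c a * (H (col.Γ i t) / (col.Γ i t - a) * dz (col.Γ i) t) := fun i a ha =>
    continuous_const.mul ((((hB.continuous_comp hH.continuousOn i).div
      ((col.continuous_ofReal_apply i).sub continuous_const)
      (hB.sub_ne_zero hΩ (hS a ha) i))).mul (col.continuous_dz_ofReal i))
  have h3 : ∀ i, ∫ t in (0 : ℝ)..2 * Real.pi,
      H (col.Γ i t) * (M (col.Γ i t) + ∑ a ∈ S, c a / (col.Γ i t - a)) * dz (col.Γ i) t =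
      (∫ t in (0 : ℝ)..2 * Real.pi, H (col.Γ i t) * M (col.Γ i t) * dz (col.Γ i) t) +
      ∑ a ∈ S, c a * ∫ t in (0 : ℝ)..2 * Real.pi,
        H (col.Γ i t) / (col.Γ i t - a) * dz (col.Γ i) t := fun i => by
    simp_rw [← intervalIntegral.integral_const_mul]
    rw [← intervalIntegral.integral_finsetSum fun a ha => (h2 i a ha).intervalIntegrable _ _,
      ← intervalIntegral.integral_add ((h1 i).intervalIntegrable _ _)
        ((continuous_finsetSum S (h2 i)).intervalIntegrable _ _)]
    refine intervalIntegral.integral_congr fun t _ => ?_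
    rw [mul_add, add_mul, Finset.mul_sum, Finset.sum_mul]
    congr 1
    refine Finset.sum_congr rfl fun a _ => ?_
    ring
  rw [Finset.sum_congr rfl fun i _ => h3 i, Finset.sum_add_distrib, Finset.sum_comm]
  have h4 := hB.bint_eq_zero hΩ hne hb hHM
  rw [bint] at h4
  rw [h4, zero_add]
  refine Finset.sum_congr rfl fun a ha => ?_
  rw [← hB.cauchy_formula hΩ hb hH (hS a ha), bint, Finset.mul_sum]

/-- The symbol given by the conjugate of the unit tangent vector. -/
theorem exists_isSymbol_tangent (col : Collar n) : ∃ τ, col.IsSymbol τ ∧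
    ∀ i (t : ℝ), τ i t = conj (dz (col.Γ i) t) / ‖dz (col.Γ i) t‖ := by
  refine col.exists_isSymbol (b := fun i t => conj (dz (col.Γ i) t) / ‖dz (col.Γ i) t‖)
    (fun i => ?_) fun i t => ?_
  · have h1 := col.contDiff_dz_ofReal i
    have h2 : ContDiff ℝ (⊤ : ℕ∞) fun t : ℝ => conj (dz (col.Γ i) t) :=
      Complex.conjCLE.contDiff.comp h1
    have h3 : ContDiff ℝ (⊤ : ℕ∞) fun t : ℝ => (‖dz (col.Γ i) t‖ : ℂ) :=
      Complex.ofRealCLM.contDiff.comp (h1.norm ℝ (col.dz_ofReal_ne_zero i))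
    simp_rw [div_eq_mul_inv]
    exact h2.mul (h3.inv fun t => by simpa using col.dz_ofReal_ne_zero i t)
  · have := col.periodic_dz_ofReal i t
    beta_reduce at this ⊢
    rw [this]

theorem norm_conj_div {w : ℂ} (hw : w ≠ 0) : ‖conj w / (‖w‖ : ℂ)‖ = 1 := by
  rw [norm_div, RCLike.norm_conj, Complex.norm_real, norm_norm, div_self (norm_ne_zero_iff.2 hw)]

/-- The arclength integral over the boundary of the image of `Ω`. -/
theorem Bounds.setIntegral_frontier_image (hB : col.Bounds Ω) (hΩ : IsOpen Ω)
    (hb : Bornology.IsBounded Ω) {g s f : ℂ → ℂ} (hg : ContDiff ℝ (⊤ : ℕ∞) g)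
    (hs : ∀ i, ContDiff ℝ (⊤ : ℕ∞) fun t : ℝ => s (col.Γ i t))
    (hd : ∀ z ∈ closure Ω, HasDerivAt g (s z * s z) z) (hs0 : ∀ z ∈ closure Ω, s z ≠ 0)
    (hinj : InjOn g (closure Ω)) (hf : ContinuousOn f (closure (g '' Ω))) :
    ∫ z in frontier (g '' Ω), f z ∂(μH[1]) = ∑ i, ∫ t in (0 : ℝ)..2 * Real.pi,
      f (g (col.Γ i t)) * s (col.Γ i t) * (conj (s (col.Γ i t)) * ‖dz (col.Γ i) t‖) := by
  have hpi := Real.pi_pos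
  have ho : IsOpen (g '' Ω) := isOpen_image_of_hasDerivAt hΩ
    (fun z hz => hd z (subset_closure hz))
    fun z hz => mul_ne_zero (hs0 z (subset_closure hz)) (hs0 z (subset_closure hz))
  have hcl : ∀ i (t : ℝ), col.Γ i t ∈ closure Ω := fun i t =>
    frontier_subset_closure (hB.mem_frontier i t)
  set γ : Fin n → ℝ → ℂ := fun i t => g (col.Γ i t) with hγ
  set γ' : Fin n → ℝ → ℂ := fun i t => dz (col.Γ i) t * (s (col.Γ i t) * s (col.Γ i t)) with hγ'
  have hγd : ∀ i t, HasDerivAt (γ i) (γ' i t) t := fun i t =>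
    (hd _ (hcl i t)).scomp t (col.hasDerivAt_ofReal i t)
  have hγc : ∀ i, Continuous (γ i) := fun i =>
    hg.continuous.comp (col.continuous_ofReal_apply i)
  have hγs : ∀ i, ContDiff ℝ (⊤ : ℕ∞) (γ' i) := fun i =>
    (col.contDiff_dz_ofReal i).mul ((hs i).mul (hs i))
  have hγinj : ∀ i j t u, γ i t = γ j u → i = j ∧ ∃ k : ℤ, u = t + k * (2 * Real.pi) :=
    fun i j t u h => by
    obtain ⟨rfl, k, hk⟩ := col.inj i j t u (by simpa using col.ε_pos) (by simpa using col.ε_pos)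
      (hinj (hcl i t) (hcl j u) h)
    exact ⟨rfl, k, mod_cast hk⟩
  have hinjOn : ∀ i, InjOn (γ i) (Ioc 0 (2 * Real.pi)) := fun i t ht u hu h => by
    obtain ⟨-, k, hk⟩ := hγinj i i t u h
    have h1 : (k : ℝ) < 1 := by
      by_contra! h1
      nlinarith [hu.2, ht.1]
    have h2 : (-1 : ℝ) < k := by
      by_contra! h2
      nlinarith [hu.1, ht.2]
    have h3 : k < 1 := by exact_mod_cast h1
    have h4 : -1 < k := by exact_mod_cast h2
    obtain rfl : k = 0 := by omega
    simpa using hk.symm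
  have hper : ∀ i, Function.Periodic (γ i) (2 * Real.pi) := fun i t =>
    congrArg g (col.periodic_ofReal i t)
  have himg : ∀ i, γ i '' Ioc 0 (2 * Real.pi) = range (γ i) := fun i => by
    have := (hper i).image_Ioc (by positivity) 0
    rwa [zero_add] at this
  have hfr : frontier (g '' Ω) = ⋃ i, γ i '' Ioc 0 (2 * Real.pi) := by
    rw [frontier_image_eq hΩ hb hg.continuous.continuousOn hinj ho, hB.frontier_eq, image_iUnion]
    refine iUnion_congr fun i => ?_
    rw [himg, ← range_comp]
    rfl
  have hm : ∀ i, MeasurableSet (γ i '' Ioc 0 (2 * Real.pi)) := fun i =>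
    measurableSet_Ioc.image_of_continuousOn_injOn (hγc i).continuousOn (hinjOn i)
  have hdisj : Pairwise (Function.onFun Disjoint fun i => γ i '' Ioc 0 (2 * Real.pi)) := by
    intro i j hij
    refine Set.disjoint_left.2 ?_
    rintro _ ⟨t, -, rfl⟩ ⟨u, -, h⟩
    exact hij (hγinj j i u t h).1.symm
  choose K hK using fun i => exists_lipschitz_Icc (hγs i) 0 (2 * Real.pi)
  have hcpt : ∀ i, IsCompact (γ i '' Ioc 0 (2 * Real.pi)) := fun i => by
    have := (hper i).image_Icc (by positivity) 0
    rw [himg, ← this]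
    exact isCompact_Icc.image (hγc i)
  have hsub : ∀ i, γ i '' Ioc 0 (2 * Real.pi) ⊆ closure (g '' Ω) := fun i =>
    (subset_iUnion (fun i => γ i '' Ioc 0 (2 * Real.pi)) i).trans
      (hfr ▸ frontier_subset_closure)
  rw [hfr, integral_iUnion_fintype hm hdisj fun i => ?_]
  · refine Finset.sum_congr rfl fun i _ => ?_
    rw [setIntegral_image_Ioc (hγd i) (hγs i).continuous (hK i) (hinjOn i) (by positivity)]
    refine intervalIntegral.integral_congr fun t _ => ?_
    have h1 : ((‖s (col.Γ i t)‖ : ℝ) : ℂ) * ‖s (col.Γ i t)‖ = s (col.Γ i t) * conj (s (col.Γ i t)) := by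
      rw [Complex.mul_conj', sq]
    rw [hγ', hγ]
    beta_reduce
    rw [norm_mul, norm_mul]
    push_cast
    rw [h1]
    ring
  · refine ContinuousOn.integrableOn_of_subset_isCompact (hf.mono (hsub i)) (hcpt i) (hm i)
      Subset.rfl ?_
    rw [hausdorffMeasure_image_Ioc (hγd i) (hγs i).continuous (hK i) (hinjOn i) le_rfl
      (by positivity) le_rfl]
    exact ENNReal.ofReal_ne_top

/-- The quadrature identity for the image of `Ω` under a map whose derivative is the square of a
reflective function. -/
theorem Bounds.exists_quadrature (hB : col.Bounds Ω) (hΩ : IsOpen Ω) (hne : Ω.Nonempty)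
    (hb : Bornology.IsBounded Ω)
    (hτ : ∀ i (t : ℝ), τ i t = conj (dz (col.Γ i) t) / ‖dz (col.Γ i) t‖)
    {g s : ℂ → ℂ} (hs : col.IsReflective Ω τ s) (hg : ContDiff ℝ (⊤ : ℕ∞) g)
    (hd : ∀ z ∈ closure Ω, HasDerivAt g (s z * s z) z) (hs0 : ∀ z ∈ closure Ω, s z ≠ 0)
    (hinj : InjOn g (closure Ω)) : ∃ (S : Finset ℂ) (C : ℂ → ℂ), (∀ a ∈ S, a ∈ Ω) ∧
      ∀ f : ℂ → ℂ, DifferentiableOn ℂ f (g '' Ω) → ContinuousOn f (closure (g '' Ω)) →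
        ∫ z in frontier (g '' Ω), f z ∂(μH[1]) = ∑ a ∈ S, C a * f (g a) := by
  obtain ⟨M, S, c, hM, hS, hc⟩ := hs.exists_eq
  refine ⟨S, fun a => c a * (2 * Real.pi * I * s a), hS, fun f hf hfc => ?_⟩
  have hgd : DiffContOnCl ℂ g Ω :=
    ⟨fun z hz => (hd z (subset_closure hz)).differentiableAt.differentiableWithinAt,
      hg.continuous.continuousOn⟩
  have hfg : DiffContOnCl ℂ (fun z => f (g z)) Ω :=
    (DiffContOnCl.mk hf hfc).comp hgd (mapsTo_image g Ω)
  have hH : DiffContOnCl ℂ (fun z => f (g z) * s z) Ω := hfg.smul hs.diffContOnCl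
  rw [hB.setIntegral_frontier_image hΩ hb hg hs.contDiff hd hs0 hinj hfc]
  have h1 := hB.sum_integral_eq hΩ hne hb hH hM hS c
  refine Eq.trans (Finset.sum_congr rfl fun i _ => intervalIntegral.integral_congr fun t _ => ?_)
    (h1.trans (Finset.sum_congr rfl fun a _ => ?_))
  · have hn : (‖dz (col.Γ i) t‖ : ℂ) ≠ 0 := by simpa using col.dz_ofReal_ne_zero i t
    have h2 : conj (dz (col.Γ i) t) * dz (col.Γ i) t = ‖dz (col.Γ i) t‖ * ‖dz (col.Γ i) t‖ := by
      rw [Complex.conj_mul', sq]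
    rw [← hc, hτ, mul_assoc (f _ * s _)]
    congr 1
    field_simp
    linear_combination -conj (s (col.Γ i t)) * h2
  · beta_reduce
    ring

end Collar

theorem exists_quadrature_map {Ω : Set ℂ} (hΩo : IsOpen Ω) (hΩc : IsConnected Ω)
    (hb : Bornology.IsBounded Ω) {n : ℕ} {γ : Fin n → ℝ → ℂ}
    (h1 : ∀ i, ContDiff ℝ (⊤ : ℕ∞) (γ i)) (h2 : ∀ i, Function.Periodic (γ i) (2 * Real.pi))
    (h3 : ∀ i, InjOn (γ i) (Ico 0 (2 * Real.pi))) (h4 : ∀ i t, deriv (γ i) t ≠ 0)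
    (h5 : Pairwise fun i j => Disjoint (range (γ i)) (range (γ j)))
    (h6 : frontier Ω = ⋃ i, range (γ i)) (m : ℕ) {δ : ℝ} (hδ : 0 < δ) :
    ∃ g : ℂ → ℂ, ContDiff ℝ (⊤ : ℕ∞) g ∧ DifferentiableOn ℂ g Ω ∧ InjOn g (closure Ω) ∧
      (∀ k ≤ m, ∀ z ∈ closure Ω, ‖iteratedFDeriv ℝ k (fun w => g w - w) z‖ ≤ δ) ∧
      ∃ (S : Finset ℂ) (C : ℂ → ℂ), (∀ a ∈ S, a ∈ Ω) ∧
        ∀ f : ℂ → ℂ, DifferentiableOn ℂ f (g '' Ω) → ContinuousOn f (closure (g '' Ω)) →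
          ∫ z in frontier (g '' Ω), f z ∂(μH[1]) = ∑ a ∈ S, C a * f (g a) := by
  obtain ⟨col₀, h0⟩ := exists_collar h1 h2 h3 h4 h5
  have hf : frontier Ω = ⋃ i, range fun t : ℝ => col₀.Γ i t := by
    simp_rw [h0]
    exact h6
  obtain ⟨col, hB⟩ := Collar.exists_bounds col₀ hΩo hΩc hb hf
  obtain ⟨τ, hτ, hτe⟩ := col.exists_isSymbol_tangent
  obtain ⟨g, s, hs, hg, hd, hs0, hinj, hm⟩ := hB.exists_map hΩo hΩc hb hτ
    (fun i t => by rw [hτe]; exact Collar.norm_conj_div (col.dz_ofReal_ne_zero i t)) m hδ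
  exact ⟨g, hg, fun z hz => (hd z (subset_closure hz)).differentiableAt.differentiableWithinAt,
    hinj, hm, hB.exists_quadrature hΩo hΩc.nonempty hb hτe hs hg hd hs0 hinj⟩

/-- every smoothly bounded domain admits, for each `m` and `δ > 0`, a
holomorphic map `g`, smooth and injective on the closure and `(m, δ)`-close to the identity,
such that `g(Ω)` is a quadrature domain with respect to boundary arclength measure. -/
theorem stmt_18 (Ω : Set ℂ) (hΩo : IsOpen Ω) (hΩc : IsConnected Ω)
    (hsm : HasSmoothBoundary Ω) (m : ℕ) (δ : ℝ) (hδ : 0 < δ) :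
    ∃ g : ℂ → ℂ,
      (∃ U : Set ℂ, IsOpen U ∧ closure Ω ⊆ U ∧ ContDiffOn ℝ (⊤ : ℕ∞) g U) ∧
      DifferentiableOn ℂ g Ω ∧ InjOn g (closure Ω) ∧ CloseToId Ω m δ g ∧
      ∃ N : ℕ, 0 < N ∧ ∃ (w : Fin N → ℂ) (n : Fin N → ℕ) (c : Fin N → ℕ → ℂ),
        (∀ j, w j ∈ g '' Ω) ∧
        ∀ f : ℂ → ℂ, DifferentiableOn ℂ f (g '' Ω) →
          ContinuousOn f (closure (g '' Ω)) →
          (∫ z in frontier (g '' Ω), f z ∂(μH[1])) =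
            ∑ j, ∑ k ∈ Finset.range (n j + 1),
              c j k * iteratedDerivWithin k f (g '' Ω) (w j) := by
  obtain ⟨hb, n, γ, h1, h2, h3, h4, h5, h6⟩ := hsm
  obtain ⟨g, hg, hgd, hinj, hm, S, C, hS, hC⟩ :=
    exists_quadrature_map hΩo hΩc hb h1 h2 h3 h4 h5 h6 m hδ
  refine ⟨g, ⟨univ, isOpen_univ, subset_univ _, hg.contDiffOn⟩, hgd, hinj, hm, ?_⟩
  obtain ⟨p, hp⟩ := hΩc.nonempty
  have e := S.equivFin
  refine ⟨S.card + 1, S.card.succ_pos, Fin.cons (g p) fun j => g (e.symm j), fun _ => 0,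
    Fin.cons (fun _ => 0) fun j _ => C (e.symm j), ?_, fun f hf hfc => ?_⟩
  · refine Fin.cases ⟨p, hp, rfl⟩ fun j => ⟨_, hS _ (e.symm j).2, rfl⟩
  · rw [hC f hf hfc, Fin.sum_univ_succ]
    simp only [zero_add, Finset.sum_range_one, Fin.cons_zero, Fin.cons_succ,
      iteratedDerivWithin_zero, zero_mul]
    rw [e.symm.sum_comp (fun a : S => C a * f (g a))]
    exact (Finset.sum_coe_sort S fun a => C a * f (g a)).symm
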